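/- Let M be a positive integer and let f be a transcendental meromorphic function in the plane with Schwarzian derivative S_f = 2A such that: (i) f has finitely many critical values and all multiple points of f have multiplicity at most M; (ii) the inverse function of f has finitely many transcendental singularities. If A is transcendental, then A does not have the Wiman-Valiron property. -/

import Mathlib

open Filter Set Topology Bornology MeasureTheory

noncomputable section

/-! ### The extended plane and the chordal metric

ℂ∞ is modelled as `Option ℂ`, with `none` denoting the point ∞. -/

/-- The chordal metric χ on the extended complex plane ℂ∞ (`none` = ∞). -/
def chordal : Option ℂ → Option ℂ → ℝ
  | Option.none, Option.none => 0
  | Option.none, Option.some w => 1 / Real.sqrt (1 + ‖w‖ ^ 2)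
  | Option.some z, Option.none => 1 / Real.sqrt (1 + ‖z‖ ^ 2)
  | Option.some z, Option.some w =>
      ‖z - w‖ / Real.sqrt ((1 + ‖z‖ ^ 2) * (1 + ‖w‖ ^ 2))

/-! ### Meromorphic functions in the plane -/

/-- `f` is meromorphic on the plane with pole set `P`: poles form a discrete closed set,
`f` is analytic off `P`, and `|f| → ∞` at each point of `P`. -/
def MeroPlane (f : ℂ → ℂ) (P : Set ℂ) : Prop :=
  (∀ K : Set ℂ, IsCompact K → (P ∩ K).Finite) ∧
  (∀ z ∉ P, AnalyticAt ℂ f z) ∧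
  ∀ p ∈ P, Tendsto (fun z => ‖f z‖) (nhdsWithin p Pᶜ) atTop

/-- `f` coincides with a rational function away from its poles. -/
def RationalFn (f : ℂ → ℂ) (P : Set ℂ) : Prop :=
  ∃ p q : Polynomial ℂ, q ≠ 0 ∧ ∀ z ∉ P, q.eval z ≠ 0 → f z = p.eval z / q.eval z

/-- `f` is a transcendental meromorphic function in the plane, with pole set `P`. -/
def TranscMeroPlane (f : ℂ → ℂ) (P : Set ℂ) : Prop :=
  MeroPlane f P ∧ ¬ RationalFn f P

/-- `f` has a pole of order `m` at `z₀`. -/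
def PoleOrder (f : ℂ → ℂ) (z₀ : ℂ) (m : ℕ) : Prop :=
  0 < m ∧ ∃ g : ℂ → ℂ, AnalyticAt ℂ g z₀ ∧ g z₀ ≠ 0 ∧
    ∀ᶠ z in nhdsWithin z₀ {z₀}ᶜ, f z = g z / (z - z₀) ^ m

/-- `f` has a zero of order `m` at `z₀`. -/
def ZeroOrder (f : ℂ → ℂ) (z₀ : ℂ) (m : ℕ) : Prop :=
  0 < m ∧ ∃ g : ℂ → ℂ, AnalyticAt ℂ g z₀ ∧ g z₀ ≠ 0 ∧
    ∀ᶠ z in nhds z₀, f z = (z - z₀) ^ m * g z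

/-- `z₀` is a multiple point of `f` of multiplicity `μ`: either a pole of `f` of order `μ ≥ 2`,
or a point of analyticity where `f'` has a zero of order `μ - 1`. -/
def MultiplePointWithMult (f : ℂ → ℂ) (z₀ : ℂ) (μ : ℕ) : Prop :=
  2 ≤ μ ∧ (PoleOrder f z₀ μ ∨ (AnalyticAt ℂ f z₀ ∧ ZeroOrder (deriv f) z₀ (μ - 1)))

/-- `z₀` is a multiple point of `f`. -/
def MultiplePoint (f : ℂ → ℂ) (z₀ : ℂ) : Prop :=
  ∃ μ, MultiplePointWithMult f z₀ μ

open scoped Classical in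
/-- The value of `f` at `z` as an element of ℂ∞, given the pole set `P`. -/
def valueAt (f : ℂ → ℂ) (P : Set ℂ) (z : ℂ) : Option ℂ :=
  if z ∈ P then none else some (f z)

/-- The set of critical values of `f` in ℂ∞ (values at multiple points). -/
def CriticalValues (f : ℂ → ℂ) (P : Set ℂ) : Set (Option ℂ) :=
  {w | ∃ z, MultiplePoint f z ∧ w = valueAt f P z}

/-! ### Transcendental singularities of the inverse function -/

/-- A path tending to infinity on which `f → a`; such a path determines a transcendental
singularity of `f⁻¹` over `a`. -/
def AsymptoticPath (f : ℂ → ℂ) (P : Set ℂ) (a : Option ℂ) (γ : ℝ → ℂ) : Prop :=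
  ContinuousOn γ (Ici 0) ∧
  Tendsto (fun t => ‖γ t‖) atTop atTop ∧
  Tendsto (fun t => chordal (valueAt f P (γ t)) a) atTop (nhds 0)

/-- `C` is a connected component of the set `S`. -/
def IsComponentOf (C S : Set ℂ) : Prop :=
  ∃ x ∈ S, C = connectedComponentIn S x

/-- The paths `γ₁`, `γ₂`, with asymptotic values `a₁`, `a₂` respectively, determine
distinct transcendental singularities of `f⁻¹`. -/
def DistinctSingularities (f : ℂ → ℂ) (P : Set ℂ) (a₁ a₂ : Option ℂ) (γ₁ γ₂ : ℝ → ℂ) : Prop :=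
  a₁ ≠ a₂ ∨ ∃ t : ℝ, 0 < t ∧ ∃ C₁ C₂ : Set ℂ,
    IsComponentOf C₁ {z | chordal (valueAt f P z) a₁ < t} ∧
    IsComponentOf C₂ {z | chordal (valueAt f P z) a₂ < t} ∧
    Disjoint C₁ C₂ ∧
    IsBounded (γ₁ '' Ici 0 \ C₁) ∧ IsBounded (γ₂ '' Ici 0 \ C₂)

/-- The inverse function of `f` has finitely many transcendental singularities: there is a
bound `n` on the size of any family of pairwise distinct transcendental singularities. -/
def FinitelyManyTranscSing (f : ℂ → ℂ) (P : Set ℂ) : Prop :=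
  ∃ n : ℕ, ∀ m : ℕ, ∀ a : Fin m → Option ℂ, ∀ γ : Fin m → ℝ → ℂ,
    (∀ i, AsymptoticPath f P (a i) (γ i)) →
    (∀ i j, i ≠ j → DistinctSingularities f P (a i) (a j) (γ i) (γ j)) →
    m ≤ n

/-- The Schwarzian derivative `S_f = f'''/f' - (3/2)(f''/f')²`. -/
def schwarzian (f : ℂ → ℂ) (z : ℂ) : ℂ :=
  deriv (deriv (deriv f)) z / deriv f z - (3 / 2) * (deriv (deriv f) z / deriv f z) ^ 2

/-- `w` is a singular value of `f⁻¹`: a critical value or an asymptotic value of `f`. -/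
def SingularValue (f : ℂ → ℂ) (P : Set ℂ) (w : Option ℂ) : Prop :=
  w ∈ CriticalValues f P ∨ ∃ γ : ℝ → ℂ, AsymptoticPath f P w γ

/-! ### Nevanlinna theory -/

open scoped Classical in
/-- The order of the pole of `f` at `z` (junk value `0` if there is no pole). -/
def poleOrderAt (f : ℂ → ℂ) (z : ℂ) : ℕ :=
  if h : ∃ m, PoleOrder f z m then h.choose else 0

/-- `n(t, f)`: the number of poles of `f` of modulus at most `t`, counted with multiplicity. -/
def nCount (f : ℂ → ℂ) (t : ℝ) : ℕ :=
  ∑ᶠ z ∈ {w : ℂ | ‖w‖ ≤ t}, poleOrderAt f z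

/-- `N(r, f)`: the integrated counting function of the poles of `f`. -/
def nevN (f : ℂ → ℂ) (r : ℝ) : ℝ :=
  (nCount f 0 : ℝ) * Real.log r + ∫ t in (0:ℝ)..r, ((nCount f t : ℝ) - (nCount f 0 : ℝ)) / t

/-- `m(r, f)`: the Nevanlinna proximity function. -/
def nevm (f : ℂ → ℂ) (r : ℝ) : ℝ :=
  (1 / (2 * Real.pi)) * ∫ θ in (0:ℝ)..(2 * Real.pi),
    Real.log (max 1 (‖f (r * Complex.exp (θ * Complex.I))‖))

/-- `T(r, f)`: the Nevanlinna characteristic. -/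
def nevT (f : ℂ → ℂ) (r : ℝ) : ℝ := nevm f r + nevN f r

/-- The order of growth `ρ(f) = limsup_{r→∞} log T(r,f)/log r`, as an extended real. -/
def growthOrder (f : ℂ → ℂ) : EReal :=
  Filter.limsup (fun r : ℝ => ((Real.log (nevT f r) / Real.log r : ℝ) : EReal)) atTop

/-- ∞ is a Borel exceptional value of `f`. -/
def BorelExceptionalInfty (f : ℂ → ℂ) : Prop :=
  Filter.limsup (fun r : ℝ => ((Real.log (nevN f r) / Real.log r : ℝ) : EReal)) atTop <
  Filter.limsup (fun r : ℝ => ((Real.log (nevT f r) / Real.log r : ℝ) : EReal)) atTop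

/-! ### Meromorphic functions near infinity and the Wiman-Valiron property -/

/-- `A` is meromorphic in `R ≤ |z| < ∞` with pole set `P`. -/
def MeroAnnulus (A : ℂ → ℂ) (R : ℝ) (P : Set ℂ) : Prop :=
  P ⊆ {z : ℂ | R ≤ ‖z‖} ∧
  (∀ K : Set ℂ, IsCompact K → (P ∩ K).Finite) ∧
  (∀ z : ℂ, R < ‖z‖ → z ∉ P → AnalyticAt ℂ A z) ∧
  ∀ p ∈ P, Tendsto (fun z => ‖A z‖) (nhdsWithin p Pᶜ) atTop

/-- `A` (meromorphic near ∞ with pole set `P`) has an essential singularity at infinity: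
it is not the case that the poles are bounded and `A(z) ~ c zⁿ` as `z → ∞`. -/
def EssSingAtInfty (A : ℂ → ℂ) (P : Set ℂ) : Prop :=
  ¬ (IsBounded P ∧ ∃ (n : ℤ) (c : ℂ), c ≠ 0 ∧
      Tendsto (fun z : ℂ => A z / z ^ n)
        (Filter.comap (fun z : ℂ => ‖z‖) atTop ⊓ Filter.principal Pᶜ) (nhds c))

/-- The logarithmic rectangle `D(z_r, L)` of Definition 2.1. -/
def WVDisk (z₀ : ℂ) (Nr phir L : ℝ) : Set ℂ :=
  {z : ℂ | ∃ τ : ℂ, z = z₀ * Complex.exp τ ∧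
    |τ.re| ≤ L * phir / Nr ∧ |τ.im| ≤ L * phir / Nr}

/-- Data witnessing the Wiman-Valiron property for `A`, meromorphic in `R ≤ |z| < ∞`:
an unbounded set `F1 ⊆ [R,∞)`, functions `N : F1 → [2,∞)`, `phi : F1 → [1,∞)` and points
`zr r` with `|zr r| = r`, such that `N(r) → ∞`, `phi(r)/N(r) → 0`, `phi(r)/log N(r) → ∞`,
`phi(r) = o(log⁺ |A(zr r)|)`, and `A(z) ~ (z/zr r)^{N(r)} A(zr r)` on `D(zr r, 8)`,
uniformly as `r → ∞` in `F1`.  (For `z = zr r · e^τ` one has `(z/zr r)^{N(r)} = e^{N(r)τ}`.) -/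
structure WVData (A : ℂ → ℂ) (R : ℝ) where
  F1 : Set ℝ
  N : ℝ → ℝ
  phi : ℝ → ℝ
  zr : ℝ → ℂ
  F1_sub : F1 ⊆ Ici R
  F1_unbounded : ∀ c : ℝ, ∃ r ∈ F1, c < r
  N_ge : ∀ r ∈ F1, 2 ≤ N r
  phi_ge : ∀ r ∈ F1, 1 ≤ phi r
  N_tendsto : Tendsto N (atTop ⊓ Filter.principal F1) atTop
  phi_over_N : Tendsto (fun r => phi r / N r) (atTop ⊓ Filter.principal F1) (nhds 0)
  phi_over_logN : Tendsto (fun r => phi r / Real.log (N r)) (atTop ⊓ Filter.principal F1) atTop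
  zr_abs : ∀ r ∈ F1, ‖zr r‖ = r
  phi_small : Tendsto (fun r => phi r / Real.log (max 1 (‖A (zr r)‖)))
      (atTop ⊓ Filter.principal F1) (nhds 0)
  approx : ∀ ε : ℝ, 0 < ε → ∀ᶠ r in atTop ⊓ Filter.principal F1, ∀ τ : ℂ,
      |τ.re| ≤ 8 * phi r / N r → |τ.im| ≤ 8 * phi r / N r →
      ‖A (zr r * Complex.exp τ) - Complex.exp ((N r : ℂ) * τ) * A (zr r)‖
        ≤ ε * ‖Complex.exp ((N r : ℂ) * τ) * A (zr r)‖

/-- `A` has the Wiman-Valiron property (Definition 2.1). -/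
def HasWVProp (A : ℂ → ℂ) (R : ℝ) : Prop := Nonempty (WVData A R)

/-- The point `w_r = z_r exp(-4 phi(r)/N(r))`. -/
def WVwr {A : ℂ → ℂ} {R : ℝ} (W : WVData A R) (r : ℝ) : ℂ :=
  W.zr r * Complex.exp (((-(4 * W.phi r / W.N r) : ℝ) : ℂ))

/-- The quantity `Z_r = |2 z_r A(z_r)^{1/2} / (N(r)+2)|`. -/
def WVZr {A : ℂ → ℂ} {R : ℝ} (W : WVData A R) (r : ℝ) : ℝ :=
  2 * r * Real.sqrt (‖A (W.zr r)‖) / (W.N r + 2)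

/-- The data of an analytic branch `sqA r` of `A^{1/2}` on `D(z_r, 4)` together with the
primitive `Z r` of `A^{1/2}` with `Z r (w_r) = 2 w_r A(w_r)^{1/2}/(N+2)`; this encodes
`Z(z) = 2 w_r A(w_r)^{1/2}/(N+2) + ∫_{w_r}^z A(t)^{1/2} dt`. -/
def IsZData {A : ℂ → ℂ} {R : ℝ} (W : WVData A R) (sqA Z : ℝ → ℂ → ℂ) (r : ℝ) : Prop :=
  (∀ z ∈ WVDisk (W.zr r) (W.N r) (W.phi r) 4,
      (sqA r z) ^ 2 = A z ∧ AnalyticAt ℂ (sqA r) z ∧ HasDerivAt (Z r) (sqA r z) z) ∧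
  Z r (WVwr W r) = 2 * WVwr W r * sqA r (WVwr W r) / ((W.N r : ℂ) + 2)

/-- The closed logarithmic rectangle `J₁ = {Z : |log|Z/Z_r|| ≤ phi(r), |arg Z| ≤ π/4}`. -/
def J1 (Zr phir : ℝ) : Set ℂ :=
  {w : ℂ | w ≠ 0 ∧ |Real.log (‖w‖ / Zr)| ≤ phir ∧ |Complex.arg w| ≤ Real.pi / 4}

/-! ### ε-sets -/

/-- An ε-set: a countable union of discs `B(b_j, ρ_j)` with `|b_j| → ∞` and
`Σ ρ_j/|b_j| < ∞`. -/
def IsEpsilonSet (E : Set ℂ) : Prop :=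
  ∃ (b : ℕ → ℂ) (ρ : ℕ → ℝ), (∀ j, 0 ≤ ρ j) ∧
    Tendsto (fun j => ‖b j‖) atTop atTop ∧
    Summable (fun j => ρ j / ‖b j‖) ∧
    E = ⋃ j, Metric.ball (b j) (ρ j)


namespace SW
open Metric

lemma inj_basic {U : Set ℂ} {g : ℂ → ℂ} (hU : IsOpen U) (hg : DifferentiableOn ℂ g U)
    (hi : InjOn g U) : IsOpen (g '' U) ∧
    DifferentiableOn ℂ (Function.invFunOn g U) (g '' U) ∧ ∀ z ∈ U, deriv g z ≠ 0 := by
  classical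
  have hana : ∀ z ∈ U, AnalyticAt ℂ g z := fun z hz => hg.analyticAt (hU.mem_nhds hz)
  have hnc : ∀ z ∈ U, ¬ ∀ᶠ w in 𝓝 z, g w = g z := by
    intro z hz h
    have h2 : ∀ᶠ w in 𝓝[≠] z, w = z := by
      have := (h.and (hU.mem_nhds hz)).filter_mono (nhdsWithin_le_nhds (s := {z}ᶜ))
      filter_upwards [this] with w hw
      exact hi hw.2 hz hw.1
    have h3 : ∀ᶠ w in 𝓝[≠] z, w ≠ z := eventually_mem_nhdsWithin
    obtain ⟨w, hw1, hw2⟩ := (h2.and h3).exists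
    exact hw2 hw1
  have hmap : ∀ z ∈ U, 𝓝 (g z) ≤ map g (𝓝 z) := fun z hz =>
    ((hana z hz).eventually_constant_or_nhds_le_map_nhds).resolve_left (hnc z hz)
  have hopen : IsOpen (g '' U) := by
    rw [isOpen_iff_mem_nhds]
    rintro _ ⟨z, hz, rfl⟩
    exact hmap z hz (image_mem_map (hU.mem_nhds hz))
  set k := Function.invFunOn g U with hk
  have hkg : ∀ z ∈ U, k (g z) = z := fun z hz => hi.leftInvOn_invFunOn hz
  have hgk : ∀ w ∈ g '' U, g (k w) = w := by
    rintro _ ⟨z, hz, rfl⟩; rw [hkg z hz]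
  have hcont : ∀ z ∈ U, ContinuousAt k (g z) := by
    intro z hz
    rw [ContinuousAt, hkg z hz]
    intro W hW
    have : g '' (W ∩ U) ∈ 𝓝 (g z) :=
      hmap z hz (image_mem_map (inter_mem hW (hU.mem_nhds hz)))
    refine mem_map.2 (mem_of_superset this ?_)
    rintro _ ⟨y, hy, rfl⟩
    simpa [hkg y hy.2] using hy.1
  have hder : ∀ z ∈ U, deriv g z ≠ 0 → DifferentiableAt ℂ k (g z) := by
    intro z hz h
    have h1 : HasDerivAt g (deriv g z) (k (g z)) := by
      rw [hkg z hz]; exact (hana z hz).differentiableAt.hasDerivAt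
    refine (HasDerivAt.of_local_left_inverse (hcont z hz) h1 h ?_).differentiableAt
    filter_upwards [hopen.mem_nhds (mem_image_of_mem g hz)] with w hw using hgk w hw
  have hmain : ∀ z ∈ U, DifferentiableAt ℂ k (g z) := by
    intro z hz
    refine (Complex.analyticAt_of_differentiable_on_punctured_nhds_of_continuousAt ?_
      (hcont z hz)).differentiableAt
    have hz0 : ∀ᶠ w in 𝓝[≠] z, deriv g w ≠ 0 := by
      refine ((hana z hz).deriv.eventually_eq_zero_or_eventually_ne_zero).resolve_left ?_
      intro h
      obtain ⟨r, hr, hrs⟩ := Metric.eventually_nhds_iff_ball.1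
        (h.and (hU.mem_nhds hz))
      refine hnc z hz ?_
      filter_upwards [ball_mem_nhds z hr] with w hw
      refine (convex_ball z r).is_const_of_fderivWithin_eq_zero (𝕜 := ℂ) (f := g) ?_ ?_ hw
        (mem_ball_self hr)
      · exact fun x hx => (hana x (hrs x hx).2).differentiableAt.differentiableWithinAt
      · intro x hx
        rw [fderivWithin_of_isOpen isOpen_ball hx]
        ext; simp [(hrs x hx).1]
    rw [eventually_nhdsWithin_iff] at hz0 ⊢
    have : g '' ({w | w ∈ ({z}ᶜ : Set ℂ) → deriv g w ≠ 0} ∩ U) ∈ 𝓝 (g z) :=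
      hmap z hz (image_mem_map (inter_mem hz0 (hU.mem_nhds hz)))
    filter_upwards [this]
    rintro _ ⟨y, hy, rfl⟩ hne
    exact hder y hy.2 (hy.1 fun h => hne (by rw [mem_singleton_iff.1 h]; rfl))
  refine ⟨hopen, ?_, ?_⟩
  · rintro _ ⟨z, hz, rfl⟩
    exact (hmain z hz).differentiableWithinAt
  · intro z hz h0
    have h1 := (hmain z hz).hasDerivAt.comp z (hana z hz).differentiableAt.hasDerivAt
    have h2 : (k ∘ g) =ᶠ[𝓝 z] id := by
      filter_upwards [hU.mem_nhds hz] with y hy using hkg y hy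
    have h3 := (h1.congr_of_eventuallyEq h2.symm).unique (hasDerivAt_id z)
    simp [h0] at h3

/-- Bloch-type estimate. -/
lemma bloch {L : ℂ → ℂ} (hL : DifferentiableOn ℂ L (ball 0 1))
    (hi : ∀ x ∈ ball (0:ℂ) 1, ∀ y ∈ ball (0:ℂ) 1, L x - L y ≠ 2 * Real.pi * Complex.I)
    {z : ℂ} (hz : ‖z‖ < 1) : ‖deriv L z‖ * (1 - ‖z‖) ≤ 200 := by
  have hdL : DifferentiableOn ℂ (deriv L) (ball 0 1) := hL.deriv isOpen_ball
  have key : ∀ r, ‖z‖ < r → r < 1 → (r - ‖z‖) * ‖deriv L z‖ ≤ 200 := by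
    intro r hzr hr
    have hsub : closedBall (0:ℂ) r ⊆ ball 0 1 := closedBall_subset_ball hr
    obtain ⟨z1, hz1, hmax⟩ := (isCompact_closedBall (0:ℂ) r).exists_isMaxOn
      (f := fun z => (r - ‖z‖) * ‖deriv L z‖) ⟨z, by simpa using hzr.le⟩
      ((continuous_const.sub continuous_norm).continuousOn.mul
        ((hdL.continuousOn.mono hsub).norm))
    have hm : ∀ y, ‖y‖ ≤ r → (r - ‖y‖) * ‖deriv L y‖ ≤ (r - ‖z1‖) * ‖deriv L z1‖ :=
      fun y hy => hmax (by simpa using hy)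
    refine (hm z hzr.le).trans ?_
    have hz1r : ‖z1‖ ≤ r := by simpa using hz1
    by_contra hcon
    push Not at hcon
    set m := ‖deriv L z1‖ with hmdef
    have hd0 : 0 < r - ‖z1‖ := by
      rcases hz1r.lt_or_eq with h | h
      · linarith
      · rw [h] at hcon; simp at hcon; linarith
    set d := (r - ‖z1‖) / 2 with hd
    have hdpos : 0 < d := by positivity
    have hmpos : 0 < m := by
      by_contra h; push Not at h
      nlinarith
    have hballsub : ∀ y ∈ ball z1 d, ‖y‖ < r - d := by
      intro y hy
      have h1 : ‖y - z1‖ < d := by simpa [dist_eq_norm] using hy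
      have := norm_le_norm_add_norm_sub' y z1
      linarith
    have hin : ball z1 d ⊆ ball 0 1 := by
      intro y hy; have := hballsub y hy
      simp; linarith
    have hb : ∀ y ∈ ball z1 d, ‖deriv L y‖ ≤ 2 * m := by
      intro y hy
      have h1 := hballsub y hy
      have h2 := hm y (by linarith)
      have h3 : d * ‖deriv L y‖ ≤ (r - ‖y‖) * ‖deriv L y‖ := by
        apply mul_le_mul_of_nonneg_right _ (norm_nonneg _); linarith
      have h4 : d * ‖deriv L y‖ ≤ d * (2 * m) := by
        calc _ ≤ _ := h3
          _ ≤ _ := h2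
          _ = _ := by rw [hd]; ring
      exact le_of_mul_le_mul_left h4 hdpos
    have hb2 : ∀ y ∈ ball z1 d, ‖deriv L y - deriv L z1‖ ≤ 3 * m / d * ‖y - z1‖ := by
      intro y hy
      have := Complex.dist_le_div_mul_dist_of_mapsTo_ball (R₂ := 3 * m) (hdL.mono hin)
        (fun x hx => ?_) hy
      · simpa [dist_eq_norm] using this
      · rw [mem_closedBall, dist_eq_norm]
        calc _ ≤ ‖deriv L x‖ + m := norm_sub_le _ _
          _ ≤ 3 * m := by linarith [hb x hx]
    set ρ := d / 6 with hρ
    have hρpos : 0 < ρ := by positivity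
    have hcb : closedBall z1 ρ ⊆ ball z1 d := closedBall_subset_ball (by linarith)
    have hlow : ∀ y ∈ sphere z1 ρ, ρ * m / 2 ≤ ‖L y - L z1‖ := by
      intro y hy
      have hy' : ‖y - z1‖ = ρ := by simpa [dist_eq_norm] using hy
      have h1 : ‖(L y - deriv L z1 * y) - (L z1 - deriv L z1 * z1)‖ ≤ m / 2 * ‖y - z1‖ := by
        refine (convex_closedBall z1 ρ).norm_image_sub_le_of_norm_hasDerivWithin_le
          (f := fun y => L y - deriv L z1 * y)
          (f' := fun y => deriv L y - deriv L z1) ?_ ?_ (mem_closedBall_self hρpos.le)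
          (sphere_subset_closedBall hy)
        · intro x hx
          have h2 := (hL.differentiableAt (isOpen_ball.mem_nhds (hin (hcb hx)))).hasDerivAt
          have h3 := (hasDerivAt_id x).const_mul (deriv L z1)
          have h4 := (h2.sub h3).hasDerivWithinAt (s := closedBall z1 ρ)
          rw [mul_one] at h4
          exact h4
        · intro x hx
          have hx' : ‖x - z1‖ ≤ ρ := by simpa [dist_eq_norm] using hx
          calc _ ≤ 3 * m / d * ‖x - z1‖ := hb2 x (hcb hx)
            _ ≤ 3 * m / d * ρ := by gcongr
            _ = m / 2 := by rw [hρ]; field_simp; norm_num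
      have h2 : deriv L z1 * (y - z1) = (L y - L z1) -
          ((L y - deriv L z1 * y) - (L z1 - deriv L z1 * z1)) := by ring
      have h3 : m * ρ ≤ ‖L y - L z1‖ + m / 2 * ρ := by
        calc m * ρ = ‖deriv L z1 * (y - z1)‖ := by rw [norm_mul, hy']
          _ ≤ ‖L y - L z1‖ + ‖(L y - deriv L z1 * y) - (L z1 - deriv L z1 * z1)‖ := by
            rw [h2]; exact norm_sub_le _ _
          _ ≤ _ := by rw [hy'] at h1; exact add_le_add_right h1 _
      linarith
    have hcov := DiffContOnCl.ball_subset_image_closedBall (f := L) (z₀ := z1)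
      (ε := ρ * m / 2) (r := ρ)
      ((hL.mono (hcb.trans hin)).diffContOnCl_ball subset_rfl) hρpos hlow ?_
    · have hbig : Real.pi < ρ * m / 2 / 2 := by
        have : ρ * m / 2 / 2 = (r - ‖z1‖) * m / 48 := by rw [hρ, hd]; ring
        rw [this]; linarith [Real.pi_lt_d2]
      have hpi : ∀ σ : ℝ, |σ| = 1 → L z1 + σ * Real.pi * Complex.I ∈ L '' closedBall z1 ρ := by
        intro σ hσ
        apply hcov
        simp [dist_eq_norm, hσ, abs_of_pos Real.pi_pos, hbig]
      obtain ⟨x, hx, hx2⟩ := hpi 1 (by simp)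
      obtain ⟨y, hy, hy2⟩ := hpi (-1) (by simp)
      apply hi x (hin (hcb hx)) y (hin (hcb hy))
      rw [hx2, hy2]; push_cast; ring
    · by_contra h
      rw [not_frequently] at h
      have h' : L =ᶠ[𝓝 z1] fun _ => L z1 := by
        filter_upwards [h] with y hy; simpa using hy
      have := h'.deriv_eq
      simp at this
      simp [hmdef, this] at hmpos
  have : Tendsto (fun r : ℝ => (r - ‖z‖) * ‖deriv L z‖) (𝓝[<] 1) (𝓝 ((1 - ‖z‖) * ‖deriv L z‖)) :=
    (((continuous_id.sub continuous_const).mul continuous_const).tendsto 1).mono_left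
      nhdsWithin_le_nhds
  rw [mul_comm]
  refine le_of_tendsto this ?_
  filter_upwards [Ioo_mem_nhdsLT hz] with r hr using key r hr.1 hr.2

lemma omitted {g : ℂ → ℂ} (hg : DifferentiableOn ℂ g (ball 0 1)) (hi : InjOn g (ball 0 1))
    (h0 : g 0 = 0) : ∃ c, c ≠ 0 ∧ ‖c‖ ≤ 2 * ‖deriv g 0‖ ∧ ∀ z ∈ ball (0:ℂ) 1, g z ≠ c := by
  obtain ⟨-, hk, hne⟩ := inj_basic isOpen_ball hg hi
  have h00 : (0:ℂ) ∈ ball (0:ℂ) 1 := by simp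
  have hd := norm_pos_iff.2 (hne 0 h00)
  by_contra hcon
  push Not at hcon
  have hsub : ball (0:ℂ) (2 * ‖deriv g 0‖) ⊆ g '' ball 0 1 := by
    intro c hc
    by_cases hc0 : c = 0
    · exact ⟨0, h00, by rw [h0, hc0]⟩
    · obtain ⟨z, hz, h⟩ := hcon c hc0 (by simpa using (mem_ball_zero_iff.1 hc).le); exact ⟨z, hz, h⟩
  set k := Function.invFunOn g (ball 0 1)
  have hkg : ∀ z ∈ ball (0:ℂ) 1, k (g z) = z := fun z hz => hi.leftInvOn_invFunOn hz
  have hk0 : k 0 = 0 := by have := hkg 0 h00; rwa [h0] at this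
  have hb := Complex.norm_deriv_le_div_of_mapsTo_ball (c := 0) (R₂ := 1) (hk.mono hsub) (by
    intro w hw
    obtain ⟨z, hz, rfl⟩ := hsub hw
    rw [hkg z hz, hk0]; exact ball_subset_closedBall hz) (by positivity)
  have hkd : DifferentiableAt ℂ k 0 := hk.differentiableAt
    (mem_of_superset (ball_mem_nhds 0 (by positivity)) hsub)
  have h1 : HasDerivAt (k ∘ g) (deriv k 0 * deriv g 0) 0 := by
    refine HasDerivAt.comp 0 (by rw [h0]; exact hkd.hasDerivAt)
      (hg.differentiableAt (isOpen_ball.mem_nhds h00)).hasDerivAt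
  have h2 : (k ∘ g) =ᶠ[𝓝 0] id := by
    filter_upwards [isOpen_ball.mem_nhds h00] with y hy using hkg y hy
  have h3 := (h1.congr_of_eventuallyEq h2.symm).unique (hasDerivAt_id 0)
  have h4 : ‖deriv k 0‖ * ‖deriv g 0‖ = 1 := by rw [← norm_mul, h3]; simp
  have : ‖deriv k 0‖ * ‖deriv g 0‖ ≤ 1 / (2 * ‖deriv g 0‖) * ‖deriv g 0‖ := by gcongr
  rw [h4] at this
  field_simp at this
  norm_num at this

lemma koebe1 {g : ℂ → ℂ} (hg : DifferentiableOn ℂ g (ball 0 1)) (hi : InjOn g (ball 0 1))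
    (h0 : g 0 = 0) {t : ℝ} (ht : t < 1) {z : ℂ} (hz : ‖z‖ ≤ t) :
    ‖g z‖ ≤ 2 * (1 + Real.exp (200 / (1 - t))) * ‖deriv g 0‖ := by
  obtain ⟨c, hc0, hc, hom⟩ := omitted hg hi h0
  have hom' : ∀ x ∈ ball (0:ℂ) 1, g x - c ≠ 0 := fun x hx => sub_ne_zero.2 (hom x hx)
  have hq : DifferentiableOn ℂ (fun x => deriv g x / (g x - c)) (ball 0 1) :=
    (hg.deriv isOpen_ball).div (hg.sub_const c) hom'
  obtain ⟨L, hL0, hL⟩ := hq.isExactOn_ball.with_val_at 0 0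
  have hexp : ∀ x ∈ ball (0:ℂ) 1, Complex.exp (L x) = 1 - g x / c := by
    have hconst : ∀ x ∈ ball (0:ℂ) 1, (g x - c) * Complex.exp (-L x) = -c := by
      intro x hx
      have h1 : ∀ y ∈ ball (0:ℂ) 1, HasDerivWithinAt
          (fun y => (g y - c) * Complex.exp (-L y)) 0 (ball 0 1) y := by
        intro y hy
        have hgd := (hg.differentiableAt (isOpen_ball.mem_nhds hy)).hasDerivAt
        have h2 := (hgd.sub_const c).mul (hL y hy).neg.cexp
        refine HasDerivAt.hasDerivWithinAt ?_
        refine h2.congr_deriv ?_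
        have := mul_div_cancel₀ (deriv g y) (hom' y hy)
        linear_combination -Complex.exp ((-L) y) * this
      have h2 := (convex_ball (0:ℂ) 1).norm_image_sub_le_of_norm_hasDerivWithin_le h1
        (C := 0) (by simp) (mem_ball_self one_pos) hx
      simp only [h0, hL0] at h2
      have h3 : (g x - c) * Complex.exp (-L x) - (0 - c) * Complex.exp (-0) = 0 := by
        simpa using h2
      simp at h3
      linear_combination h3
    intro x hx
    have := hconst x hx
    rw [Complex.exp_neg] at this
    field_simp [Complex.exp_ne_zero] at this ⊢
    linear_combination this
  have hLd : DifferentiableOn ℂ L (ball 0 1) := fun x hx =>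
    (hL x hx).differentiableAt.differentiableWithinAt
  have hbl : ∀ x, ‖x‖ < 1 → ‖deriv L x‖ * (1 - ‖x‖) ≤ 200 := fun x hx => by
    refine bloch hLd ?_ hx
    intro x hx y hy h
    have h1 : Complex.exp (L x) = Complex.exp (L y) := by
      rw [← sub_add_cancel (L x) (L y), h, Complex.exp_add]
      rw [Complex.exp_two_pi_mul_I, one_mul]
    rw [hexp x hx, hexp y hy] at h1
    have h2 : g x = g y := by field_simp at h1; linear_combination -h1
    rw [hi hx hy h2, sub_self] at h
    have := Real.pi_ne_zero
    simp [this] at h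
  have ht0 : 0 ≤ t := (norm_nonneg z).trans hz
  have h1t : 0 < 1 - t := by linarith
  have hLz : ‖L z - L 0‖ ≤ 200 / (1 - t) * ‖z - 0‖ := by
    refine (convex_closedBall (0:ℂ) t).norm_image_sub_le_of_norm_deriv_le ?_ ?_
      (mem_closedBall_self ht0) (by simpa using hz)
    · intro x hx
      exact (hL x (closedBall_subset_ball ht hx)).differentiableAt
    · intro x hx
      have hx' : ‖x‖ ≤ t := by simpa using hx
      rw [le_div_iff₀ h1t]
      refine le_trans ?_ (hbl x (by linarith))
      gcongr
  have hLz' : ‖L z‖ ≤ 200 / (1 - t) := by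
    rw [hL0] at hLz; simp at hLz
    refine hLz.trans ?_
    have : 0 ≤ 200 / (1 - t) := by positivity
    nlinarith
  have hz1 : z ∈ ball (0:ℂ) 1 := by simp; linarith
  have hgz : g z = c * (1 - Complex.exp (L z)) := by
    rw [hexp z hz1]; field_simp; ring
  rw [hgz, norm_mul]
  calc ‖c‖ * ‖1 - Complex.exp (L z)‖ ≤ (2 * ‖deriv g 0‖) * (1 + Real.exp (200 / (1 - t))) := by
        gcongr
        refine (norm_sub_le _ _).trans ?_
        rw [norm_one, Complex.norm_exp]
        gcongr
        exact (Complex.re_le_norm _).trans hLz'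
    _ = _ := by ring

def KC (t : ℝ) : ℝ := 2 * (1 + Real.exp (200 / (1 - t)))

lemma KC_pos (t : ℝ) : 0 < KC t := by unfold KC; positivity

lemma koebe {g : ℂ → ℂ} {c : ℂ} {R : ℝ} (hR : 0 < R) (hg : DifferentiableOn ℂ g (ball c R))
    (hi : InjOn g (ball c R)) {t : ℝ} (ht : t < 1) {z : ℂ} (hz : ‖z - c‖ ≤ t * R) :
    ‖g z - g c‖ ≤ KC t * (R * ‖deriv g c‖) := by
  have hmap : ∀ x ∈ ball (0:ℂ) 1, c + R * x ∈ ball c R := by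
    intro x hx
    have : ‖x‖ < 1 := by simpa using hx
    simp [dist_eq_norm, abs_of_pos hR]; nlinarith
  have hRc : (R:ℂ) ≠ 0 := by exact_mod_cast hR.ne'
  have haff : ∀ x : ℂ, HasDerivAt (fun x : ℂ => c + R * x) R x := fun x => by
    simpa using ((hasDerivAt_id x).const_mul (R:ℂ)).const_add c
  have h0 : DifferentiableAt ℂ g c := hg.differentiableAt (ball_mem_nhds c hR)
  have hd : HasDerivAt (fun x => g (c + R * x) - g c) (deriv g c * R) 0 := by
    have h1 : HasDerivAt g (deriv g c) (c + R * 0) := by simpa using h0.hasDerivAt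
    exact (HasDerivAt.comp (0:ℂ) h1 (haff 0)).sub_const (g c)
  have := koebe1 (g := fun x => g (c + R * x) - g c) (t := t) (z := (z - c) / R) ?_ ?_ ?_ ht ?_
  · rw [hd.deriv] at this
    simp only [mul_div_cancel₀ _ hRc, add_sub_cancel, norm_mul] at this
    simpa [KC, abs_of_pos hR, mul_comm, mul_left_comm, mul_assoc] using this
  · exact (hg.comp (fun x _ => (haff x).differentiableAt.differentiableWithinAt) hmap).sub_const _
  · intro x hx y hy hxy
    have := hi (hmap x hx) (hmap y hy) (sub_left_injective hxy)
    simpa [hRc] using this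
  · simp
  · simp [abs_of_pos hR]; rwa [div_le_iff₀ hR]

end SW

namespace SW
open Metric

def KD (t : ℝ) : ℝ := KC ((1 + t) / 2) * 2 / (1 - t)

lemma koebe_deriv {g : ℂ → ℂ} {c : ℂ} {R : ℝ} (hR : 0 < R) (hg : DifferentiableOn ℂ g (ball c R))
    (hi : InjOn g (ball c R)) {t : ℝ} (ht : t < 1) {z : ℂ} (hz : ‖z - c‖ ≤ t * R) :
    ‖deriv g z‖ ≤ KD t * ‖deriv g c‖ := by
  have h1t : 0 < (1 - t) / 2 := by linarith
  have hin : ∀ x ∈ closedBall z ((1 - t) / 2 * R), ‖x - c‖ ≤ (1 + t) / 2 * R := by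
    intro x hx
    have : ‖x - z‖ ≤ (1 - t) / 2 * R := by simpa [dist_eq_norm] using hx
    calc _ ≤ ‖x - z‖ + ‖z - c‖ := norm_sub_le_norm_sub_add_norm_sub _ _ _
      _ ≤ (1 - t) / 2 * R + t * R := by gcongr
      _ = _ := by ring
  have hsub : closedBall z ((1 - t) / 2 * R) ⊆ ball c R := by
    intro x hx
    have := hin x hx
    rw [mem_ball, dist_eq_norm]; nlinarith
  have := Complex.norm_deriv_le_of_forall_mem_sphere_norm_le (f := fun x => g x - g c) (c := z)
    (R := (1 - t) / 2 * R) (C := KC ((1 + t) / 2) * (R * ‖deriv g c‖)) (by positivity)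
    (((hg.sub_const _).mono hsub).diffContOnCl_ball subset_rfl)
    (fun x hx => koebe hR hg hi (by linarith) (hin x (sphere_subset_closedBall hx)))
  rw [deriv_sub_const] at this
  refine this.trans_eq ?_
  unfold KD
  have : 1 - t ≠ 0 := by linarith
  field_simp

def K0 : ℝ := KD (1 / 2) + 1

lemma K0_pos : 1 < K0 := by
  unfold K0 KD
  have := KC_pos ((1 + 1 / 2) / 2)
  have : 0 < KC ((1 + 1 / 2) / 2) * 2 / (1 - 1 / 2) := by
    apply div_pos <;> [positivity; norm_num]
  linarith

lemma koebe_half {g : ℂ → ℂ} {c : ℂ} {R : ℝ} (hR : 0 < R) (hg : DifferentiableOn ℂ g (ball c R))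
    (hi : InjOn g (ball c R)) {z : ℂ} (hz : ‖z - c‖ ≤ R / 2) :
    ‖deriv g z‖ ≤ K0 * ‖deriv g c‖ := by
  have := koebe_deriv hR hg hi (t := 1 / 2) (by norm_num) (z := z) (by linarith)
  refine this.trans ?_
  gcongr
  unfold K0; linarith

lemma koebe_dist {g : ℂ → ℂ} {c : ℂ} {R : ℝ} (hR : 0 < R) (hg : DifferentiableOn ℂ g (ball c R))
    (hi : InjOn g (ball c R)) {z : ℂ} (hz : ‖z - c‖ < R / 2) :
    ‖deriv g z - deriv g c‖ ≤ 4 * K0 * ‖deriv g c‖ / R * ‖z - c‖ := by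
  have hsub : ball c (R / 2) ⊆ ball c R := ball_subset_ball (by linarith)
  have := Complex.dist_le_div_mul_dist_of_mapsTo_ball (f := deriv g) (c := c) (R₁ := R / 2)
    (R₂ := 2 * K0 * ‖deriv g c‖) (z := z) ((hg.deriv isOpen_ball).mono hsub) (fun x hx => ?_)
    (by simpa [dist_eq_norm] using hz)
  · rw [dist_eq_norm, dist_eq_norm] at this
    refine this.trans_eq ?_
    field_simp; ring
  · rw [mem_closedBall, dist_eq_norm]
    have h1 := koebe_half hR hg hi (z := x) (by
      have := mem_ball.1 hx; rw [dist_eq_norm] at this; linarith)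
    have h2 := norm_sub_le (deriv g x) (deriv g c)
    nlinarith [norm_nonneg (deriv g c), K0_pos]

/-- linear approximation -/
lemma koebe_lin {g : ℂ → ℂ} {c : ℂ} {R : ℝ} (hR : 0 < R) (hg : DifferentiableOn ℂ g (ball c R))
    (hi : InjOn g (ball c R)) {z : ℂ} (hz : ‖z - c‖ < R / 2) :
    ‖g z - g c - deriv g c * (z - c)‖ ≤ 4 * K0 * ‖deriv g c‖ / R * ‖z - c‖ ^ 2 := by
  have h1 : ‖(g z - deriv g c * z) - (g c - deriv g c * c)‖ ≤
      4 * K0 * ‖deriv g c‖ / R * ‖z - c‖ * ‖z - c‖ := by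
    refine (convex_closedBall c ‖z - c‖).norm_image_sub_le_of_norm_hasDerivWithin_le
      (f := fun y => g y - deriv g c * y)
      (f' := fun y => deriv g y - deriv g c) ?_ ?_ (mem_closedBall_self (norm_nonneg _))
      (by simp [dist_eq_norm])
    · intro x hx
      have hx' : x ∈ ball c R := closedBall_subset_ball (by linarith) hx
      have h2 := (hg.differentiableAt (isOpen_ball.mem_nhds hx')).hasDerivAt
      have h4 := (h2.sub ((hasDerivAt_id x).const_mul (deriv g c))).hasDerivWithinAt
        (s := closedBall c ‖z - c‖)
      rw [mul_one] at h4
      exact h4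
    · intro x hx
      have hx' : ‖x - c‖ ≤ ‖z - c‖ := by simpa [dist_eq_norm] using hx
      refine (koebe_dist hR hg hi (hx'.trans_lt hz)).trans ?_
      have := K0_pos
      gcongr
  have h2 : g z - g c - deriv g c * (z - c) =
    (g z - deriv g c * z) - (g c - deriv g c * c) := by ring
  rw [h2]
  refine h1.trans_eq (by ring)

def KS : ℝ := 8 * K0 + 6 * K0 ^ 2

lemma KS_pos : 0 < KS := by have := K0_pos; unfold KS; positivity

lemma schwarz_bound {g : ℂ → ℂ} {c : ℂ} {R : ℝ} (hR : 0 < R)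
    (hg : DifferentiableOn ℂ g (ball c R)) (hi : InjOn g (ball c R)) :
    ‖schwarzian g c‖ ≤ KS / R ^ 2 := by
  have hne : 0 < ‖deriv g c‖ := norm_pos_iff.2
    ((inj_basic isOpen_ball hg hi).2.2 c (mem_ball_self hR))
  have hd : DiffContOnCl ℂ (deriv g) (ball c (R / 2)) :=
    ((hg.deriv isOpen_ball).mono (closedBall_subset_ball (by linarith))).diffContOnCl_ball
      subset_rfl
  have hb : ∀ x ∈ sphere c (R / 2), ‖deriv g x‖ ≤ K0 * ‖deriv g c‖ := fun x hx =>
    koebe_half hR hg hi (by rw [mem_sphere, dist_eq_norm] at hx; exact hx.le)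
  have h1 := Complex.norm_deriv_le_of_forall_mem_sphere_norm_le (by positivity) hd hb
  have h2 := Complex.norm_iteratedDeriv_le_of_forall_mem_sphere_norm_le 2 (by positivity) hd hb
  rw [iteratedDeriv_succ, iteratedDeriv_one] at h2
  have h3 : ‖deriv (deriv g) c / deriv g c‖ ≤ 2 * K0 / R := by
    rw [norm_div, div_le_iff₀ hne]; refine h1.trans_eq ?_; field_simp
  have h4 : ‖deriv (deriv (deriv g)) c / deriv g c‖ ≤ 8 * K0 / R ^ 2 := by
    rw [norm_div, div_le_iff₀ hne]; refine h2.trans_eq ?_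
    simp [Nat.factorial]; field_simp; ring
  unfold schwarzian
  refine (norm_sub_le _ _).trans ?_
  rw [norm_mul, norm_pow]
  have h5 : ‖(3 / 2 : ℂ)‖ = 3 / 2 := by norm_num
  rw [h5]
  calc _ ≤ 8 * K0 / R ^ 2 + 3 / 2 * (2 * K0 / R) ^ 2 := by gcongr
    _ = _ := by unfold KS; field_simp; ring

/-! Schwarzian calculus -/

lemma schwarzian_congr {f g : ℂ → ℂ} {z : ℂ} (h : f =ᶠ[𝓝 z] g) :
    schwarzian f z = schwarzian g z := by
  unfold schwarzian
  rw [h.deriv_eq, h.deriv.deriv_eq, h.deriv.deriv.deriv_eq]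

lemma schwarzian_comp {f g : ℂ → ℂ} {z : ℂ} (hg : AnalyticAt ℂ g z) (hf : AnalyticAt ℂ f (g z))
    (hf' : deriv f (g z) ≠ 0) (hg' : deriv g z ≠ 0) :
    schwarzian (fun x => f (g x)) z = schwarzian f (g z) * deriv g z ^ 2 + schwarzian g z := by
  have hev : ∀ᶠ x in 𝓝 z, AnalyticAt ℂ g x ∧ AnalyticAt ℂ f (g x) :=
    hg.eventually_analyticAt.and (hg.continuousAt.eventually hf.eventually_analyticAt)
  have e1 : deriv (fun x => f (g x)) =ᶠ[𝓝 z] fun x => deriv f (g x) * deriv g x := by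
    filter_upwards [hev] with x hx
    exact (HasDerivAt.comp x hx.2.differentiableAt.hasDerivAt
      hx.1.differentiableAt.hasDerivAt).deriv
  have e2' : ∀ᶠ x in 𝓝 z, HasDerivAt (fun x => deriv f (g x) * deriv g x)
      (deriv (deriv f) (g x) * deriv g x * deriv g x + deriv f (g x) * deriv (deriv g) x) x := by
    filter_upwards [hev] with x hx
    exact (HasDerivAt.comp x hx.2.deriv.differentiableAt.hasDerivAt
      hx.1.differentiableAt.hasDerivAt).mul hx.1.deriv.differentiableAt.hasDerivAt
  have e2 : deriv (deriv (fun x => f (g x))) =ᶠ[𝓝 z] fun x =>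
      deriv (deriv f) (g x) * deriv g x * deriv g x + deriv f (g x) * deriv (deriv g) x := by
    refine e1.deriv.trans ?_
    filter_upwards [e2'] with x hx using hx.deriv
  have e3 : deriv (deriv (deriv (fun x => f (g x)))) z =
      deriv (deriv (deriv f)) (g z) * deriv g z ^ 3 + 3 * deriv (deriv f) (g z) * deriv g z *
        deriv (deriv g) z + deriv f (g z) * deriv (deriv (deriv g)) z := by
    rw [e2.deriv_eq]
    have hgz := hg.differentiableAt.hasDerivAt
    have d1 := hg.deriv.differentiableAt.hasDerivAt
    have d2 := hg.deriv.deriv.differentiableAt.hasDerivAt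
    have d3 := HasDerivAt.comp z hf.deriv.differentiableAt.hasDerivAt hgz
    have d4 := HasDerivAt.comp z hf.deriv.deriv.differentiableAt.hasDerivAt hgz
    have := ((d4.mul d1).mul d1).add (d3.mul d2)
    refine (this.congr_deriv ?_).deriv
    simp only [Function.comp, Pi.mul_apply]
    ring
  unfold schwarzian
  rw [e3, e2.eq_of_nhds, e1.eq_of_nhds]
  field_simp
  ring

lemma schwarzian_of_derivs {f : ℂ → ℂ} {z : ℂ} {f1 f2 : ℂ → ℂ} {f3 : ℂ}
    (h1 : ∀ᶠ x in 𝓝 z, HasDerivAt f (f1 x) x) (h2 : ∀ᶠ x in 𝓝 z, HasDerivAt f1 (f2 x) x)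
    (h3 : HasDerivAt f2 f3 z) :
    schwarzian f z = f3 / f1 z - (3 / 2) * (f2 z / f1 z) ^ 2 := by
  have e1 : deriv f =ᶠ[𝓝 z] f1 := h1.mono fun x hx => hx.deriv
  have e2 : deriv (deriv f) =ᶠ[𝓝 z] f2 := e1.deriv.trans (h2.mono fun x hx => hx.deriv)
  unfold schwarzian
  rw [e1.eq_of_nhds, e2.eq_of_nhds, e2.deriv_eq, h3.deriv]

lemma schwarzian_id (z : ℂ) : schwarzian (fun x => x) z = 0 := by
  rw [schwarzian_of_derivs (f1 := fun _ => 1) (f2 := fun _ => 0) (f3 := 0)]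
  · simp
  · exact Eventually.of_forall fun x => hasDerivAt_id x
  · exact Eventually.of_forall fun x => hasDerivAt_const x 1
  · exact hasDerivAt_const z 0

lemma schwarzian_inv {z : ℂ} (hz : z ≠ 0) : schwarzian (fun x => x⁻¹) z = 0 := by
  have hev : ∀ᶠ x : ℂ in 𝓝 z, x ≠ 0 := isOpen_ne.mem_nhds hz
  rw [schwarzian_of_derivs (f1 := fun x => -x ^ (-2 : ℤ)) (f2 := fun x => 2 * x ^ (-3 : ℤ))
    (f3 := -6 * z ^ (-4 : ℤ))]
  · field_simp
    ring
  · filter_upwards [hev] with x hx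
    have := hasDerivAt_zpow (-1) x (Or.inl hx)
    simpa using this
  · filter_upwards [hev] with x hx
    have := (hasDerivAt_zpow (-2) x (Or.inl hx)).neg
    exact this.congr_deriv (by push_cast; norm_num)
  · have := (hasDerivAt_zpow (-3) z (Or.inl hz)).const_mul 2
    exact this.congr_deriv (by push_cast; norm_num; ring)

lemma schwarzian_exp (a δ z : ℂ) (hδ : δ ≠ 0) (k : ℂ) (hk : k ≠ 0) :
    schwarzian (fun x => a + δ * Complex.exp (k * x)) z = - k ^ 2 / 2 := by
  have h : ∀ x : ℂ, HasDerivAt (fun x => Complex.exp (k * x)) (k * Complex.exp (k * x)) x := by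
    intro x
    have := ((hasDerivAt_id x).const_mul k).cexp
    exact this.congr_deriv (by simp [mul_comm])
  rw [schwarzian_of_derivs (f1 := fun x => δ * (k * Complex.exp (k * x)))
    (f2 := fun x => δ * (k * (k * Complex.exp (k * x))))
    (f3 := δ * (k * (k * (k * Complex.exp (k * z)))))]
  · field_simp [Complex.exp_ne_zero]
    ring
  · exact Eventually.of_forall fun x => ((h x).const_mul δ).const_add a
  · exact Eventually.of_forall fun x => ((h x).const_mul k).const_mul δ
  · exact (((h z).const_mul k).const_mul k).const_mul δ

lemma schwarzian_pow (a δ z : ℂ) (hδ : δ ≠ 0) (hz : z ≠ 0) (m : ℕ) (hm : 1 ≤ m) :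
    schwarzian (fun x => a + δ * x ^ m) z = (1 - (m:ℂ) ^ 2) / (2 * z ^ 2) := by
  have hev : ∀ᶠ x : ℂ in 𝓝 z, x ≠ 0 := isOpen_ne.mem_nhds hz
  have h : ∀ k : ℤ, ∀ x : ℂ, x ≠ 0 → HasDerivAt (fun x => x ^ k) (k * x ^ (k - 1)) x :=
    fun k x hx => hasDerivAt_zpow k x (Or.inl hx)
  rw [schwarzian_of_derivs (f1 := fun x => δ * (((m:ℤ):ℂ) * x ^ ((m:ℤ) - 1)))
    (f2 := fun x => δ * (((m:ℤ):ℂ) * ((((m:ℤ) - 1 : ℤ) : ℂ) * x ^ ((m:ℤ) - 1 - 1))))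
    (f3 := δ * (((m:ℤ):ℂ) * ((((m:ℤ) - 1 : ℤ) : ℂ) * ((((m:ℤ) - 1 - 1 : ℤ) : ℂ) *
      z ^ ((m:ℤ) - 1 - 1 - 1)))))]
  · have hm' : (m:ℂ) ≠ 0 := by exact_mod_cast (by omega : m ≠ 0)
    rw [zpow_sub_one₀ hz, zpow_sub_one₀ hz, zpow_sub_one₀ hz]
    have := zpow_ne_zero (m:ℤ) hz
    push_cast
    field_simp
    ring
  · filter_upwards [hev] with x hx
    simpa using ((h m x hx).const_mul δ).const_add a
  · filter_upwards [hev] with x hx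
    exact ((h _ x hx).const_mul _).const_mul _
  · exact (((h _ z hz).const_mul _).const_mul _).const_mul _

end SW

namespace SW
open Metric

structure Good (Φ : ℂ → ℂ) (P : Set ℂ) (V : Set ℂ) (A : ℂ → ℂ) (M : ℕ) : Prop where
  mero : MeroPlane Φ P
  notrat : ¬ RationalFn Φ P
  fin : V.Finite
  crit : ∀ z, z ∉ P → deriv Φ z = 0 → Φ z ∈ V
  asym : ∀ (γ : ℝ → ℂ) (a : ℂ), ContinuousOn γ (Ici 0) → (∀ t, 0 ≤ t → γ t ∉ P) →
    Tendsto (fun t => ‖γ t‖) atTop atTop → Tendsto (fun t => Φ (γ t)) atTop (𝓝 a) → a ∈ V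
  mult : ∀ z, z ∉ P → ∀ m, 2 ≤ m → ZeroOrder (deriv Φ) z (m - 1) → m ≤ M
  schw : ∀ z, z ∉ P → deriv Φ z ≠ 0 → schwarzian Φ z = 2 * A z

def XX (Φ : ℂ → ℂ) (P : Set ℂ) : Set ℂ := {z | z ∉ P ∧ deriv Φ z ≠ 0}

lemma lf_isClosed {P : Set ℂ} (h : ∀ K : Set ℂ, IsCompact K → (P ∩ K).Finite) : IsClosed P := by
  rw [← isOpen_compl_iff, isOpen_iff_mem_nhds]
  intro z hz
  have h1 := (h _ (isCompact_closedBall z 1)).isClosed.isOpen_compl.mem_nhds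
    (fun h : z ∈ P ∩ closedBall z 1 => hz h.1)
  filter_upwards [h1, closedBall_mem_nhds z one_pos] with w hw hw2 hw3 using hw ⟨hw3, hw2⟩

lemma lf_disc {P : Set ℂ} (h : ∀ K : Set ℂ, IsCompact K → (P ∩ K).Finite) (z : ℂ) :
    ∀ᶠ w in 𝓝[≠] z, w ∉ P := by
  have h1 := ((h _ (isCompact_closedBall z 1)).subset
    (sdiff_subset (t := {z}))).isClosed.isOpen_compl.mem_nhds
    (fun h : z ∈ (P ∩ closedBall z 1) \ {z} => h.2 rfl)
  rw [eventually_nhdsWithin_iff]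
  filter_upwards [h1, closedBall_mem_nhds z one_pos] with w hw hw2 hw4 hw3
    using hw ⟨⟨hw3, hw2⟩, hw4⟩

lemma lf_conn {P : Set ℂ} (h : ∀ K : Set ℂ, IsCompact K → (P ∩ K).Finite) :
    IsPreconnected Pᶜ := by
  refine (Set.Countable.isPathConnected_compl_of_one_lt_rank (by simp) ?_).isConnected.isPreconnected
  have : P = ⋃ n : ℕ, P ∩ closedBall (0:ℂ) n := by
    rw [← inter_iUnion, iUnion_closedBall_nat, inter_univ]
  rw [this]
  exact countable_iUnion fun n => (h _ (isCompact_closedBall _ _)).countable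

section
variable {Φ : ℂ → ℂ} {P V : Set ℂ} {A : ℂ → ℂ} {M : ℕ}

lemma mero_pole (h : MeroPlane Φ P) {p : ℂ} (hp : p ∈ P) :
    Tendsto (fun z => ‖Φ z‖) (𝓝[≠] p) atTop := by
  refine (h.2.2 p hp).mono_left ?_
  exact le_inf nhdsWithin_le_nhds (le_principal_iff.2 (lf_disc h.1 p))

lemma mero_ev (hm : MeroPlane Φ P) (hr : ¬ RationalFn Φ P) (z b : ℂ) :
    ∀ᶠ w in 𝓝[≠] z, w ∉ P ∧ Φ w ≠ b := by
  refine (lf_disc hm.1 z).and ?_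
  by_cases hz : z ∈ P
  · filter_upwards [(mero_pole hm hz).eventually_gt_atTop ‖b‖] with w hw h
    rw [h] at hw; exact lt_irrefl _ hw
  · have ha : AnalyticAt ℂ (fun w => Φ w - b) z := (hm.2.1 z hz).sub analyticAt_const
    rcases ha.eventually_eq_zero_or_eventually_ne_zero with h | h
    · exfalso
      have hU : AnalyticOnNhd ℂ (fun w => Φ w - b) Pᶜ := fun w hw =>
        (hm.2.1 w hw).sub analyticAt_const
      have := hU.eqOn_zero_of_preconnected_of_eventuallyEq_zero (lf_conn hm.1) hz h
      exact hr ⟨Polynomial.C b, 1, one_ne_zero, fun z hz _ => by simp [sub_eq_zero.1 (this hz)]⟩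
    · filter_upwards [h] with w hw using sub_ne_zero.1 hw

lemma Good.ev (G : Good Φ P V A M) (z b : ℂ) :
    ∀ᶠ w in 𝓝[≠] z, w ∉ P ∧ Φ w ≠ b := mero_ev G.mero G.notrat z b

lemma XX_open (h : MeroPlane Φ P) : IsOpen (XX Φ P) := by
  rw [isOpen_iff_mem_nhds]
  intro z hz
  filter_upwards [(lf_isClosed h.1).isOpen_compl.mem_nhds hz.1,
    (h.2.1 z hz.1).deriv.continuousAt.eventually_ne hz.2] with w h1 h2 using ⟨h1, h2⟩

lemma loc_homeo (h : MeroPlane Φ P) {x : ℂ} (hx : x ∈ XX Φ P) :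
    ∃ e : OpenPartialHomeomorph ℂ ℂ, x ∈ e.source ∧ e.source ⊆ XX Φ P ∧ ∀ y, e y = Φ y := by
  have h1 : HasStrictDerivAt Φ (deriv Φ x) x := (h.2.1 x hx.1).hasStrictDerivAt
  have h2 := h1.hasStrictFDerivAt_equiv hx.2
  refine ⟨(h2.toOpenPartialHomeomorph Φ).restrOpen (XX Φ P) (XX_open h), ?_, ?_, ?_⟩
  · exact ⟨h2.mem_toOpenPartialHomeomorph_source, hx⟩
  · exact fun y hy => hy.2
  · intro y; rfl

lemma XX_lochomeo (h : MeroPlane Φ P) : IsLocalHomeomorph (fun x : XX Φ P => Φ x) := by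
  rw [isLocalHomeomorph_iff_isLocalHomeomorphOn_univ]
  have h1 : IsLocalHomeomorphOn Φ (XX Φ P) := IsLocalHomeomorphOn.mk _ _ fun x hx => by
    obtain ⟨e, h1, h2, h3⟩ := loc_homeo h hx
    exact ⟨e, h1, fun y _ => (h3 y).symm⟩
  have h2 : IsLocalHomeomorphOn (Subtype.val : XX Φ P → ℂ) univ :=
    isLocalHomeomorph_iff_isLocalHomeomorphOn_univ.1
      (XX_open h).isOpenEmbedding_subtypeVal.isLocalHomeomorph
  exact h1.comp h2 fun x _ => x.2

lemma lift_unique (h : MeroPlane Φ P) {E : Type*} [TopologicalSpace E] {S : Set E}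
    (hS : IsPreconnected S) {g1 g2 : E → ℂ} (h1 : ContinuousOn g1 S) (h2 : ContinuousOn g2 S)
    (m1 : MapsTo g1 S (XX Φ P)) (m2 : MapsTo g2 S (XX Φ P)) (he : ∀ s ∈ S, Φ (g1 s) = Φ (g2 s))
    {s0 : E} (hs0 : s0 ∈ S) (h0 : g1 s0 = g2 s0) : EqOn g1 g2 S := by
  have hS' : IsPreconnected (univ : Set S) := by
    have := isPreconnected_iff_preconnectedSpace.1 hS
    exact isPreconnected_univ
  have := IsSeparatedMap.eqOn_of_comp_eqOn (T2Space.isSeparatedMap _)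
    (XX_lochomeo h).isLocallyInjective hS' (g₁ := fun s : S => (⟨g1 s, m1 s.2⟩ : XX Φ P))
    (g₂ := fun s : S => (⟨g2 s, m2 s.2⟩ : XX Φ P))
    ((continuousOn_iff_continuous_domRestrict.1 h1).subtype_mk _).continuousOn
    ((continuousOn_iff_continuous_domRestrict.1 h2).subtype_mk _).continuousOn
    (fun s _ => he s s.2) (a := ⟨s0, hs0⟩) (mem_univ _) (Subtype.ext h0)
  intro s hs
  exact congrArg Subtype.val (this (mem_univ ⟨s, hs⟩))

/-- limit of a lifted path -/
lemma Good.lim_gen (G : Good Φ P V A M) {E : Type*} {l : Filter E} [l.NeBot] {z : E → ℂ}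
    (hl : ∀ S ∈ l, ∃ S' ∈ l, S' ⊆ S ∧ IsPreconnected (z '' S')) (hP : ∀ᶠ t in l, z t ∉ P) {b : ℂ}
    (hb : Tendsto (fun t => Φ (z t)) l (𝓝 b)) :
    Tendsto (fun t => ‖z t‖) l atTop ∨
      ∃ x, x ∉ P ∧ Φ x = b ∧ Tendsto z l (𝓝 x) := by
  by_cases hinf : Tendsto (fun t => ‖z t‖) l atTop
  · exact Or.inl hinf
  right
  obtain ⟨B, hB⟩ : ∃ B : ℝ, ∃ᶠ t in l, ‖z t‖ ≤ B := by
    rw [Filter.tendsto_atTop] at hinf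
    push Not at hinf
    obtain ⟨B, hB⟩ := hinf
    exact ⟨B, hB.mono fun t ht => le_of_lt ht⟩
  obtain ⟨x, -, hx⟩ := (isCompact_closedBall (0:ℂ) B).exists_mapClusterPt_of_frequently
    (l := l) (f := z) (hB.mono fun t ht => by simpa using ht)
  have hlim : Tendsto z l (𝓝 x) := by
    rw [Metric.tendsto_nhds]
    intro ε hε
    obtain ⟨r0, hr0, hr⟩ := Metric.eventually_nhds_iff_ball.1
      (eventually_nhdsWithin_iff.1 (G.ev x b))
    set r := min (r0 / 2) (ε / 2) with hrdef
    have hrpos : 0 < r := by positivity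
    have hrr0 : r < r0 := by have := min_le_left (r0 / 2) (ε / 2); linarith
    have hrε : r < ε := by have := min_le_right (r0 / 2) (ε / 2); linarith
    have hsph : ∀ y ∈ sphere x r, y ∉ P ∧ Φ y ≠ b := fun y hy =>
      hr y (by rw [mem_ball, mem_sphere.1 hy]; exact hrr0)
        (fun h => by rw [mem_singleton_iff.1 h] at hy; simp at hy; linarith)
    have hc : ContinuousOn (fun y => ‖Φ y - b‖) (sphere x r) := fun y hy =>
      (((G.mero.2.1 y (hsph y hy).1).continuousAt.sub continuousAt_const).norm).continuousWithinAt
    obtain ⟨y0, hy0, hmin⟩ := (isCompact_sphere x r).exists_isMinOn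
      (NormedSpace.sphere_nonempty.2 hrpos.le) hc
    have hη : 0 < ‖Φ y0 - b‖ := norm_pos_iff.2 (sub_ne_zero.2 (hsph y0 hy0).2)
    have hev : ∀ᶠ t in l, ‖Φ (z t) - b‖ < ‖Φ y0 - b‖ := by
      filter_upwards [Metric.tendsto_nhds.1 hb _ hη] with t ht using by rwa [dist_eq_norm] at ht
    obtain ⟨S', hS', hsub', hconn⟩ := hl _ hev
    have hfr : ∃ᶠ t in l, z t ∈ ball x r := hx.frequently (ball_mem_nhds x hrpos)
    obtain ⟨t2, ht2, ht2'⟩ := (hfr.and_eventually hS').exists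
    have hsub := hconn.subset_of_closure_inter_subset (u := ball x r) isOpen_ball
      ⟨z t2, ⟨t2, ht2', rfl⟩, ht2⟩ (by
        rintro _ ⟨hcl, t, ht, rfl⟩
        have h1 := closure_ball_subset_closedBall hcl
        rcases (mem_closedBall.1 h1).lt_or_eq with h2 | h2
        · exact h2
        · have h3 : ‖Φ (z t) - b‖ < ‖Φ y0 - b‖ := hsub' ht
          have h4 : ‖Φ y0 - b‖ ≤ ‖Φ (z t) - b‖ := hmin (mem_sphere.2 h2)
          exact absurd h4 (not_le.2 h3))
    filter_upwards [hS'] with t ht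
    exact (mem_ball.1 (hsub ⟨t, ht, rfl⟩)).trans hrε
  have hxP : x ∉ P := by
    intro hxP
    have h1 : Tendsto z l (𝓝[≠] x) := by
      refine tendsto_nhdsWithin_iff.2 ⟨hlim, ?_⟩
      filter_upwards [hP] with t ht h
      exact ht (by rw [mem_singleton_iff.1 h]; exact hxP)
    exact not_tendsto_nhds_of_tendsto_atTop ((mero_pole G.mero hxP).comp h1) _ hb.norm
  exact ⟨x, hxP, tendsto_nhds_unique ((G.mero.2.1 x hxP).continuousAt.tendsto.comp hlim) hb, hlim⟩

lemma Good.lim (G : Good Φ P V A M) {T : ℝ} {t0 : ℝ} (hT : t0 < T) {z : ℝ → ℂ}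
    (hz : ContinuousOn z (Ico t0 T)) (hP : ∀ t ∈ Ico t0 T, z t ∉ P) {b : ℂ}
    (hb : Tendsto (fun t => Φ (z t)) (𝓝[<] T) (𝓝 b)) :
    Tendsto (fun t => ‖z t‖) (𝓝[<] T) atTop ∨
      ∃ x, x ∉ P ∧ Φ x = b ∧ Tendsto z (𝓝[<] T) (𝓝 x) := by
  refine G.lim_gen (fun S hS => ?_) (mem_of_superset (Ico_mem_nhdsLT hT) hP) hb
  obtain ⟨t1, ht1, ht1'⟩ := mem_nhdsLT_iff_exists_Ico_subset.1
    (inter_mem hS (Ico_mem_nhdsLT hT))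
  exact ⟨Ico t1 T, Ico_mem_nhdsLT ht1, fun t ht => (ht1' ht).1,
    isPreconnected_Ico.image z (hz.mono fun t ht => (ht1' ht).2)⟩

lemma Good.lim_mem (G : Good Φ P V A M) {T : ℝ} {t0 : ℝ} (hT : t0 < T) {z : ℝ → ℂ}
    (hz : ContinuousOn z (Ico t0 T)) (hX : ∀ t ∈ Ico t0 T, z t ∈ XX Φ P) {b : ℂ}
    (hb : Tendsto (fun t => Φ (z t)) (𝓝[<] T) (𝓝 b))
    (hno : ¬ ∃ x ∈ XX Φ P, Tendsto z (𝓝[<] T) (𝓝 x)) : b ∈ V := by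
  rcases G.lim hT hz (fun t ht => (hX t ht).1) hb with h | ⟨x, hxP, hxb, hx⟩
  · have hs : Tendsto (fun u : ℝ => T - (T - t0) / (1 + u)) atTop (𝓝[<] T) := by
      refine tendsto_nhdsWithin_iff.2 ⟨?_, ?_⟩
      · have : Tendsto (fun u : ℝ => (T - t0) / (1 + u)) atTop (𝓝 0) :=
          tendsto_const_nhds.div_atTop (tendsto_atTop_add_const_left _ _ tendsto_id)
        simpa using (tendsto_const_nhds (x := T)).sub this
      · filter_upwards [eventually_ge_atTop 0] with u hu
        have : 0 < (T - t0) / (1 + u) := div_pos (by linarith) (by linarith)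
        simp only [mem_Iio]; linarith
    have hm : ∀ u : ℝ, 0 ≤ u → T - (T - t0) / (1 + u) ∈ Ico t0 T := by
      intro u hu
      have h1 : 0 < (T - t0) / (1 + u) := div_pos (by linarith) (by linarith)
      have h2 : (T - t0) / (1 + u) ≤ T - t0 := div_le_self (by linarith) (by linarith)
      constructor <;> linarith
    refine G.asym (fun u => z (T - (T - t0) / (1 + u))) b ?_ (fun u hu => (hX _ (hm u hu)).1)
      (h.comp hs) (hb.comp hs)
    refine hz.comp ?_ fun u hu => hm u hu
    refine continuousOn_const.sub (continuousOn_const.div (by fun_prop) fun u hu => ?_)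
    have : (0:ℝ) ≤ u := hu
    positivity
  · by_contra hbV
    exact hno ⟨x, ⟨hxP, fun h => hbV (hxb ▸ G.crit x hxP h)⟩, hx⟩

def Lifts (Φ : ℂ → ℂ) (P : Set ℂ) (w : ℝ → ℂ) (p : ℂ) (S : Set ℝ) (z : ℝ → ℂ) : Prop :=
  ContinuousOn z S ∧ z 0 = p ∧ ∀ t ∈ S, z t ∈ XX Φ P ∧ Φ (z t) = w t

lemma Good.path_lift (G : Good Φ P V A M) {w : ℝ → ℂ} (hw : Continuous w) {p : ℂ}
    (hp : p ∈ XX Φ P) (hpw : Φ p = w 0) :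
    (∃ z, Lifts Φ P w p (Icc 0 1) z) ∨ ∃ T, 0 < T ∧ T ≤ 1 ∧ w T ∈ V ∧
      ∃ z, Lifts Φ P w p (Ico 0 T) z ∧ ¬ ∃ x ∈ XX Φ P, Tendsto z (𝓝[<] T) (𝓝 x) := by
  by_cases hfull : ∃ z, Lifts Φ P w p (Icc 0 1) z
  · exact Or.inl hfull
  right
  set S := {T : ℝ | 0 ≤ T ∧ T ≤ 1 ∧ ∃ z, Lifts Φ P w p (Icc 0 T) z} with hS
  have h0S : (0:ℝ) ∈ S := ⟨le_rfl, zero_le_one, fun _ => p, continuousOn_const, rfl, fun t ht => by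
    have : t = 0 := le_antisymm ht.2 ht.1
    subst this; exact ⟨hp, hpw⟩⟩
  have hbd : BddAbove S := ⟨1, fun t ht => ht.2.1⟩
  set T := sSup S with hTdef
  have hT0 : 0 ≤ T := le_csSup hbd h0S
  have hT1 : T ≤ 1 := csSup_le ⟨0, h0S⟩ fun t ht => ht.2.1
  have hdown : ∀ t t', t ∈ S → 0 ≤ t' → t' ≤ t → t' ∈ S := by
    rintro t t' ⟨h1, h2, z, hz⟩ h3 h4
    exact ⟨h3, h4.trans h2, z, hz.1.mono (Icc_subset_Icc_right h4), hz.2.1,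
      fun s hs => hz.2.2 s ⟨hs.1, hs.2.trans h4⟩⟩
  have hltS : ∀ t, 0 ≤ t → t < T → t ∈ S := by
    intro t h0 h
    obtain ⟨t', ht', h'⟩ := exists_lt_of_lt_csSup ⟨0, h0S⟩ h
    exact hdown t' t ht' h0 h'.le
  have hext : ∀ t ∈ S, t < 1 → ∃ t' ∈ S, t < t' := by
    rintro t ⟨h0, h1, z, hz⟩ ht1
    have hzt := hz.2.2 t ⟨h0, le_rfl⟩
    obtain ⟨e, he1, he2, he3⟩ := loc_homeo G.mero hzt.1
    have htgt : w t ∈ e.target := by rw [← hzt.2, ← he3]; exact e.map_source he1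
    obtain ⟨δ, hδ, hball⟩ := Metric.mem_nhds_iff.1
      (hw.continuousAt.preimage_mem_nhds (e.open_target.mem_nhds htgt))
    set t' := min 1 (t + δ / 2)
    have htt' : t < t' := lt_min ht1 (by linarith)
    have ht'1 : t' ≤ 1 := min_le_left _ _
    have ht'2 : t' ≤ t + δ / 2 := min_le_right _ _
    have hmem : ∀ s ∈ Icc t t', w s ∈ e.target := by
      intro s hs
      apply hball
      rw [mem_ball, Real.dist_eq, abs_of_nonneg (by linarith [hs.1])]
      linarith [hs.2]
    refine ⟨t', ⟨h0.trans htt'.le, ht'1, fun s => if s ≤ t then z s else e.symm (w s), ?_, ?_, ?_⟩,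
      htt'⟩
    · have hu : Icc 0 t' = Icc 0 t ∪ Icc t t' := (Icc_union_Icc_eq_Icc h0 htt'.le).symm
      rw [hu]
      refine ContinuousOn.union_of_isClosed ?_ ?_ isClosed_Icc isClosed_Icc
      · exact hz.1.congr fun s hs => if_pos hs.2
      · have : ContinuousOn (fun s => e.symm (w s)) (Icc t t') :=
          e.continuousOn_symm.comp hw.continuousOn hmem
        refine this.congr fun s hs => ?_
        by_cases h : s ≤ t
        · have : s = t := le_antisymm h hs.1
          subst this
          simp only [le_refl, if_true]
          rw [← hzt.2, ← he3, e.left_inv he1]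
        · exact if_neg h
    · simp [h0, hz.2.1]
    · intro s hs
      by_cases h : s ≤ t
      · simp only [h, if_true]; exact hz.2.2 s ⟨hs.1, h⟩
      · simp only [h, if_false]
        have hm := hmem s ⟨(not_le.1 h).le, hs.2⟩
        refine ⟨he2 (e.map_target hm), ?_⟩
        rw [← he3, e.right_inv hm]
  have hTS : T ∉ S := by
    intro hTS
    rcases hT1.lt_or_eq with h | h
    · obtain ⟨t', ht', h'⟩ := hext T hTS h
      exact absurd (le_csSup hbd ht') (not_le.2 h')
    · obtain ⟨-, -, hz⟩ := hTS
      rw [h] at hz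
      exact hfull hz
  have hTpos : 0 < T := lt_of_le_of_ne hT0 fun h => hTS (h ▸ h0S)
  have hch : ∀ t : ℝ, ∃ z, t ∈ S → Lifts Φ P w p (Icc 0 t) z := by
    intro t
    by_cases h : t ∈ S
    · exact ⟨h.2.2.choose, fun _ => h.2.2.choose_spec⟩
    · exact ⟨fun _ => 0, fun h' => absurd h' h⟩
  choose Z hZ using hch
  have hagree : ∀ t t', 0 ≤ t' → t' ≤ t → t < T → Z t' t' = Z t t' := by
    intro t t' h0 h1 h2
    have ha := hZ t' (hltS t' h0 (h1.trans_lt h2))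
    have hb := hZ t (hltS t (h0.trans h1) h2)
    refine lift_unique G.mero (isPreconnected_Icc (a := 0) (b := t')) ha.1
      (hb.1.mono (Icc_subset_Icc_right h1)) (fun s hs => (ha.2.2 s hs).1)
      (fun s hs => (hb.2.2 s ⟨hs.1, hs.2.trans h1⟩).1) (fun s hs => ?_)
      (left_mem_Icc.2 h0) ?_ (right_mem_Icc.2 h0)
    · rw [(ha.2.2 s hs).2, (hb.2.2 s ⟨hs.1, hs.2.trans h1⟩).2]
    · rw [ha.2.1, hb.2.1]
  set z : ℝ → ℂ := fun t => Z t t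
  have hzl : Lifts Φ P w p (Ico 0 T) z := by
    refine ⟨?_, (hZ 0 h0S).2.1, fun t ht => (hZ t (hltS t ht.1 ht.2)).2.2 t ⟨ht.1, le_rfl⟩⟩
    intro t ht
    obtain ⟨u, hu1, hu2⟩ := exists_between ht.2
    have h1 := (hZ u (hltS u (ht.1.trans hu1.le) hu2)).1 t ⟨ht.1, hu1.le⟩
    have h2 : ContinuousWithinAt (Z u) (Ico 0 T) t := by
      refine h1.mono_of_mem_nhdsWithin ?_
      filter_upwards [self_mem_nhdsWithin, mem_nhdsWithin_of_mem_nhds (Iio_mem_nhds hu1)] with s hs hs2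
        using ⟨hs.1, (mem_Iio.1 hs2).le⟩
    refine h2.congr_of_eventuallyEq ?_ (hagree u t ht.1 hu1.le hu2)
    filter_upwards [self_mem_nhdsWithin, mem_nhdsWithin_of_mem_nhds (Iio_mem_nhds hu1)] with s hs hs2
    exact hagree u s hs.1 (mem_Iio.1 hs2).le hu2
  have hno : ¬ ∃ x ∈ XX Φ P, Tendsto z (𝓝[<] T) (𝓝 x) := by
    rintro ⟨x, hx, hlim⟩
    refine hTS ⟨hT0, hT1, Function.update z T x, ?_, ?_, ?_⟩
    · have h1 : ContinuousOn (Function.update z T x) (Icc 0 T) := by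
        rw [continuousOn_update_iff]
        refine ⟨?_, fun _ => ?_⟩
        · rw [Icc_sdiff_right]; exact hzl.1
        · rw [Icc_sdiff_right]
          exact hlim.mono_left (nhdsWithin_mono _ Ico_subset_Iio_self)
      exact h1
    · rw [Function.update_of_ne hTpos.ne, hzl.2.1]
    · intro t ht
      rcases ht.2.lt_or_eq with h | h
      · rw [Function.update_of_ne h.ne]; exact hzl.2.2 t ⟨ht.1, h⟩
      · subst h
        rw [Function.update_self]
        refine ⟨hx, tendsto_nhds_unique ((G.mero.2.1 x hx.1).continuousAt.tendsto.comp hlim) ?_⟩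
        refine (hw.continuousAt.tendsto.mono_left nhdsWithin_le_nhds).congr' ?_
        filter_upwards [Ico_mem_nhdsLT hTpos] with s hs using (hzl.2.2 s hs).2.symm
  refine ⟨T, hTpos, hT1, ?_, z, hzl, hno⟩
  refine G.lim_mem hTpos hzl.1 (fun t ht => (hzl.2.2 t ht).1) ?_ hno
  refine (hw.continuousAt.tendsto.mono_left nhdsWithin_le_nhds).congr' ?_
  filter_upwards [Ico_mem_nhdsLT hTpos] with s hs using (hzl.2.2 s hs).2.symm

lemma lift_diff (h : MeroPlane Φ P) {U : Set ℂ} (hU : IsOpen U) {θ ψ : ℂ → ℂ}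
    (hθ : DifferentiableOn ℂ θ U) (hψ : ContinuousOn ψ U)
    (hX : ∀ ζ ∈ U, ψ ζ ∈ XX Φ P ∧ Φ (ψ ζ) = θ ζ) : DifferentiableOn ℂ ψ U := by
  intro ζ hζ
  obtain ⟨hx, hx2⟩ := hX ζ hζ
  obtain ⟨e, he1, he2, he3⟩ := loc_homeo h hx
  have hψc := hψ.continuousAt (hU.mem_nhds hζ)
  have hk : HasDerivAt e.symm (deriv Φ (ψ ζ))⁻¹ (θ ζ) := by
    have hz : e.symm (θ ζ) = ψ ζ := by rw [← hx2, ← he3, e.left_inv he1]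
    have hm : θ ζ ∈ e.target := by rw [← hx2, ← he3]; exact e.map_source he1
    refine HasDerivAt.of_local_left_inverse (f := Φ)
      (e.continuousAt_symm hm)
      (by rw [hz]; exact (h.2.1 _ hx.1).differentiableAt.hasDerivAt) hx.2 ?_
    filter_upwards [e.open_target.mem_nhds hm] with y hy
    rw [← he3, e.right_inv hy]
  have h2 := HasDerivAt.comp ζ hk (hθ.differentiableAt (hU.mem_nhds hζ)).hasDerivAt
  refine (h2.congr_of_eventuallyEq ?_).differentiableAt.differentiableWithinAt
  filter_upwards [hψc.preimage_mem_nhds (e.open_source.mem_nhds he1), hU.mem_nhds hζ] with y hy hyU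
  rw [Function.comp, ← (hX y hyU).2, ← he3, e.left_inv hy]

/-- lifting over a convex open set -/
lemma Good.lift (G : Good Φ P V A M) {U : Set ℂ} (hU : IsOpen U) (hc : Convex ℝ U) {c p : ℂ}
    (hcU : c ∈ U) {θ : ℂ → ℂ} (hθ : DifferentiableOn ℂ θ U) 
    (hl : ∀ ζ ∈ U, ∃ z, Lifts Φ P (fun t => θ (c + t * (ζ - c))) p (Icc 0 1) z) :
    ∃ ψ : ℂ → ℂ, DifferentiableOn ℂ ψ U ∧ ψ c = p ∧ ∀ ζ ∈ U, ψ ζ ∈ XX Φ P ∧ Φ (ψ ζ) = θ ζ := by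
  have hmem : ∀ ζ ∈ U, ∀ t ∈ Icc (0:ℝ) 1, c + t * (ζ - c) ∈ U := by
    intro ζ hζ t ht
    have := hc.add_smul_sub_mem hcU hζ ht
    simpa [Complex.real_smul] using this
  choose! Z hZ using hl
  let f : C(unitInterval × U, ℂ) := ⟨fun x => θ (c + (x.1 : ℝ) * ((x.2 : ℂ) - c)), by
    refine hθ.continuousOn.comp_continuous (by fun_prop) ?_
    exact fun x => hmem x.2 x.2.2 x.1 x.1.2⟩
  let g : unitInterval × U → XX Φ P := fun x =>
    ⟨Z x.2 x.1, ((hZ x.2 x.2.2).2.2 x.1 x.1.2).1⟩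
  have hcont : Continuous g := by
    refine (XX_lochomeo G.mero).continuous_lift (T2Space.isSeparatedMap _) f ?_ ?_ ?_
    · funext x
      exact ((hZ x.2 x.2.2).2.2 x.1 x.1.2).2
    · have : (fun x : U => g (0, x)) = fun x : U => g (0, ⟨c, hcU⟩) := by
        funext x
        refine Subtype.ext ?_
        exact ((hZ x x.2).2.1).trans ((hZ c hcU).2.1).symm
      rw [this]; exact continuous_const
    · intro a
      refine Continuous.subtype_mk ?_ _
      exact (hZ a a.2).1.comp_continuous continuous_subtype_val fun t => t.2
  have h1 : ∀ ζ ∈ U, Z ζ 1 ∈ XX Φ P ∧ Φ (Z ζ 1) = θ ζ := by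
    intro ζ hζ
    have := (hZ ζ hζ).2.2 1 (by simp)
    simpa using this
  refine ⟨fun ζ => Z ζ 1, ?_, ?_, h1⟩
  · refine lift_diff G.mero hU hθ ?_ h1
    rw [continuousOn_iff_continuous_domRestrict]
    exact continuous_subtype_val.comp (hcont.comp
      (continuous_const.prodMk continuous_id : Continuous fun x : U => ((1 : unitInterval), x)))
  · have h2 := hZ c hcU
    have : EqOn (Z c) (fun _ => p) (Icc 0 1) := by
      have hp : p ∈ XX Φ P := by rw [← h2.2.1]; exact (h2.2.2 0 (by simp)).1
      have hp2 : Φ p = θ c := by rw [← h2.2.1]; simpa using (h2.2.2 0 (by simp)).2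
      refine lift_unique G.mero isPreconnected_Icc h2.1 continuousOn_const
        (fun s hs => (h2.2.2 s hs).1) (fun s hs => hp) (fun s hs => ?_)
        (left_mem_Icc.2 zero_le_one) h2.2.1
      simpa [hp2] using (h2.2.2 s hs).2
    exact this (right_mem_Icc.2 zero_le_one)

end
end SW

namespace SW
open Metric

open scoped Classical in
def Fb (f : ℂ → ℂ) (P : Set ℂ) (b z : ℂ) : ℂ := if z ∈ P then 0 else (f z - b)⁻¹
def Pb (f : ℂ → ℂ) (P : Set ℂ) (b : ℂ) : Set ℂ := {z | z ∉ P ∧ f z = b}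
open scoped Classical in
def iv (b a : ℂ) : Option ℂ := if a = 0 then none else some (b + a⁻¹)

lemma iv_inj (b : ℂ) : Function.Injective (iv b) := by
  intro x y h
  unfold iv at h
  split_ifs at h with h1 h2 h3
  · rw [h1, h2]
  · simpa using h

lemma lf_of_ev {S : Set ℂ} (h : ∀ z, ∀ᶠ w in 𝓝[≠] z, w ∉ S) (K : Set ℂ) (hK : IsCompact K) :
    (S ∩ K).Finite := by
  by_contra hinf
  obtain ⟨x, -, hx⟩ := Set.Infinite.exists_accPt_of_subset_isCompact hinf hK inter_subset_right
  have := accPt_iff_frequently_nhdsNE.1 hx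
  exact this ((h x).mono fun w hw hw2 => hw hw2.1)

section
variable {f A : ℂ → ℂ} {P PA : Set ℂ} {M : ℕ} {b : ℂ}

lemma Fb_ev (hm : MeroPlane f P) {z : ℂ} (hz : z ∉ P) : Fb f P b =ᶠ[𝓝 z] fun x => (f x - b)⁻¹ := by
  filter_upwards [(lf_isClosed hm.1).isOpen_compl.mem_nhds hz] with w hw
  exact if_neg hw

lemma Fb_ne (hm : MeroPlane f P) (hr : ¬ RationalFn f P) (z : ℂ) : ∀ᶠ w in 𝓝[≠] z, w ∉ P ∧ f w ≠ b ∧ Fb f P b w ≠ 0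
    ∧ f w = b + (Fb f P b w)⁻¹ := by
  filter_upwards [mero_ev hm hr z b] with w hw
  have : Fb f P b w = (f w - b)⁻¹ := if_neg hw.1
  exact ⟨hw.1, hw.2, by rw [this]; exact inv_ne_zero (sub_ne_zero.2 hw.2), by rw [this, inv_inv]; ring⟩

lemma Fb_an (hm : MeroPlane f P) (hr : ¬ RationalFn f P) {z : ℂ} (hz : z ∉ Pb f P b) :
    AnalyticAt ℂ (Fb f P b) z := by
  by_cases hP : z ∈ P
  · refine Complex.analyticAt_of_differentiable_on_punctured_nhds_of_continuousAt ?_ ?_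
    · filter_upwards [Fb_ne (b := b) hm hr z] with w hw
      exact ((((hm.2.1 w hw.1).sub analyticAt_const).inv (sub_ne_zero.2 hw.2.1)).congr
        (Fb_ev hm hw.1).symm).differentiableAt
    · rw [continuousAt_iff_punctured_nhds]
      have h0 : Fb f P b z = 0 := if_pos hP
      rw [h0, tendsto_zero_iff_norm_tendsto_zero]
      have h1 : Tendsto (fun w => ‖f w‖ - ‖b‖) (𝓝[≠] z) atTop :=
        tendsto_atTop_add_const_right _ _ (mero_pole hm hP)
      have h2 : Tendsto (fun w => ‖f w - b‖) (𝓝[≠] z) atTop :=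
        tendsto_atTop_mono (fun w => norm_sub_norm_le _ _) h1
      refine h2.inv_tendsto_atTop.congr' ?_
      filter_upwards [lf_disc hm.1 z] with w hw
      simp [Fb, hw]
  · have hb : f z ≠ b := fun h => hz ⟨hP, h⟩
    exact ((((hm.2.1 z hP).sub analyticAt_const).inv (sub_ne_zero.2 hb)).congr
        (Fb_ev hm hP).symm)

lemma Fb_mero (hm : MeroPlane f P) (hr : ¬ RationalFn f P) : MeroPlane (Fb f P b) (Pb f P b) := by
  refine ⟨lf_of_ev fun z => ?_, fun z hz => Fb_an hm hr hz, ?_⟩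
  · filter_upwards [mero_ev hm hr z b] with w hw h using hw.2 h.2
  · intro p hp
    have h1 : Tendsto (fun z => f z - b) (𝓝[(Pb f P b)ᶜ] p) (𝓝[≠] 0) := by
      refine tendsto_nhdsWithin_iff.2 ⟨?_, ?_⟩
      · have : ContinuousAt (fun z => f z - b) p := ((hm.2.1 p hp.1).continuousAt.sub continuousAt_const)
        have h := this.tendsto
        rw [hp.2, sub_self] at h
        exact h.mono_left nhdsWithin_le_nhds
      · filter_upwards [self_mem_nhdsWithin, mem_nhdsWithin_of_mem_nhds
          ((lf_isClosed hm.1).isOpen_compl.mem_nhds hp.1)] with w hw hw2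
        exact fun h => hw ⟨hw2, sub_eq_zero.1 h⟩
    have h2 := (tendsto_norm_inv_nhdsNE_zero_atTop (α := ℂ)).comp h1
    refine h2.congr' ?_
    filter_upwards [mem_nhdsWithin_of_mem_nhds (Fb_ev (b := b) hm hp.1)] with w hw
    rw [Function.comp, hw]

lemma Fb_notrat (hm : MeroPlane f P) (hr : ¬ RationalFn f P) :
    ¬ RationalFn (Fb f P b) (Pb f P b) := by
  rintro ⟨p, q, hq, h⟩
  have hqev : ∀ z : ℂ, ∀ᶠ w in 𝓝[≠] z, q.eval w ≠ 0 := fun z => by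
    have hfin : ({w | q.eval w = 0} : Set ℂ).Finite := by
      refine q.roots.toFinset.finite_toSet.subset fun w hw => ?_
      simpa [hq] using hw
    exact (lf_disc (fun K _ => hfin.subset inter_subset_left) z)
  have hp : p ≠ 0 := by
    rintro rfl
    obtain ⟨w, hw1, hw2⟩ := ((Fb_ne (b := b) hm hr 0).and (hqev 0)).exists
    exact hw1.2.2.1 (by rw [h w (fun h => hw1.2.1 h.2) hw2]; simp)
  refine hr ⟨(Polynomial.C b * p + q) * q, p * q, mul_ne_zero hp hq, fun z hz hpq => ?_⟩
  rw [Polynomial.eval_mul] at hpq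
  have hp0 := left_ne_zero_of_mul hpq
  have hq0 := right_ne_zero_of_mul hpq
  by_cases hzb : z ∈ Pb f P b
  · exfalso
    have h1 := mero_pole (Fb_mero hm hr) hzb
    have h2 : Tendsto (fun z => ‖Fb f P b z‖) (𝓝[≠] z) (𝓝 ‖p.eval z / q.eval z‖) := by
      have h3 : ContinuousAt (fun z => ‖p.eval z / q.eval z‖) z :=
        (p.continuous.continuousAt.div q.continuous.continuousAt hq0).norm
      refine (h3.tendsto.mono_left nhdsWithin_le_nhds).congr' ?_
      filter_upwards [Fb_ne (b := b) hm hr z, hqev z] with w hw1 hw2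
      rw [h w (fun h => hw1.2.1 h.2) hw2]
    exact not_tendsto_nhds_of_tendsto_atTop h1 _ h2
  · have h1 := h z hzb hq0
    rw [Fb, if_neg hz] at h1
    have h2 : f z - b = q.eval z / p.eval z := by rw [← inv_inv (f z - b), h1, inv_div]
    have h3 : f z = b + q.eval z / p.eval z := by rw [← h2]; ring
    rw [h3]; simp only [Polynomial.eval_mul, Polynomial.eval_add, Polynomial.eval_C]
    field_simp

lemma Fb_schw (hm : MeroPlane f P) (hr : ¬ RationalFn f P) (hA : MeroPlane A PA)
    (hS : ∀ z, z ∉ P → deriv f z ≠ 0 → schwarzian f z = 2 * A z) {z : ℂ}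
    (hz : z ∉ Pb f P b) (hd : deriv (Fb f P b) z ≠ 0) : schwarzian (Fb f P b) z = 2 * A z := by
  have key : ∀ w, w ∉ P → f w ≠ b → deriv (Fb f P b) w ≠ 0 → schwarzian (Fb f P b) w = 2 * A w := by
    intro w hw hb hd
    have ha : AnalyticAt ℂ (fun x => f x - b) w := (hm.2.1 w hw).sub analyticAt_const
    have hfd : deriv (fun x => f x - b) w = deriv f w := by simp
    have hd1 : HasDerivAt (Fb f P b) (-deriv f w / (f w - b) ^ 2) w := by
      have := (ha.differentiableAt.hasDerivAt.inv (sub_ne_zero.2 hb)).congr_of_eventuallyEq (Fb_ev hm hw)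
      rwa [hfd] at this
    have hfd2 : deriv f w ≠ 0 := fun h => hd (by rw [hd1.deriv, h]; simp)
    rw [schwarzian_congr (Fb_ev hm hw), schwarzian_comp (f := fun x => x⁻¹) (g := fun x => f x - b) ha
      (analyticAt_inv (sub_ne_zero.2 hb))
      (by rw [deriv_inv]; exact neg_ne_zero.2 (inv_ne_zero (pow_ne_zero _ (sub_ne_zero.2 hb))))
      (by rwa [hfd]),
      schwarzian_inv (sub_ne_zero.2 hb), zero_mul, zero_add, ← hS w hw hfd2]
    simp only [schwarzian]
    have e1 : deriv (fun x => f x - b) = deriv f := by funext x; simp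
    rw [e1]
  by_cases hP : z ∈ P
  · have hFa := Fb_an (b := b) hm hr hz
    have hc : ContinuousAt (schwarzian (Fb f P b)) z := by
      unfold schwarzian
      exact ((hFa.deriv.deriv.deriv.continuousAt.div hFa.deriv.continuousAt hd).sub
        (continuousAt_const.mul ((hFa.deriv.deriv.continuousAt.div hFa.deriv.continuousAt hd).pow 2)))
    have hev : ∀ᶠ w in 𝓝[≠] z, schwarzian (Fb f P b) w = 2 * A w := by
      filter_upwards [Fb_ne (b := b) hm hr z, (hFa.deriv.continuousAt.eventually_ne hd).filter_mono
        nhdsWithin_le_nhds] with w h1 h2 using key w h1.1 h1.2.1 h2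
    have h2A : Tendsto (fun w => 2 * A w) (𝓝[≠] z) (𝓝 (schwarzian (Fb f P b) z)) :=
      (hc.tendsto.mono_left nhdsWithin_le_nhds).congr' hev
    have hzA : z ∉ PA := by
      intro h
      have h1 := mero_pole hA h
      have h3 : Tendsto (fun w => 2 * ‖A w‖) (𝓝[≠] z) atTop := h1.const_mul_atTop two_pos
      refine not_tendsto_nhds_of_tendsto_atTop h3 ‖schwarzian (Fb f P b) z‖ ?_
      simpa using h2A.norm
    exact tendsto_nhds_unique h2A (((continuousAt_const.mul
      (hA.2.1 z hzA).continuousAt).tendsto).mono_left nhdsWithin_le_nhds)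
  · exact key z hP (fun h => hz ⟨hP, h⟩) hd

lemma Fb_mult (hm : MeroPlane f P) (hr : ¬ RationalFn f P) {z : ℂ} (hz : z ∉ Pb f P b) {m : ℕ}
    (hm2 : 2 ≤ m) (hzo : ZeroOrder (deriv (Fb f P b)) z (m - 1)) : MultiplePointWithMult f z m := by
  have hFa := Fb_an (b := b) hm hr hz
  refine ⟨hm2, ?_⟩
  by_cases hP : z ∈ P
  · left
    have hF0 : Fb f P b z = 0 := if_pos hP
    obtain ⟨hm0, g, hg, hg0, hev⟩ := hzo
    have ho : analyticOrderAt (deriv (Fb f P b)) z = ((m - 1 : ℕ) : ℕ∞) :=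
      hFa.deriv.analyticOrderAt_eq_natCast.2 ⟨g, hg, hg0, by simpa [smul_eq_mul] using hev⟩
    have ho2 := hFa.analyticOrderAt_deriv_add_one
    simp only [hF0, sub_zero] at ho2
    have ho3 : analyticOrderAt (Fb f P b) z = (m : ℕ∞) := by
      have : analyticOrderAt (Fb f P b) z = ((m - 1 : ℕ) : ℕ∞) + 1 := by rw [← ho]; exact ho2.symm
      rw [this]; exact_mod_cast (Nat.sub_add_cancel (by omega : 1 ≤ m))
    obtain ⟨k, hk, hk0, hkev⟩ := hFa.analyticOrderAt_eq_natCast.1 ho3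
    refine ⟨by omega, fun w => (b * (w - z) ^ m * k w + 1) / k w, ?_, ?_, ?_⟩
    · exact AnalyticAt.div (by fun_prop) hk hk0
    · have : m ≠ 0 := by omega
      simp [this, hk0]
    · filter_upwards [Fb_ne (b := b) hm hr z, hkev.filter_mono nhdsWithin_le_nhds,
        (hk.continuousAt.eventually_ne hk0).filter_mono nhdsWithin_le_nhds, self_mem_nhdsWithin]
        with w h1 h2 h3 h4
      have h5 : w - z ≠ 0 := sub_ne_zero.2 h4
      rw [h1.2.2.2, h2, smul_eq_mul]
      field_simp
  · right
    have hb : f z ≠ b := fun h => hz ⟨hP, h⟩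
    refine ⟨hm.2.1 z hP, hzo.1, ?_⟩
    obtain ⟨hm0, g, hg, hg0, hev⟩ := hzo
    refine ⟨fun w => - g w * (f w - b) ^ 2, (hg.neg).mul (((hm.2.1 z hP).sub analyticAt_const).pow 2),
      mul_ne_zero (neg_ne_zero.2 hg0) (pow_ne_zero _ (sub_ne_zero.2 hb)), ?_⟩
    filter_upwards [hev, (Fb_ev (b := b) hm hP).eventually_nhds, (hm.2.1 z hP).eventually_analyticAt,
      (hm.2.1 z hP).continuousAt.eventually_ne hb] with w h1 h2 h3 h4
    have hd1 := ((h3.differentiableAt.hasDerivAt.sub_const b).inv (sub_ne_zero.2 h4)).congr_of_eventuallyEq h2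
    have h5 := sub_ne_zero.2 h4
    rw [hd1.deriv] at h1
    have : deriv f w = - (-deriv f w / (f w - b) ^ 2) * (f w - b) ^ 2 := by field_simp
    rw [this, h1]; ring
lemma val_iv {z : ℂ} (hz : z ∉ Pb f P b) : valueAt f P z = iv b (Fb f P b z) := by
  by_cases hP : z ∈ P
  · simp [valueAt, iv, Fb, hP]
  · have hb : f z - b ≠ 0 := sub_ne_zero.2 fun h => hz ⟨hP, h⟩
    simp [valueAt, iv, Fb, hP, hb]

lemma chordal_iv (b a : ℂ) : Tendsto (fun x => chordal (iv b x) (iv b a)) (𝓝 a) (𝓝 0) := by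
  have hn : ∀ z : ℂ, 0 < Real.sqrt (1 + ‖z‖ ^ 2) := fun z => Real.sqrt_pos.2 (by positivity)
  by_cases ha : a = 0
  · subst ha
    have h1 : Tendsto (fun x : ℂ => ‖x‖ / (1 - ‖b‖ * ‖x‖)) (𝓝 0) (𝓝 0) := by
      have : ContinuousAt (fun x : ℂ => ‖x‖ / (1 - ‖b‖ * ‖x‖)) 0 :=
        ContinuousAt.div (by fun_prop) (by fun_prop) (by simp)
      simpa using this.tendsto
    have h2 : ∀ᶠ x : ℂ in 𝓝 0, ‖b‖ * ‖x‖ < 1 := by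
      have : ContinuousAt (fun x : ℂ => ‖b‖ * ‖x‖) 0 := by fun_prop
      exact this.eventually_lt continuousAt_const (by simp)
    refine squeeze_zero' (Eventually.of_forall fun x => ?_) ?_ h1
    · unfold iv; split_ifs <;> simp only [chordal] <;> positivity
    · filter_upwards [h2] with x hx
      by_cases hx0 : x = 0
      · simp [hx0, iv, chordal]
      · have hxp : 0 < ‖x‖ := norm_pos_iff.2 hx0
        simp only [iv, hx0, if_false, if_true, chordal]
        rw [div_le_div_iff₀ (hn _) (by linarith)]
        have h3 : ‖x⁻¹‖ - ‖b‖ ≤ ‖b + x⁻¹‖ := by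
          have := norm_sub_norm_le (x⁻¹) (-b)
          simp only [norm_neg, sub_neg_eq_add] at this; rwa [add_comm b]
        have h4 : ‖b + x⁻¹‖ ≤ Real.sqrt (1 + ‖b + x⁻¹‖ ^ 2) := Real.le_sqrt_of_sq_le (by linarith)
        have h5 : 1 - ‖b‖ * ‖x‖ = ‖x‖ * (‖x⁻¹‖ - ‖b‖) := by
          rw [norm_inv]; field_simp
        rw [one_mul, h5]
        exact mul_le_mul_of_nonneg_left (h3.trans h4) hxp.le
  · have h1 : Tendsto (fun x : ℂ => ‖(b + x⁻¹) - (b + a⁻¹)‖) (𝓝 a) (𝓝 0) := by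
      have : ContinuousAt (fun x : ℂ => ‖(b + x⁻¹) - (b + a⁻¹)‖) a := by
        have := continuousAt_inv₀ ha
        fun_prop
      simpa using this.tendsto
    refine squeeze_zero' (Eventually.of_forall fun x => ?_) ?_ h1
    · unfold iv; split_ifs <;> simp only [chordal] <;> positivity
    · filter_upwards [isOpen_ne.mem_nhds ha] with x hx
      have hx : x ≠ 0 := hx
      simp only [iv, hx, ha, if_false, chordal]
      refine div_le_self (norm_nonneg _) ?_
      rw [Real.one_le_sqrt]
      nlinarith [sq_nonneg ‖b + x⁻¹‖, sq_nonneg ‖b + a⁻¹‖, mul_nonneg (sq_nonneg ‖b + x⁻¹‖) (sq_nonneg ‖b + a⁻¹‖)]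

lemma Fb_path {γ : ℝ → ℂ} {a : ℂ} (h1 : ContinuousOn γ (Ici 0))
    (h2 : ∀ t, 0 ≤ t → γ t ∉ Pb f P b) (h3 : Tendsto (fun t => ‖γ t‖) atTop atTop)
    (h4 : Tendsto (fun t => Fb f P b (γ t)) atTop (𝓝 a)) : AsymptoticPath f P (iv b a) γ := by
  refine ⟨h1, h3, ((chordal_iv b a).comp h4).congr' ?_⟩
  filter_upwards [eventually_ge_atTop 0] with t ht
  rw [Function.comp, val_iv (h2 t ht)]

lemma deriv_notev (hm : MeroPlane f P) (hr : ¬ RationalFn f P) {z : ℂ} (hz : z ∉ P)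
    (h : ∀ᶠ w in 𝓝 z, deriv f w = 0) : False := by
  have hU : AnalyticOnNhd ℂ (deriv f) Pᶜ := fun w hw => (hm.2.1 w hw).deriv
  have h0 := hU.eqOn_zero_of_preconnected_of_eventuallyEq_zero (lf_conn hm.1) hz h
  have hd : DifferentiableOn ℂ f Pᶜ := fun w hw => (hm.2.1 w hw).differentiableAt.differentiableWithinAt
  have hc : ∀ w, w ∉ P → f w = f z := fun w hw =>
    (lf_isClosed hm.1).isOpen_compl.is_const_of_deriv_eq_zero (lf_conn hm.1) hd h0 hw hz
  exact hr ⟨Polynomial.C (f z), 1, one_ne_zero, fun w hw _ => by simpa using hc w hw⟩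

lemma good_Fb {S : Set (Option ℂ)} (hSf : S.Finite) (hm : MeroPlane f P) (hr : ¬ RationalFn f P)
    (hA : MeroPlane A PA)
    (hS : ∀ z, z ∉ P → deriv f z ≠ 0 → schwarzian f z = 2 * A z)
    (hmult : ∀ z μ, MultiplePointWithMult f z μ → μ ≤ M)
    (hcr : CriticalValues f P ⊆ S) (has : ∀ a γ, AsymptoticPath f P a γ → a ∈ S) (b : ℂ) :
    Good (Fb f P b) (Pb f P b) {a | iv b a ∈ S} A M where
  mero := Fb_mero hm hr
  notrat := Fb_notrat hm hr
  fin := hSf.preimage (iv_inj b).injOn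
  crit := fun z hz hd => by
    have hFa := Fb_an (b := b) hm hr hz
    have hne : analyticOrderAt (deriv (Fb f P b)) z ≠ ⊤ := fun h =>
      deriv_notev (Fb_mero (b := b) hm hr) (Fb_notrat hm hr) hz (analyticOrderAt_eq_top.1 h)
    obtain ⟨n, hn⟩ := ENat.ne_top_iff_exists.1 hne
    obtain ⟨g, hg, hg0, hev⟩ := hFa.deriv.analyticOrderAt_eq_natCast.1 hn.symm
    have hn0 : n ≠ 0 := by
      rintro rfl
      have := hev.self_of_nhds
      simp [hd] at this
      exact hg0 this.symm
    refine hcr ⟨z, ⟨n + 1, Fb_mult hm hr hz (by omega) ⟨by omega, g, hg, hg0, ?_⟩⟩, (val_iv hz).symm⟩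
    simpa [smul_eq_mul] using hev
  asym := fun γ a h1 h2 h3 h4 => has _ _ (Fb_path h1 h2 h3 h4)
  mult := fun z hz m h2 h => hmult z m (Fb_mult hm hr hz h2 h)
  schw := fun z hz hd => Fb_schw hm hr hA hS hz hd

lemma asym_finite (h : FinitelyManyTranscSing f P) : {a | ∃ γ, AsymptoticPath f P a γ}.Finite := by
  obtain ⟨n, hn⟩ := h
  by_contra hinf
  obtain ⟨t, ht, hc⟩ := (show Set.Infinite _ from hinf).exists_subset_card_eq (n + 1)
  choose! γ hγ using fun a (ha : a ∈ {a | ∃ γ, AsymptoticPath f P a γ}) => ha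
  have e := t.equivFin
  rw [hc] at e
  have := hn (n + 1) (fun i => (e.symm i).1) (fun i => γ (e.symm i).1)
    (fun i => hγ _ (ht (e.symm i).2))
    (fun i j hij => Or.inl fun h => hij (e.symm.injective (Subtype.ext h)))
  omega
end

end SW

namespace SW
open Metric

section
variable {Φ : ℂ → ℂ} {P V : Set ℂ} {A : ℂ → ℂ} {M : ℕ}

def Obs (Φ : ℂ → ℂ) (P : Set ℂ) (a p : ℂ) (d : ℝ) : Prop :=
  ∃ z : ℝ → ℂ, ContinuousOn z (Ico 0 1) ∧ z 0 = p ∧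
    (∀ t ∈ Ico (0:ℝ) 1, z t ∈ XX Φ P ∧ ‖Φ (z t) - a‖ ≤ d ∧ Φ (z t) ≠ a) ∧
    Tendsto (fun t => Φ (z t)) (𝓝[<] 1) (𝓝 a) ∧ ¬ ∃ x ∈ XX Φ P, Tendsto z (𝓝[<] 1) (𝓝 x)

lemma affine_of_inj {h : ℂ → ℂ} (hd : Differentiable ℂ h) (hi : Function.Injective h) (c : ℂ) :
    deriv h c ≠ 0 ∧ ∀ w, h w = h c + deriv h c * (w - c) := by
  have h1 : ∀ w, deriv h w = deriv h c := by
    intro w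
    by_contra hne
    have hpos : 0 < ‖deriv h w - deriv h c‖ := norm_pos_iff.2 (sub_ne_zero.2 hne)
    set R := 2 * ‖w - c‖ + 1 + 4 * K0 * ‖deriv h c‖ * ‖w - c‖ / ‖deriv h w - deriv h c‖ with hR
    have hK := K0_pos
    have hR0 : 0 < R := by positivity
    have h2 := koebe_dist hR0 hd.differentiableOn (hi.injOn) (z := w) (c := c) (by
      have : 0 ≤ 4 * K0 * ‖deriv h c‖ * ‖w - c‖ / ‖deriv h w - deriv h c‖ := by positivity
      linarith)
    rw [div_mul_eq_mul_div, le_div_iff₀ hR0, hR, mul_add, mul_div_cancel₀ _ hpos.ne'] at h2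
    have h3 : 0 ≤ ‖deriv h w - deriv h c‖ * (2 * ‖w - c‖) := by positivity
    rw [mul_add] at h2
    linarith
  refine ⟨(inj_basic isOpen_univ hd.differentiableOn hi.injOn).2.2 c (mem_univ _), fun w => ?_⟩
  have h3 : ∀ x, HasDerivAt (fun w => h w - deriv h c * (w - c)) 0 x := fun x => by
    have := (hd x).hasDerivAt.sub (((hasDerivAt_id x).sub_const c).const_mul (deriv h c))
    exact this.congr_deriv (by rw [h1 x]; ring)
  have h4 := is_const_of_deriv_eq_zero (fun x => (h3 x).differentiableAt) (fun x => (h3 x).deriv) w c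
  simp only [sub_self, mul_zero, sub_zero] at h4
  rw [← h4]; ring

lemma Good.disc (G : Good Φ P V A M) {p : ℂ} (hp : p ∈ XX Φ P) :
    ∃ a ∈ V, a ≠ Φ p ∧ ∃ h : ℂ → ℂ, DifferentiableOn ℂ h (ball (Φ p) ‖a - Φ p‖) ∧ h (Φ p) = p ∧
      (∀ w ∈ ball (Φ p) ‖a - Φ p‖, h w ∈ XX Φ P ∧ Φ (h w) = w) ∧
      ¬ ∃ x ∈ XX Φ P, Tendsto (fun t : ℝ => h (Φ p + t * (a - Φ p))) (𝓝[<] 1) (𝓝 x) := by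
  set w0 := Φ p with hw0
  let O : Set ℂ := {a | a ∈ V ∧ a ≠ w0 ∧ ∃ z, Lifts Φ P (fun t : ℝ => w0 + t * (a - w0)) p (Ico 0 1) z ∧
    ¬ ∃ x ∈ XX Φ P, Tendsto z (𝓝[<] 1) (𝓝 x)}
  have key : ∀ ζ : ℂ, (∃ z, Lifts Φ P (fun t : ℝ => w0 + t * (ζ - w0)) p (Icc 0 1) z) ∨
      ∃ a ∈ O, ‖a - w0‖ ≤ ‖ζ - w0‖ := by
    intro ζ
    by_cases hζ : ζ = w0
    · left
      refine ⟨fun _ => p, continuousOn_const, rfl, fun t _ => ⟨hp, ?_⟩⟩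
      simp [hζ, hw0]
    rcases G.path_lift (w := fun t : ℝ => w0 + t * (ζ - w0)) (by fun_prop) hp (by simp [hw0]) with
      h | ⟨T, hT0, hT1, hTV, z, hz, hno⟩
    · exact Or.inl h
    · right
      have hsub : w0 + T * (ζ - w0) - w0 = T * (ζ - w0) := by ring
      refine ⟨w0 + T * (ζ - w0), ⟨hTV, ?_, fun t => z (T * t), ⟨?_, ?_, ?_⟩, ?_⟩, ?_⟩
      · intro h
        have : (T : ℂ) * (ζ - w0) = 0 := by rw [← hsub, h, sub_self]
        rcases mul_eq_zero.1 this with h1 | h1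
        · exact hT0.ne' (by exact_mod_cast h1)
        · exact hζ (sub_eq_zero.1 h1)
      · refine hz.1.comp (by fun_prop) fun t ht => ⟨mul_nonneg hT0.le ht.1, ?_⟩
        nlinarith [ht.2]
      · simpa using hz.2.1
      · intro t ht
        have := hz.2.2 (T * t) ⟨mul_nonneg hT0.le ht.1, by nlinarith [ht.2]⟩
        refine ⟨this.1, this.2.trans ?_⟩
        simp only [hsub]; push_cast; ring
      · rintro ⟨x, hx, hlim⟩
        refine hno ⟨x, hx, ?_⟩
        have h2 : Tendsto (fun t : ℝ => t / T) (𝓝[<] T) (𝓝[<] 1) := by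
          refine tendsto_nhdsWithin_iff.2 ⟨?_, ?_⟩
          · have : ContinuousAt (fun t : ℝ => t / T) T := by fun_prop
            have h := this.tendsto
            rw [div_self hT0.ne'] at h
            exact h.mono_left nhdsWithin_le_nhds
          · filter_upwards [self_mem_nhdsWithin] with t ht
            exact (div_lt_one hT0).2 ht
        refine (hlim.comp h2).congr fun t => ?_
        simp only [Function.comp]; rw [mul_div_cancel₀ _ hT0.ne']
      · rw [hsub, norm_mul, Complex.norm_real, Real.norm_of_nonneg hT0.le]
        exact mul_le_of_le_one_left (norm_nonneg _) hT1
  have hOfin : O.Finite := G.fin.subset fun a ha => ha.1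
  have hOne : O.Nonempty := by
    by_contra hemp
    rw [not_nonempty_iff_eq_empty] at hemp
    obtain ⟨h, hd, hc, hh⟩ := G.lift isOpen_univ convex_univ (mem_univ w0) (p := p) (θ := fun x => x)
      differentiableOn_id (fun ζ _ => by
        rcases key ζ with h | ⟨a, ha, -⟩
        · exact h
        · rw [hemp] at ha; exact absurd ha (notMem_empty _))
    have hinj : Function.Injective h := fun x y hxy => by
      rw [← (hh x (mem_univ _)).2, hxy, (hh y (mem_univ _)).2]
    obtain ⟨hk, haff⟩ := affine_of_inj (differentiableOn_univ.1 hd) hinj w0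
    set k := deriv h w0
    refine G.notrat ⟨Polynomial.C w0 + Polynomial.C k⁻¹ * (Polynomial.X - Polynomial.C p), 1,
      one_ne_zero, fun z hz _ => ?_⟩
    have h1 := haff (w0 + k⁻¹ * (z - p))
    have h2 : h (w0 + k⁻¹ * (z - p)) = z := by
      rw [h1, hc]; field_simp; ring
    have h3 := (hh (w0 + k⁻¹ * (z - p)) (mem_univ _)).2
    rw [h2] at h3
    simpa using h3
  obtain ⟨a, ⟨haV, hane, z, hz, hno⟩, hmin⟩ := hOfin.exists_minimalFor (fun a => ‖a - w0‖) _ hOne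
  have hmin' : ∀ a' ∈ O, ‖a - w0‖ ≤ ‖a' - w0‖ := fun a' ha' => by
    by_contra hlt
    exact hlt (hmin ha' (not_le.1 hlt).le)
  have hpos : 0 < ‖a - w0‖ := norm_pos_iff.2 (sub_ne_zero.2 hane)
  obtain ⟨h, hd, hc, hh⟩ := G.lift isOpen_ball (convex_ball w0 ‖a - w0‖) (mem_ball_self hpos) (p := p)
    (θ := fun x => x) differentiableOn_id (fun ζ hζ => by
        rcases key ζ with h | ⟨a', ha', hle⟩
        · exact h
        · have := hmin' a' ha'
          rw [mem_ball, dist_eq_norm] at hζ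
          linarith)
  refine ⟨a, haV, hane, h, hd, hc, hh, ?_⟩
  have hmem : ∀ t ∈ Ico (0:ℝ) 1, w0 + t * (a - w0) ∈ ball w0 ‖a - w0‖ := by
    intro t ht
    rw [mem_ball, dist_eq_norm, add_sub_cancel_left, norm_mul, Complex.norm_real,
      Real.norm_of_nonneg ht.1]
    nlinarith [ht.2]
  have heq : EqOn z (fun t : ℝ => h (w0 + t * (a - w0))) (Ico 0 1) := by
    refine lift_unique G.mero isPreconnected_Ico hz.1 (hd.continuousOn.comp (by fun_prop) hmem)
      (fun t ht => (hz.2.2 t ht).1) (fun t ht => (hh _ (hmem t ht)).1) (fun t ht => ?_)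
      (left_mem_Ico.2 one_pos) ?_
    · rw [(hz.2.2 t ht).2, (hh _ (hmem t ht)).2]
    · simp [hz.2.1, hc]
  rintro ⟨x, hx, hlim⟩
  refine hno ⟨x, hx, hlim.congr' ?_⟩
  filter_upwards [Ico_mem_nhdsLT (one_pos : (0:ℝ) < 1)] with t ht using (heq ht).symm

/-- obstruction at points of the segment -/
lemma obs_of_disc {a w0 : ℂ} {h : ℂ → ℂ} (hd : DifferentiableOn ℂ h (ball w0 ‖a - w0‖))
    (hh : ∀ w ∈ ball w0 ‖a - w0‖, h w ∈ XX Φ P ∧ Φ (h w) = w) (hane : a ≠ w0)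
    (hno : ¬ ∃ x ∈ XX Φ P, Tendsto (fun t : ℝ => h (w0 + t * (a - w0))) (𝓝[<] 1) (𝓝 x))
    {u : ℝ} (hu0 : 0 ≤ u) (hu1 : u < 1) : Obs Φ P a (h (w0 + u * (a - w0))) ((1 - u) * ‖a - w0‖) := by
  have hpos : 0 < ‖a - w0‖ := norm_pos_iff.2 (sub_ne_zero.2 hane)
  have hv : ∀ t ∈ Ico (0:ℝ) 1, u + t * (1 - u) ∈ Ico (0:ℝ) 1 := fun t ht =>
    ⟨by nlinarith [ht.1], by nlinarith [ht.2]⟩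
  have hmem : ∀ t ∈ Ico (0:ℝ) 1, w0 + t * (a - w0) ∈ ball w0 ‖a - w0‖ := by
    intro t ht
    rw [mem_ball, dist_eq_norm, add_sub_cancel_left, norm_mul, Complex.norm_real,
      Real.norm_of_nonneg ht.1]
    nlinarith [ht.2]
  have hnorm : ∀ t : ℝ, t < 1 → ‖w0 + t * (a - w0) - a‖ = (1 - t) * ‖a - w0‖ := by
    intro t ht
    have : w0 + t * (a - w0) - a = -(((1 - t : ℝ) : ℂ) * (a - w0)) := by push_cast; ring
    rw [this, norm_neg, norm_mul, Complex.norm_real, Real.norm_of_nonneg (by linarith)]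
  refine ⟨fun t => h (w0 + ((u + t * (1 - u) : ℝ) : ℂ) * (a - w0)), ?_, by simp, ?_, ?_, ?_⟩
  · exact hd.continuousOn.comp (by fun_prop) fun t ht => hmem _ (hv t ht)
  · intro t ht
    obtain ⟨h1, h2⟩ := hh _ (hmem _ (hv t ht))
    refine ⟨h1, ?_, ?_⟩
    · rw [h2, hnorm _ (hv t ht).2]
      have : 0 ≤ t * (1 - u) := mul_nonneg ht.1 (by linarith)
      nlinarith
    · intro h5
      rw [h2] at h5
      have := hnorm _ (hv t ht).2
      rw [h5, sub_self, norm_zero] at this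
      have h6 := (hv t ht).2
      nlinarith
  · have h1 : Tendsto (fun t : ℝ => w0 + ((u + t * (1 - u) : ℝ) : ℂ) * (a - w0)) (𝓝[<] 1) (𝓝 a) := by
      have : Continuous (fun t : ℝ => w0 + ((u + t * (1 - u) : ℝ) : ℂ) * (a - w0)) := by fun_prop
      have h2 := this.tendsto 1
      simp only [one_mul, add_sub_cancel, Complex.ofReal_one] at h2
      exact h2.mono_left nhdsWithin_le_nhds
    refine h1.congr' ?_
    filter_upwards [Ico_mem_nhdsLT (one_pos : (0:ℝ) < 1)] with t ht
    exact (hh _ (hmem _ (hv t ht))).2.symm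
  · rintro ⟨x, hx, hlim⟩
    refine hno ⟨x, hx, ?_⟩
    have h2 : Tendsto (fun t : ℝ => (t - u) / (1 - u)) (𝓝[<] 1) (𝓝[<] 1) := by
      refine tendsto_nhdsWithin_iff.2 ⟨?_, ?_⟩
      · have : Continuous (fun t : ℝ => (t - u) / (1 - u)) := by fun_prop
        have h := this.tendsto 1
        rw [div_self (sub_pos.2 hu1).ne'] at h
        exact h.mono_left nhdsWithin_le_nhds
      · filter_upwards [self_mem_nhdsWithin] with t ht
        have h3 : t < 1 := ht
        show (t - u) / (1 - u) < 1
        rw [div_lt_one (sub_pos.2 hu1)]; linarith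
    refine (hlim.comp h2).congr fun t => ?_
    simp only [Function.comp]
    rw [div_mul_cancel₀ _ (sub_pos.2 hu1).ne', add_sub_cancel]
end

end SW

namespace SW
open Metric

lemma poly_of_growth {g : ℂ → ℂ} (hg : Differentiable ℂ g) {Q : Polynomial ℂ} {B C : ℝ}
    (h : ∀ z, B < ‖z‖ → ‖g z‖ ≤ C * ‖Q.eval z‖) (hC : 0 ≤ C) :
    ∃ p : Polynomial ℂ, ∀ z, g z = p.eval z := by
  set d := Q.natDegree
  set S := ∑ i ∈ Finset.range (d + 1), ‖Q.coeff i‖ with hS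
  have hz : ∀ n, d < n → iteratedDeriv n g 0 = 0 := by
    intro n hn
    have h1 : ∀ R : ℝ, max B 1 < R → ‖iteratedDeriv n g 0‖ ≤ n.factorial * (C * S) / R := by
      intro R hR
      have hR1 : 1 < R := (le_max_right _ _).trans_lt hR
      have h2 := Complex.norm_iteratedDeriv_le_of_forall_mem_sphere_norm_le n (c := 0)
        (C := C * (S * R ^ d)) (by linarith : 0 < R) hg.diffContOnCl (fun z hz => by
          have hzR : ‖z‖ = R := by simpa using hz
          refine (h z (by rw [hzR]; exact (le_max_left _ _).trans_lt hR)).trans ?_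
          refine mul_le_mul_of_nonneg_left ?_ hC
          rw [Polynomial.eval_eq_sum_range, hS, Finset.sum_mul]
          refine (norm_sum_le _ _).trans (Finset.sum_le_sum fun i hi => ?_)
          rw [norm_mul, norm_pow, hzR]
          exact mul_le_mul_of_nonneg_left (pow_le_pow_right₀ hR1.le
            (Finset.mem_range_succ_iff.1 hi)) (norm_nonneg _))
      refine h2.trans ?_
      rw [div_le_div_iff₀ (by positivity) (by linarith)]
      have h3 : R ^ d * R ≤ R ^ n := by rw [← pow_succ]; exact pow_le_pow_right₀ hR1.le hn
      have hS0 : 0 ≤ S := Finset.sum_nonneg fun i _ => norm_nonneg _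
      calc (n.factorial : ℝ) * (C * (S * R ^ d)) * R = n.factorial * (C * S) * (R ^ d * R) := by ring
        _ ≤ _ := mul_le_mul_of_nonneg_left h3 (by positivity)
    have h2 : Tendsto (fun R : ℝ => n.factorial * (C * S) / R) atTop (𝓝 0) :=
      tendsto_const_nhds.div_atTop tendsto_id
    have h3 := ge_of_tendsto h2 ((eventually_gt_atTop (max B 1)).mono h1)
    exact norm_le_zero_iff.1 h3
  refine ⟨∑ n ∈ Finset.range (d + 1), Polynomial.C ((n.factorial : ℂ)⁻¹ * iteratedDeriv n g 0) *
    Polynomial.X ^ n, fun z => ?_⟩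
  have h1 := Complex.hasSum_taylorSeries_of_entire hg 0 z
  have h2 := hasSum_sum_of_ne_finset_zero (L := SummationFilter.unconditional ℕ) (s := Finset.range (d + 1))
    (f := fun n => ((n.factorial : ℂ))⁻¹ • (z - 0) ^ n • iteratedDeriv n g 0) (fun n hn => by
      rw [hz n (by simpa using hn)]; simp)
  rw [h1.unique h2, Polynomial.eval_finsetSum]
  refine Finset.sum_congr rfl fun n _ => ?_
  simp; ring

lemma rational_of_bdd {Φ : ℂ → ℂ} {P : Set ℂ} (hm : MeroPlane Φ P) {B C : ℝ}
    (h : ∀ z, B < ‖z‖ → z ∉ P → ‖Φ z‖ ≤ C) : RationalFn Φ P := by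
  by_contra hr
  have hPB : P ⊆ closedBall 0 B := by
    intro p hp
    by_contra hpB
    have hpB' : B < ‖p‖ := by simpa using hpB
    have h1 : ∀ᶠ z in 𝓝[≠] p, B < ‖z‖ := nhdsWithin_le_nhds
      (continuous_norm.continuousAt.eventually_const_lt hpB')
    obtain ⟨z, h2, h3, h4⟩ := (h1.and ((lf_disc hm.1 p).and
      ((mero_pole hm hp).eventually_gt_atTop C))).exists
    exact absurd (h z h2 h3) (not_le.2 h4)
  have hfin : P.Finite := by
    have := hm.1 _ (isCompact_closedBall 0 B)
    rwa [inter_eq_left.2 hPB] at this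
  have hma : ∀ p ∈ P, ∃ n : ℕ, AnalyticAt ℂ (fun z => (z - p) ^ n • Φ z) p := by
    intro p hp
    have h1 : AnalyticAt ℂ (Fb Φ P 0) p := Fb_an hm hr (fun h => h.1 hp)
    have h2 : MeromorphicAt (Fb Φ P 0)⁻¹ p := h1.meromorphicAt.inv
    refine h2.congr ?_
    filter_upwards [lf_disc hm.1 p] with z hz
    simp [Fb, hz]
  choose! n hn using hma
  set Q : Polynomial ℂ := ∏ p ∈ hfin.toFinset, (Polynomial.X - Polynomial.C p) ^ n p with hQ
  have hQ0 : Q ≠ 0 := Finset.prod_ne_zero_iff.2 fun p _ => pow_ne_zero _ (Polynomial.X_sub_C_ne_zero p)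
  have hg : Differentiable ℂ fun z => Q.eval z * Φ z := by
    intro z
    by_cases hz : z ∈ P
    · have h1 := (hn z hz).differentiableAt
      have h2 : (fun w => Q.eval w * Φ w) = fun w =>
          (∏ p ∈ hfin.toFinset.erase z, (Polynomial.X - Polynomial.C p) ^ n p).eval w *
            ((w - z) ^ n z • Φ w) := by
        funext w
        rw [hQ, ← Finset.mul_prod_erase _ _ (hfin.mem_toFinset.2 hz)]
        simp; ring
      rw [h2]
      exact (Polynomial.differentiableAt _).mul h1
    · exact (Polynomial.differentiableAt _).mul (hm.2.1 z hz).differentiableAt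
  obtain ⟨p, hp⟩ := poly_of_growth hg (Q := Q) (B := B) (C := max C 0) (fun z hz => by
    have hzP : z ∉ P := fun h => absurd (hPB h) (by simpa using hz)
    rw [norm_mul, mul_comm]
    exact mul_le_mul_of_nonneg_right ((h z hz hzP).trans (le_max_left _ _)) (norm_nonneg _))
    (le_max_right _ _)
  exact hr ⟨p, Q, hQ0, fun z _ hz => by rw [eq_div_iff hz, ← hp]; ring⟩

end SW

namespace SW
open Metric

def Hp : Set ℂ := {ζ | 0 < ζ.re}
lemma mem_Hp {ζ : ℂ} : ζ ∈ Hp ↔ 0 < ζ.re := Iff.rfl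
lemma Hp_open : IsOpen Hp := isOpen_lt continuous_const Complex.continuous_re
lemma Hp_convex : Convex ℝ Hp := convex_halfSpace_re_gt 0

lemma norm_cexp_neg (ζ : ℂ) : ‖Complex.exp (-ζ)‖ = Real.exp (-ζ.re) := by
  rw [Complex.norm_exp, Complex.neg_re]

structure Tr (Φ : ℂ → ℂ) (P : Set ℂ) (a : ℂ) (δ : ℝ) (ψ : ℂ → ℂ) : Prop where
  diff : DifferentiableOn ℂ ψ Hp
  lift : ∀ ζ ∈ Hp, ψ ζ ∈ XX Φ P ∧ Φ (ψ ζ) = a + δ * Complex.exp (-ζ)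

section
variable {Φ : ℂ → ℂ} {P V : Set ℂ} {A : ℂ → ℂ} {M : ℕ} {a : ℂ} {δ : ℝ} {ψ : ℂ → ℂ}

lemma Good.tract (G : Good Φ P V A M) (hδ : 0 < δ) (hV : ∀ v ∈ V, v ≠ a → δ ≤ ‖v - a‖) {p : ℂ}
    (hp : p ∈ XX Φ P) (h1 : Φ p ≠ a) (h2 : ‖Φ p - a‖ < δ) :
    ∃ ψ, Tr Φ P a δ ψ ∧ ∃ ζ ∈ Hp, ψ ζ = p := by
  have hδ' : (δ:ℂ) ≠ 0 := by exact_mod_cast hδ.ne'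
  have h3 : (Φ p - a) / δ ≠ 0 := div_ne_zero (sub_ne_zero.2 h1) hδ'
  set c := -Complex.log ((Φ p - a) / δ) with hc
  have hce : a + δ * Complex.exp (-c) = Φ p := by
    rw [hc, neg_neg, Complex.exp_log h3]; field_simp; ring
  have hcH : c ∈ Hp := by
    show 0 < c.re
    rw [hc, Complex.neg_re, Complex.log_re, neg_pos]
    refine Real.log_neg (norm_pos_iff.2 h3) ?_
    rw [norm_div, Complex.norm_real, Real.norm_of_nonneg hδ.le, div_lt_one hδ]; exact h2
  obtain ⟨ψ, hd, hψ, hl⟩ := G.lift Hp_open Hp_convex hcH (p := p)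
    (θ := fun ζ => a + δ * Complex.exp (-ζ)) (by fun_prop) (fun ζ hζ => by
      rcases G.path_lift (w := fun t : ℝ => a + δ * Complex.exp (-(c + t * (ζ - c)))) (by fun_prop) hp
        (by simp [hce]) with h | ⟨T, hT0, hT1, hTV, -⟩
      · exact h
      · exfalso
        have h4 : c + T * (ζ - c) ∈ Hp := by
          have := Hp_convex hcH hζ (by linarith : 0 ≤ 1 - T) hT0.le (by ring)
          convert this using 1
          simp only [Complex.real_smul]; push_cast; ring
        have h5 := hV _ hTV (by simp [hδ.ne'])
        rw [add_sub_cancel_left, norm_mul, norm_cexp_neg, Complex.norm_real, Real.norm_of_nonneg hδ.le] at h5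
        have h6 : Real.exp (-(c + T * (ζ - c)).re) < 1 := Real.exp_lt_one_iff.2 (neg_lt_zero.2 h4)
        nlinarith)
  exact ⟨ψ, ⟨hd, hl⟩, c, hcH, hψ⟩

lemma Tr.norm (T : Tr Φ P a δ ψ) (hδ : 0 < δ) {ζ : ℂ} (hζ : ζ ∈ Hp) :
    ‖Φ (ψ ζ) - a‖ = δ * Real.exp (-ζ.re) := by
  rw [(T.lift ζ hζ).2, add_sub_cancel_left, norm_mul, norm_cexp_neg, Complex.norm_real,
    Real.norm_of_nonneg hδ.le]

lemma Tr.hd (T : Tr Φ P a δ ψ) {ζ : ℂ} (hζ : ζ ∈ Hp) : DifferentiableAt ℂ ψ ζ :=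
  T.diff.differentiableAt (Hp_open.mem_nhds hζ)

lemma Tr.dmul (T : Tr Φ P a δ ψ) (hm : MeroPlane Φ P) {ζ : ℂ} (hζ : ζ ∈ Hp) :
    deriv Φ (ψ ζ) * deriv ψ ζ = - (δ * Complex.exp (-ζ)) := by
  have h1 : HasDerivAt (fun x => Φ (ψ x)) (deriv Φ (ψ ζ) * deriv ψ ζ) ζ :=
    (hm.2.1 _ (T.lift ζ hζ).1.1).differentiableAt.hasDerivAt.comp ζ (T.hd hζ).hasDerivAt
  have h2 : HasDerivAt (fun x => a + δ * Complex.exp (-x)) (- (δ * Complex.exp (-ζ))) ζ :=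
    (((hasDerivAt_neg ζ).cexp.const_mul (δ:ℂ)).const_add a).congr_deriv (by ring)
  refine (h2.congr_of_eventuallyEq ?_).unique h1 |>.symm
  filter_upwards [Hp_open.mem_nhds hζ] with x hx using (T.lift x hx).2

lemma Tr.deriv_ne (T : Tr Φ P a δ ψ) (hδ : 0 < δ) (hm : MeroPlane Φ P) {ζ : ℂ} (hζ : ζ ∈ Hp) :
    deriv ψ ζ ≠ 0 := fun h => by
  have := T.dmul hm hζ
  rw [h, mul_zero] at this
  simp [hδ.ne'] at this

lemma Tr.isOpen (T : Tr Φ P a δ ψ) (hδ : 0 < δ) (hm : MeroPlane Φ P) : IsOpen (ψ '' Hp) := by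
  rw [isOpen_iff_mem_nhds]
  rintro _ ⟨ζ, hζ, rfl⟩
  have h := (T.diff.analyticAt (Hp_open.mem_nhds hζ)).hasStrictDerivAt.map_nhds_eq
    (T.deriv_ne hδ hm hζ)
  rw [← h]
  exact image_mem_map (Hp_open.mem_nhds hζ)

/-- two tracts that meet coincide -/
lemma Tr.meet (hδ : 0 < δ) (hm : MeroPlane Φ P) {ψ2 : ℂ → ℂ} (T : Tr Φ P a δ ψ)
    (T2 : Tr Φ P a δ ψ2) {ζ1 ζ2 : ℂ} (h1 : ζ1 ∈ Hp) (h2 : ζ2 ∈ Hp) (h : ψ ζ1 = ψ2 ζ2) :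
    ∃ k : ℤ, ζ2 = ζ1 + k * (2 * Real.pi * Complex.I) ∧
      ∀ ζ ∈ Hp, ψ ζ = ψ2 (ζ + k * (2 * Real.pi * Complex.I)) := by
  have h3 := (T.lift ζ1 h1).2
  rw [h, (T2.lift ζ2 h2).2] at h3
  have h4 : Complex.exp (-ζ2) = Complex.exp (-ζ1) :=
    mul_left_cancel₀ (by exact_mod_cast hδ.ne' : (δ:ℂ) ≠ 0) (add_left_cancel h3)
  obtain ⟨k, hk⟩ := Complex.exp_eq_exp_iff_exists_int.1 h4
  have h5 : ζ2 = ζ1 + (-k : ℤ) * (2 * Real.pi * Complex.I) := by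
    push_cast; linear_combination -hk
  have hmem : ∀ ζ ∈ Hp, ζ + (-k : ℤ) * (2 * Real.pi * Complex.I) ∈ Hp := by
    intro ζ hζ
    have : (ζ + (-k : ℤ) * (2 * Real.pi * Complex.I)).re = ζ.re := by simp
    rw [mem_Hp]
    rw [this]; exact hζ
  refine ⟨-k, h5, ?_⟩
  refine lift_unique hm Hp_convex.isPreconnected T.diff.continuousOn
    (T2.diff.continuousOn.comp (by fun_prop) hmem) (fun s hs => (T.lift s hs).1)
    (fun s hs => (T2.lift _ (hmem s hs)).1) (fun s hs => ?_) h1 (by rw [h, h5])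
  rw [(T.lift s hs).2, (T2.lift _ (hmem s hs)).2]
  have : -(s + (-k : ℤ) * (2 * Real.pi * Complex.I)) = -s + k * (2 * Real.pi * Complex.I) := by
    push_cast; ring
  rw [this, Complex.exp_add, Complex.exp_int_mul_two_pi_mul_I, mul_one]

lemma Tr.stay (G : Good Φ P V A M) (hδ : 0 < δ) (hV : ∀ v ∈ V, v ≠ a → δ ≤ ‖v - a‖)
    (T : Tr Φ P a δ ψ) {S : Set ℂ} (hS : IsPreconnected S)
    (hSP : ∀ z ∈ S, z ∉ P ∧ Φ z ≠ a ∧ ‖Φ z - a‖ < δ) {z0 : ℂ} (h0 : z0 ∈ S) (h0' : z0 ∈ ψ '' Hp) :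
    S ⊆ ψ '' Hp := by
  refine hS.subset_of_closure_inter_subset (T.isOpen hδ G.mero) ⟨z0, h0, h0'⟩ ?_
  rintro z ⟨hcl, hz⟩
  obtain ⟨hzP, hza, hzδ⟩ := hSP z hz
  have hzX : z ∈ XX Φ P := ⟨hzP, fun h => not_lt.2 (hV _ (G.crit z hzP h) hza) hzδ⟩
  obtain ⟨ψ2, T2, ζ, hζ, rfl⟩ := G.tract hδ hV hzX hza hzδ
  obtain ⟨_, ⟨ζ2, h2, rfl⟩, ζ1, h1, h12⟩ := mem_closure_iff.1 hcl _ (T2.isOpen hδ G.mero) ⟨ζ, hζ, rfl⟩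
  obtain ⟨k, -, hk⟩ := T2.meet hδ G.mero T h2 h1 h12.symm
  refine ⟨ζ + k * (2 * Real.pi * Complex.I), ?_, (hk ζ hζ).symm⟩
  have : (ζ + k * (2 * Real.pi * Complex.I)).re = ζ.re := by simp
  rw [mem_Hp]
  rw [this]; exact hζ

lemma cusp {m : ℕ} (hm : 0 < m) (hψ : DifferentiableOn ℂ ψ Hp)
    (hper : ∀ ζ ∈ Hp, ψ (ζ + m * (2 * Real.pi * Complex.I)) = ψ ζ) :
    ∃ Ψ : ℂ → ℂ, DifferentiableOn ℂ Ψ (ball 0 1 \ {0}) ∧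
      ∀ ζ ∈ Hp, Ψ (Complex.exp (-ζ / m)) = ψ ζ := by
  classical
  have hmC : (m:ℂ) ≠ 0 := by exact_mod_cast hm.ne'
  have hpi : (Real.pi : ℂ) ≠ 0 := by exact_mod_cast Real.pi_ne_zero
  set h : ℝ := 2 * Real.pi * m with hh
  have hh0 : 0 < h := by positivity
  set k : ℂ → ℂ := fun z => if 0 < z.im then ψ (-Complex.I * z) else 0 with hk
  have hHp : ∀ z : ℂ, 0 < z.im → -Complex.I * z ∈ Hp := fun z hz => by
    rw [mem_Hp]
    simpa using hz
  have hkp : Function.Periodic k h := by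
    intro z
    have him : (z + (h:ℂ)).im = z.im := by simp
    simp only [hk, him]
    split_ifs with hz
    · have h1 := hper _ (hHp (z + h) (by rw [him]; exact hz))
      rw [← h1]
      congr 1
      rw [hh]; push_cast; ring
    · rfl
  have hq : ∀ z : ℂ, Function.Periodic.qParam h z = Complex.exp (-(-Complex.I * z) / m) := fun z => by
    unfold Function.Periodic.qParam
    congr 1
    rw [hh]; push_cast; field_simp
  have hIz : ∀ ζ : ℂ, -Complex.I * (Complex.I * ζ) = ζ := fun ζ => by
    rw [← mul_assoc, neg_mul, Complex.I_mul_I]; ring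
  refine ⟨Function.Periodic.cuspFunction h k, ?_, ?_⟩
  · rintro η ⟨hη, hη0⟩
    have hη0' : η ≠ 0 := hη0
    have hη1 : ‖η‖ < 1 := by simpa using hη
    set z := Function.Periodic.invQParam h η
    have hz : Function.Periodic.qParam h z = η := Function.Periodic.qParam_right_inv hh0.ne' hη0'
    have hzim : 0 < z.im := by
      rw [Function.Periodic.im_invQParam]
      have := Real.log_neg (norm_pos_iff.2 hη0') hη1
      have h2 : 0 < h / (2 * Real.pi) := by positivity
      rw [neg_div]; nlinarith
    rw [← hz]
    refine (Function.Periodic.differentiableAt_cuspFunction hh0.ne' hkp ?_).differentiableWithinAt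
    have h3 : DifferentiableAt ℂ (fun z => ψ (-Complex.I * z)) z :=
      (hψ.differentiableAt (Hp_open.mem_nhds (hHp z hzim))).comp z (by fun_prop)
    refine h3.congr_of_eventuallyEq ?_
    filter_upwards [(isOpen_lt continuous_const Complex.continuous_im).mem_nhds hzim] with w hw
    exact if_pos hw
  · intro ζ hζ
    have h1 := Function.Periodic.eq_cuspFunction hh0.ne' hkp (Complex.I * ζ)
    rw [hq, hIz] at h1
    rw [h1]
    have : 0 < (Complex.I * ζ).im := by have : 0 < ζ.re := hζ; simpa using this
    simp only [hk, this, if_true, hIz]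

lemma exp_surj {m : ℕ} (hm : 0 < m) {η : ℂ} (h0 : η ≠ 0) (h1 : ‖η‖ < 1) :
    -(m * Complex.log η) ∈ Hp ∧ Complex.exp (-(-(m * Complex.log η)) / m) = η := by
  have hmC : (m:ℂ) ≠ 0 := by exact_mod_cast hm.ne'
  constructor
  · rw [mem_Hp]
    have := Real.log_neg (norm_pos_iff.2 h0) h1
    have hm' : (0:ℝ) < m := by exact_mod_cast hm
    simp [Complex.log_re]
    nlinarith
  · rw [neg_neg, mul_div_cancel_left₀ _ hmC, Complex.exp_log h0]

lemma cusp_tendsto {m : ℕ} (hm : 0 < m) {Ψ : ℂ → ℂ}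
    (hΨ : ∀ ζ ∈ Hp, Ψ (Complex.exp (-ζ / m)) = ψ ζ) {X : Type*} {l : Filter X} {g : ℂ → X}
    (h : Tendsto (fun ζ => g (ψ ζ)) (comap Complex.re atTop) l) :
    Tendsto (fun η => g (Ψ η)) (𝓝[≠] 0) l := by
  have h1 : Tendsto (fun η : ℂ => -(m * Complex.log η)) (𝓝[≠] 0) (comap Complex.re atTop) := by
    rw [tendsto_comap_iff]
    have h2 : Tendsto (fun η : ℂ => (-(m:ℝ)) * Real.log ‖η‖) (𝓝[≠] 0) atTop := by
      refine Tendsto.const_mul_atBot_of_neg (by simpa using hm) ?_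
      exact Real.tendsto_log_nhdsGT_zero.comp tendsto_norm_nhdsNE_zero
    refine h2.congr fun η => ?_
    simp [Complex.log_re]
  refine (h.comp h1).congr' ?_
  filter_upwards [self_mem_nhdsWithin, nhdsWithin_le_nhds (ball_mem_nhds (0:ℂ) one_pos)] with η h2 h3
  obtain ⟨h4, h5⟩ := exp_surj hm h2 (by simpa using h3)
  simp only [Function.comp]
  rw [← hΨ _ h4, h5]
end

end SW

namespace SW
open Metric

lemma blow {g : ℂ → ℂ} {x : ℂ} (hd : ∀ᶠ z in 𝓝[≠] x, DifferentiableAt ℂ g z)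
    (ht : Tendsto (fun z => ‖g z‖) (𝓝[≠] x) atTop) {S : Set ℂ} (hS : S ∈ 𝓝[≠] x) :
    ∃ B : ℝ, ∀ w, B < ‖w‖ → ∃ z ∈ S, g z = w := by
  classical
  set u : ℂ → ℂ := fun z => if z = x then 0 else (g z)⁻¹ with hu
  have hu0 : u x = 0 := if_pos rfl
  have hne : ∀ᶠ z in 𝓝[≠] x, g z ≠ 0 := by
    filter_upwards [ht.eventually_gt_atTop 0] with z hz using norm_pos_iff.1 hz
  have hune : ∀ᶠ z in 𝓝[≠] x, u z = (g z)⁻¹ := by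
    filter_upwards [self_mem_nhdsWithin] with z hz using if_neg hz
  have hua : AnalyticAt ℂ u x := by
    refine Complex.analyticAt_of_differentiable_on_punctured_nhds_of_continuousAt ?_ ?_
    · have h1 := eventually_eventually_nhdsWithin.2 hune
      filter_upwards [hd, hne, self_mem_nhdsWithin] with z h1 h2 h3
      refine (h1.inv h2).congr_of_eventuallyEq ?_
      filter_upwards [isOpen_ne.mem_nhds h3] with w hw using if_neg hw
    · rw [continuousAt_iff_punctured_nhds, hu0]
      refine Tendsto.congr' (hune.mono fun z hz => hz.symm) ?_
      rw [tendsto_zero_iff_norm_tendsto_zero]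
      simp only [norm_inv]
      exact ht.inv_tendsto_atTop
  rcases hua.eventually_constant_or_nhds_le_map_nhds with h | h
  · have h' : ∀ᶠ z in 𝓝[≠] x, u z = u x := nhdsWithin_le_nhds h
    obtain ⟨z, h1, h2, h3⟩ := (h'.and (hne.and hune)).exists
    rw [h3, hu0] at h1
    exact absurd h1 (inv_ne_zero h2)
  · rw [hu0] at h
    have h1 : u '' (insert x S) ∈ 𝓝 (0:ℂ) := h (image_mem_map (insert_mem_nhds_iff.2 hS))
    obtain ⟨ε, hε, hb⟩ := Metric.mem_nhds_iff.1 h1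
    refine ⟨ε⁻¹, fun w hw => ?_⟩
    have hw0 : w ≠ 0 := norm_pos_iff.1 ((inv_pos.2 hε).trans hw)
    obtain ⟨z, hz, hzw⟩ := hb (show w⁻¹ ∈ ball 0 ε by
      rw [mem_ball_zero_iff, norm_inv]; exact inv_lt_of_inv_lt₀ hε hw)
    have hzx : z ≠ x := fun h => inv_ne_zero hw0 (by rw [← hzw, h, hu0])
    refine ⟨z, (mem_insert_iff.1 hz).resolve_left hzx, ?_⟩
    rw [hu] at hzw
    simp only [hzx, if_false] at hzw
    exact inv_injective hzw

lemma punct_conn (x : ℂ) {r : ℝ} (hr : 0 < r) : IsPreconnected (ball x r \ {x}) := by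
  have : ball x r \ {x} = (fun ζ => x + r * Complex.exp (-ζ)) '' Hp := by
    ext z
    constructor
    · rintro ⟨h1, h2⟩
      have h2' : z - x ≠ 0 := sub_ne_zero.2 h2
      have hr' : (r:ℂ) ≠ 0 := by exact_mod_cast hr.ne'
      have h3 : ‖(z - x) / r‖ < 1 := by
        rw [norm_div, Complex.norm_real, Real.norm_of_nonneg hr.le, div_lt_one hr, ← dist_eq_norm]
        exact h1
      obtain ⟨h4, h5⟩ := exp_surj (m := 1) one_pos (div_ne_zero h2' hr') h3
      refine ⟨_, h4, ?_⟩
      simp only [Nat.cast_one, div_one] at h5 ⊢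
      rw [h5]; field_simp; ring
    · rintro ⟨ζ, hζ, rfl⟩
      constructor
      · rw [mem_ball, dist_eq_norm, add_sub_cancel_left, norm_mul, norm_cexp_neg, Complex.norm_real,
          Real.norm_of_nonneg hr.le]
        have : Real.exp (-ζ.re) < 1 := Real.exp_lt_one_iff.2 (neg_lt_zero.2 hζ)
        nlinarith
      · simp [hr.ne']
  rw [this]
  exact Hp_convex.isPreconnected.image _ (by fun_prop)

section
variable {Φ : ℂ → ℂ} {P V : Set ℂ} {A : ℂ → ℂ} {M : ℕ} {a : ℂ} {δ : ℝ} {ψ : ℂ → ℂ}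

lemma Tr.lim (G : Good Φ P V A M) (hδ : 0 < δ) (T : Tr Φ P a δ ψ) :
    Tendsto (fun ζ => ‖ψ ζ‖) (comap Complex.re atTop) atTop ∨
      ∃ x, x ∉ P ∧ Φ x = a ∧ Tendsto ψ (comap Complex.re atTop) (𝓝 x) := by
  have hne : (comap Complex.re atTop).NeBot := by
    refine comap_neBot fun t ht => ?_
    obtain ⟨c, hc⟩ := mem_atTop_sets.1 ht
    exact ⟨c, by simpa using hc c le_rfl⟩
  have hH : ∀ᶠ ζ : ℂ in comap Complex.re atTop, ζ ∈ Hp :=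
    tendsto_comap.eventually (eventually_gt_atTop (0:ℝ))
  refine G.lim_gen (fun S hS => ?_) (hH.mono fun ζ hζ => (T.lift ζ hζ).1.1) ?_
  · obtain ⟨t, ht, hts⟩ := hS
    obtain ⟨c, hc⟩ := mem_atTop_sets.1 ht
    refine ⟨{ζ | max c 0 < ζ.re}, preimage_mem_comap (Ioi_mem_atTop _), fun ζ hζ => hts ?_, ?_⟩
    · exact hc _ ((le_max_left _ _).trans (le_of_lt hζ))
    · exact (convex_halfSpace_re_gt _).isPreconnected.image _
        (T.diff.continuousOn.mono fun ζ (hζ : max c 0 < ζ.re) => mem_Hp.2 ((le_max_right _ _).trans_lt hζ))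
  · rw [tendsto_iff_norm_sub_tendsto_zero]
    have h1 : Tendsto (fun ζ : ℂ => δ * Real.exp (-ζ.re)) (comap Complex.re atTop) (𝓝 (δ * 0)) :=
      (Real.tendsto_exp_neg_atTop_nhds_zero.comp tendsto_comap).const_mul δ
    rw [mul_zero] at h1
    exact h1.congr' (hH.mono fun ζ hζ => (T.norm hδ hζ).symm)

lemma Tr.dich (G : Good Φ P V A M) (hδ : 0 < δ) (hV : ∀ v ∈ V, v ≠ a → δ ≤ ‖v - a‖)
    (T : Tr Φ P a δ ψ) :
    (InjOn ψ Hp ∧ Tendsto (fun ζ => ‖ψ ζ‖) (comap Complex.re atTop) atTop) ∨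
    ∃ m : ℕ, 0 < m ∧ ∃ Ψ : ℂ → ℂ, DifferentiableOn ℂ Ψ (ball 0 1) ∧ InjOn Ψ (ball 0 1) ∧
      (∀ ζ ∈ Hp, Ψ (Complex.exp (-ζ / m)) = ψ ζ) ∧ Ψ 0 ∉ P ∧
      ∀ η ∈ ball (0:ℂ) 1, Φ (Ψ η) = a + δ * η ^ m := by
  classical
  have hX := T.lim G hδ
  have hsh : ∀ ζ ∈ Hp, ∀ k : ℤ, ζ + k * (2 * Real.pi * Complex.I) ∈ Hp := by
    intro ζ hζ k
    have : (ζ + k * (2 * Real.pi * Complex.I)).re = ζ.re := by simp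
    rw [mem_Hp, this]; exact hζ
  by_cases hinj : InjOn ψ Hp
  · rcases hX with h | ⟨x, hxP, hxa, hx⟩
    · exact Or.inl ⟨hinj, h⟩
    exfalso
    obtain ⟨-, hinv, -⟩ := inj_basic Hp_open T.diff hinj
    have h1 : ∀ᶠ z in 𝓝[≠] x, z ∉ P ∧ Φ z ≠ a ∧ ‖Φ z - a‖ < δ := by
      have h2 : ∀ᶠ z in 𝓝[≠] x, ‖Φ z - a‖ < δ := by
        have := ((G.mero.2.1 x hxP).continuousAt.sub_const a).norm
        exact nhdsWithin_le_nhds (this.eventually_lt_const (by simpa [hxa] using hδ))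
      filter_upwards [G.ev x a, h2] with z h3 h4 using ⟨h3.1, h3.2, h4⟩
    obtain ⟨r, hr, hball⟩ := Metric.eventually_nhds_iff_ball.1 (eventually_nhdsWithin_iff.1 h1)
    obtain ⟨ζ0, h5, h6⟩ : ∃ ζ, ζ ∈ Hp ∧ ψ ζ ∈ ball x r := by
      have hne : (comap Complex.re atTop).NeBot := by
        refine comap_neBot fun t ht => ?_
        obtain ⟨c, hc⟩ := mem_atTop_sets.1 ht
        exact ⟨c, by simpa using hc c le_rfl⟩
      have hH : ∀ᶠ ζ : ℂ in comap Complex.re atTop, ζ ∈ Hp :=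
        tendsto_comap.eventually (eventually_gt_atTop (0:ℝ))
      exact (hH.and (hx.eventually (ball_mem_nhds x hr))).exists
    have hψx : ψ ζ0 ≠ x := fun h => by
      have := T.norm hδ h5
      rw [h, hxa, sub_self, norm_zero] at this
      exact (by positivity : 0 < δ * Real.exp (-ζ0.re)).ne this
    have hsub := T.stay G hδ hV (punct_conn x hr) (fun z hz => hball z hz.1 hz.2) ⟨h6, hψx⟩
      ⟨ζ0, h5, rfl⟩
    have hnear : ball x r \ {x} ∈ 𝓝[≠] x := sdiff_mem_nhdsWithin_compl (ball_mem_nhds x hr) _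
    set g := Function.invFunOn ψ Hp
    have hg : ∀ z ∈ ball x r \ {x}, g z ∈ Hp ∧ ψ (g z) = z := fun z hz =>
      ⟨Function.invFunOn_mem (hsub hz), Function.invFunOn_eq (hsub hz)⟩
    obtain ⟨B, hB⟩ := blow (g := g) (x := x) (by
        filter_upwards [hnear] with z hz
        exact hinv.differentiableAt ((T.isOpen hδ G.mero).mem_nhds (hsub hz))) (by
        have h2 : Tendsto (fun z => -Real.log (‖Φ z - a‖ / δ)) (𝓝[≠] x) atTop := by
          rw [tendsto_neg_atTop_iff]
          refine Real.tendsto_log_nhdsGT_zero.comp (tendsto_nhdsWithin_iff.2 ⟨?_, ?_⟩)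
          · have := (((G.mero.2.1 x hxP).continuousAt.sub_const a).norm.div_const δ)
            simp only [hxa, sub_self, norm_zero, zero_div] at this
            exact this.mono_left nhdsWithin_le_nhds
          · filter_upwards [h1] with z hz
            exact div_pos (norm_pos_iff.2 (sub_ne_zero.2 hz.2.1)) hδ
        refine tendsto_atTop_mono' _ ?_ h2
        filter_upwards [hnear] with z hz
        obtain ⟨h3, h4⟩ := hg z hz
        have := T.norm hδ h3
        rw [h4] at this
        rw [this, mul_div_cancel_left₀ _ hδ.ne', Real.log_exp, neg_neg]
        exact Complex.re_le_norm _) hnear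
    obtain ⟨z, hz, hgz⟩ := hB (-((|B| + 1 : ℝ) : ℂ)) (by
      rw [norm_neg, Complex.norm_real, Real.norm_of_nonneg (by positivity)]
      exact (le_abs_self B).trans_lt (lt_add_one _))
    have h3 : 0 < (g z).re := (hg z hz).1
    rw [hgz, Complex.neg_re, Complex.ofReal_re] at h3
    have := abs_nonneg B
    linarith
  · right
    let Per : AddSubgroup ℤ :=
      { carrier := {k | ∀ ζ ∈ Hp, ψ (ζ + k * (2 * Real.pi * Complex.I)) = ψ ζ}
        zero_mem' := fun ζ _ => by simp
        add_mem' := fun {k l} hk hl ζ hζ => by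
          rw [← hk ζ hζ, ← hl _ (hsh ζ hζ k)]; congr 1; push_cast; ring
        neg_mem' := fun {k} hk ζ hζ => by
          rw [← hk _ (hsh ζ hζ (-k))]; congr 1; push_cast; ring }
    have hPer : ∀ {ζ1 ζ2 : ℂ}, ζ1 ∈ Hp → ζ2 ∈ Hp → ψ ζ1 = ψ ζ2 →
        ∃ k ∈ Per, ζ2 = ζ1 + k * (2 * Real.pi * Complex.I) := by
      intro ζ1 ζ2 h1 h2 h
      obtain ⟨k, hk1, hk2⟩ := T.meet hδ G.mero T h1 h2 h
      exact ⟨k, fun ζ hζ => (hk2 ζ hζ).symm, hk1⟩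
    obtain ⟨g, hg⟩ := Int.subgroup_cyclic Per
    have hmemP : ∀ k : ℤ, k ∈ Per ↔ ∃ n : ℤ, n * g = k := fun k => by
      rw [hg, AddSubgroup.mem_closure_singleton]; simp
    have hg0 : g ≠ 0 := by
      rintro rfl
      refine hinj fun ζ1 h1 ζ2 h2 h => ?_
      obtain ⟨k, hk, hk2⟩ := hPer h1 h2 h
      obtain ⟨n, hn⟩ := (hmemP k).1 hk
      rw [hk2, ← hn]; simp
    set m := g.natAbs with hmdef
    have hm : 0 < m := Int.natAbs_pos.2 hg0
    have hmC : (m:ℂ) ≠ 0 := by exact_mod_cast hm.ne'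
    have hmP : (m : ℤ) ∈ Per := by
      rw [hmemP]
      rcases Int.natAbs_eq g with h | h
      · exact ⟨1, by rw [one_mul]; exact h⟩
      · exact ⟨-1, by rw [neg_one_mul, hmdef, h]; simp⟩
    obtain ⟨Ψ0, hΨd, hΨ⟩ := cusp hm T.diff (fun ζ hζ => by simpa using hmP ζ hζ)
    have hΨ' : ∀ η : ℂ, η ≠ 0 → ‖η‖ < 1 → ∃ ζ ∈ Hp, Complex.exp (-ζ / m) = η ∧ Ψ0 η = ψ ζ := by
      intro η h0 h1
      obtain ⟨h2, h3⟩ := exp_surj hm h0 h1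
      exact ⟨_, h2, h3, by rw [← hΨ _ h2, h3]⟩
    have hΦΨ : ∀ η : ℂ, η ≠ 0 → ‖η‖ < 1 → Φ (Ψ0 η) = a + δ * η ^ m := by
      intro η h0 h1
      obtain ⟨ζ, h2, h3, h4⟩ := hΨ' η h0 h1
      rw [h4, (T.lift ζ h2).2, ← h3, ← Complex.exp_nat_mul, mul_div_cancel₀ _ hmC]
    have hnear : ball (0:ℂ) 1 \ {0} ∈ 𝓝[≠] (0:ℂ) := sdiff_mem_nhdsWithin_compl (ball_mem_nhds 0 one_pos) _
    have hop : IsOpen (ball (0:ℂ) 1 \ {0}) := isOpen_ball.sdiff isClosed_singleton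
    rcases hX with h | ⟨x, hxP, hxa, hx⟩
    · exfalso
      have h1 := cusp_tendsto hm hΨ (g := fun z => ‖z‖) h
      obtain ⟨B, hB⟩ := blow (by
        filter_upwards [hnear] with η hη using hΨd.differentiableAt (hop.mem_nhds hη)) h1 hnear
      refine G.notrat (rational_of_bdd G.mero (B := B) (C := ‖a‖ + δ) fun z hz _ => ?_)
      obtain ⟨η, hη, rfl⟩ := hB z hz
      have hη1 : ‖η‖ < 1 := by simpa using hη.1
      rw [hΦΨ η hη.2 hη1]
      refine (norm_add_le _ _).trans (add_le_add_right ?_ _)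
      rw [norm_mul, Complex.norm_real, Real.norm_of_nonneg hδ.le, norm_pow]
      exact mul_le_of_le_one_right hδ.le (pow_le_one₀ (norm_nonneg _) hη1.le)
    · have h1 : Tendsto Ψ0 (𝓝[≠] 0) (𝓝 x) := cusp_tendsto hm hΨ (g := id) hx
      set Ψ := Function.update Ψ0 0 x with hΨdef
      have hΨne : ∀ η, η ≠ 0 → Ψ η = Ψ0 η := fun η h => Function.update_of_ne h _ _
      have hΨ0 : Ψ 0 = x := Function.update_self _ _ _
      have hΨev : ∀ η, η ≠ 0 → Ψ =ᶠ[𝓝 η] Ψ0 := fun η h => by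
        filter_upwards [isOpen_ne.mem_nhds h] with w hw using hΨne w hw
      have hd : ∀ η ∈ ball (0:ℂ) 1, η ≠ 0 → DifferentiableAt ℂ Ψ η := fun η hη h0 =>
        (hΨd.differentiableAt (hop.mem_nhds ⟨hη, h0⟩)).congr_of_eventuallyEq (hΨev η h0)
      refine ⟨m, hm, Ψ, fun η hη => ?_, ?_, fun ζ hζ => ?_, by rwa [hΨ0], fun η hη => ?_⟩
      · by_cases h0 : η = 0
        · subst h0
          refine (Complex.analyticAt_of_differentiable_on_punctured_nhds_of_continuousAt ?_
            ?_).differentiableAt.differentiableWithinAt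
          · filter_upwards [hnear] with η hη using hd η hη.1 hη.2
          · rw [continuousAt_iff_punctured_nhds, hΨ0]
            refine h1.congr' ?_
            filter_upwards [self_mem_nhdsWithin] with η hη using (hΨne η hη).symm
        · exact (hd η hη h0).differentiableWithinAt
      · have hx0 : ∀ η ∈ ball (0:ℂ) 1, η ≠ 0 → Ψ η ≠ x := by
          intro η hη h0 h
          have := hΦΨ η h0 (by simpa using hη)
          rw [← hΨne η h0, h, hxa] at this
          have h2 : (δ:ℂ) * η ^ m = 0 := by linear_combination -this
          simp [hδ.ne', h0] at h2
        intro η1 hη1 η2 hη2 h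
        by_cases h01 : η1 = 0
        · by_contra hne
          rw [h01, hΨ0] at h
          exact hx0 η2 hη2 (fun h => hne (by rw [h01, h])) h.symm
        by_cases h02 : η2 = 0
        · rw [h02, hΨ0] at h
          exact absurd h (hx0 η1 hη1 h01)
        rw [hΨne _ h01, hΨne _ h02] at h
        obtain ⟨ζ1, h1, h2, h3⟩ := hΨ' η1 h01 (by simpa using hη1)
        obtain ⟨ζ2, h4, h5, h6⟩ := hΨ' η2 h02 (by simpa using hη2)
        rw [h3, h6] at h
        obtain ⟨k, hk, hk2⟩ := hPer h1 h4 h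
        obtain ⟨n, hn⟩ := (hmemP k).1 hk
        obtain ⟨n', hn'⟩ : ∃ n' : ℤ, k = n' * m := by
          rcases Int.natAbs_eq g with h | h
          · exact ⟨n, by rw [← hn, hmdef]; congr 1⟩
          · exact ⟨-n, by rw [← hn, h]; simp [hmdef]⟩
        rw [← h2, ← h5, hk2, hn']
        have : -(ζ1 + ((n' * m : ℤ) : ℂ) * (2 * Real.pi * Complex.I)) / m =
            -ζ1 / m + (-n' : ℤ) * (2 * Real.pi * Complex.I) := by push_cast; field_simp; ring
        rw [this, Complex.exp_add, Complex.exp_int_mul_two_pi_mul_I, mul_one]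
      · rw [hΨne _ (Complex.exp_ne_zero _), hΨ ζ hζ]
      · by_cases h0 : η = 0
        · rw [h0, hΨ0, hxa]; simp [hm.ne']
        · rw [hΨne _ h0, hΦΨ η h0 (by simpa using hη)]
end

end SW

namespace SW
open Metric

section
variable {Φ : ℂ → ℂ} {P V : Set ℂ} {A : ℂ → ℂ} {M : ℕ} {a : ℂ} {δ : ℝ} {ψ : ℂ → ℂ}

lemma Good.no_crit (G : Good Φ P V A M) {x : ℂ} (hx : x ∉ P) (h0 : deriv Φ x = 0) {C : ℝ}
    (hb : ∀ᶠ z in 𝓝 x, ‖A z‖ ≤ C) : False := by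
  have hD : AnalyticAt ℂ (deriv Φ) x := (G.mero.2.1 x hx).deriv
  have ht : analyticOrderAt (deriv Φ) x ≠ ⊤ := fun h =>
    deriv_notev G.mero G.notrat hx (analyticOrderAt_eq_top.1 h)
  obtain ⟨g, hg, hg0, hev⟩ := hD.analyticOrderAt_ne_top.1 ht
  set n := analyticOrderNatAt (deriv Φ) x with hn
  have hn1 : n ≠ 0 := fun h => by
    have := hev.self_of_nhds
    simp [h] at this
    exact hg0 (this ▸ h0)
  set g1 : ℂ → ℂ := fun z => n * g z + (z - x) * deriv g z with hg1
  set g2 : ℂ → ℂ := fun z => n * g1 z + (z - x) * deriv g1 z - g1 z with hg2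
  have hga1 : AnalyticAt ℂ g1 x := (analyticAt_const.mul hg).add
    ((analyticAt_id.sub analyticAt_const).mul hg.deriv)
  have hpow : ∀ z : ℂ, HasDerivAt (fun w : ℂ => (w - x) ^ n) (n * (z - x) ^ (n - 1)) z := fun z => by
    have h := ((hasDerivAt_id z).sub_const x).pow n
    exact h.congr_deriv (by simp)
  have hmul : ∀ z : ℂ, (z - x) * (z - x) ^ (n - 1) = (z - x) ^ n := fun z => by
    rw [← pow_succ', Nat.sub_add_cancel (Nat.pos_of_ne_zero hn1)]
  have e1 : ∀ᶠ z in 𝓝 x, (z - x) * deriv (deriv Φ) z = (z - x) ^ n * g1 z := by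
    filter_upwards [hev.eventually_nhds, hg.eventually_analyticAt] with z hz hgz
    have h1 := (hpow z).mul hgz.differentiableAt.hasDerivAt
    rw [(show deriv Φ =ᶠ[𝓝 z] fun w => (w - x) ^ n * g w from hz).deriv_eq]
    have h1' : deriv (fun w => (w - x) ^ n * g w) z = _ := h1.deriv
    rw [h1', ← hmul z, hg1]
    ring
  have e2 : ∀ᶠ z in 𝓝 x, (z - x) ^ 2 * deriv (deriv (deriv Φ)) z = (z - x) ^ n * g2 z := by
    filter_upwards [e1.eventually_nhds, hga1.eventually_analyticAt, hD.deriv.eventually_analyticAt]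
      with z hz hgz hDz
    have h1 := ((hpow z).mul hgz.differentiableAt.hasDerivAt).deriv
    have h2 := (((hasDerivAt_id z).sub_const x).mul hDz.differentiableAt.hasDerivAt).deriv
    have h3 := (show (fun w => (w - x) * deriv (deriv Φ) w) =ᶠ[𝓝 z] fun w => (w - x) ^ n * g1 w
      from hz).deriv_eq
    have h4 := hz.self_of_nhds
    simp only [id] at h2
    rw [show deriv (fun w => (w - x) * deriv (deriv Φ) w) z = _ from h2,
      show deriv (fun w => (w - x) ^ n * g1 w) z = _ from h1] at h3
    have h5 : (z - x) ^ 2 * deriv (deriv (deriv Φ)) z = (z - x) * (1 * deriv (deriv Φ) z +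
      (z - x) * deriv (deriv (deriv Φ)) z) - (z - x) * deriv (deriv Φ) z := by ring
    rw [h5, h3, h4]
    simp only [hg2]
    rw [← hmul z]; ring
  have hlim : Tendsto (fun z => g2 z / g z - 3 / 2 * (g1 z / g z) ^ 2 - 2 * ((z - x) ^ 2 * A z)) (𝓝[≠] x)
      (𝓝 (g2 x / g x - 3 / 2 * (g1 x / g x) ^ 2 - 2 * 0)) := by
    have hc2 : ContinuousAt g2 x := (((analyticAt_const.mul hga1).add
      ((analyticAt_id.sub analyticAt_const).mul hga1.deriv)).sub hga1).continuousAt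
    have hA0 : Tendsto (fun z => (z - x) ^ 2 * A z) (𝓝 x) (𝓝 0) := by
      refine squeeze_zero_norm' (a := fun z => ‖z - x‖ ^ 2 * C) ?_ ?_
      · filter_upwards [hb] with z hz
        rw [norm_mul, norm_pow]; gcongr
      · have : Continuous fun z => ‖z - x‖ ^ 2 * C := by fun_prop
        simpa using this.tendsto x
    have h3 : ContinuousAt (fun z => g2 z / g z - 3 / 2 * (g1 z / g z) ^ 2) x :=
      (hc2.div hg.continuousAt hg0).sub (((hga1.continuousAt.div hg.continuousAt hg0).pow 2).const_mul _)
    exact (h3.tendsto.sub (hA0.const_mul 2)).mono_left nhdsWithin_le_nhds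
  have hz : ∀ᶠ z in 𝓝[≠] x, g2 z / g z - 3 / 2 * (g1 z / g z) ^ 2 - 2 * ((z - x) ^ 2 * A z) = 0 := by
    have hPo : ∀ᶠ z in 𝓝 x, z ∉ P := (lf_isClosed G.mero.1).isOpen_compl.mem_nhds hx
    filter_upwards [nhdsWithin_le_nhds e1, nhdsWithin_le_nhds e2, nhdsWithin_le_nhds hev,
      nhdsWithin_le_nhds hPo, nhdsWithin_le_nhds (hg.continuousAt.eventually_ne hg0),
      self_mem_nhdsWithin] with z h1 h2 h3 h4 h5 h6
    have h6' : z - x ≠ 0 := sub_ne_zero.2 h6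
    rw [smul_eq_mul] at h3
    have h7 : deriv Φ z ≠ 0 := by rw [h3]; exact mul_ne_zero (pow_ne_zero _ h6') h5
    have h8 := G.schw z h4 h7
    have hp := pow_ne_zero n h6'
    have h9 : deriv (deriv Φ) z = (z - x) ^ n * g1 z / (z - x) := by rw [← h1]; field_simp
    have h10 : deriv (deriv (deriv Φ)) z = (z - x) ^ n * g2 z / (z - x) ^ 2 := by rw [← h2]; field_simp
    unfold schwarzian at h8
    rw [h9, h10, h3] at h8
    have : 2 * ((z - x) ^ 2 * A z) = (z - x) ^ 2 * (2 * A z) := by ring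
    rw [this, ← h8]
    field_simp
    ring
  have := tendsto_nhds_unique_of_eventuallyEq hlim tendsto_const_nhds hz
  simp only [hg1, hg2, sub_self, zero_mul, add_zero, mul_zero, sub_zero] at this
  field_simp at this
  have h4 : ((n:ℂ) * (n + 2)) = 0 := by linear_combination (-1 : ℂ) * this
  have h5 : (n * (n + 2) : ℕ) = 0 := by exact_mod_cast h4
  simp [hn1] at h5

/-- constant depth -/
def LL (M : ℕ) : ℝ := M * (4 + 16 * KS)

lemma Good.obs_dich (G : Good Φ P V A M) (hδ : 0 < δ) (hV : ∀ v ∈ V, v ≠ a → δ ≤ ‖v - a‖)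
    {d : ℝ} {p : ℂ} (hd : d < δ) (hO : Obs Φ P a p d) :
    ∃ ψ, Tr Φ P a δ ψ ∧ ∃ ζ ∈ Hp, ψ ζ = p ∧ δ * Real.exp (-ζ.re) ≤ d ∧
    ((InjOn ψ Hp ∧ Tendsto (fun ζ => ‖ψ ζ‖) (comap Complex.re atTop) atTop) ∨
    ∃ m : ℕ, 2 ≤ m ∧ m ≤ M ∧ ∃ Ψ : ℂ → ℂ, DifferentiableOn ℂ Ψ (ball 0 1) ∧ InjOn Ψ (ball 0 1) ∧
      (∀ ζ ∈ Hp, Ψ (Complex.exp (-ζ / m)) = ψ ζ) ∧ Ψ 0 ∉ P ∧ deriv Φ (Ψ 0) = 0 ∧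
      ∀ η ∈ ball (0:ℂ) 1, Φ (Ψ η) = a + δ * η ^ m) := by
  have hδ' : (δ:ℂ) ≠ 0 := by exact_mod_cast hδ.ne'
  obtain ⟨z, hzc, hz0, hz, hza, hzn⟩ := hO
  obtain ⟨q1, q2, q3⟩ := hz 0 ⟨le_rfl, one_pos⟩
  rw [hz0] at q1 q2 q3
  obtain ⟨ψ, T, ζ, hζ, hψζ⟩ := G.tract hδ hV q1 q3 (q2.trans_lt hd)
  refine ⟨ψ, T, ζ, hζ, hψζ, by rw [← T.norm hδ hζ, hψζ]; exact q2, ?_⟩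
  rcases T.dich G hδ hV with h | ⟨m, hm, Ψ, hΨd, hΨi, hΨ, hΨP, hΨΦ⟩
  · exact Or.inl h
  right
  have h00 : (0:ℂ) ∈ ball (0:ℂ) 1 := by simp
  have hΨa : AnalyticAt ℂ Ψ 0 := hΨd.analyticAt (isOpen_ball.mem_nhds h00)
  have hΨ' := (inj_basic isOpen_ball hΨd hΨi).2.2 0 h00
  have hder : ∀ᶠ η in 𝓝 (0:ℂ), deriv Φ (Ψ η) * deriv Ψ η = δ * m * η ^ (m - 1) := by
    have hPo : ∀ᶠ η in 𝓝 (0:ℂ), Ψ η ∉ P :=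
      hΨa.continuousAt ((lf_isClosed G.mero.1).isOpen_compl.mem_nhds hΨP)
    filter_upwards [isOpen_ball.mem_nhds h00, hPo] with η hη hηP
    have h1 : HasDerivAt (fun x => Φ (Ψ x)) (deriv Φ (Ψ η) * deriv Ψ η) η :=
      (G.mero.2.1 _ hηP).differentiableAt.hasDerivAt.comp η
        (hΨd.differentiableAt (isOpen_ball.mem_nhds hη)).hasDerivAt
    have h2 : HasDerivAt (fun x : ℂ => a + δ * x ^ m) (δ * m * η ^ (m - 1)) η :=
      (((hasDerivAt_pow m η).const_mul (δ:ℂ)).const_add a).congr_deriv (by ring)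
    refine (h2.congr_of_eventuallyEq ?_).unique h1 |>.symm
    filter_upwards [isOpen_ball.mem_nhds hη] with x hx using hΨΦ x hx
  have hm1 : m ≠ 1 := by
    rintro rfl
    refine hzn ⟨Ψ 0, ⟨hΨP, fun h => ?_⟩, ?_⟩
    · have := hder.self_of_nhds
      simp [h] at this
      exact hδ' this.symm
    · have hS : z '' Ico 0 1 ⊆ ψ '' Hp := T.stay G hδ hV (isPreconnected_Ico.image _ hzc)
        (by rintro _ ⟨t, ht, rfl⟩; exact ⟨(hz t ht).1.1, (hz t ht).2.2, (hz t ht).2.1.trans_lt hd⟩)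
        (z0 := p) ⟨0, ⟨le_rfl, one_pos⟩, hz0⟩ ⟨ζ, hζ, hψζ⟩
      have h1 : Tendsto (fun t => (Φ (z t) - a) / δ) (𝓝[<] 1) (𝓝 0) := by
        simpa using (hza.sub_const a).div_const (δ:ℂ)
      refine (hΨa.continuousAt.tendsto.comp h1).congr' ?_
      filter_upwards [Ico_mem_nhdsLT (one_pos : (0:ℝ) < 1)] with t ht
      obtain ⟨ξ, hξ, hξt⟩ := hS ⟨t, ht, rfl⟩
      have h2 := hΨ ξ hξ
      rw [Function.comp, ← hξt, (T.lift ξ hξ).2, ← h2]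
      congr 1
      field_simp
      simp
  have hm2 : 2 ≤ m := by omega
  have hc0 : deriv Φ (Ψ 0) = 0 := by
    have := hder.self_of_nhds
    rw [zero_pow (by omega), mul_zero] at this
    exact (mul_eq_zero.1 this).resolve_right hΨ'
  refine ⟨m, hm2, G.mult _ hΨP m hm2 ?_, Ψ, hΨd, hΨi, hΨ, hΨP, hc0, hΨΦ⟩
  have hD : AnalyticAt ℂ (deriv Φ) (Ψ 0) := (G.mero.2.1 _ hΨP).deriv
  have h1 : analyticOrderAt (fun η => deriv Φ (Ψ η) * deriv Ψ η) 0 = ((m - 1 : ℕ) : ℕ∞) := by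
    rw [analyticOrderAt_congr hder, AnalyticAt.analyticOrderAt_eq_natCast (by fun_prop)]
    exact ⟨fun _ => δ * m, analyticAt_const, by simp [hδ.ne', hm.ne'],
      Eventually.of_forall fun η => by simp [mul_comm]⟩
  have h2 : analyticOrderAt (fun η => deriv Φ (Ψ η) * deriv Ψ η) 0 =
      analyticOrderAt (deriv Φ ∘ Ψ) 0 + analyticOrderAt (deriv Ψ) 0 :=
    analyticOrderAt_mul (hD.comp hΨa) hΨa.deriv
  rw [hΨa.deriv.analyticOrderAt_eq_zero.2 hΨ', add_zero,
    analyticOrderAt_comp_of_deriv_ne_zero hΨa hΨ', h1] at h2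
  obtain ⟨g, hg, hg0, hev⟩ := hD.analyticOrderAt_eq_natCast.1 h2.symm
  exact ⟨by omega, g, hg, hg0, hev⟩

lemma Tr.schw (G : Good Φ P V A M) (hδ : 0 < δ) (T : Tr Φ P a δ ψ) {ζ : ℂ} (hζ : ζ ∈ Hp) :
    2 * A (ψ ζ) * deriv ψ ζ ^ 2 = -1 / 2 - schwarzian ψ ζ := by
  have hδ' : (δ:ℂ) ≠ 0 := by exact_mod_cast hδ.ne'
  obtain ⟨h1, h2⟩ := T.lift ζ hζ
  have h3 := schwarzian_comp (T.diff.analyticAt (Hp_open.mem_nhds hζ)) (G.mero.2.1 _ h1.1) h1.2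
    (T.deriv_ne hδ G.mero hζ)
  rw [G.schw _ h1.1 h1.2] at h3
  have h4 : (fun x => Φ (ψ x)) =ᶠ[𝓝 ζ] fun x => a + δ * Complex.exp (-1 * x) := by
    filter_upwards [Hp_open.mem_nhds hζ] with x hx
    rw [(T.lift x hx).2, neg_one_mul]
  rw [schwarzian_congr h4, schwarzian_exp a δ ζ hδ' (-1) (by simp)] at h3
  linear_combination -h3

lemma ball_re_sub {ζ : ℂ} : ball ζ ζ.re ⊆ Hp := fun x hx => by
  rw [mem_ball, dist_eq_norm] at hx
  have := (abs_le.1 (Complex.abs_re_le_norm (x - ζ))).1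
  rw [Complex.sub_re] at this
  rw [mem_Hp]; linarith

lemma Tr.sbound (T : Tr Φ P a δ ψ) (hi : InjOn ψ Hp) {ζ : ℂ} (hζ : ζ ∈ Hp) :
    ‖schwarzian ψ ζ‖ ≤ KS / ζ.re ^ 2 :=
  schwarz_bound hζ (T.diff.mono ball_re_sub) (hi.mono ball_re_sub)

lemma LL_ge (hM : 0 < M) : 4 + 16 * KS ≤ LL M := by
  have : (1:ℝ) ≤ M := by exact_mod_cast hM
  have := KS_pos
  unfold LL; nlinarith

lemma Good.deep (G : Good Φ P V A M) (hM : 0 < M) (hδ : 0 < δ) (hV : ∀ v ∈ V, v ≠ a → δ ≤ ‖v - a‖)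
    {d : ℝ} {p : ℂ} (hd : d ≤ δ * Real.exp (-LL M)) (hO : Obs Φ P a p d) :
    ‖deriv Φ p‖ ^ 2 ≤ 8 * (‖A p‖ * ‖Φ p - a‖ ^ 2) ∧
    ((∃ x, x ∉ P ∧ deriv Φ x = 0 ∧ ‖x - p‖ * ‖deriv Φ p‖ ≤ 3 * K0 * M * ‖Φ p - a‖) ∨
     ∃ ψ, Tr Φ P a δ ψ ∧ ∃ ζ ∈ Hp, ψ ζ = p ∧ δ * Real.exp (-ζ.re) ≤ d ∧
      InjOn ψ Hp ∧ Tendsto (fun ζ => ‖ψ ζ‖) (comap Complex.re atTop) atTop) := by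
  have hKS := KS_pos
  have hK0 := K0_pos
  have hLL := LL_ge hM
  have hM1 : (1:ℝ) ≤ M := by exact_mod_cast hM
  have hδ' : (δ:ℂ) ≠ 0 := by exact_mod_cast hδ.ne'
  have hd' : d < δ := hd.trans_lt (by
    have : Real.exp (-LL M) < 1 := Real.exp_lt_one_iff.2 (by linarith)
    nlinarith)
  obtain ⟨ψ, T, ζ, hζ, hψζ, hζd, hcase⟩ := G.obs_dich hδ hV hd' hO
  have hre : LL M ≤ ζ.re := by
    have := le_of_mul_le_mul_left (hζd.trans hd) hδ
    rw [Real.exp_le_exp] at this; linarith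
  have hdm := T.dmul G.mero hζ
  have hpa : ‖Φ p - a‖ = ‖deriv Φ p‖ * ‖deriv ψ ζ‖ := by
    rw [← hψζ, (T.lift ζ hζ).2, add_sub_cancel_left, ← norm_mul, hdm, norm_neg]
  rcases hcase with hinj | ⟨m, hm2, hmM, Ψ, hΨd, hΨi, hΨ, hΨP, hc0, hΨΦ⟩
  · refine ⟨?_, Or.inr ⟨ψ, T, ζ, hζ, hψζ, hζd, hinj⟩⟩
    have h1 := T.schw G hδ hζ
    have h2 := T.sbound hinj.1 hζ
    have h3 : KS / ζ.re ^ 2 ≤ 1 / 4 := by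
      rw [div_le_iff₀ (by have := hζ; rw [mem_Hp] at this; positivity)]
      nlinarith
    have h4 : (1:ℝ) / 4 ≤ ‖2 * A (ψ ζ) * deriv ψ ζ ^ 2‖ := by
      rw [h1]
      have := norm_sub_norm_le (-1 / 2 : ℂ) (schwarzian ψ ζ)
      have h5 : ‖(-1 / 2 : ℂ)‖ = 1 / 2 := by norm_num
      linarith
    rw [norm_mul, norm_mul, norm_pow, hψζ, Complex.norm_two] at h4
    rw [hpa]
    nlinarith [mul_le_mul_of_nonneg_left h4 (sq_nonneg ‖deriv Φ p‖)]
  · set η := Complex.exp (-ζ / m) with hη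
    have hmpos : (0:ℝ) < m := by exact_mod_cast (by omega : 0 < m)
    have hmC : (m:ℂ) ≠ 0 := by exact_mod_cast hmpos.ne'
    have hη0 : η ≠ 0 := Complex.exp_ne_zero _
    have hηn : ‖η‖ ≤ 1 / (4 + 16 * KS) := by
      rw [hη, Complex.norm_exp]
      have h1 : (-ζ / m : ℂ).re = -(ζ.re / m) := by
        rw [neg_div, Complex.neg_re, Complex.div_natCast_re]
      have h2 : 4 + 16 * KS ≤ ζ.re / m := by
        rw [le_div_iff₀ hmpos]
        refine le_trans ?_ hre
        unfold LL
        have : (m:ℝ) ≤ M := by exact_mod_cast hmM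
        nlinarith
      rw [h1, Real.exp_neg, ← one_div]
      refine one_div_le_one_div_of_le (by positivity) (le_trans h2 ?_)
      linarith [Real.add_one_le_exp (ζ.re / m)]
    have hη4 : ‖η‖ ≤ 1 / 4 := hηn.trans (one_div_le_one_div_of_le (by norm_num) (by linarith))
    have hηb : η ∈ ball (0:ℂ) 1 := by simpa using by linarith
    have hbs : ball η (3 / 4) ⊆ ball (0:ℂ) 1 := ball_subset_ball' (by
      rw [dist_zero_right]; linarith)
    have hΨp : Ψ η = p := by rw [hη, hΨ ζ hζ, hψζ]
    have hpX : p ∈ XX Φ P := hψζ ▸ (T.lift ζ hζ).1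
    have hΨa : AnalyticAt ℂ Ψ η := hΨd.analyticAt (isOpen_ball.mem_nhds hηb)
    have hΨ' := (inj_basic isOpen_ball hΨd hΨi).2.2 η hηb
    have hevΨ : (fun x => Φ (Ψ x)) =ᶠ[𝓝 η] fun x => a + δ * x ^ m := by
      filter_upwards [isOpen_ball.mem_nhds hηb] with x hx using hΨΦ x hx
    have hder : deriv Φ p * deriv Ψ η * η = m * (Φ p - a) := by
      have h1 : HasDerivAt (fun x => Φ (Ψ x)) (deriv Φ (Ψ η) * deriv Ψ η) η :=
        (G.mero.2.1 _ (hΨp ▸ hpX.1)).differentiableAt.hasDerivAt.comp η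
          hΨa.differentiableAt.hasDerivAt
      have h2 : HasDerivAt (fun x : ℂ => a + δ * x ^ m) (δ * m * η ^ (m - 1)) η :=
        (((hasDerivAt_pow m η).const_mul (δ:ℂ)).const_add a).congr_deriv (by ring)
      have h3 := (h2.congr_of_eventuallyEq hevΨ).unique h1
      rw [hΨp] at h3
      have h5 := hΨΦ η hηb
      rw [hΨp] at h5
      have h4 : η ^ (m - 1) * η = η ^ m := by rw [← pow_succ, Nat.sub_add_cancel (by omega)]
      rw [← h3, h5, mul_assoc, h4]; ring
    have hdn : ‖deriv Φ p‖ * (‖deriv Ψ η‖ * ‖η‖) = m * ‖Φ p - a‖ := by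
      have := congrArg norm hder
      rw [norm_mul, norm_mul, norm_mul, Complex.norm_natCast] at this
      linarith
    constructor
    · have h1 := schwarzian_comp hΨa (G.mero.2.1 _ (hΨp ▸ hpX.1)) (by rw [hΨp]; exact hpX.2) hΨ'
      rw [schwarzian_congr hevΨ, schwarzian_pow a δ η hδ' hη0 m (by omega), hΨp,
        G.schw p hpX.1 hpX.2] at h1
      have h2 := schwarz_bound (by norm_num : (0:ℝ) < 3 / 4) (hΨd.mono hbs) (hΨi.mono hbs)
      have h3 : 2 * A p * (deriv Ψ η * η) ^ 2 = (1 - (m:ℂ) ^ 2) / 2 - η ^ 2 * schwarzian Ψ η := by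
        have : (1 - (m:ℂ) ^ 2) / 2 = η ^ 2 * ((1 - (m:ℂ) ^ 2) / (2 * η ^ 2)) := by field_simp
        rw [this, h1]; ring
      have h4 : ‖η ^ 2 * schwarzian Ψ η‖ ≤ 1 / 8 := by
        rw [norm_mul, norm_pow]
        have h5 : ‖η‖ * (4 + 16 * KS) ≤ 1 := by
          rwa [le_div_iff₀ (by positivity)] at hηn
        have h6 : ‖schwarzian Ψ η‖ ≤ 2 * KS := h2.trans (by
          rw [div_le_iff₀ (by norm_num)]; nlinarith)
        have h7 : ‖η‖ ^ 2 ≤ 1 / 4 * ‖η‖ := by nlinarith [norm_nonneg η]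
        have h8 : ‖η‖ * ‖schwarzian Ψ η‖ ≤ ‖η‖ * (2 * KS) := by gcongr
        nlinarith [norm_nonneg (schwarzian Ψ η), norm_nonneg η]
      have h5 : ‖(1 - (m:ℂ) ^ 2) / 2‖ = ((m:ℝ) ^ 2 - 1) / 2 := by
        have : (1 - (m:ℂ) ^ 2) / 2 = (((1 - (m:ℝ) ^ 2) / 2 : ℝ) : ℂ) := by push_cast; ring
        have hm2' : (2:ℝ) ≤ m := by exact_mod_cast hm2
        rw [this, Complex.norm_real, Real.norm_of_nonpos (by nlinarith)]; ring
      have h6 := norm_sub_norm_le ((1 - (m:ℂ) ^ 2) / 2) (η ^ 2 * schwarzian Ψ η)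
      rw [← h3, h5, norm_mul (2 * A p), norm_mul 2, norm_pow (deriv Ψ η * η), norm_mul (deriv Ψ η), Complex.norm_two] at h6
      have hm2' : (2:ℝ) ≤ m := by exact_mod_cast hm2
      have h7 : (m:ℝ) ^ 2 / 4 ≤ 2 * ‖A p‖ * (‖deriv Ψ η‖ * ‖η‖) ^ 2 := by nlinarith
      have h8 := mul_le_mul_of_nonneg_left h7 (sq_nonneg ‖deriv Φ p‖)
      have h9 : ‖deriv Φ p‖ ^ 2 * (2 * ‖A p‖ * (‖deriv Ψ η‖ * ‖η‖) ^ 2) =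
          2 * ‖A p‖ * (m * ‖Φ p - a‖) ^ 2 := by rw [← hdn]; ring
      rw [h9] at h8
      have h10 : (m:ℝ) ^ 2 * ‖deriv Φ p‖ ^ 2 ≤ (m:ℝ) ^ 2 * (8 * (‖A p‖ * ‖Φ p - a‖ ^ 2)) := by nlinarith
      exact le_of_mul_le_mul_left h10 (by positivity)
    · refine Or.inl ⟨Ψ 0, hΨP, hc0, ?_⟩
      have h1 := koebe_lin (by norm_num : (0:ℝ) < 3 / 4) (hΨd.mono hbs) (hΨi.mono hbs) (z := 0)
        (by rw [zero_sub, norm_neg]; linarith)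
      rw [zero_sub, norm_neg, hΨp] at h1
      have h2 := norm_le_norm_sub_add (Ψ 0 - p) (deriv Ψ η * -η)
      rw [norm_mul, norm_neg] at h2
      have h3 : ‖Ψ 0 - p‖ ≤ 3 * K0 * (‖deriv Ψ η‖ * ‖η‖) := by
        have h4 : 4 * K0 * ‖deriv Ψ η‖ / (3 / 4) * ‖η‖ ^ 2 ≤ 4 / 3 * K0 * (‖deriv Ψ η‖ * ‖η‖) := by
          have : ‖η‖ ^ 2 ≤ 1 / 4 * ‖η‖ := by nlinarith [norm_nonneg η]
          calc _ ≤ 4 * K0 * ‖deriv Ψ η‖ / (3 / 4) * (1 / 4 * ‖η‖) := by gcongr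
            _ = _ := by ring
        nlinarith [mul_nonneg (norm_nonneg (deriv Ψ η)) (norm_nonneg η)]
      have hmM' : (m:ℝ) ≤ M := by exact_mod_cast hmM
      calc _ ≤ 3 * K0 * (‖deriv Ψ η‖ * ‖η‖) * ‖deriv Φ p‖ := by gcongr
        _ = 3 * K0 * m * ‖Φ p - a‖ := by rw [mul_assoc (3 * K0) (m:ℝ), ← hdn]; ring
        _ ≤ _ := by gcongr
end

end SW

namespace SW
open Metric

structure TrI (Φ : ℂ → ℂ) (P : Set ℂ) (a : ℂ) (δ : ℝ) (ψ : ℂ → ℂ) : Prop extends Tr Φ P a δ ψ where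
  inj : InjOn ψ Hp
  lim : Tendsto (fun ζ => ‖ψ ζ‖) (comap Complex.re atTop) atTop

section
variable {Φ : ℂ → ℂ} {P V : Set ℂ} {A : ℂ → ℂ} {M : ℕ} {δ : ℝ}

lemma Good.tile0 (G : Good Φ P V A M) (hM : 0 < M) (hδ : 0 < δ)
    (hV : ∀ a ∈ V, ∀ v ∈ V, v ≠ a → δ ≤ ‖v - a‖) {d0 : ℝ} (hd0 : 0 < d0)
    (hd : d0 ≤ δ * Real.exp (-LL M)) :
    ∃ t0 : ℝ, 0 ≤ t0 ∧ t0 < 1 ∧ ∀ p ∈ XX Φ P, ‖Φ p‖ ≤ 2 → ∃ a ∈ V, ∃ g : ℂ → ℂ,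
      DifferentiableOn ℂ g (ball 0 1) ∧ InjOn g (ball 0 1) ∧ g 0 = p ∧
      (∀ x ∈ ball (0:ℂ) 1, A (g x) * deriv g x ^ 2 = - schwarzian g x / 2) ∧
      ∃ x' : ℂ, ‖x'‖ ≤ t0 ∧ 1 / 8 ≤ ‖A (g x')‖ * ‖deriv g x'‖ ^ 2 ∧
      ((∃ x, x ∉ P ∧ deriv Φ x = 0 ∧ ‖x - g x'‖ ≤ 3 * K0 * M * ‖deriv g x'‖) ∨
        ∃ ψ ζ, TrI Φ P a δ ψ ∧ ζ ∈ Hp ∧ ψ ζ = g x' ∧ δ * Real.exp (-ζ.re) ≤ d0) := by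
  obtain ⟨C, hC⟩ := G.fin.isBounded.exists_norm_le
  have hC2 : 0 < |C| + 2 := by positivity
  refine ⟨1 - min 1 (d0 / (|C| + 2)), by linarith [min_le_left 1 (d0 / (|C| + 2))],
    by linarith [lt_min one_pos (div_pos hd0 hC2)], fun p hp hp2 => ?_⟩
  obtain ⟨a, haV, hane, h, hhd, hh0, hh, hno⟩ := G.disc hp
  set w0 := Φ p
  set R := ‖a - w0‖ with hR
  have hRpos : 0 < R := norm_pos_iff.2 (sub_ne_zero.2 hane)
  have hRc : (R:ℂ) ≠ 0 := by exact_mod_cast hRpos.ne'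
  have hRC : R ≤ |C| + 2 := (norm_sub_le _ _).trans (add_le_add ((hC a haV).trans (le_abs_self C)) hp2)
  set u := 1 - min 1 (d0 / R) with hu
  have hu0 : 0 ≤ u := by linarith [min_le_left 1 (d0 / R)]
  have hu1 : u < 1 := by linarith [lt_min one_pos (div_pos hd0 hRpos)]
  have hut : u ≤ 1 - min 1 (d0 / (|C| + 2)) := by
    have : min 1 (d0 / (|C| + 2)) ≤ min 1 (d0 / R) :=
      min_le_min le_rfl (div_le_div_of_nonneg_left hd0.le hRpos hRC)
    linarith
  have hud : (1 - u) * R ≤ d0 := by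
    have : 1 - u ≤ d0 / R := by rw [hu]; linarith [min_le_right 1 (d0 / R)]
    calc _ ≤ d0 / R * R := by gcongr
      _ = d0 := by field_simp
  have hmap : ∀ x ∈ ball (0:ℂ) 1, w0 + R * x ∈ ball w0 R := fun x hx => by
    have : ‖x‖ < 1 := by simpa using hx
    rw [mem_ball, dist_eq_norm, add_sub_cancel_left, norm_mul, Complex.norm_real,
      Real.norm_of_nonneg hRpos.le]
    nlinarith
  set g : ℂ → ℂ := fun x => h (w0 + R * x) with hg
  have hgd : DifferentiableOn ℂ g (ball 0 1) := hhd.comp (by fun_prop) hmap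
  have hgΦ : ∀ x ∈ ball (0:ℂ) 1, g x ∈ XX Φ P ∧ Φ (g x) = w0 + R * x := fun x hx => hh _ (hmap x hx)
  have hgi : InjOn g (ball 0 1) := fun x hx y hy hxy => by
    have h1 := (hgΦ x hx).2
    rw [hxy, (hgΦ y hy).2] at h1
    exact (mul_left_cancel₀ hRc (add_left_cancel h1)).symm
  have hga : ∀ x ∈ ball (0:ℂ) 1, AnalyticAt ℂ g x := fun x hx => hgd.analyticAt (isOpen_ball.mem_nhds hx)
  have hgn := (inj_basic isOpen_ball hgd hgi).2.2
  have hev : ∀ x ∈ ball (0:ℂ) 1, (fun y => Φ (g y)) =ᶠ[𝓝 x] fun y => w0 + R * y := fun x hx => by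
    filter_upwards [isOpen_ball.mem_nhds hx] with y hy using (hgΦ y hy).2
  have hlin : ∀ x : ℂ, HasDerivAt (fun y : ℂ => w0 + R * y) R x := fun x =>
    (((hasDerivAt_id x).const_mul (R:ℂ)).const_add w0).congr_deriv (by simp)
  have hder : ∀ x ∈ ball (0:ℂ) 1, deriv Φ (g x) * deriv g x = R := fun x hx =>
    HasDerivAt.unique ((G.mero.2.1 _ (hgΦ x hx).1.1).differentiableAt.hasDerivAt.comp x
      (hga x hx).differentiableAt.hasDerivAt) ((hlin x).congr_of_eventuallyEq (hev x hx))
  set x' : ℂ := u * ((a - w0) / R) with hx'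
  have hx'n : ‖x'‖ = u := by
    rw [hx', norm_mul, norm_div, Complex.norm_real, Complex.norm_real, ← hR,
      Real.norm_of_nonneg hu0, Real.norm_of_nonneg hRpos.le, div_self hRpos.ne', mul_one]
  have hx'b : x' ∈ ball (0:ℂ) 1 := by simpa [hx'n] using hu1
  have hgx' : g x' = h (w0 + u * (a - w0)) := by
    rw [hg, hx']; simp only; congr 2; field_simp
  have hO := obs_of_disc hhd hh hane hno hu0 hu1
  rw [← hgx'] at hO
  have hO' : Obs Φ P a (g x') d0 := by
    obtain ⟨z, q1, q2, q3, q4⟩ := hO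
    exact ⟨z, q1, q2, fun t ht => ⟨(q3 t ht).1, (q3 t ht).2.1.trans hud, (q3 t ht).2.2⟩, q4⟩
  obtain ⟨hd1, hd2⟩ := G.deep hM hδ (hV a haV) hd hO'
  have hΦa : ‖Φ (g x') - a‖ ≤ R := by
    have : Φ (g x') - a = ((1 - u : ℝ) : ℂ) * (w0 - a) := by
      rw [(hgΦ x' hx'b).2, hx']; push_cast; field_simp; ring
    rw [this, norm_mul, Complex.norm_real, Real.norm_of_nonneg (by linarith), norm_sub_rev, ← hR]
    nlinarith
  have hdn : ‖deriv Φ (g x')‖ * ‖deriv g x'‖ = R := by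
    rw [← norm_mul, hder x' hx'b, Complex.norm_real, Real.norm_of_nonneg hRpos.le]
  have hΦ'pos : 0 < ‖deriv Φ (g x')‖ := norm_pos_iff.2 (hgΦ x' hx'b).1.2
  refine ⟨a, haV, g, hgd, hgi, by simp [hg, hh0], fun x hx => ?_, x', hx'n.le.trans hut, ?_, ?_⟩
  · have h1 := schwarzian_comp (hga x hx) (G.mero.2.1 _ (hgΦ x hx).1.1) (hgΦ x hx).1.2 (hgn x hx)
    rw [schwarzian_congr (hev x hx), G.schw _ (hgΦ x hx).1.1 (hgΦ x hx).1.2,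
      schwarzian_of_derivs (f1 := fun _ => (R:ℂ)) (f2 := fun _ => 0) (f3 := 0)
      (Eventually.of_forall hlin) (Eventually.of_forall fun y => hasDerivAt_const y _)
      (hasDerivAt_const x 0)] at h1
    simp only [zero_div] at h1
    linear_combination (-1/2 : ℂ) * h1
  · have h2 : ‖Φ (g x') - a‖ ^ 2 ≤ R ^ 2 := by gcongr
    have h3 : ‖deriv Φ (g x')‖ ^ 2 * (1 / 8) ≤ ‖deriv Φ (g x')‖ ^ 2 * (‖A (g x')‖ * ‖deriv g x'‖ ^ 2) := by
      have : ‖A (g x')‖ * ‖Φ (g x') - a‖ ^ 2 ≤ ‖A (g x')‖ * R ^ 2 := by gcongr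
      rw [← hdn] at this
      linarith
    exact le_of_mul_le_mul_left h3 (by positivity)
  · rcases hd2 with ⟨x, q1, q2, q3⟩ | ⟨ψ, q1, ζ, q2, q3, q4, q5, q6⟩
    · refine Or.inl ⟨x, q1, q2, le_of_mul_le_mul_right ?_ hΦ'pos⟩
      refine q3.trans ?_
      rw [mul_assoc _ ‖deriv g x'‖, mul_comm ‖deriv g x'‖, hdn]
      have := K0_pos
      gcongr
    · exact Or.inr ⟨ψ, ζ, ⟨q1, q5, q6⟩, q2, q3, q4⟩

lemma doubling {C t0 t1 c0 : ℝ} (hc0 : 0 < c0) (ht0 : 0 ≤ t0) (ht : t0 < t1) (ht1 : t1 < 1) (hC : 0 < C) :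
    ∃ D r0 : ℝ, 0 < D ∧ 0 < r0 ∧ ∀ f : ℂ → ℂ, DifferentiableOn ℂ f (ball 0 1) →
      (∀ x : ℂ, ‖x‖ ≤ t1 → ‖f x‖ ≤ C) → (∃ x : ℂ, ‖x‖ ≤ t0 ∧ c0 ≤ ‖f x‖) →
      ∀ r m : ℝ, 0 < r → r ≤ r0 → (∀ x : ℂ, ‖x‖ ≤ r → ‖f x‖ ≤ m) →
        0 < m ∧ ∀ x : ℂ, ‖x‖ ≤ 8 * r → ‖f x‖ ≤ D * m := by
  have ht1p : 0 < t1 := ht0.trans_lt ht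
  obtain ⟨n0, hn0⟩ : ∃ n0 : ℕ, C * (t0 / t1) ^ n0 * (1 - t0 / t1)⁻¹ < c0 / 2 := by
    have h1 := tendsto_pow_atTop_nhds_zero_of_lt_one (div_nonneg ht0 ht1p.le) ((div_lt_one ht1p).2 ht)
    have h2 := (h1.const_mul C).mul_const (1 - t0 / t1)⁻¹
    rw [mul_zero, zero_mul] at h2
    exact (h2.eventually (gt_mem_nhds (half_pos hc0))).exists
  have hn0' : (0:ℝ) < n0 + 1 := by positivity
  set c := c0 / (4 * (n0 + 1)) with hc
  have hcp : 0 < c := by positivity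
  refine ⟨8 ^ n0 * n0 + 2 * C * (8 / t1) ^ n0 / c + 1, t1 / 16, by positivity, by positivity,
    fun f hf hfC ⟨x1, hx1, hfx1⟩ r m hr hr0 hm => ?_⟩
  set b : ℕ → ℂ := fun n => (n.factorial : ℂ)⁻¹ * iteratedDeriv n f 0 with hb
  have hsum : ∀ x ∈ ball (0:ℂ) 1, HasSum (fun n => b n * x ^ n) (f x) := fun x hx => by
    have := Complex.hasSum_taylorSeries_on_ball (r := 1) (c := 0) (f := f) (by simpa using hf) (z := x) (by simpa using hx)
    simpa [hb, mul_comm, mul_left_comm, mul_assoc] using this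
  have hcau : ∀ (n : ℕ) (ρ K : ℝ), 0 < ρ → ρ < 1 → (∀ x : ℂ, ‖x‖ ≤ ρ → ‖f x‖ ≤ K) → ‖b n‖ * ρ ^ n ≤ K := by
    intro n ρ K hρ hρ1 hK
    have h1 := Complex.norm_iteratedDeriv_le_of_forall_mem_sphere_norm_le (c := 0) (R := ρ) (C := K) n hρ
      (hf.diffContOnCl_ball (closedBall_subset_ball hρ1))
      (fun z hz => hK z (by simpa using (mem_sphere.1 hz).le))
    rw [hb, norm_mul, norm_inv, Complex.norm_natCast]
    have hf0 : (0:ℝ) < n.factorial := by exact_mod_cast n.factorial_pos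
    rw [inv_mul_eq_div, div_mul_eq_mul_div, div_le_iff₀ hf0]
    rw [le_div_iff₀ (by positivity)] at h1
    linarith
  have htail : ∀ x : ℂ, ‖x‖ < t1 → ‖f x - ∑ n ∈ Finset.range n0, b n * x ^ n‖ ≤
      C * (‖x‖ / t1) ^ n0 * (1 - ‖x‖ / t1)⁻¹ := by
    intro x hx
    have h1 := (hasSum_nat_add_iff' n0).2 (hsum x (by simpa using hx.trans ht1))
    have h2 := (hasSum_geometric_of_lt_one (div_nonneg (norm_nonneg x) ht1p.le)
      ((div_lt_one ht1p).2 hx)).mul_left (C * (‖x‖ / t1) ^ n0)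
    refine h1.norm_le_of_bounded h2 fun n => ?_
    have h3 := hcau (n + n0) t1 C ht1p ht1 hfC
    rw [norm_mul, norm_pow, mul_assoc, ← pow_add, add_comm n0 n, div_pow, mul_div_assoc', le_div_iff₀ (by positivity)]
    nlinarith [pow_nonneg (norm_nonneg x) (n + n0)]
  have hr1 : r ≤ 1 := by linarith
  obtain ⟨n, hn, hbn⟩ : ∃ n < n0, c ≤ ‖b n‖ := by
    by_contra! hcon
    have h1 := htail x1 (hx1.trans_lt ht)
    have h2 : C * (‖x1‖ / t1) ^ n0 * (1 - ‖x1‖ / t1)⁻¹ ≤ C * (t0 / t1) ^ n0 * (1 - t0 / t1)⁻¹ := by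
      have : 0 < 1 - t0 / t1 := sub_pos.2 ((div_lt_one ht1p).2 ht)
      have h' : 0 ≤ (1 - ‖x1‖ / t1)⁻¹ := inv_nonneg.2 (sub_nonneg.2 ((div_le_one ht1p).2 (hx1.trans ht.le)))
      gcongr
    have h3 : ‖∑ n ∈ Finset.range n0, b n * x1 ^ n‖ ≤ n0 * c := by
      refine (norm_sum_le _ _).trans ?_
      rw [← nsmul_eq_mul, ← Finset.card_range n0, Finset.card_range]
      refine (Finset.sum_le_card_nsmul _ _ c fun i hi => ?_).trans (by rw [Finset.card_range])
      rw [norm_mul, norm_pow]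
      have : ‖x1‖ ^ i ≤ 1 := pow_le_one₀ (norm_nonneg _) (by linarith)
      nlinarith [hcon i (Finset.mem_range.1 hi), norm_nonneg (b i)]
    have h4 := norm_le_norm_sub_add (f x1) (∑ n ∈ Finset.range n0, b n * x1 ^ n)
    have h5 : n0 * c ≤ c0 / 4 := by
      rw [hc, mul_div_assoc', div_le_iff₀ (by positivity)]; nlinarith
    linarith
  have hmc : c * r ^ n0 ≤ m := by
    have h1 := hcau n r m hr (by linarith) hm
    have h2 : r ^ n0 ≤ r ^ n := pow_le_pow_of_le_one hr.le hr1 hn.le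
    nlinarith [pow_pos hr n0]
  have hmp : 0 < m := lt_of_lt_of_le (by positivity) hmc
  refine ⟨hmp, fun x hx => ?_⟩
  have hxt : ‖x‖ / t1 ≤ 1 / 2 := by rw [div_le_iff₀ ht1p]; linarith
  have h1 := htail x (by rw [div_le_iff₀ ht1p] at hxt; linarith)
  have h2 : C * (‖x‖ / t1) ^ n0 * (1 - ‖x‖ / t1)⁻¹ ≤ 2 * C * (8 / t1) ^ n0 / c * m := by
    have h3 : (1 - ‖x‖ / t1)⁻¹ ≤ 2 := by rw [inv_le_comm₀ (by linarith) two_pos]; linarith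
    have h' : 0 ≤ (1 - ‖x‖ / t1)⁻¹ := inv_nonneg.2 (by linarith)
    have h4 : (‖x‖ / t1) ^ n0 ≤ (8 / t1) ^ n0 * r ^ n0 := by
      rw [← mul_pow]
      refine pow_le_pow_left₀ (by positivity) ?_ _
      rw [div_mul_eq_mul_div]; gcongr
    calc _ ≤ C * ((8 / t1) ^ n0 * r ^ n0) * 2 := by gcongr
      _ = 2 * C * (8 / t1) ^ n0 / c * (c * r ^ n0) := by field_simp
      _ ≤ _ := by gcongr
  have h3 : ‖∑ n ∈ Finset.range n0, b n * x ^ n‖ ≤ n0 * (m * 8 ^ n0) := by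
    refine (norm_sum_le _ _).trans ?_
    rw [← nsmul_eq_mul]
    refine (Finset.sum_le_card_nsmul _ _ (m * 8 ^ n0) fun i hi => ?_).trans (by rw [Finset.card_range])
    rw [norm_mul, norm_pow]
    have h4 := hcau i r m hr (by linarith) hm
    calc _ ≤ ‖b i‖ * (8 * r) ^ i := by gcongr
      _ = ‖b i‖ * r ^ i * 8 ^ i := by rw [mul_pow]; ring
      _ ≤ m * 8 ^ n0 := by
        have := (Finset.mem_range.1 hi).le
        gcongr
        norm_num
  have h4 := norm_le_norm_sub_add (f x) (∑ n ∈ Finset.range n0, b n * x ^ n)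
  linarith
end

end SW

namespace SW
open Metric

def ee (z : ℂ) (ν : ℝ) (s : ℂ) : ℂ := z * Complex.exp (s / ν)

structure Box (A : ℂ → ℂ) (z : ℂ) (ν B ε : ℝ) (q0 : ℂ) : Prop where
  z0 : z ≠ 0
  ap : ∀ s : ℂ, ‖s‖ ≤ B → ‖A (ee z ν s) * ee z ν s ^ 2 / ν ^ 2 - q0 * Complex.exp s‖ ≤
    ε * ‖q0 * Complex.exp s‖

lemma Box.mono {A : ℂ → ℂ} {z : ℂ} {ν B ε : ℝ} {q0 : ℂ} (b : Box A z ν B ε q0) {B' ε' : ℝ} (h : B' ≤ B)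
    (he : ε ≤ ε') : Box A z ν B' ε' q0 :=
  ⟨b.z0, fun s hs => (b.ap s (hs.trans h)).trans (by gcongr)⟩

lemma Box.shift {A : ℂ → ℂ} {z : ℂ} {ν B ε : ℝ} {q0 : ℂ} (b : Box A z ν B ε q0) {B' : ℝ} (s0 : ℂ)
    (h : B' + ‖s0‖ ≤ B) : Box A (ee z ν s0) ν B' ε (q0 * Complex.exp s0) := by
  refine ⟨mul_ne_zero b.z0 (Complex.exp_ne_zero _), fun s hs => ?_⟩
  have := b.ap (s0 + s) (by linarith [norm_add_le s0 s])
  rw [Complex.exp_add, ← mul_assoc] at this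
  have h2 : ee (ee z ν s0) ν s = ee z ν (s0 + s) := by
    simp only [ee]; rw [add_div, Complex.exp_add]; ring
  rwa [h2]

lemma log_lem {z w : ℂ} {ν τ : ℝ} (hz : z ≠ 0) (hν : 0 < ν) (h : ‖w - z‖ * ν ≤ τ * ‖z‖) (hτ : τ ≤ ν / 2) :
    ∃ s, ee z ν s = w ∧ ‖s - ν * (w - z) / z‖ ≤ τ ^ 2 / ν ∧ ‖s‖ ≤ 2 * τ := by
  have hz' : 0 < ‖z‖ := norm_pos_iff.2 hz
  set x := (w - z) / z with hx
  have hxn : ‖x‖ ≤ τ / ν := by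
    rw [hx, norm_div, div_le_div_iff₀ hz' hν]; exact h
  have hx2 : ‖x‖ ≤ 1 / 2 := hxn.trans (by rw [div_le_iff₀ hν]; linarith)
  have hτ0 : 0 ≤ τ := by
    by_contra hc
    nlinarith [norm_nonneg (w - z), mul_nonneg (norm_nonneg (w - z)) hν.le]
  have hνc : (ν:ℂ) ≠ 0 := by exact_mod_cast hν.ne'
  have h1 : ‖(ν:ℂ) * Complex.log (1 + x) - ν * (w - z) / z‖ ≤ τ ^ 2 / ν := by
    have h2 := Complex.norm_log_one_add_sub_self_le (z := x) (by linarith)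
    have h3 : (1 - ‖x‖)⁻¹ ≤ 2 := by rw [inv_le_comm₀ (by linarith) two_pos]; linarith
    have h4 : ‖Complex.log (1 + x) - x‖ ≤ (τ / ν) ^ 2 := by
      refine h2.trans ?_
      have : ‖x‖ ^ 2 ≤ (τ / ν) ^ 2 := by gcongr
      nlinarith [sq_nonneg ‖x‖]
    rw [mul_div_assoc, ← hx, ← mul_sub, norm_mul, Complex.norm_real, Real.norm_of_nonneg hν.le]
    calc _ ≤ ν * (τ / ν) ^ 2 := by gcongr
      _ = _ := by field_simp
  refine ⟨ν * Complex.log (1 + x), ?_, h1, ?_⟩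
  · have : 1 + x ≠ 0 := fun h0 => by
      have : ‖x‖ = 1 := by rw [eq_neg_of_add_eq_zero_right h0]; simp
      linarith
    rw [ee, mul_div_assoc, mul_div_left_comm, div_self hνc, mul_one, Complex.exp_log this, hx]
    field_simp; ring
  · have h5 : ‖(ν:ℂ) * (w - z) / z‖ ≤ τ := by
      rw [norm_div, norm_mul, Complex.norm_real, Real.norm_of_nonneg hν.le, div_le_iff₀ hz', mul_comm]
      exact h
    have h6 : τ ^ 2 / ν ≤ τ := by rw [div_le_iff₀ hν]; nlinarith
    linarith [norm_le_norm_sub_add ((ν:ℂ) * Complex.log (1 + x)) (ν * (w - z) / z)]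

lemma norm_ee {z : ℂ} {ν : ℝ} {s : ℂ} : ‖ee z ν s‖ = ‖z‖ * Real.exp (s.re / ν) := by
  rw [ee, norm_mul, Complex.norm_exp]; congr 2
  exact Complex.div_ofReal_re s ν

section
variable {A : ℂ → ℂ} {z : ℂ} {ν B ε : ℝ} {q0 : ℂ}

lemma exp2 : Real.exp 2 ≤ 8 := by
  have : Real.exp 2 = Real.exp 1 ^ 2 := by rw [← Real.exp_nat_mul]; norm_num
  rw [this]; nlinarith [Real.exp_one_lt_d9, Real.exp_pos 1]

lemma Box.le (b : Box A z ν B ε q0) (hε : ε ≤ 1 / 2) (hν : 0 < ν) {s : ℂ} (hs : ‖s‖ ≤ B) (hs' : ‖s‖ ≤ ν) :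
    ‖A (ee z ν s)‖ * ‖z‖ ^ 2 ≤ 16 * ‖q0‖ * Real.exp s.re * ν ^ 2 ∧
    ‖q0‖ * Real.exp s.re * ν ^ 2 ≤ 16 * (‖A (ee z ν s)‖ * ‖z‖ ^ 2) := by
  have h1 := b.ap s hs
  have hn : ‖q0 * Complex.exp s‖ = ‖q0‖ * Real.exp s.re := by rw [norm_mul, Complex.norm_exp]
  have hQ : ‖A (ee z ν s) * ee z ν s ^ 2 / ν ^ 2‖ = ‖A (ee z ν s)‖ * ‖z‖ ^ 2 * Real.exp (s.re / ν) ^ 2 / ν ^ 2 := by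
    rw [norm_div, norm_mul, norm_pow, norm_pow, norm_ee, Complex.norm_real, Real.norm_of_nonneg hν.le]; ring
  have h2 := norm_le_norm_sub_add (A (ee z ν s) * ee z ν s ^ 2 / ν ^ 2) (q0 * Complex.exp s)
  have h3 := norm_le_norm_sub_add (q0 * Complex.exp s) (A (ee z ν s) * ee z ν s ^ 2 / ν ^ 2)
  rw [norm_sub_rev] at h3
  have h0 : 0 ≤ ‖q0‖ * Real.exp s.re := by positivity
  rw [hn] at h1 h2 h3; rw [hQ] at h2 h3
  have h4 : ε * (‖q0‖ * Real.exp s.re) ≤ 1 / 2 * (‖q0‖ * Real.exp s.re) := by gcongr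
  have hre := abs_le.1 ((Complex.abs_re_le_norm s).trans hs')
  have h5 : Real.exp (s.re / ν) ^ 2 ≤ 8 := by
    refine le_trans ?_ exp2
    rw [← Real.exp_nat_mul]; gcongr
    have : s.re / ν ≤ 1 := by rw [div_le_iff₀ hν]; linarith
    push_cast; linarith
  have h6 : 1 ≤ 8 * Real.exp (s.re / ν) ^ 2 := by
    have : Real.exp (-2) ≤ Real.exp (s.re / ν) ^ 2 := by
      rw [← Real.exp_nat_mul]; gcongr
      have : -1 ≤ s.re / ν := by rw [le_div_iff₀ hν]; linarith
      push_cast; linarith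
    have h7 : Real.exp (-2) * Real.exp 2 = 1 := by rw [← Real.exp_add]; simp
    nlinarith [exp2, Real.exp_pos (-2)]
  set E := ‖A (ee z ν s)‖ * ‖z‖ ^ 2 with hE
  have hE0 : 0 ≤ E := by positivity
  have hν2 : 0 < ν ^ 2 := by positivity
  have h8 : E * Real.exp (s.re / ν) ^ 2 ≤ 3 / 2 * (‖q0‖ * Real.exp s.re) * ν ^ 2 := by
    rw [← div_le_iff₀ hν2]; linarith
  have h9 : 1 / 2 * (‖q0‖ * Real.exp s.re) * ν ^ 2 ≤ E * Real.exp (s.re / ν) ^ 2 := by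
    rw [← le_div_iff₀ hν2]; linarith
  constructor
  · nlinarith [mul_nonneg h0 hν2.le]
  · nlinarith

lemma Box.bdd (b : Box A z ν B ε q0) (hε : ε ≤ 1 / 2) (hν : 2 ≤ ν) (hB : 2 ≤ B) {w : ℂ}
    (hw : ‖w - z‖ * ν ≤ 1 / 2 * ‖z‖) : ∃ C, ∀ᶠ y in 𝓝 w, ‖A y‖ ≤ C := by
  have hz' : 0 < ‖z‖ := norm_pos_iff.2 b.z0
  refine ⟨16 * ‖q0‖ * Real.exp 2 * ν ^ 2 / ‖z‖ ^ 2, ?_⟩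
  have : ∀ᶠ y in 𝓝 w, ‖y - z‖ * ν < 1 * ‖z‖ := by
    have hc : ContinuousAt (fun y => ‖y - z‖ * ν) w := by fun_prop
    exact hc.eventually (gt_mem_nhds (by linarith))
  filter_upwards [this] with y hy
  obtain ⟨s, rfl, -, hs⟩ := log_lem b.z0 (by linarith) hy.le (by linarith)
  rw [le_div_iff₀ (by positivity)]
  refine (b.le hε (by linarith) (by linarith) (by linarith)).1.trans ?_
  have := (Complex.re_le_norm s)
  gcongr; linarith
end

lemma schwarzian_diff {g : ℂ → ℂ} (hg : DifferentiableOn ℂ g (ball 0 1)) (hi : InjOn g (ball 0 1)) :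
    DifferentiableOn ℂ (fun x => - schwarzian g x / 2) (ball 0 1) := by
  have hne := (inj_basic isOpen_ball hg hi).2.2
  have h1 := hg.deriv isOpen_ball
  have h2 := h1.deriv isOpen_ball
  have h3 := h2.deriv isOpen_ball
  unfold schwarzian
  exact (((h3.div h1 hne).sub (((h2.div h1 hne).pow 2).const_mul _)).neg).div_const _

section
variable {Φ : ℂ → ℂ} {P V : Set ℂ} {A : ℂ → ℂ} {M : ℕ} {δ : ℝ}

lemma Good.box_XX (G : Good Φ P V A M) {z q0 : ℂ} {ν B ε : ℝ} (b : Box A z ν B ε q0) (hε : ε ≤ 1 / 2)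
    (hν : 2 ≤ ν) (hB : 2 ≤ B) {w : ℂ} (hw : ‖w - z‖ * ν ≤ 1 / 2 * ‖z‖) (hP : w ∉ P) : w ∈ XX Φ P := by
  obtain ⟨C, hC⟩ := b.bdd hε hν hB hw
  exact ⟨hP, fun h => G.no_crit hP h hC⟩

lemma schw_half {g : ℂ → ℂ} (hg : DifferentiableOn ℂ g (ball 0 1)) (hi : InjOn g (ball 0 1)) {t : ℝ} (ht : t < 1)
    {x : ℂ} (hx : ‖x‖ ≤ t) : ‖- schwarzian g x / 2‖ ≤ KS / (1 - t) ^ 2 / 2 := by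
  have hsub : ball x (1 - t) ⊆ ball (0:ℂ) 1 := ball_subset_ball' (by simp; linarith)
  have := schwarz_bound (by linarith) (hg.mono hsub) (hi.mono hsub)
  rw [norm_div, norm_neg]; simp; linarith

set_option maxHeartbeats 1600000 in
lemma Good.tile1 (G : Good Φ P V A M) (hM : 0 < M) (hδ : 0 < δ)
    (hV : ∀ a ∈ V, ∀ v ∈ V, v ≠ a → δ ≤ ‖v - a‖) :
    ∃ c B ν0 : ℝ, 0 < c ∧ ∀ (z q0 : ℂ) (ν ε : ℝ), ε ≤ 1 / 2 → ν0 ≤ ν → Box A z ν B ε q0 → z ∉ P → ‖Φ z‖ ≤ 2 →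
      c ≤ ‖q0‖ := by
  obtain ⟨t0, ht0, ht01, H⟩ := G.tile0 hM hδ hV (d0 := δ * Real.exp (-LL M)) (by positivity) le_rfl
  have hKS := KS_pos
  have hK0 := K0_pos
  set t1 := (1 + t0) / 2 with ht1
  obtain ⟨D, r0, hD, hr0, HD⟩ := doubling (C := KS / (1 - t1) ^ 2 / 2) (c0 := 1 / 8) (t0 := t0) (t1 := t1) (by norm_num) ht0
    (by linarith) (by linarith) (by have : 0 < 1 - t1 := by linarith
                                    positivity)
  obtain ⟨T, hT1, hTD⟩ : ∃ T : ℝ, 1 ≤ T ∧ 256 * K0 ^ 4 * D < Real.exp (7 * T - 2) := by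
    refine ⟨max 1 (256 * K0 ^ 4 * D), le_max_left _ _, ?_⟩
    have := Real.add_one_le_exp (7 * max 1 (256 * K0 ^ 4 * D) - 2)
    linarith [le_max_left 1 (256 * K0 ^ 4 * D), le_max_right 1 (256 * K0 ^ 4 * D)]
  set K1 := 512 * K0 * T ^ 2 + T / r0 + 32 * T + 1 with hK1
  have hTr : 0 < T / r0 := by positivity
  have hK1p : 1 ≤ K1 := by
    have : 0 ≤ 512 * K0 * T ^ 2 := by positivity
    linarith
  have hKC := KC_pos t0
  set τ := KC t0 * K1 with hτ
  have hKCp : 0 < τ := by positivity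
  set KK := KD t0 with hKK
  have hKD : 0 < KK := by
    have := KC_pos ((1 + t0) / 2)
    have : 0 < 1 - t0 := by linarith
    rw [hKK]; unfold KD; positivity
  refine ⟨1 / (128 * Real.exp (2 * τ) * KK ^ 2 * K1 ^ 2), 18 * T + 2 * τ + 2, 162 * T ^ 2 + 18 * T + 2 * τ + 2,
    by positivity, fun z q0 ν ε hε hν b hzP hΦ => ?_⟩
  have hz' : 0 < ‖z‖ := norm_pos_iff.2 b.z0
  have hT2 : 0 < T ^ 2 := by positivity
  have hν0 : 0 < ν := by linarith
  have hzX : z ∈ XX Φ P := G.box_XX b hε (by linarith) (by linarith) (by simp) hzP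
  obtain ⟨a, haV, g, hg, hgi, hg0, hgA, x', hx', hA8, -⟩ := H z hzX hΦ
  have hfd := schwarzian_diff hg hgi
  have hne := (inj_basic isOpen_ball hg hgi).2.2
  have hg0n : deriv g 0 ≠ 0 := hne 0 (by simp)
  have hg0p : 0 < ‖deriv g 0‖ := norm_pos_iff.2 hg0n
  set K := ‖deriv g 0‖ * ν / ‖z‖ with hK
  have hKp : 0 < K := by positivity
  have hKz : ‖deriv g 0‖ * ν = K * ‖z‖ := by rw [hK]; field_simp
  have hmem : ∀ x : ℂ, ‖x‖ < 1 → x ∈ ball (0:ℂ) 1 := fun x hx => by simpa using hx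
  have hnf : ∀ x : ℂ, ‖x‖ < 1 → ‖- schwarzian g x / 2‖ = ‖A (g x)‖ * ‖deriv g x‖ ^ 2 := fun x hx => by
    rw [← hgA x (hmem x hx), norm_mul, norm_pow]
  rcases lt_or_ge K K1 with hlt | hge
  · have h1 := koebe one_pos hg hgi ht01 (z := x') (by simpa using hx')
    rw [one_mul, hg0] at h1
    obtain ⟨s, hs, -, hsn⟩ := log_lem (w := g x') (τ := τ) b.z0 hν0 (by
      calc _ ≤ KC t0 * ‖deriv g 0‖ * ν := by gcongr
        _ = KC t0 * K * ‖z‖ := by rw [mul_assoc, hKz]; ring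
        _ ≤ _ := by rw [hτ]; gcongr) (by linarith)
    have h2 := (b.le hε hν0 (s := s) (by linarith) (by linarith)).1
    rw [hs] at h2
    have h3 := koebe_deriv one_pos hg hgi ht01 (z := x') (by simpa using hx')
    have h4 : ‖A (g x')‖ * ‖deriv g x'‖ ^ 2 ≤ ‖A (g x')‖ * (KK * ‖deriv g 0‖) ^ 2 := by gcongr
    have h5 : ‖A (g x')‖ * (KK * ‖deriv g 0‖) ^ 2 * (ν ^ 2 * ‖z‖ ^ 2) ≤
        16 * ‖q0‖ * Real.exp (2 * τ) * KK ^ 2 * K1 ^ 2 * (ν ^ 2 * ‖z‖ ^ 2) := by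
      calc _ = ‖A (g x')‖ * ‖z‖ ^ 2 * KK ^ 2 * (‖deriv g 0‖ * ν) ^ 2 := by ring
        _ = ‖A (g x')‖ * ‖z‖ ^ 2 * KK ^ 2 * (K * ‖z‖) ^ 2 := by rw [hKz]
        _ ≤ (16 * ‖q0‖ * Real.exp (2 * τ) * ν ^ 2) * KK ^ 2 * (K1 * ‖z‖) ^ 2 := by
          have : s.re ≤ 2 * τ := (Complex.re_le_norm s).trans hsn
          have h7 := h2.trans (b := 16 * ‖q0‖ * Real.exp s.re * ν ^ 2) (c := 16 * ‖q0‖ * Real.exp (2 * τ) * ν ^ 2) (by gcongr)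
          rw [mul_assoc, mul_assoc (16 * ‖q0‖ * Real.exp (2 * τ) * ν ^ 2)]
          refine mul_le_mul h7 (by gcongr) (by positivity) (by positivity)
        _ = _ := by ring
    have h6 := le_of_mul_le_mul_right h5 (by positivity)
    rw [div_le_iff₀ (by positivity)]
    linarith only [h6, h4, hA8]
  · exfalso
    have hKT : 512 * K0 * T ^ 2 ≤ K ∧ T / r0 ≤ K ∧ 32 * T ≤ K := by
      have : 0 < 512 * K0 * T ^ 2 := by positivity
      refine ⟨?_, ?_, ?_⟩ <;> linarith
    set r := T / K with hr
    have hrp : 0 < r := by positivity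
    have hrr : r ≤ r0 := by rw [hr, div_le_iff₀ hKp, mul_comm]; exact (div_le_iff₀ hr0).1 hKT.2.1
    have hr8 : 8 * r ≤ 1 / 4 := by rw [hr, mul_div_assoc', div_le_iff₀ hKp]; linarith [hKT.2.2]
    set k := deriv g 0 * ν / z with hk
    have hkn : ‖k‖ = K := by rw [hk, norm_div, norm_mul, Complex.norm_real, Real.norm_of_nonneg hν0.le]
    have hk0 : k ≠ 0 := norm_pos_iff.1 (by rw [hkn]; exact hKp)
    have key : ∀ x : ℂ, ‖x‖ ≤ 8 * r → ∃ s, ee z ν s = g x ∧ ‖s - k * x‖ ≤ 1 ∧ ‖s‖ ≤ 18 * T := by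
      intro x hx
      have h1 := koebe_lin one_pos hg hgi (z := x) (by simp; linarith)
      rw [sub_zero, hg0, div_one] at h1
      have hxK : ‖x‖ * K ≤ 8 * T := by
        calc _ ≤ 8 * r * K := by gcongr
          _ = 8 * T := by rw [hr]; field_simp
      have h2 : ‖g x - z - deriv g 0 * x‖ * ν ≤ 1 / 2 * ‖z‖ := by
        calc _ ≤ 4 * K0 * ‖deriv g 0‖ * ‖x‖ ^ 2 * ν := by gcongr
          _ = 4 * K0 * ‖x‖ ^ 2 * (‖deriv g 0‖ * ν) := by ring
          _ = 4 * K0 * (‖x‖ * K) ^ 2 / K * ‖z‖ := by rw [hKz]; field_simp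
          _ ≤ 4 * K0 * (8 * T) ^ 2 / K * ‖z‖ := by gcongr
          _ ≤ _ := by
            refine mul_le_mul_of_nonneg_right ?_ hz'.le
            rw [div_le_iff₀ hKp]; linarith only [hKT.1]
      have h3 : ‖g x - z‖ * ν ≤ 9 * T * ‖z‖ := by
        have h4 := norm_le_norm_sub_add (g x - z) (deriv g 0 * x)
        rw [norm_mul] at h4
        calc _ ≤ (‖g x - z - deriv g 0 * x‖ + ‖deriv g 0‖ * ‖x‖) * ν := by gcongr
          _ = ‖g x - z - deriv g 0 * x‖ * ν + ‖x‖ * (‖deriv g 0‖ * ν) := by ring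
          _ ≤ 1 / 2 * ‖z‖ + ‖x‖ * (K * ‖z‖) := by rw [hKz]; gcongr
          _ ≤ 1 / 2 * ‖z‖ + 8 * T * ‖z‖ := by rw [← mul_assoc]; gcongr
          _ ≤ _ := by nlinarith only [mul_le_mul_of_nonneg_right hT1 hz'.le, hz']
      obtain ⟨s, hs, hs1, hs2⟩ := log_lem b.z0 hν0 h3 (by linarith)
      refine ⟨s, hs, ?_, by linarith⟩
      have h5 : (9 * T) ^ 2 / ν ≤ 1 / 2 := by rw [div_le_iff₀ hν0]; linarith only [hν, hT1, hKCp]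
      have h6 : ‖ν * (g x - z) / z - k * x‖ ≤ 1 / 2 := by
        have : ν * (g x - z) / z - k * x = (g x - z - deriv g 0 * x) * ν / z := by rw [hk]; ring
        rw [this, norm_div, norm_mul, Complex.norm_real, Real.norm_of_nonneg hν0.le, div_le_iff₀ hz']
        exact h2
      calc _ = ‖(s - ν * (g x - z) / z) + (ν * (g x - z) / z - k * x)‖ := by congr 1; ring
        _ ≤ _ := (norm_add_le _ _).trans (by linarith)
    have hzν : 0 < ‖z‖ ^ 2 * ν ^ 2 := by positivity
    obtain ⟨hm, hdb⟩ := HD _ hfd (fun x hx => schw_half hg hgi (by linarith) hx) ⟨x', hx', by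
      rw [hnf x' (by linarith)]; exact hA8⟩ r (16 * ‖q0‖ * Real.exp (T + 1) * K0 ^ 2 * K ^ 2) hrp hrr (by
      intro x hx
      obtain ⟨s, hs, hs1, hs2⟩ := key x (by linarith)
      rw [hnf x (by linarith)]
      have h2 := (b.le hε hν0 (s := s) (by linarith) (by linarith)).1
      rw [hs] at h2
      have h3 := koebe_half one_pos hg hgi (z := x) (by simp; linarith)
      have h4 : s.re ≤ T + 1 := by
        have h5 := Complex.re_le_norm s
        have h6 := norm_le_norm_sub_add s (k * x)
        rw [norm_mul, hkn] at h6
        have : K * ‖x‖ ≤ T := by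
          calc _ ≤ K * r := by gcongr
            _ = T := by rw [hr]; field_simp
        linarith
      refine le_of_mul_le_mul_right ?_ hzν
      calc _ ≤ ‖A (g x)‖ * (K0 * ‖deriv g 0‖) ^ 2 * (‖z‖ ^ 2 * ν ^ 2) := by gcongr
        _ = ‖A (g x)‖ * ‖z‖ ^ 2 * K0 ^ 2 * (‖deriv g 0‖ * ν) ^ 2 := by ring
        _ ≤ 16 * ‖q0‖ * Real.exp s.re * ν ^ 2 * K0 ^ 2 * (K * ‖z‖) ^ 2 := by
          rw [hKz]
          exact mul_le_mul_of_nonneg_right (mul_le_mul_of_nonneg_right h2 (by positivity)) (by positivity)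
        _ ≤ 16 * ‖q0‖ * Real.exp (T + 1) * ν ^ 2 * K0 ^ 2 * (K * ‖z‖) ^ 2 := by gcongr
        _ = _ := by ring)
    set x := (8 * T : ℂ) / k with hx
    have hxn : ‖x‖ = 8 * r := by
      rw [hx, norm_div, hkn, hr, norm_mul, Complex.norm_real, Real.norm_of_nonneg (by linarith)]; norm_num
      ring
    have hkx : k * x = (8 * T : ℝ) := by rw [hx]; push_cast; field_simp
    obtain ⟨s, hs, hs1, hs2⟩ := key x hxn.le
    have h1 := hdb x hxn.le
    rw [hnf x (by linarith)] at h1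
    have h2 := (b.le hε hν0 (s := s) (by linarith) (by linarith)).2
    rw [hs] at h2
    have h4 : 8 * T - 1 ≤ s.re := by
      have h5 := Complex.abs_re_le_norm (s - k * x)
      rw [hkx, Complex.sub_re, Complex.ofReal_re] at h5
      rw [hkx] at hs1
      linarith [(abs_le.1 (h5.trans hs1)).1]
    have h3 : ‖deriv g 0‖ ≤ K0 * ‖deriv g x‖ := by
      have hsub : ball x (1 / 2) ⊆ ball (0:ℂ) 1 := ball_subset_ball' (by simp; linarith)
      exact koebe_half (by norm_num) (hg.mono hsub) (hgi.mono hsub) (by simp; linarith)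
    have hq : 0 < ‖q0‖ := by
      rcases (norm_nonneg q0).eq_or_lt with h | h
      · rw [← h] at hm; simp at hm
      · exact h
    have h5 : ‖q0‖ * Real.exp (8 * T - 1) * K ^ 2 * (‖z‖ ^ 2 * ν ^ 2) ≤
        256 * K0 ^ 4 * D * ‖q0‖ * Real.exp (T + 1) * K ^ 2 * (‖z‖ ^ 2 * ν ^ 2) := by
      calc _ = ‖q0‖ * Real.exp (8 * T - 1) * ν ^ 2 * (K * ‖z‖) ^ 2 := by ring
        _ ≤ ‖q0‖ * Real.exp s.re * ν ^ 2 * (K * ‖z‖) ^ 2 := by gcongr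
        _ ≤ 16 * (‖A (g x)‖ * ‖z‖ ^ 2) * (‖deriv g 0‖ * ν) ^ 2 := by
          rw [hKz]; exact mul_le_mul_of_nonneg_right h2 (by positivity)
        _ ≤ 16 * (‖A (g x)‖ * ‖z‖ ^ 2) * (K0 * ‖deriv g x‖ * ν) ^ 2 := by gcongr
        _ = 16 * K0 ^ 2 * (‖A (g x)‖ * ‖deriv g x‖ ^ 2) * (‖z‖ ^ 2 * ν ^ 2) := by ring
        _ ≤ 16 * K0 ^ 2 * (D * (16 * ‖q0‖ * Real.exp (T + 1) * K0 ^ 2 * K ^ 2)) * (‖z‖ ^ 2 * ν ^ 2) := by gcongr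
        _ = _ := by ring
    have h6 := le_of_mul_le_mul_right h5 hzν
    have h7 : Real.exp (8 * T - 1) = Real.exp (7 * T - 2) * Real.exp (T + 1) := by
      rw [← Real.exp_add]; congr 1; ring
    rw [h7] at h6
    have h8 : 0 < ‖q0‖ * Real.exp (T + 1) * K ^ 2 := by positivity
    nlinarith only [h8, h6, mul_lt_mul_of_pos_right hTD h8]

set_option maxHeartbeats 1600000 in
lemma Good.tile2 (G : Good Φ P V A M) (hM : 0 < M) (hδ : 0 < δ)
    (hV : ∀ a ∈ V, ∀ v ∈ V, v ≠ a → δ ≤ ‖v - a‖) {η : ℝ} (hη : 0 < η) (hη1 : η ≤ 1) (L : ℝ) :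
    ∃ Q0 : ℝ, 0 < Q0 ∧ ∀ (z q0 : ℂ) (ν ε : ℝ), ε ≤ 1 / 2 → 2 ≤ ν → Box A z ν 2 ε q0 → z ∉ P → ‖Φ z‖ ≤ 2 →
      Q0 ≤ ‖q0‖ → ∃ s', ‖s'‖ ≤ η ∧ ∃ a ∈ V, ∃ ψ ζ, TrI Φ P a δ ψ ∧ ζ ∈ Hp ∧ ψ ζ = ee z ν s' ∧ L ≤ ζ.re := by
  obtain ⟨t0, ht0, ht01, H⟩ := G.tile0 hM hδ hV (d0 := δ * Real.exp (-max L (LL M))) (by positivity)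
    (by gcongr; exact le_max_right _ _)
  have hKS := KS_pos
  have hK0 := K0_pos
  have hKC := KC_pos t0
  set KK := KD t0 with hKK
  have hKD : 0 < KK := by
    have := KC_pos ((1 + t0) / 2)
    have : 0 < 1 - t0 := by linarith
    rw [hKK]; unfold KD; positivity
  set W := KC t0 + 3 * K0 * M * KK with hW
  have hWp : 0 < W := by positivity
  refine ⟨8 * KS * (2 * W / η) ^ 2, by positivity, fun z q0 ν ε hε hν b hzP hΦ hQ => ?_⟩
  have hz' : 0 < ‖z‖ := norm_pos_iff.2 b.z0
  have hν0 : 0 < ν := by linarith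
  have hzX : z ∈ XX Φ P := G.box_XX b hε hν le_rfl (by simp) hzP
  obtain ⟨a, haV, g, hg, hgi, hg0, hgA, x', hx', -, hd⟩ := H z hzX hΦ
  set K := ‖deriv g 0‖ * ν / ‖z‖ with hK
  have hKz : ‖deriv g 0‖ * ν = K * ‖z‖ := by rw [hK]; field_simp
  have hK0' : 0 ≤ K := by positivity
  have hWK : W * K ≤ η / 2 := by
    have h1 := (b.le hε hν0 (s := 0) (by simp) (by simpa using hν0.le)).2
    have h2 := schw_half hg hgi one_half_lt_one (x := 0) (by simp)
    rw [← hgA 0 (by simp), norm_mul, norm_pow, hg0] at h2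
    have hs := schwarz_bound one_pos hg hgi
    have h2 : ‖A z‖ * ‖deriv g 0‖ ^ 2 ≤ KS / 2 := by
      rw [← hg0, ← norm_pow, ← norm_mul, hgA 0 (by simp), norm_div, norm_neg]; simp at hs ⊢; linarith
    have h0 : ee z ν 0 = z := by simp [ee]
    rw [h0, Complex.zero_re, Real.exp_zero, mul_one] at h1
    have h3 : ‖q0‖ * K ^ 2 * (‖z‖ ^ 2 * ν ^ 2) ≤ 8 * KS * (‖z‖ ^ 2 * ν ^ 2) := by
      calc _ = ‖q0‖ * ν ^ 2 * (K * ‖z‖) ^ 2 := by ring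
        _ ≤ 16 * (‖A z‖ * ‖z‖ ^ 2) * (‖deriv g 0‖ * ν) ^ 2 := by
          rw [hKz]; exact mul_le_mul_of_nonneg_right h1 (by positivity)
        _ = 16 * (‖A z‖ * ‖deriv g 0‖ ^ 2) * (‖z‖ ^ 2 * ν ^ 2) := by ring
        _ ≤ 16 * (KS / 2) * (‖z‖ ^ 2 * ν ^ 2) := by gcongr
        _ = _ := by ring
    have h4 := le_of_mul_le_mul_right h3 (by positivity)
    have h5 : 8 * KS * (2 * W / η * K) ^ 2 ≤ 8 * KS * 1 := by
      calc _ = 8 * KS * (2 * W / η) ^ 2 * K ^ 2 := by ring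
        _ ≤ ‖q0‖ * K ^ 2 := by gcongr
        _ ≤ _ := by linarith
    have h6 := le_of_mul_le_mul_left h5 (by positivity)
    have h7 : 2 * W / η * K ≤ 1 := by
      by_contra hc; push Not at hc; nlinarith
    rw [div_mul_eq_mul_div, div_le_one hη] at h7; linarith
  have hκ := koebe one_pos hg hgi ht01 (z := x') (by simpa using hx')
  rw [one_mul, hg0] at hκ
  have hκ' := koebe_deriv one_pos hg hgi ht01 (z := x') (by simpa using hx')
  have hMr : (0:ℝ) < M := by exact_mod_cast hM
  obtain ⟨s, hs, -, hsn⟩ := log_lem (w := g x') (τ := η / 2) b.z0 hν0 (by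
      calc _ ≤ KC t0 * ‖deriv g 0‖ * ν := by gcongr
        _ = KC t0 * K * ‖z‖ := by rw [mul_assoc, hKz]; ring
        _ ≤ W * K * ‖z‖ := by gcongr; rw [hW]; linarith [show 0 ≤ 3 * K0 * M * KK by positivity]
        _ ≤ _ := by gcongr) (by linarith)
  rcases hd with ⟨x, hxP, hx0, hxn⟩ | ⟨ψ, ζ, T, hζ, hψ, hd⟩
  · exfalso
    refine (G.box_XX b hε hν le_rfl (w := x) ?_ hxP).2 hx0
    have : ‖x - z‖ ≤ W * ‖deriv g 0‖ := by
      calc _ = ‖(x - g x') + (g x' - z)‖ := by congr 1; ring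
        _ ≤ 3 * K0 * M * ‖deriv g x'‖ + KC t0 * ‖deriv g 0‖ := (norm_add_le _ _).trans (by linarith)
        _ ≤ 3 * K0 * M * (KK * ‖deriv g 0‖) + KC t0 * ‖deriv g 0‖ := by gcongr
        _ = _ := by rw [hW]; ring
    calc _ ≤ W * ‖deriv g 0‖ * ν := by gcongr
      _ = W * K * ‖z‖ := by rw [mul_assoc, hKz]; ring
      _ ≤ _ := by gcongr; linarith
  · refine ⟨s, by linarith, a, haV, ψ, ζ, T, hζ, by rw [hψ, hs], ?_⟩
    have := le_of_mul_le_mul_left hd hδ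
    rw [Real.exp_le_exp] at this
    linarith [le_max_left L (LL M)]
end

end SW

namespace SW
open Metric

def rho (C : ℝ) (s : ℂ) : ℂ := C * Complex.exp (s / 2)
def th0 : ℝ := 1 / (1000 * K0)
def L0 : ℝ := 1000 * K0 * (KS + 1)

lemma th0_pos : 0 < th0 := by have := K0_pos; unfold th0; positivity
lemma th0_K : K0 * th0 = 1 / 1000 := by have := K0_pos; unfold th0; field_simp
lemma th0_le : th0 ≤ 1 / 1000 := by nlinarith [th0_K, K0_pos, th0_pos]
lemma L0_ge : 1000 * K0 ≤ L0 := by have := K0_pos; have := KS_pos; unfold L0; nlinarith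
lemma L0_ge' : 1000 ≤ L0 := by linarith [L0_ge, K0_pos]
lemma L0_sq : 32 * KS ≤ th0 * L0 ^ 2 := by
  have h1 := K0_pos
  have h2 := KS_pos
  have : th0 * L0 ^ 2 = 1000 * K0 * (KS + 1) ^ 2 := by unfold th0 L0; field_simp
  rw [this]; nlinarith

lemma norm_rho {C : ℝ} (hC : 0 ≤ C) (s : ℂ) : ‖rho C s‖ = C * Real.exp (s.re / 2) := by
  rw [rho, norm_mul, Complex.norm_exp, Complex.norm_real, Real.norm_of_nonneg hC]; congr 2
  exact Complex.div_ofNat_re s 2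

lemma rho_hd {C : ℝ} {s : ℂ} : HasDerivAt (rho C) (rho C s / 2) s := by
  unfold rho
  exact (((hasDerivAt_id s).div_const 2).cexp.const_mul (C:ℂ)).congr_deriv (by simp; ring)

lemma rho_add {C : ℝ} {s d : ℂ} : rho C (s + d) = rho C s * Complex.exp (d / 2) := by
  rw [rho, rho, add_div, Complex.exp_add]; ring

lemma ee_hd {z : ℂ} {ν : ℝ} {s : ℂ} : HasDerivAt (ee z ν) (ee z ν s / ν) s := by
  unfold ee
  exact (((hasDerivAt_id s).div_const (ν:ℂ)).cexp.const_mul z).congr_deriv (by simp; ring)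

lemma ee_add {z : ℂ} {ν : ℝ} {s d : ℂ} : ee z ν (s + d) = ee z ν s * Complex.exp (d / ν) := by
  rw [ee, ee, add_div, Complex.exp_add]; ring

structure Ctx (Φ : ℂ → ℂ) (P V : Set ℂ) (A : ℂ → ℂ) (M : ℕ) (δ : ℝ) (z : ℂ) (ν B C : ℝ) : Prop where
  G : Good Φ P V A M
  hδ : 0 < δ
  box : Box A z ν B (th0 / 4) (-(C ^ 2 / 4 : ℝ))
  hC : L0 ≤ C
  hν : 4 * B ≤ ν
  hB : 100 ≤ B

def On (ψ : ℂ → ℂ) (z : ℂ) (ν C : ℝ) (σ s ζ : ℂ) : Prop :=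
  ψ ζ = ee z ν s ∧ ‖ee z ν s / ν - σ * rho C s * deriv ψ ζ‖ ≤ th0 * ‖rho C s‖ * ‖deriv ψ ζ‖

section
variable {Φ : ℂ → ℂ} {P V : Set ℂ} {A : ℂ → ℂ} {M : ℕ} {δ : ℝ} {z : ℂ} {ν B C : ℝ}
  {a : ℂ} {ψ : ℂ → ℂ}

lemma Ctx.Cpos (c : Ctx Φ P V A M δ z ν B C) : 0 < C := by linarith [c.hC, L0_ge']
lemma Ctx.νpos (c : Ctx Φ P V A M δ z ν B C) : 0 < ν := by linarith [c.hν, c.hB]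
lemma Ctx.rho_ne (c : Ctx Φ P V A M δ z ν B C) (s : ℂ) : 0 < ‖rho C s‖ := by
  rw [norm_rho c.Cpos.le]; have := c.Cpos; positivity
lemma Ctx.ee_ne (c : Ctx Φ P V A M δ z ν B C) (s : ℂ) : ee z ν s ≠ 0 :=
  mul_ne_zero c.box.z0 (Complex.exp_ne_zero _)

lemma Ctx.dich (c : Ctx Φ P V A M δ z ν B C) (T : TrI Φ P a δ ψ) {s ζ : ℂ} (hs : ‖s‖ ≤ B) (hL : L0 / 2 ≤ ζ.re)
    (h : ψ ζ = ee z ν s) : On ψ z ν C 1 s ζ ∨ On ψ z ν C (-1) s ζ := by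
  have hth := th0_pos
  have hζ : ζ ∈ Hp := by rw [mem_Hp]; linarith [L0_ge']
  have hd : deriv ψ ζ ≠ 0 := T.deriv_ne c.hδ c.G.mero hζ
  have hdp : 0 < ‖deriv ψ ζ‖ := norm_pos_iff.2 hd
  have h1 := Tr.schw c.G c.hδ T.toTr hζ
  have h2 := Tr.sbound T.toTr T.inj hζ
  set S := schwarzian ψ ζ with hS
  have hS2 : ‖S‖ ≤ th0 / 8 := by
    refine h2.trans ?_
    have h4 : (L0 / 2) ^ 2 ≤ ζ.re ^ 2 := by
      have := L0_ge'
      gcongr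
    rw [div_le_iff₀ (by nlinarith only [h4, L0_ge'])]
    nlinarith only [h4, L0_sq, th0_pos]
  have hbox := c.box.ap s hs
  rw [h] at h1
  set q := A (ee z ν s) * ee z ν s ^ 2 / ν ^ 2 with hq
  set D := ee z ν s / ν / deriv ψ ζ with hD
  set ρ := rho C s with hρ
  have hρ2 : -((C ^ 2 / 4 : ℝ) : ℂ) * Complex.exp s = - ρ ^ 2 / 4 := by
    rw [hρ, rho, mul_pow, ← Complex.exp_nat_mul]
    have : ((2:ℕ):ℂ) * (s / 2) = s := by push_cast; ring
    rw [this]; push_cast; ring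
  rw [hρ2] at hbox
  have hνc : (ν:ℂ) ≠ 0 := by exact_mod_cast c.νpos.ne'
  have hDq : D ^ 2 * (1 + 2 * S) = - 4 * q := by
    have : 1 + 2 * S = - 4 * (A (ee z ν s) * deriv ψ ζ ^ 2) := by linear_combination 2 * h1
    rw [this, hD, hq]; field_simp
  have hb2 : ‖-4 * q - ρ ^ 2‖ ≤ th0 / 4 * ‖ρ‖ ^ 2 := by
    have e1 : -4 * q - ρ ^ 2 = (-4) * (q - -ρ ^ 2 / 4) := by ring
    rw [e1, norm_mul]
    have e2 : ‖-ρ ^ 2 / 4‖ = ‖ρ‖ ^ 2 / 4 := by rw [norm_div, norm_neg, norm_pow]; norm_num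
    rw [e2] at hbox
    have : ‖(-4:ℂ)‖ = 4 := by norm_num
    rw [this]; linarith only [hbox]
  have hD2 : ‖D ^ 2‖ ≤ 2 * ‖ρ‖ ^ 2 := by
    have e1 : D ^ 2 = (-4 * q - ρ ^ 2) + ρ ^ 2 - 2 * S * D ^ 2 := by rw [← hDq]; ring
    have e2 : ‖D ^ 2‖ ≤ th0 / 4 * ‖ρ‖ ^ 2 + ‖ρ‖ ^ 2 + 2 * (th0 / 8) * ‖D ^ 2‖ := by
      calc ‖D ^ 2‖ = ‖(-4 * q - ρ ^ 2) + ρ ^ 2 - 2 * S * D ^ 2‖ := congrArg _ e1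
        _ ≤ ‖-4 * q - ρ ^ 2‖ + ‖ρ ^ 2‖ + ‖2 * S * D ^ 2‖ := (norm_sub_le _ _).trans (by gcongr; exact norm_add_le _ _)
        _ ≤ _ := by
          rw [norm_mul (2 * S), norm_mul 2 S, norm_pow ρ, show ‖(2:ℂ)‖ = 2 by norm_num]; gcongr
    nlinarith only [e2, th0_le, th0_pos, sq_nonneg ‖ρ‖, norm_nonneg (D ^ 2)]
  have key : ‖D - ρ‖ * ‖D + ρ‖ ≤ th0 * ‖ρ‖ ^ 2 := by
    rw [← norm_mul]
    have e1 : (D - ρ) * (D + ρ) = (-4 * q - ρ ^ 2) - 2 * S * D ^ 2 := by rw [← hDq]; ring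
    rw [e1]
    calc _ ≤ ‖-4 * q - ρ ^ 2‖ + ‖2 * S * D ^ 2‖ := norm_sub_le _ _
      _ ≤ th0 / 4 * ‖ρ‖ ^ 2 + 2 * (th0 / 8) * (2 * ‖ρ‖ ^ 2) := by
          rw [norm_mul (2 * S), norm_mul 2 S, show ‖(2:ℂ)‖ = 2 by norm_num]; gcongr
      _ ≤ _ := by nlinarith only [th0_pos, sq_nonneg ‖ρ‖]
  have hρp : 0 < ‖ρ‖ := c.rho_ne s
  have hsum : 2 * ‖ρ‖ ≤ ‖D - ρ‖ + ‖D + ρ‖ := by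
    calc 2 * ‖ρ‖ = ‖(D + ρ) - (D - ρ)‖ := by
          rw [show (D + ρ) - (D - ρ) = 2 * ρ by ring, norm_mul]; norm_num
      _ ≤ _ := by linarith only [norm_sub_le (D + ρ) (D - ρ)]
  have hfin : ∀ σ : ℂ, ‖D - σ * ρ‖ ≤ th0 * ‖ρ‖ → On ψ z ν C σ s ζ := fun σ hσ => by
    refine ⟨h, ?_⟩
    have : ee z ν s / ν - σ * rho C s * deriv ψ ζ = (D - σ * ρ) * deriv ψ ζ := by rw [hD, hρ]; field_simp
    rw [this, norm_mul]; gcongr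
  rcases le_total ‖D - ρ‖ ‖D + ρ‖ with h5 | h5
  · refine Or.inl (hfin 1 ?_)
    rw [one_mul]
    refine le_of_mul_le_mul_right ?_ hρp
    nlinarith only [key, hsum, h5, norm_nonneg (D - ρ)]
  · refine Or.inr (hfin (-1) ?_)
    rw [neg_one_mul, sub_neg_eq_add]
    refine le_of_mul_le_mul_right ?_ hρp
    nlinarith only [key, hsum, h5, norm_nonneg (D + ρ)]

lemma Ctx.Zd (c : Ctx Φ P V A M δ z ν B C) (T : TrI Φ P a δ ψ) {s ζ : ℂ} (hζ : ζ ∈ Hp) (h : ψ ζ = ee z ν s) :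
    Function.invFunOn ψ Hp (ee z ν s) = ζ ∧
    HasDerivAt (fun s => Function.invFunOn ψ Hp (ee z ν s)) (ee z ν s / ν / deriv ψ ζ) s ∧
    ∀ᶠ x in 𝓝 s, Function.invFunOn ψ Hp (ee z ν x) ∈ Hp ∧ ψ (Function.invFunOn ψ Hp (ee z ν x)) = ee z ν x := by
  obtain ⟨ho, hdi, -⟩ := inj_basic Hp_open T.diff T.inj
  have hmem : ee z ν s ∈ ψ '' Hp := ⟨ζ, hζ, h⟩
  have h0 : Function.invFunOn ψ Hp (ee z ν s) = ζ := by
    rw [← h]; exact T.inj.leftInvOn_invFunOn hζ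
  refine ⟨h0, ?_, ?_⟩
  · have hd := (hdi.differentiableAt (ho.mem_nhds hmem)).hasDerivAt
    have h3 : HasDerivAt (fun w => ψ (Function.invFunOn ψ Hp w))
        (deriv ψ ζ * deriv (Function.invFunOn ψ Hp) (ee z ν s)) (ee z ν s) := by
      refine HasDerivAt.comp (ee z ν s) ?_ hd
      rw [h0]; exact (T.hd hζ).hasDerivAt
    have h4 : (fun w => ψ (Function.invFunOn ψ Hp w)) =ᶠ[𝓝 (ee z ν s)] id := by
      filter_upwards [ho.mem_nhds hmem] with w hw using Function.invFunOn_eq hw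
    have h5 := h3.unique ((hasDerivAt_id _).congr_of_eventuallyEq h4)
    have hne := T.deriv_ne c.hδ c.G.mero hζ
    refine (hd.comp s ee_hd).congr_deriv ?_
    rw [eq_div_iff hne]; linear_combination (ee z ν s / ν) * h5
  · filter_upwards [(ee_hd (z := z) (ν := ν) (s := s)).continuousAt.preimage_mem_nhds (ho.mem_nhds hmem)] with x hx
    exact ⟨Function.invFunOn_mem hx, Function.invFunOn_eq hx⟩

set_option maxHeartbeats 800000 in
lemma Ctx.cont (c : Ctx Φ P V A M δ z ν B C) (T : TrI Φ P a δ ψ) {s1 d ζ1 σ : ℂ} (hσ : σ = 1 ∨ σ = -1) {Λ : ℝ}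
    (hB : ∀ t : ℝ, 0 ≤ t → t ≤ 1 → ‖s1 + t * d‖ ≤ B) (h1 : On ψ z ν C σ s1 ζ1)
    (hΛ : ∀ t : ℝ, 0 ≤ t → t ≤ 1 → ‖rho C (s1 + t * d)‖ ≤ Λ)
    (hre : ∀ t : ℝ, 0 ≤ t → t ≤ 1 → L0 ≤ ζ1.re + (σ * (2 * rho C (s1 + t * d) - 2 * rho C s1)).re - th0 * Λ * ‖d‖ * t) :
    ∀ t : ℝ, 0 ≤ t → t ≤ 1 → ∃ ζ, L0 ≤ ζ.re ∧ On ψ z ν C σ (s1 + t * d) ζ ∧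
      ‖ζ - ζ1 - σ * (2 * rho C (s1 + t * d) - 2 * rho C s1)‖ ≤ th0 * Λ * ‖d‖ * t := by
  have hL := L0_ge'
  have hLHp : ∀ ζ : ℂ, L0 / 2 ≤ ζ.re → ζ ∈ Hp := fun ζ h => by rw [mem_Hp]; linarith only [h, hL]
  have hLHp' : ∀ ζ : ℂ, L0 ≤ ζ.re → ζ ∈ Hp := fun ζ h => hLHp ζ (by linarith only [h, hL])
  set X : ℝ → ℂ := fun t => s1 + t * d with hX
  have hXd : ∀ t : ℝ, HasDerivAt X d t := fun t => by
    exact (((hasDerivAt_id t).ofReal_comp.mul_const d).const_add s1).congr_deriv (by simp)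
  have hXc : Continuous X := by rw [hX]; fun_prop
  have hrc : Continuous (rho C) := by unfold rho; fun_prop
  have hec : Continuous (ee z ν) := by unfold ee; fun_prop
  have hdc : ContinuousOn (deriv ψ) Hp := (T.diff.deriv Hp_open).continuousOn
  set F : Set (ℝ × ℂ) := {x | x.1 ∈ Icc (0:ℝ) 1 ∧ L0 ≤ x.2.re ∧
    ‖x.2 - ζ1 - σ * (2 * rho C (X x.1) - 2 * rho C s1)‖ ≤ th0 * Λ * ‖d‖ * x.1} with hF
  have hFc : IsClosed F := by
    have c1 : IsClosed {x : ℝ × ℂ | L0 ≤ x.2.re} := isClosed_le (by fun_prop) (by fun_prop)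
    have c2 : IsClosed {x : ℝ × ℂ | ‖x.2 - ζ1 - σ * (2 * rho C (X x.1) - 2 * rho C s1)‖ ≤ th0 * Λ * ‖d‖ * x.1} :=
      isClosed_le (by fun_prop) (by fun_prop)
    exact (isClosed_Icc.preimage continuous_fst).inter (c1.inter c2)
  have hsnd : MapsTo (fun x : ℝ × ℂ => x.2) F Hp := fun x hx => hLHp' _ hx.2.1
  set S : Set (ℝ × ℂ) := {x ∈ F | ‖ψ x.2 - ee z ν (X x.1)‖ ≤ 0} ∩
    {x ∈ F | ‖ee z ν (X x.1) / ν - σ * rho C (X x.1) * deriv ψ x.2‖ ≤ th0 * ‖rho C (X x.1)‖ * ‖deriv ψ x.2‖} with hS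
  have hψc : ContinuousOn (fun x : ℝ × ℂ => ψ x.2) F := T.diff.continuousOn.comp continuous_snd.continuousOn hsnd
  have hψc' : ContinuousOn (fun x : ℝ × ℂ => deriv ψ x.2) F := hdc.comp continuous_snd.continuousOn hsnd
  have hSc : IsClosed S := by
    refine (hFc.isClosed_le ?_ continuousOn_const).inter (hFc.isClosed_le ?_ ?_)
    · exact (hψc.sub (by fun_prop : Continuous fun x : ℝ × ℂ => ee z ν (X x.1)).continuousOn).norm
    · exact ((by fun_prop : Continuous fun x : ℝ × ℂ => ee z ν (X x.1) / ν).continuousOn.sub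
        ((by fun_prop : Continuous fun x : ℝ × ℂ => σ * rho C (X x.1)).continuousOn.mul hψc')).norm
    · exact (by fun_prop : Continuous fun x : ℝ × ℂ => th0 * ‖rho C (X x.1)‖).continuousOn.mul hψc'.norm
  have hth := th0_pos
  have hΛ0 : 0 ≤ Λ := (norm_nonneg _).trans (hΛ 0 le_rfl zero_le_one)
  have hσn : ‖σ‖ = 1 := by rcases hσ with h | h <;> rw [h] <;> simp
  have hSb : IsBounded S := by
    obtain ⟨R, hR⟩ := (isCompact_Icc (a := (0:ℝ)) (b := 1)).exists_bound_of_continuousOn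
      (f := fun t => ζ1 + σ * (2 * rho C (X t) - 2 * rho C s1)) (by fun_prop)
    refine ((isCompact_Icc (a := (0:ℝ)) (b := 1)).prod (isCompact_closedBall (0:ℂ) (R + th0 * Λ * ‖d‖))).isBounded.subset ?_
    rintro ⟨t, ζ⟩ ⟨⟨⟨ht, -, h3⟩, -⟩, -⟩
    refine ⟨ht, ?_⟩
    simp only [mem_closedBall, dist_zero_right]
    have h4 := norm_le_norm_sub_add ζ (ζ1 + σ * (2 * rho C (X t) - 2 * rho C s1))
    rw [← sub_sub] at h4
    have h5 : th0 * Λ * ‖d‖ * t ≤ th0 * Λ * ‖d‖ * 1 := by gcongr; exact ht.2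
    have h6 := hR t ht
    dsimp only at h3
    linarith only [h4, h5, h6, h3]
  have hI : IsClosed (Prod.fst '' S) := ((isCompact_of_isClosed_isBounded hSc hSb).image continuous_fst).isClosed
  have hmain : Icc (0:ℝ) 1 ⊆ Prod.fst '' S := by
    refine IsClosed.Icc_subset_of_forall_mem_nhdsWithin (hI.inter isClosed_Icc) ?_ ?_
    · have hX0 : X 0 = s1 := by simp [hX]
      have h3 := hre 0 le_rfl zero_le_one
      have h0 : ((0:ℝ), ζ1) ∈ F := by
        refine ⟨by simp, by simpa using h3, by simp [hX0]⟩
      refine ⟨(0, ζ1), ⟨⟨h0, ?_⟩, h0, ?_⟩, rfl⟩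
      · simp [hX0, h1.1]
      · simpa [hX0] using h1.2
    · rintro _ ⟨⟨⟨t0, ζ0⟩, ⟨⟨hF0, he0⟩, -, hs0⟩, rfl⟩, ht0, ht1⟩
      dsimp only at *
      have hψ0 : ψ ζ0 = ee z ν (X t0) := sub_eq_zero.1 (norm_le_zero_iff.1 he0)
      obtain ⟨hz0, hzd, hzev⟩ := c.Zd T (hLHp' _ hF0.2.1) hψ0
      set Zf : ℂ → ℂ := fun s => Function.invFunOn ψ Hp (ee z ν s) with hZf
      have hz0' : Zf (X t0) = ζ0 := hz0
      have hZc : ContinuousAt (fun t => Zf (X t)) t0 := ContinuousAt.comp (f := X) hzd.continuousAt hXc.continuousAt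
      have hζ0 := hLHp' _ hF0.2.1
      have hne0 := T.deriv_ne c.hδ c.G.mero hζ0
      have hdcc : ContinuousAt (fun t => deriv ψ (Zf (X t))) t0 := by
        refine ContinuousAt.comp (g := deriv ψ) (f := fun t => Zf (X t)) ?_ hZc
        show ContinuousAt (deriv ψ) (Zf (X t0))
        rw [hz0']; exact hdc.continuousAt (Hp_open.mem_nhds hζ0)
      have ev1 : ∀ᶠ t in 𝓝 t0, L0 / 2 < (Zf (X t)).re :=
        (Complex.continuous_re.continuousAt.comp hZc).eventually (lt_mem_nhds (by
          show L0 / 2 < (Zf (X t0)).re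
          rw [hz0']; linarith only [hF0.2.1, hL]))
      have ev2 : ∀ᶠ t in 𝓝 t0, ‖ee z ν (X t) / ν - σ * rho C (X t) * deriv ψ (Zf (X t))‖ <
          ‖rho C (X t)‖ * ‖deriv ψ (Zf (X t))‖ := by
        refine Filter.Tendsto.eventually_lt (f := fun t => ‖ee z ν (X t) / ν - σ * rho C (X t) * deriv ψ (Zf (X t))‖)
          (g := fun t => ‖rho C (X t)‖ * ‖deriv ψ (Zf (X t))‖)
          (ContinuousAt.tendsto (((by fun_prop : Continuous fun t => ee z ν (X t) / ν).continuousAt.sub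
            ((by fun_prop : Continuous fun t => σ * rho C (X t)).continuousAt.mul hdcc)).norm))
          (ContinuousAt.tendsto ((by fun_prop : Continuous fun t => ‖rho C (X t)‖).continuousAt.mul hdcc.norm)) ?_
        rw [hz0']
        have := mul_pos (c.rho_ne (X t0)) (norm_pos_iff.2 hne0)
        refine hs0.trans_lt ?_
        nlinarith only [this, th0_le]
      obtain ⟨η, hη, hball⟩ := Metric.eventually_nhds_iff_ball.1
        (ev1.and (ev2.and (hXc.continuousAt.eventually hzev)))
      have hon : ∀ t ∈ ball t0 η, t ∈ Icc (0:ℝ) 1 → On ψ z ν C σ (X t) (Zf (X t)) := fun t ht ht' => by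
        obtain ⟨e1, e2, e3, e4⟩ := hball t ht
        have hBt := hB t ht'.1 ht'.2
        have hnd := norm_pos_iff.2 (T.deriv_ne c.hδ c.G.mero e3)
        have hpos := mul_pos (c.rho_ne (X t)) hnd
        have hbad : ∀ σ' : ℂ, ‖σ - σ'‖ = 2 → On ψ z ν C σ' (X t) (Zf (X t)) → False := fun σ' h2 h => by
          have h3 := h.2
          have h5 : 2 * (‖rho C (X t)‖ * ‖deriv ψ (Zf (X t))‖) ≤
              ‖ee z ν (X t) / ν - σ' * rho C (X t) * deriv ψ (Zf (X t))‖ +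
              ‖ee z ν (X t) / ν - σ * rho C (X t) * deriv ψ (Zf (X t))‖ := by
            refine le_trans (le_of_eq ?_) (norm_sub_le _ _)
            rw [← h2, ← norm_mul, ← norm_mul]; congr 1; ring
          nlinarith only [h3, h5, e2, hpos, th0_le]
        rcases c.dich T hBt e1.le e4 with h | h <;> rcases hσ with h' | h' <;> subst h'
        · exact h
        · exact (hbad 1 (by norm_num) h).elim
        · exact (hbad (-1) (by norm_num) h).elim
        · exact h
      have hder : ∀ t ∈ ball t0 η, t ∈ Icc (0:ℝ) 1 → HasDerivAt (fun t => Zf (X t) - σ * (2 * rho C (X t)))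
          ((ee z ν (X t) / ν / deriv ψ (Zf (X t)) - σ * rho C (X t)) * d) t := fun t ht ht' => by
        obtain ⟨e1, e2, e3, e4⟩ := hball t ht
        obtain ⟨-, f2, -⟩ := c.Zd T e3 e4
        have g1 := HasDerivAt.comp t f2 (hXd t)
        have g2 := HasDerivAt.comp t (rho_hd (C := C) (s := X t)) (hXd t)
        exact (g1.sub ((g2.const_mul 2).const_mul σ)).congr_deriv (by ring)
      have hnb : Ioo t0 (min 1 (t0 + η)) ∈ 𝓝[>] t0 :=
        Ioo_mem_nhdsGT (lt_min ht1 (by linarith only [hη]))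
      filter_upwards [hnb] with t ht
      have ht1' := ht.2.trans_le (min_le_left _ _)
      have htη := ht.2.trans_le (min_le_right _ _)
      have hin : ∀ x ∈ Icc t0 t, x ∈ ball t0 η ∧ x ∈ Icc (0:ℝ) 1 := fun x hx => by
        refine ⟨?_, ht0.trans hx.1, hx.2.trans ht1'.le⟩
        rw [mem_ball, Real.dist_eq, abs_lt]; constructor <;> linarith only [hx.1, hx.2, htη, hη]
      have hmv := norm_image_sub_le_of_norm_deriv_le_segment' (a := t0) (b := t)
        (f := fun t => Zf (X t) - σ * (2 * rho C (X t))) (C := th0 * Λ * ‖d‖)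
        (fun x hx => (hder x (hin x hx).1 (hin x hx).2).hasDerivWithinAt) (fun x hx => by
          obtain ⟨i1, i2⟩ := hin x (Ico_subset_Icc_self hx)
          obtain ⟨-, -, e3, -⟩ := hball x i1
          have hnd := T.deriv_ne c.hδ c.G.mero e3
          have hndp := norm_pos_iff.2 hnd
          have h3 := (hon x i1 i2).2
          have h4 : (ee z ν (X x) / ν / deriv ψ (Zf (X x)) - σ * rho C (X x)) =
            (ee z ν (X x) / ν - σ * rho C (X x) * deriv ψ (Zf (X x))) / deriv ψ (Zf (X x)) := by rw [sub_div, mul_div_cancel_right₀ _ hnd]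
          rw [norm_mul, h4, norm_div]
          refine mul_le_mul_of_nonneg_right ?_ (norm_nonneg d)
          rw [div_le_iff₀ hndp]
          refine h3.trans ?_
          have := hΛ x i2.1 i2.2
          gcongr) t ⟨ht.1.le, le_rfl⟩
      obtain ⟨i1, i2⟩ := hin t ⟨ht.1.le, le_rfl⟩
      have hdist : ‖Zf (X t) - ζ1 - σ * (2 * rho C (X t) - 2 * rho C s1)‖ ≤ th0 * Λ * ‖d‖ * t := by
        have h3 := hF0.2.2
        have h4 : Zf (X t) - ζ1 - σ * (2 * rho C (X t) - 2 * rho C s1) =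
          (Zf (X t) - σ * (2 * rho C (X t)) - (Zf (X t0) - σ * (2 * rho C (X t0)))) +
          (ζ0 - ζ1 - σ * (2 * rho C (X t0) - 2 * rho C s1)) := by
            rw [show Zf (X t0) = ζ0 from hz0]; ring
        rw [h4]
        refine (norm_add_le _ _).trans ((add_le_add hmv h3).trans (le_of_eq ?_))
        ring
      have hreL : L0 ≤ (Zf (X t)).re := by
        have h3 := hre t i2.1 i2.2
        have h4 := (abs_le.1 ((Complex.abs_re_le_norm _).trans hdist)).1
        rw [Complex.sub_re, Complex.sub_re] at h4
        linarith only [h3, h4]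
      have ho := hon t i1 i2
      have hFt : (t, Zf (X t)) ∈ F := ⟨i2, hreL, hdist⟩
      exact ⟨(t, Zf (X t)), ⟨⟨hFt, by simp [ho.1]⟩, hFt, ho.2⟩, rfl⟩
  intro t ht0 ht1
  obtain ⟨⟨t', ζ⟩, ⟨⟨h3, h4⟩, -, h5⟩, rfl⟩ := hmain ⟨ht0, ht1⟩
  exact ⟨ζ, h3.2.1, ⟨sub_eq_zero.1 (norm_le_zero_iff.1 h4), h5⟩, h3.2.2⟩
end

end SW

namespace SW
open Metric

section
variable {Φ : ℂ → ℂ} {P V : Set ℂ} {A : ℂ → ℂ} {M : ℕ} {δ : ℝ} {z : ℂ} {ν B C : ℝ}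
  {a : ℂ} {ψ : ℂ → ℂ}

lemma Ctx.cont' (c : Ctx Φ P V A M δ z ν B C) (T : TrI Φ P a δ ψ) {s1 d ζ1 σ : ℂ} (hσ : σ = 1 ∨ σ = -1) {Λ : ℝ}
    (hB : ∀ t : ℝ, 0 ≤ t → t ≤ 1 → ‖s1 + t * d‖ ≤ B) (h1 : On ψ z ν C σ s1 ζ1) (hL : L0 ≤ ζ1.re)
    (hΛ : ∀ t : ℝ, 0 ≤ t → t ≤ 1 → ‖rho C (s1 + t * d)‖ ≤ Λ)
    (hm : ∀ t : ℝ, 0 ≤ t → t ≤ 1 → th0 * Λ * ‖d‖ ≤ (σ * rho C (s1 + t * d) * d).re) :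
    ∀ t : ℝ, 0 ≤ t → t ≤ 1 → ∃ ζ, L0 ≤ ζ.re ∧ On ψ z ν C σ (s1 + t * d) ζ ∧
      ‖ζ - ζ1 - σ * (2 * rho C (s1 + t * d) - 2 * rho C s1)‖ ≤ th0 * Λ * ‖d‖ * t := by
  refine c.cont T hσ hB h1 hΛ fun t h0 ht1 => ?_
  have hd : ∀ x : ℝ, HasDerivAt (fun t : ℝ => (σ * (2 * rho C (s1 + t * d))).re - th0 * Λ * ‖d‖ * t)
      ((σ * rho C (s1 + x * d) * d).re - th0 * Λ * ‖d‖) x := fun x => by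
    have h3 : HasDerivAt (fun w : ℂ => σ * (2 * rho C (s1 + w * d))) (σ * rho C (s1 + x * d) * d) x := by
      have h4 := ((hasDerivAt_id (x:ℂ)).mul_const d).const_add s1
      have h5 := HasDerivAt.comp (x:ℂ) (h₂ := rho C) rho_hd h4
      exact ((h5.const_mul 2).const_mul σ).congr_deriv (by simp; ring)
    exact (h3.real_of_complex.sub ((hasDerivAt_id x).const_mul _)).congr_deriv (by simp)
  have hmono : MonotoneOn (fun t : ℝ => (σ * (2 * rho C (s1 + t * d))).re - th0 * Λ * ‖d‖ * t) (Icc 0 1) := by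
    refine monotoneOn_of_deriv_nonneg (convex_Icc _ _) (fun x _ => (hd x).continuousAt.continuousWithinAt)
      (fun x _ => (hd x).differentiableAt.differentiableWithinAt) fun x hx => ?_
    rw [interior_Icc] at hx
    rw [(hd x).deriv]
    linarith only [hm x hx.1.le hx.2.le]
  have := hmono ⟨le_rfl, zero_le_one⟩ ⟨h0, ht1⟩ h0
  simp only [Complex.ofReal_zero, zero_mul, add_zero, mul_zero, sub_zero] at this
  rw [mul_sub, Complex.sub_re]
  linarith only [this, hL]

lemma Ctx.claim1 (c : Ctx Φ P V A M δ z ν B C) (T : TrI Φ P a δ ψ) {s ζ : ℂ} (hs : ‖s‖ ≤ B - 13)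
    (h : ψ ζ = ee z ν s) (hre : L0 + 14 * ‖rho C s‖ ≤ ζ.re) : False := by
  have hth := th0_pos
  have hth1 := th0_le
  have hL := L0_ge'
  have hΛ := c.rho_ne s
  have hpi := Real.pi_lt_d2
  have hpi0 := Real.pi_gt_three
  have hdn : ‖(4 * Real.pi * Complex.I : ℂ)‖ = 4 * Real.pi := by
    simp [abs_of_pos Real.pi_pos]
  have hn : ∀ t : ℝ, ‖rho C (s + t * (4 * Real.pi * Complex.I))‖ = ‖rho C s‖ := fun t => by
    rw [norm_rho c.Cpos.le, norm_rho c.Cpos.le]; simp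
  obtain ⟨σ, hσ, ho⟩ : ∃ σ : ℂ, (σ = 1 ∨ σ = -1) ∧ On ψ z ν C σ s ζ := by
    rcases c.dich T (by linarith only [hs]) (by linarith only [hL, hΛ, hre]) h with h | h
    · exact ⟨1, Or.inl rfl, h⟩
    · exact ⟨-1, Or.inr rfl, h⟩
  have hσn : ‖σ‖ = 1 := by rcases hσ with h | h <;> rw [h] <;> simp
  obtain ⟨ζ2, h2, h3, h4⟩ := c.cont T (s1 := s) (d := 4 * Real.pi * Complex.I) (Λ := ‖rho C s‖) hσ (fun t h0 ht1 => by
      refine (norm_add_le _ _).trans ?_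
      rw [norm_mul, hdn, Complex.norm_real, Real.norm_of_nonneg h0]
      nlinarith only [h0, ht1, hpi, hpi0, hs]) ho (fun t _ _ => (hn t).le) (fun t h0 ht1 => by
      have e1 : |(σ * (2 * rho C (s + t * (4 * Real.pi * Complex.I)) - 2 * rho C s)).re| ≤ 4 * ‖rho C s‖ := by
        refine (Complex.abs_re_le_norm _).trans ?_
        rw [norm_mul, hσn, one_mul]
        refine (norm_sub_le _ _).trans ?_
        rw [norm_mul, norm_mul, hn]; simp; linarith only
      have e2 := (abs_le.1 e1).1
      rw [hdn]
      have e3 : th0 * ‖rho C s‖ * (4 * Real.pi) * t ≤ 1 / 1000 * ‖rho C s‖ * (4 * 3.15) * 1 := by gcongr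
      linarith only [e2, e3, hre, hΛ]) 1 zero_le_one le_rfl
  have hp : rho C (s + (1:ℝ) * (4 * Real.pi * Complex.I)) = rho C s := by
    rw [rho_add, show ((1:ℝ):ℂ) * (4 * Real.pi * Complex.I) / 2 = 2 * Real.pi * Complex.I by push_cast; ring,
      Complex.exp_two_pi_mul_I, mul_one]
  rw [hp, sub_self, mul_zero, sub_zero, hdn] at h4
  have hr : 0 < ζ.re := by linarith only [hL, hΛ, hre]
  have hK := K0_pos
  have hζ : ζ ∈ Hp := by rw [mem_Hp]; exact hr
  have hsub := ball_re_sub (ζ := ζ)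
  have hdn0 := norm_pos_iff.2 (T.deriv_ne c.hδ c.G.mero hζ)
  have hmv : ‖ψ ζ2 - ψ ζ‖ ≤ (K0 * ‖deriv ψ ζ‖) * ‖ζ2 - ζ‖ := by
    have hmem : ∀ x ∈ closedBall ζ (ζ.re / 2), x ∈ ball ζ ζ.re := fun x hx =>
      closedBall_subset_ball (by linarith only [hr]) hx
    refine (convex_closedBall ζ (ζ.re / 2)).norm_image_sub_le_of_norm_deriv_le (fun x hx => T.hd (hsub (hmem x hx)))
      (fun x hx => koebe_half hr (T.diff.mono hsub) (T.inj.mono hsub) (mem_closedBall_iff_norm.1 hx)) ?_ ?_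
    · exact mem_closedBall_self (by linarith only [hr])
    · rw [mem_closedBall_iff_norm]
      refine h4.trans ?_
      have : th0 * ‖rho C s‖ * (4 * Real.pi) * 1 ≤ 1 / 1000 * ‖rho C s‖ * (4 * 3.15) * 1 := by gcongr
      linarith only [this, hre, hΛ, hL]
  have hν := c.νpos
  have hx : ‖(4 * Real.pi * Complex.I : ℂ) / ν‖ = 4 * Real.pi / ν := by
    rw [norm_div, hdn, Complex.norm_real, Real.norm_of_nonneg hν.le]
  have hx1 : 4 * Real.pi / ν ≤ 1 / 2 := by
    rw [div_le_iff₀ hν]; linarith only [hpi, c.hν, c.hB]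
  have hx0 : 0 < 4 * Real.pi / ν := by positivity
  have hlow : ‖ee z ν s‖ * (2 * Real.pi / ν) ≤ ‖ψ ζ2 - ψ ζ‖ := by
    rw [h3.1, h, ee_add]
    have e1 : ee z ν s * Complex.exp ((1:ℝ) * (4 * Real.pi * Complex.I) / ν) - ee z ν s =
      ee z ν s * (Complex.exp ((4 * Real.pi * Complex.I) / ν) - 1) := by push_cast; rw [one_mul]; ring
    rw [e1, norm_mul]
    refine mul_le_mul_of_nonneg_left ?_ (norm_nonneg _)
    have e2 := Complex.norm_exp_sub_one_sub_id_le (x := (4 * Real.pi * Complex.I : ℂ) / ν) (by rw [hx]; linarith only [hx1])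
    have e3 := norm_sub_norm_le ((4 * Real.pi * Complex.I : ℂ) / ν) (((4 * Real.pi * Complex.I : ℂ) / ν) - (Complex.exp ((4 * Real.pi * Complex.I) / ν) - 1))
    rw [sub_sub_cancel, norm_sub_rev ((4 * Real.pi * Complex.I : ℂ) / ν), hx] at e3
    rw [hx] at e2
    have e4 : 2 * Real.pi / ν = (4 * Real.pi / ν) / 2 := by ring
    rw [e4]; nlinarith only [e2, e3, hx0, hx1]
  have hOn : ‖rho C s‖ * ‖deriv ψ ζ‖ * (1 - th0) ≤ ‖ee z ν s‖ / ν := by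
    have e1 := ho.2
    have e2 := norm_sub_norm_le (σ * rho C s * deriv ψ ζ) (ee z ν s / ν)
    rw [norm_sub_rev, norm_mul, norm_mul, hσn, norm_div, Complex.norm_real, Real.norm_of_nonneg hν.le] at e2
    linarith only [e1, e2]
  have h5 : ‖ee z ν s‖ * (2 * Real.pi / ν) = (‖ee z ν s‖ / ν) * (2 * Real.pi) := by ring
  have h6 : K0 * ‖deriv ψ ζ‖ * ‖ζ2 - ζ‖ ≤ K0 * ‖deriv ψ ζ‖ * (th0 * ‖rho C s‖ * (4 * Real.pi) * 1) := by gcongr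
  have h7 : K0 * ‖deriv ψ ζ‖ * (th0 * ‖rho C s‖ * (4 * Real.pi) * 1) = (K0 * th0) * (‖rho C s‖ * ‖deriv ψ ζ‖) * (4 * Real.pi) := by ring
  rw [h7, th0_K] at h6
  have h8 := mul_pos hΛ hdn0
  have h9 : (‖ee z ν s‖ / ν) * (2 * Real.pi) ≤ 1 / 1000 * (‖rho C s‖ * ‖deriv ψ ζ‖) * (4 * Real.pi) := by
    linarith only [h5, h6, hmv, hlow]
  have h10 : (‖ee z ν s‖ / ν) ≤ 1 / 500 * (‖rho C s‖ * ‖deriv ψ ζ‖) := by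
    refine le_of_mul_le_mul_right ?_ (by positivity : (0:ℝ) < 2 * Real.pi)
    linarith only [h9]
  nlinarith only [h10, hOn, h8, hth1]
end

def sj (j : ℕ) : ℂ := j * (2 * Real.pi * Complex.I)

lemma rho_sj (C : ℝ) (j : ℕ) (w : ℂ) : rho C (sj j + w) = (-1) ^ j * rho C w := by
  rw [rho, rho, sj, show ((j:ℂ) * (2 * Real.pi * Complex.I) + w) / 2 = j * (Real.pi * Complex.I) + w / 2 by ring,
    Complex.exp_add, Complex.exp_nat_mul, Complex.exp_pi_mul_I]
  ring

lemma re_exp_lb {w d : ℂ} (hw : |w.im| ≤ 1 / 50) (hd : |d.im| ≤ d.re / 50) :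
    Real.exp (w.re / 2) * (0.99 * d.re) ≤ (Complex.exp (w / 2) * d).re := by
  rw [Complex.mul_re, Complex.exp_re, Complex.exp_im, Complex.div_ofNat_re, Complex.div_ofNat_im]
  have h1 := Real.one_sub_sq_div_two_le_cos (x := w.im / 2)
  have h2 : |Real.sin (w.im / 2)| ≤ |w.im / 2| := Real.abs_sin_le_abs
  have h3 : |w.im / 2| ≤ 1 / 100 := by rw [abs_div, abs_two]; linarith
  have h4 : |Real.sin (w.im / 2) * d.im| ≤ 1 / 100 * (d.re / 50) := by
    rw [abs_mul]; exact mul_le_mul (h2.trans h3) hd (abs_nonneg _) (by norm_num)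
  have hd0 : 0 ≤ d.re := by linarith [abs_nonneg d.im]
  have h5 : (w.im / 2) ^ 2 ≤ (1 / 100) ^ 2 := sq_le_sq' (abs_le.1 h3).1 (abs_le.1 h3).2
  have h6 : 0.999 * d.re ≤ Real.cos (w.im / 2) * d.re := by
    refine mul_le_mul_of_nonneg_right ?_ hd0
    linarith
  have h7 : 0.99 * d.re ≤ Real.cos (w.im / 2) * d.re - Real.sin (w.im / 2) * d.im := by
    linarith [(abs_le.1 h4).2]
  calc _ ≤ Real.exp (w.re / 2) * (Real.cos (w.im / 2) * d.re - Real.sin (w.im / 2) * d.im) := by gcongr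
    _ = _ := by ring

lemma exp5 : Real.exp 5 ≤ 149 ∧ 148 ≤ Real.exp 5 := by
  have h1 := Real.exp_one_lt_d9
  have h2 := Real.exp_one_gt_d9
  have h3 : Real.exp 5 = Real.exp 1 ^ 5 := by rw [← Real.exp_nat_mul]; norm_num
  rw [h3]
  constructor
  · calc Real.exp 1 ^ 5 ≤ 2.7182818286 ^ 5 := by gcongr
      _ ≤ 149 := by norm_num
  · calc (148:ℝ) ≤ 2.7182818283 ^ 5 := by norm_num
      _ ≤ _ := by gcongr

lemma exp4 : Real.exp (-4) ≤ 1 / 50 := by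
  have h2 := Real.exp_one_gt_d9
  have h3 : Real.exp 4 = Real.exp 1 ^ 4 := by rw [← Real.exp_nat_mul]; norm_num
  rw [Real.exp_neg, inv_le_comm₀ (Real.exp_pos _) (by norm_num), h3]
  calc _ ≤ (2.7182818283:ℝ) ^ 4 := by norm_num
    _ ≤ _ := by gcongr

end SW

namespace SW
open Metric

lemma sgn_cases (j : ℕ) : ((-1:ℂ) ^ j = 1 ∨ (-1:ℂ) ^ j = -1) ∧ (-1:ℂ) ^ j * (-1) ^ j = 1 :=
  ⟨neg_one_pow_eq_or ℂ j, by rw [← mul_pow]; norm_num⟩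

lemma rho_re_lb {C : ℝ} (hC : 0 < C) {w d : ℂ} (hw : |w.im| ≤ 1 / 50) (hd : |d.im| ≤ d.re / 50) :
    C * (Real.exp (w.re / 2) * (0.99 * d.re)) ≤ (rho C w * d).re := by
  rw [rho, mul_assoc, Complex.re_ofReal_mul]
  exact mul_le_mul_of_nonneg_left (re_exp_lb hw hd) hC.le

section
variable {Φ : ℂ → ℂ} {P V : Set ℂ} {A : ℂ → ℂ} {M : ℕ} {δ : ℝ} {z : ℂ} {ν B C : ℝ}
  {a : ℂ} {ψ : ℂ → ℂ}

lemma Ctx.noleft (c : Ctx Φ P V A M δ z ν B C) (T : TrI Φ P a δ ψ) {j : ℕ} {s' ζ : ℂ} (hs : ‖s'‖ ≤ 1 / 100)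
    (hj : ‖sj j‖ + 30 ≤ B) (hL : L0 ≤ ζ.re) (h : On ψ z ν C (-(-1) ^ j) (sj j + (-1 + s')) ζ) : False := by
  have hC := c.Cpos
  have hth := th0_pos
  have hth1 := th0_le
  obtain ⟨hτ, hτ2⟩ := sgn_cases j
  set τ : ℂ := (-1) ^ j with hτd
  have hre := (Complex.abs_re_le_norm s').trans hs
  have him := (Complex.abs_im_le_norm s').trans hs
  obtain ⟨hre1, hre2⟩ := abs_le.1 hre
  have hw : ∀ t : ℝ, sj j + (-1 + s') + t * (-8) = sj j + (-1 + s' - 8 * t) := fun t => by ring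
  have hwre : ∀ t : ℝ, (-1 + s' - 8 * (t:ℂ)).re = -1 + s'.re - 8 * t := fun t => by simp
  have hwim : ∀ t : ℝ, (-1 + s' - 8 * (t:ℂ)).im = s'.im := fun t => by simp
  have hτn : ‖τ‖ = 1 := by rcases hτ with h | h <;> rw [h] <;> simp
  have hwn : ∀ t : ℝ, 0 ≤ t → t ≤ 1 → ‖-1 + s' - 8 * (t:ℂ)‖ ≤ 10 := fun t h0 h1 => by
    calc _ ≤ ‖(-1:ℂ)‖ + ‖s'‖ + ‖8 * (t:ℂ)‖ := (norm_sub_le _ _).trans (by gcongr; exact norm_add_le _ _)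
      _ ≤ 1 + 1 / 100 + 8 * 1 := by
        rw [norm_mul, Complex.norm_real, Real.norm_of_nonneg h0]; simp only [norm_neg, norm_one, Complex.norm_ofNat]; gcongr
      _ ≤ 10 := by norm_num
  obtain ⟨ζ2, h2, h3, h4⟩ := c.cont' T (s1 := sj j + (-1 + s')) (d := -8) (Λ := C) (σ := -τ) (by
      rcases hτ with h | h <;> rw [h] <;> simp) (fun t h0 h1 => by
      rw [hw]
      linarith only [norm_add_le (sj j) (-1 + s' - 8 * (t:ℂ)), hwn t h0 h1, hj]) h hL (fun t h0 h1 => by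
      rw [hw, rho_sj, norm_mul, hτn, one_mul, norm_rho hC.le, hwre]
      have : Real.exp ((-1 + s'.re - 8 * t) / 2) ≤ 1 := Real.exp_le_one_iff.2 (by linarith only [hre2, h0])
      nlinarith only [this, hC]) (fun t h0 h1 => by
      rw [hw, rho_sj, ← hτd]
      have e0 : -τ * (τ * rho C (-1 + s' - 8 * t)) * (-8) = rho C (-1 + s' - 8 * t) * (8:ℝ) := by
        push_cast; linear_combination (8 * rho C (-1 + s' - 8 * t)) * hτ2
      rw [e0]
      refine le_trans ?_ (rho_re_lb hC (by rw [hwim]; linarith only [him]) (by simp; norm_num))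
      rw [hwre]
      have e1 : Real.exp (-5) ≤ Real.exp ((-1 + s'.re - 8 * t) / 2) := Real.exp_le_exp.2 (by linarith only [hre1, h1])
      have e2 : 1 / 149 ≤ Real.exp (-5) := by
        rw [Real.exp_neg, one_div]; exact inv_anti₀ (Real.exp_pos _) exp5.1
      have e3 : ‖(-8:ℂ)‖ = 8 := by norm_num
      have e4 : 1 / 1000 * 8 ≤ (Real.exp ((-1 + s'.re - 8 * t) / 2) * (0.99 * (8:ℝ))) := by linarith only [e1, e2]
      rw [e3, Complex.ofReal_re]
      nlinarith only [e4, hC, hth1]) 1 zero_le_one le_rfl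
  rw [hw] at h3 h4
  refine c.claim1 T (s := sj j + (-1 + s' - 8 * (1:ℝ))) (by
    linarith only [norm_add_le (sj j) (-1 + s' - 8 * ((1:ℝ):ℂ)), hwn 1 zero_le_one le_rfl, hj]) h3.1 ?_
  have e1 := (abs_le.1 ((Complex.abs_re_le_norm _).trans h4)).1
  have e2 : ζ2 - ζ - -τ * (2 * rho C (sj j + (-1 + s' - 8 * (1:ℝ))) - 2 * rho C (sj j + (-1 + s'))) =
      ζ2 - ζ - (rho C (-1 + s') * (1:ℝ) * 2 - rho C (-1 + s' - 8 * (1:ℝ)) * 2) := by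
    rw [rho_sj, rho_sj, ← hτd]; push_cast
    linear_combination (2 * rho C (-1 + s' - 8 * 1) - 2 * rho C (-1 + s')) * hτ2
  rw [e2] at e1
  have e3 := rho_re_lb hC (w := -1 + s') (d := (1:ℝ)) (by simp; linarith only [him]) (by simp)
  have e4 := (abs_le.1 (Complex.abs_re_le_norm (rho C (-1 + s' - 8 * (1:ℝ))))).2
  have e5 : ‖rho C (-1 + s' - 8 * (1:ℝ))‖ ≤ C * (1 / 50) := by
    rw [norm_rho hC.le, hwre]
    refine mul_le_mul_of_nonneg_left (le_trans (Real.exp_le_exp.2 ?_) exp4) hC.le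
    linarith only [hre2]
  have e6 : C * 0.49 ≤ C * (Real.exp ((-1 + s').re / 2) * (0.99 * ((1:ℝ):ℂ).re)) := by
    refine mul_le_mul_of_nonneg_left ?_ hC.le
    have := Real.add_one_le_exp ((-1 + s').re / 2)
    simp only [Complex.add_re, Complex.neg_re, Complex.one_re, Complex.ofReal_re] at this ⊢
    linarith only [this, hre1]
  have e7 : ‖(-8:ℂ)‖ = 8 := by norm_num
  have e8 : th0 * C ≤ 1 / 1000 * C := by gcongr
  have e9 : ∀ x : ℂ, (x * 2).re = x.re * 2 := fun x => by simp
  rw [e7, Complex.sub_re, Complex.sub_re, Complex.sub_re, e9, e9] at e1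
  rw [rho_sj, norm_mul, ← hτd, hτn, one_mul]
  linarith only [e1, e3, e4, e5, e6, e8, hL, hC]

set_option maxHeartbeats 800000 in
lemma Ctx.start (G : Good Φ P V A M) (hM : 0 < M) (hδ : 0 < δ) (hV : ∀ a ∈ V, ∀ v ∈ V, v ≠ a → δ ≤ ‖v - a‖) :
    ∃ Q0 : ℝ, ∀ z ν B C, Ctx Φ P V A M δ z ν B C → Q0 ≤ C → ∀ j : ℕ, ‖sj j‖ + 30 ≤ B →
      ee z ν (sj j - 1) ∉ P → ‖Φ (ee z ν (sj j - 1))‖ ≤ 2 →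
      ∃ a ∈ V, ∃ ψ, TrI Φ P a δ ψ ∧ (∃ ζ, L0 ≤ ζ.re ∧ On ψ z ν C ((-1) ^ j) (sj j) ζ) ∧
      (∀ t : ℝ, 0 ≤ t → t ≤ 10 → ∃ ζ ∈ Hp, ψ ζ = ee z ν (sj j + t)) ∧
      ∃ ζ, 290 * C ≤ ζ.re ∧ ψ ζ = ee z ν (sj j + 10) := by
  obtain ⟨Q0, hQ0, H⟩ := G.tile2 hM hδ hV (η := 1 / 100) (by norm_num) (by norm_num) L0
  refine ⟨Q0 * 32 + 1, fun z ν B C c hQ j hj hP hΦ => ?_⟩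
  have hC := c.Cpos
  have hth := th0_pos
  have hth1 := th0_le
  have hsub : sj j - 1 = sj j + (-1) := by ring
  have hn1 : ‖sj j - 1‖ ≤ ‖sj j‖ + 1 := (norm_sub_le _ _).trans (by simp)
  obtain ⟨s', hs', a, haV, ψ, ζ0, T, hζ0, he, hL⟩ := H _ _ ν (th0 / 4) (by linarith only [hth1])
    (by linarith only [c.hν, c.hB]) (c.box.shift (B' := 2) (sj j - 1) (by linarith only [hn1, hj])) hP hΦ (by
      rw [norm_mul, norm_neg, Complex.norm_real, Complex.norm_exp, Real.norm_of_nonneg (by positivity)]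
      have e1 : (sj j - 1).re = -1 := by simp [sj]
      have e2 : 1 / 8 ≤ Real.exp (-1) := by
        rw [Real.exp_neg, one_div]; refine inv_anti₀ (Real.exp_pos _) ?_
        linarith only [Real.exp_one_lt_d9]
      rw [e1]
      have e3 : Q0 * 32 ≤ C ^ 2 := by nlinarith only [hQ, hQ0]
      nlinarith only [e3, e2, sq_nonneg C])
  have he' : ψ ζ0 = ee z ν (sj j + (-1 + s')) := by
    rw [he, ← add_assoc, ← hsub]; exact (ee_add).symm
  obtain ⟨hτ, hτ2⟩ := sgn_cases j
  have hre := (Complex.abs_re_le_norm s').trans hs'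
  have him := (Complex.abs_im_le_norm s').trans hs'
  obtain ⟨hre1, hre2⟩ := abs_le.1 hre
  have hn2 : ‖sj j + (-1 + s')‖ ≤ ‖sj j‖ + 2 := by
    refine (norm_add_le _ _).trans ?_
    have := norm_add_le (-1) s'
    simp only [norm_neg, norm_one] at this
    linarith only [this, hs']
  have hon0 : On ψ z ν C ((-1) ^ j) (sj j + (-1 + s')) ζ0 := by
    have hno : On ψ z ν C (-(-1) ^ j) (sj j + (-1 + s')) ζ0 → On ψ z ν C ((-1) ^ j) (sj j + (-1 + s')) ζ0 :=
      fun h => (c.noleft T hs' hj hL h).elim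
    rcases c.dich T (by linarith only [hn2, hj]) (by linarith only [hL, L0_ge']) he' with h | h <;>
      rcases hτ with h' | h' <;> rw [h'] at hno ⊢
    · exact h
    · exact hno (by rwa [neg_neg])
    · exact hno h
    · exact h
  have hτn : ‖(-1:ℂ) ^ j‖ = 1 := by simp
  set τ : ℂ := (-1) ^ j with hτd
  have hdn : ‖1 - s'‖ ≤ 2 := by
    refine (norm_sub_le _ _).trans ?_
    rw [norm_one]; linarith only [hs']
  have hw : ∀ t : ℝ, sj j + (-1 + s') + t * (1 - s') = sj j + (-1 + s' + t * (1 - s')) := fun t => by ring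
  have hwre : ∀ t : ℝ, (-1 + s' + t * (1 - s')).re = (1 - t) * (-1 + s'.re) := fun t => by simp; ring
  have hwim : ∀ t : ℝ, (-1 + s' + t * (1 - s')).im = (1 - t) * s'.im := fun t => by simp; ring
  obtain ⟨ζ1, hL1, hon1, -⟩ := c.cont' T (s1 := sj j + (-1 + s')) (d := 1 - s') (Λ := C) hτ (fun t h0 h1 => by
      refine (norm_add_le _ _).trans ?_
      rw [norm_mul, Complex.norm_real, Real.norm_of_nonneg h0]
      nlinarith only [hdn, h0, h1, hn2, hj, norm_nonneg (1 - s')]) hon0 hL (fun t h0 h1 => by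
      rw [hw, rho_sj, norm_mul, ← hτd, hτn, one_mul, norm_rho hC.le, hwre]
      have : Real.exp ((1 - t) * (-1 + s'.re) / 2) ≤ 1 := Real.exp_le_one_iff.2 (by nlinarith only [hre2, h0, h1])
      nlinarith only [this, hC]) (fun t h0 h1 => by
      rw [hw, rho_sj, ← hτd]
      have e0 : τ * (τ * rho C (-1 + s' + t * (1 - s'))) * (1 - s') = rho C (-1 + s' + t * (1 - s')) * (1 - s') := by
        linear_combination (rho C (-1 + s' + t * (1 - s')) * (1 - s')) * hτ2
      rw [e0]
      have e5 : (1 - s').re = 1 - s'.re := by simp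
      refine le_trans ?_ (rho_re_lb hC ?_ ?_)
      · rw [hwre, e5]
        have e1 := Real.add_one_le_exp ((1 - t) * (-1 + s'.re) / 2)
        have e2 : 0.48 ≤ Real.exp ((1 - t) * (-1 + s'.re) / 2) := by nlinarith only [e1, h0, h1, hre1, hre2]
        have e3 : 0.48 * (0.99 * 0.99) ≤ Real.exp ((1 - t) * (-1 + s'.re) / 2) * (0.99 * (1 - s'.re)) := by
          gcongr; linarith only [hre2]
        have e4 : th0 * C * ‖1 - s'‖ ≤ 1 / 1000 * C * 2 := by gcongr
        nlinarith only [e3, e4, hC]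
      · rw [hwim, abs_mul, abs_of_nonneg (by linarith only [h1])]
        nlinarith only [him, h0, h1, abs_nonneg s'.im]
      · rw [e5]; simp only [Complex.sub_im, Complex.one_im, zero_sub, abs_neg]
        linarith only [him, hre2]) 1 zero_le_one le_rfl
  have e1 : sj j + (-1 + s') + (1:ℝ) * (1 - s') = sj j := by push_cast; ring
  rw [e1] at hon1
  have hrt : ∀ t : ℝ, rho C (sj j + t * 10) = τ * (C * Real.exp (t * 5) : ℝ) := fun t => by
    rw [rho_sj, ← hτd, rho]; congr 1; push_cast; congr 2; ring
  have hnt : ∀ t : ℝ, 0 ≤ t → t ≤ 1 → ‖(t:ℂ) * 10‖ ≤ 10 := fun t h0 h1 => by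
    rw [norm_mul, Complex.norm_real, Real.norm_of_nonneg h0]; norm_num; linarith only [h1]
  have hn10 : ‖(10:ℂ)‖ = 10 := by norm_num
  have hcont := c.cont' T (s1 := sj j) (d := 10) (Λ := C * 149) hτ (fun t h0 h1 => by
      linarith only [norm_add_le (sj j) (t * 10), hnt t h0 h1, hj]) hon1 hL1 (fun t h0 h1 => by
      rw [hrt, norm_mul, hτn, one_mul, Complex.norm_real, Real.norm_of_nonneg (by positivity)]
      refine mul_le_mul_of_nonneg_left (le_trans (Real.exp_le_exp.2 ?_) exp5.1) hC.le
      linarith only [h1]) (fun t h0 h1 => by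
      have e2 : τ * (τ * (C * Real.exp (t * 5) : ℝ)) * 10 = ((C * Real.exp (t * 5) * 10 : ℝ) : ℂ) := by
        push_cast; linear_combination (C * Complex.exp (t * 5) * 10) * hτ2
      rw [hrt, e2, Complex.ofReal_re, hn10]
      have e3 : 1 ≤ Real.exp (t * 5) := Real.one_le_exp (by linarith only [h0])
      have e4 : th0 * (C * 149) * 10 ≤ 1 / 1000 * (C * 149) * 10 := by gcongr
      nlinarith only [e3, e4, hC])
  refine ⟨a, haV, ψ, T, ⟨ζ1, hL1, hon1⟩, fun t h0 h1 => ?_, ?_⟩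
  · obtain ⟨ζ, g1, g2, -⟩ := hcont (t / 10) (by positivity) (by linarith only [h1])
    refine ⟨ζ, by rw [mem_Hp]; linarith only [g1, L0_ge'], ?_⟩
    rw [g2.1]; congr 2; push_cast; ring
  · obtain ⟨ζ, g1, g2, g3⟩ := hcont 1 zero_le_one le_rfl
    refine ⟨ζ, ?_, by rw [g2.1]; congr 2; push_cast; ring⟩
    have e2 := (abs_le.1 ((Complex.abs_re_le_norm _).trans g3)).1
    have e3 : τ * (2 * rho C (sj j + (1:ℝ) * 10) - 2 * rho C (sj j)) = ((2 * (C * Real.exp 5) - 2 * C : ℝ) : ℂ) := by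
      have e4 := hrt 0
      simp only [Complex.ofReal_zero, zero_mul, add_zero, Real.exp_zero, mul_one] at e4
      rw [hrt, e4]; push_cast; rw [one_mul]; linear_combination (2 * (C * Complex.exp 5) - 2 * C) * hτ2
    rw [e3, Complex.sub_re, Complex.sub_re, Complex.ofReal_re, hn10] at e2
    have e4 : th0 * (C * 149) * 10 ≤ 1 / 1000 * (C * 149) * 10 := by gcongr
    have e5 := exp5.2
    nlinarith only [e2, e4, e5, hC, hL1, L0_ge']
end

end SW

namespace SW
open Metric

def vv (H : ℂ → ℂ) (a s : ℂ) : ℂ := - deriv (deriv H) s / (2 * deriv H s) + deriv H s / (H s - a)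

lemma vv_hd {H : ℂ → ℂ} {a s : ℂ} (hH : AnalyticAt ℂ H s) (h1 : deriv H s ≠ 0) (h2 : H s ≠ a) :
    HasDerivAt (vv H a) (- schwarzian H s / 2 - vv H a s ^ 2) s := by
  have d0 := hH.differentiableAt.hasDerivAt
  have d1 := hH.deriv.differentiableAt.hasDerivAt
  have d2 := hH.deriv.deriv.differentiableAt.hasDerivAt
  have h2' := sub_ne_zero.2 h2
  have e := ((d2.neg.div (d1.const_mul 2) (mul_ne_zero two_ne_zero h1)).add (d1.div (d0.sub_const a) h2'))
  refine e.congr_deriv ?_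
  unfold vv schwarzian
  simp only [Pi.neg_apply]
  field_simp
  ring

lemma trap_ineq {x E d ρ σ : ℂ} (hx : ‖x‖ = 1 / 4) (hσ : ‖σ‖ = 1) (hd : ‖d‖ ≤ 6)
    (hr : (σ * ρ * d).re ≤ -3 * ‖ρ‖) (hρ : 100 ≤ ‖ρ‖) (hE : ‖E‖ ≤ ‖ρ‖ / 1000 + 1) :
    inner ℝ x (d * (σ * ρ * x * (1 - σ * x)) + d * E) < 0 := by
  rw [Complex.inner]
  have h1 : (starRingEnd ℂ) x * x = ((1 / 16 : ℝ) : ℂ) := by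
    rw [Complex.conj_mul', hx]; norm_num
  have h2 : (d * (σ * ρ * x * (1 - σ * x)) + d * E) * (starRingEnd ℂ) x =
      ((1 / 16 : ℝ) : ℂ) * (σ * ρ * d - σ * ρ * d * (σ * x)) + (starRingEnd ℂ) x * d * E := by
    rw [← h1]; ring
  rw [h2, Complex.add_re, Complex.re_ofReal_mul, Complex.sub_re]
  have h3 : |(σ * ρ * d * (σ * x)).re| ≤ ‖ρ‖ * 6 * (1 / 4) := by
    refine (Complex.abs_re_le_norm _).trans ?_
    rw [norm_mul, norm_mul, norm_mul, norm_mul, hσ, hx, one_mul, one_mul]; gcongr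
  have h4 : |((starRingEnd ℂ) x * d * E).re| ≤ 1 / 4 * 6 * (‖ρ‖ / 1000 + 1) := by
    refine (Complex.abs_re_le_norm _).trans ?_
    rw [norm_mul, norm_mul, RCLike.norm_conj, hx]; gcongr
  have := (abs_le.1 h3).1
  have := (abs_le.1 h4).2
  linarith

lemma trap_alg {N q ρ y σ d : ℂ} (h : ρ ≠ 0) (hσ : σ * σ = 1) :
    ((N - q - ((y - σ / 2) * ρ) ^ 2) * d * ρ - (y - σ / 2) * ρ * (ρ / 2 * d)) / ρ ^ 2 =
    d * (σ * ρ * y * (1 - σ * y)) + d * (-(q + ρ ^ 2 / 4) / ρ + N / ρ - (y - σ / 2) / 2) := by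
  field_simp
  linear_combination (16 * d * ρ ^ 2 * (y ^ 2 - 1 / 4)) * hσ

section
variable {Φ : ℂ → ℂ} {P V : Set ℂ} {A : ℂ → ℂ} {M : ℕ} {δ : ℝ} {z : ℂ} {ν B C : ℝ}
  {a : ℂ} {ψ : ℂ → ℂ}

lemma Ctx.XX (c : Ctx Φ P V A M δ z ν B C) {s : ℂ} (hs : ‖s‖ ≤ B - 2) (hP : ee z ν s ∉ P) : ee z ν s ∈ XX Φ P :=
  c.G.box_XX (c.box.shift (B' := 2) s (by linarith)) (by linarith [th0_le]) (by linarith [c.hν, c.hB]) le_rfl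
    (by simp) hP

lemma Ctx.ap (c : Ctx Φ P V A M δ z ν B C) {s : ℂ} (hs : ‖s‖ ≤ B) :
    ‖A (ee z ν s) * ee z ν s ^ 2 / ν ^ 2 + rho C s ^ 2 / 4‖ ≤ th0 / 4 * (‖rho C s‖ ^ 2 / 4) := by
  have := c.box.ap s hs
  have hρ2 : -((C ^ 2 / 4 : ℝ) : ℂ) * Complex.exp s = - (rho C s ^ 2 / 4) := by
    rw [rho, mul_pow, ← Complex.exp_nat_mul, show ((2:ℕ):ℂ) * (s / 2) = s by push_cast; ring]
    push_cast; ring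
  rw [hρ2, sub_neg_eq_add, norm_neg, norm_div, norm_pow] at this
  simpa using this

lemma Ctx.Hs (c : Ctx Φ P V A M δ z ν B C) {s : ℂ} (hs : ‖s‖ ≤ B - 2) (hP : ee z ν s ∉ P) :
    AnalyticAt ℂ (fun x => Φ (ee z ν x)) s ∧ deriv (fun x => Φ (ee z ν x)) s ≠ 0 ∧
    - schwarzian (fun x => Φ (ee z ν x)) s / 2 = 1 / (4 * ν ^ 2) - A (ee z ν s) * ee z ν s ^ 2 / ν ^ 2 := by
  have hX := c.XX hs hP
  have hν : (ν:ℂ) ≠ 0 := by exact_mod_cast c.νpos.ne'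
  have he : AnalyticAt ℂ (ee z ν) s := by unfold ee; fun_prop
  have hΦ := c.G.mero.2.1 _ hP
  have hde : deriv (ee z ν) s = ee z ν s / ν := ee_hd.deriv
  have hd0 : deriv (ee z ν) s ≠ 0 := by rw [hde]; exact div_ne_zero (c.ee_ne s) hν
  refine ⟨hΦ.comp he, ?_, ?_⟩
  · have := HasDerivAt.comp s hΦ.differentiableAt.hasDerivAt he.differentiableAt.hasDerivAt
    rw [show (fun x => Φ (ee z ν x)) = Φ ∘ ee z ν from rfl, this.deriv]
    exact mul_ne_zero hX.2 hd0
  · rw [schwarzian_comp he hΦ hX.2 hd0, c.G.schw _ hP hX.2, hde]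
    have : ee z ν = fun x => 0 + z * Complex.exp ((ν:ℂ)⁻¹ * x) := by
      funext x; rw [ee, zero_add, div_eq_inv_mul]
    have h2 : schwarzian (ee z ν) s = - (ν:ℂ)⁻¹ ^ 2 / 2 := by
      rw [this]; exact schwarzian_exp 0 z s c.box.z0 _ (inv_ne_zero hν)
    rw [h2]; field_simp; ring

lemma Ctx.trap (c : Ctx Φ P V A M δ z ν B C) {s1 d σ : ℂ} (hσ : σ = 1 ∨ σ = -1) (hd : ‖d‖ ≤ 6)
    (hB : ∀ t : ℝ, 0 ≤ t → t ≤ 1 → ‖s1 + t * d‖ ≤ B - 2)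
    (hP : ∀ t : ℝ, 0 ≤ t → t ≤ 1 → ee z ν (s1 + t * d) ∉ P ∧ Φ (ee z ν (s1 + t * d)) ≠ a)
    (hr : ∀ t : ℝ, 0 ≤ t → t ≤ 1 → (σ * rho C (s1 + t * d) * d).re ≤ -3 * ‖rho C (s1 + t * d)‖)
    (hρ : ∀ t : ℝ, 0 ≤ t → t ≤ 1 → 100 ≤ ‖rho C (s1 + t * d)‖)
    (h0 : ‖vv (fun x => Φ (ee z ν x)) a s1 / rho C s1 + σ / 2‖ ≤ 1 / 4) :
    ‖vv (fun x => Φ (ee z ν x)) a (s1 + d) / rho C (s1 + d) + σ / 2‖ ≤ 1 / 4 := by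
  have hσn : ‖σ‖ = 1 := by rcases hσ with h | h <;> rw [h] <;> simp
  have hσ2 : σ * σ = 1 := by rcases hσ with h | h <;> rw [h] <;> simp
  set H := fun x => Φ (ee z ν x) with hH
  set v := vv H a with hv
  set X : ℝ → ℂ := fun t => s1 + t * d with hX
  have hXd : ∀ t : ℝ, HasDerivAt X d t := fun t => by
    exact (((hasDerivAt_id t).ofReal_comp.mul_const d).const_add s1).congr_deriv (by simp)
  set x : ℝ → ℂ := fun t => v (X t) / rho C (X t) + σ / 2 with hx
  have hν := c.νpos
  have hder : ∀ t : ℝ, 0 ≤ t → t ≤ 1 → ∃ E : ℂ, HasDerivAt x (d * (σ * rho C (X t) * x t * (1 - σ * x t)) + d * E) t ∧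
      (‖x t‖ = 1 / 4 → ‖E‖ ≤ ‖rho C (X t)‖ / 1000 + 1) := fun t h0 h1 => by
    obtain ⟨g1, g2, g3⟩ := c.Hs (hB t h0 h1) (hP t h0 h1).1
    have hvd : HasDerivAt v (- schwarzian H (X t) / 2 - v (X t) ^ 2) (X t) := vv_hd g1 g2 (hP t h0 h1).2
    rw [show (- schwarzian H (X t) / 2) = _ from g3] at hvd
    have hap := c.ap (s := X t) (by linarith only [hB t h0 h1])
    change _ = 1 / (4 * (ν:ℂ) ^ 2) - A (ee z ν (X t)) * ee z ν (X t) ^ 2 / ν ^ 2 at g3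
    change HasDerivAt v (1 / (4 * (ν:ℂ) ^ 2) - A (ee z ν (X t)) * ee z ν (X t) ^ 2 / ν ^ 2 - v (X t) ^ 2) (X t) at hvd
    set q := A (ee z ν (X t)) * ee z ν (X t) ^ 2 / ν ^ 2 with hq
    set ρ := rho C (X t) with hρd
    have hρt : 100 ≤ ‖ρ‖ := hρ t h0 h1
    have hρ0 : ρ ≠ 0 := norm_pos_iff.1 (by linarith only [hρt])
    have k1 := HasDerivAt.comp t hvd (hXd t)
    have k2 := HasDerivAt.comp t (rho_hd (C := C) (s := X t)) (hXd t)
    refine ⟨-(q + ρ ^ 2 / 4) / ρ + 1 / (4 * ν ^ 2) / ρ - (x t - σ / 2) / 2,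
      ((k1.div k2 hρ0).add_const (σ / 2)).congr_deriv ?_, fun hxt => ?_⟩
    · have hu : v (X t) = (x t - σ / 2) * ρ := by
        rw [hx]; dsimp only; rw [← hρd]; field_simp; ring
      simp only [Function.comp_apply]
      rw [← hρd, hu]
      exact trap_alg hρ0 hσ2
    · have b1 : ‖-(q + ρ ^ 2 / 4) / ρ‖ ≤ th0 / 16 * ‖ρ‖ := by
        rw [norm_div, norm_neg, div_le_iff₀ (by linarith only [hρt])]
        refine hap.trans (le_of_eq (by ring))
      have b2 : ‖1 / (4 * (ν:ℂ) ^ 2) / ρ‖ ≤ 1 / 4 := by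
        rw [norm_div, norm_div, norm_mul, norm_pow, Complex.norm_real, Real.norm_of_nonneg hν.le, norm_one]
        have : (400:ℝ) ≤ ν := by linarith only [c.hν, c.hB]
        have h4 : ‖(4:ℂ)‖ = 4 := by norm_num
        rw [div_div, h4, div_le_iff₀ (mul_pos (by positivity) (by linarith only [hρt]))]
        have : 1 * 1 ≤ ν ^ 2 * ‖ρ‖ := mul_le_mul (by nlinarith only [this]) (by linarith only [hρt]) zero_le_one (by positivity)
        linarith only [this]
      have b3 : ‖(x t - σ / 2) / 2‖ ≤ 3 / 8 := by
        rw [norm_div]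
        have := norm_sub_le (x t) (σ / 2)
        rw [hxt, norm_div, hσn] at this
        norm_num at this ⊢; linarith only [this]
      refine (norm_sub_le _ _).trans ?_
      have b4 := norm_add_le (-(q + ρ ^ 2 / 4) / ρ) (1 / (4 * (ν:ℂ) ^ 2) / ρ)
      have b5 : th0 / 16 * ‖ρ‖ ≤ (1 / 1000) / 16 * ‖ρ‖ := by gcongr; exact th0_le
      linarith only [b1, b2, b3, b4, b5, hρt]
  choose! E hE1 hE2 using hder
  have hfin := image_le_of_deriv_right_lt_deriv_boundary' (a := 0) (b := 1) (f := fun t => ‖x t‖ ^ 2)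
    (f' := fun t => 2 * inner ℝ (x t) (d * (σ * rho C (X t) * x t * (1 - σ * x t)) + d * E t))
    (B := fun _ => 1 / 16) (B' := fun _ => 0)
    (fun t ht => (hE1 t ht.1 ht.2).norm_sq.continuousAt.continuousWithinAt)
    (fun t ht => (hE1 t ht.1 ht.2.le).norm_sq.hasDerivWithinAt) (by
      have : ‖x 0‖ ≤ 1 / 4 := by simpa [hx, hX] using h0
      nlinarith only [this, norm_nonneg (x 0)]) continuousOn_const
    (fun t _ => (hasDerivAt_const _ _).hasDerivWithinAt) (fun t ht he => by
      have hxt : ‖x t‖ = 1 / 4 := by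
        nlinarith only [he, norm_nonneg (x t), sq_nonneg (‖x t‖ - 1 / 4)]
      have := trap_ineq hxt hσn hd (hr t ht.1 ht.2.le) (hρ t ht.1 ht.2.le) (hE2 t ht.1 ht.2.le hxt)
      linarith only [this]) (x := 1) ⟨zero_le_one, le_rfl⟩
  have h1 : x 1 = v (s1 + d) / rho C (s1 + d) + σ / 2 := by simp [hx, hX]
  rw [← h1]
  nlinarith only [hfin, norm_nonneg (x 1)]
end

end SW

namespace SW
open Metric

lemma vv_tract {H Z Z1 : ℂ → ℂ} {a δ s Z2 : ℂ} (hδ : δ ≠ 0) (hH : ∀ᶠ x in 𝓝 s, H x = a + δ * Complex.exp (-Z x))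
    (hZ : ∀ᶠ x in 𝓝 s, HasDerivAt Z (Z1 x) x) (hZ1 : HasDerivAt Z1 Z2 s) (h0 : Z1 s ≠ 0) :
    vv H a s = - Z1 s / 2 - Z2 / (2 * Z1 s) := by
  have e1 : ∀ᶠ x in 𝓝 s, HasDerivAt H (-(Z1 x * (δ * Complex.exp (-Z x)))) x := by
    filter_upwards [hH.eventually_nhds, hZ] with x h1 h2
    have : HasDerivAt (fun x => a + δ * Complex.exp (-Z x)) (-(Z1 x * (δ * Complex.exp (-Z x)))) x :=
      ((h2.neg.cexp.const_mul δ).const_add a).congr_deriv (by simp only [Pi.neg_apply]; ring)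
    exact this.congr_of_eventuallyEq h1
  have e2 : deriv H =ᶠ[𝓝 s] fun x => -(Z1 x * (δ * Complex.exp (-Z x))) := e1.mono fun x h => h.deriv
  have e3 : HasDerivAt (fun x => -(Z1 x * (δ * Complex.exp (-Z x))))
      ((Z1 s ^ 2 - Z2) * (δ * Complex.exp (-Z s))) s :=
    (hZ1.mul (hZ.self_of_nhds.neg.cexp.const_mul δ)).neg.congr_deriv (by simp only [Pi.neg_apply]; ring)
  unfold vv
  rw [e2.deriv_eq, e3.deriv, e2.eq_of_nhds, hH.self_of_nhds, add_sub_cancel_left]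
  have h3 := Complex.exp_ne_zero (-Z s)
  field_simp
  ring

section
variable {Φ : ℂ → ℂ} {P V : Set ℂ} {A : ℂ → ℂ} {M : ℕ} {δ : ℝ} {z : ℂ} {ν B C : ℝ}
  {a : ℂ} {ψ : ℂ → ℂ}

lemma Ctx.uval (c : Ctx Φ P V A M δ z ν B C) (T : TrI Φ P a δ ψ) {s ζ σ : ℂ} (hσ : σ = 1 ∨ σ = -1)
    (hL : L0 ≤ ζ.re) (ho : On ψ z ν C σ s ζ) (hρ : 100 ≤ ‖rho C s‖) :
    ee z ν s ∉ P ∧ Φ (ee z ν s) ≠ a ∧ ‖vv (fun x => Φ (ee z ν x)) a s / rho C s + σ / 2‖ ≤ 1 / 4 := by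
  have hLL := L0_ge'
  have hr : 0 < ζ.re := by linarith only [hL, hLL]
  have hζ : ζ ∈ Hp := by rw [mem_Hp]; exact hr
  have hδ' : (δ:ℂ) ≠ 0 := by exact_mod_cast c.hδ.ne'
  have hσn : ‖σ‖ = 1 := by rcases hσ with h | h <;> rw [h] <;> simp
  obtain ⟨l1, l2⟩ := T.lift ζ hζ
  rw [ho.1] at l1 l2
  refine ⟨l1.1, by rw [l2]; simpa using hδ', ?_⟩
  obtain ⟨z1, z2, z3⟩ := c.Zd T hζ ho.1
  have hev : ∀ᶠ x in 𝓝 s, Φ (ee z ν x) = a + δ * Complex.exp (-Function.invFunOn ψ Hp (ee z ν x)) := by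
    filter_upwards [z3] with x hx
    rw [← (T.lift _ hx.1).2, hx.2]
  have hev1 : ∀ᶠ x in 𝓝 s, HasDerivAt (fun s => Function.invFunOn ψ Hp (ee z ν s))
      (ee z ν x / ν / deriv ψ (Function.invFunOn ψ Hp (ee z ν x))) x := by
    filter_upwards [z3] with x hx using (c.Zd T hx.1 hx.2).2.1
  have hne := T.deriv_ne c.hδ c.G.mero hζ
  have hnp := norm_pos_iff.2 hne
  have hν := c.νpos
  have hνc : (ν:ℂ) ≠ 0 := by exact_mod_cast hν.ne'
  have hdd : HasDerivAt (deriv ψ) (deriv (deriv ψ) ζ) (Function.invFunOn ψ Hp (ee z ν s)) := by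
    rw [z1]
    exact ((T.diff.deriv Hp_open).differentiableAt (Hp_open.mem_nhds hζ)).hasDerivAt
  have hZ1 := (ee_hd (z := z) (ν := ν) (s := s)).div_const (ν:ℂ) |>.div (HasDerivAt.comp s hdd z2) (by
    rw [Function.comp_apply, z1]; exact hne)
  simp only [Function.comp_apply, z1] at hZ1
  rw [vv_tract hδ' hev hev1 hZ1 (by rw [z1]; exact div_ne_zero (div_ne_zero (c.ee_ne s) hνc) hne), z1]
  set D := ee z ν s / ν / deriv ψ ζ with hD
  have hD0 : D ≠ 0 := div_ne_zero (div_ne_zero (c.ee_ne s) hνc) hne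
  have hZ2 : (ee z ν s / ↑ν / ↑ν * deriv ψ ζ - ee z ν s / ↑ν * (deriv (deriv ψ) ζ * D)) / deriv ψ ζ ^ 2 / (2 * D) =
      1 / (2 * ν) - deriv (deriv ψ) ζ / deriv ψ ζ * D / 2 := by
    have h1 : ee z ν s / ν = D * deriv ψ ζ := by rw [hD]; field_simp
    rw [h1]; field_simp
  rw [hZ2]
  have hb : ‖deriv (deriv ψ) ζ / deriv ψ ζ‖ ≤ 1 / 500 := by
    have hsub := ball_re_sub (ζ := ζ)
    have hd : DiffContOnCl ℂ (deriv ψ) (ball ζ (ζ.re / 2)) :=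
      (((T.diff.mono hsub).deriv isOpen_ball).mono (closedBall_subset_ball (by linarith only [hr]))).diffContOnCl_ball
        subset_rfl
    have := Complex.norm_deriv_le_of_forall_mem_sphere_norm_le (by linarith only [hr]) hd
      (fun x hx => koebe_half hr (T.diff.mono hsub) (T.inj.mono hsub) (mem_sphere_iff_norm.1 hx).le)
    rw [norm_div, div_le_iff₀ hnp]
    refine this.trans ?_
    rw [div_le_iff₀ (by linarith only [hr])]
    nlinarith only [mul_le_mul_of_nonneg_right (L0_ge.trans hL) hnp.le]
  have hDσ : ‖D - σ * rho C s‖ ≤ th0 * ‖rho C s‖ := by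
    have h1 : D - σ * rho C s = (ee z ν s / ν - σ * rho C s * deriv ψ ζ) / deriv ψ ζ := by
      rw [hD, sub_div, mul_div_cancel_right₀ _ hne]
    rw [h1, norm_div, div_le_iff₀ hnp]; exact ho.2
  set ρ := rho C s with hρd
  have hρp : 0 < ‖ρ‖ := by linarith only [hρ]
  have hρ0 : ρ ≠ 0 := norm_pos_iff.1 hρp
  set k := deriv (deriv ψ) ζ / deriv ψ ζ with hk
  have hDn : ‖D‖ ≤ 2 * ‖ρ‖ := by
    have := norm_le_norm_sub_add D (σ * ρ)
    rw [norm_mul, hσn, one_mul] at this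
    nlinarith only [this, hDσ, th0_le, hρp]
  have e1 : (-D / 2 - (1 / (2 * ν) - k * D / 2)) / ρ + σ / 2 = (-(D - σ * ρ) / 2 - 1 / (2 * ν) + k * D / 2) / ρ := by
    field_simp; ring
  rw [e1, norm_div, div_le_iff₀ hρp]
  have b1 : ‖-(D - σ * ρ) / 2‖ ≤ th0 * ‖ρ‖ / 2 := by
    rw [norm_div, norm_neg, Complex.norm_ofNat]; gcongr
  have b2 : ‖1 / (2 * (ν:ℂ))‖ ≤ 1 := by
    rw [norm_div, norm_mul, Complex.norm_real, Real.norm_of_nonneg hν.le, norm_one, Complex.norm_ofNat,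
      div_le_one (by positivity)]
    linarith only [c.hν, c.hB]
  have b3 : ‖k * D / 2‖ ≤ 1 / 500 * (2 * ‖ρ‖) / 2 := by
    rw [norm_div, norm_mul, Complex.norm_ofNat]; gcongr
  have b4 := norm_add_le (-(D - σ * ρ) / 2 - 1 / (2 * (ν:ℂ))) (k * D / 2)
  have b5 := norm_sub_le (-(D - σ * ρ) / 2) (1 / (2 * (ν:ℂ)))
  have b6 : th0 * ‖ρ‖ ≤ 1 / 1000 * ‖ρ‖ := by gcongr; exact th0_le
  linarith only [b1, b2, b3, b4, b5, b6, hρ]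

lemma Ctx.inj (c : Ctx Φ P V A M δ z ν B C) {s t : ℂ} (hs : ‖s‖ ≤ B) (ht : ‖t‖ ≤ B) (h : ee z ν s = ee z ν t) : s = t := by
  have h1 : Complex.exp (s / ν) = Complex.exp (t / ν) := mul_left_cancel₀ c.box.z0 h
  obtain ⟨n, hn⟩ := Complex.exp_eq_exp_iff_exists_int.1 h1
  have hν := c.νpos
  have hνc : (ν:ℂ) ≠ 0 := by exact_mod_cast hν.ne'
  have h2 : s - t = n * (2 * Real.pi * Complex.I) * ν := by field_simp at hn; linear_combination hn
  have h3 : ‖s - t‖ ≤ ν / 2 := (norm_sub_le _ _).trans (by linarith only [hs, ht, c.hν])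
  rw [h2] at h3
  have h4 : ‖(n:ℂ) * (2 * Real.pi * Complex.I) * ν‖ = |(n:ℝ)| * (2 * Real.pi) * ν := by
    simp [abs_of_pos Real.pi_pos, abs_of_pos hν]
  rw [h4] at h3
  by_cases hn0 : n = 0
  · rw [hn0] at h2; simpa [sub_eq_zero] using h2
  · have : (1:ℝ) ≤ |(n:ℝ)| := by exact_mod_cast Int.one_le_abs hn0
    have h5 := Real.pi_gt_three
    have h6 : 1 * (2 * 3) * ν ≤ |(n:ℝ)| * (2 * Real.pi) * ν := by gcongr
    linarith only [h3, h6, hν]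
end

end SW

namespace SW
open Metric

lemma sj_norm_le (j : ℕ) (w : ℂ) {r : ℝ} (h : ‖w‖ ≤ r) : ‖sj j + w‖ ≤ ‖sj j‖ + r :=
  (norm_add_le _ _).trans (by linarith)

lemma sj_succ (j : ℕ) : sj (j + 1) = sj j + 2 * Real.pi * Complex.I := by
  unfold sj; push_cast; ring

section
variable {Φ : ℂ → ℂ} {P V : Set ℂ} {A : ℂ → ℂ} {M : ℕ} {δ : ℝ} {z : ℂ} {ν B C : ℝ}
  {a : ℂ} {ψ ψ₂ : ℂ → ℂ}

lemma Ctx.bad_fin (c : Ctx Φ P V A M δ z ν B C) (a : ℂ) :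
    {s : ℂ | ‖s‖ ≤ B ∧ (ee z ν s ∈ P ∨ Φ (ee z ν s) = a)}.Finite := by
  have hc : Continuous (ee z ν) := by unfold ee; fun_prop
  have h1 := lf_of_ev (S := {w | w ∈ P ∨ Φ w = a}) (fun x => (c.G.ev x a).mono fun w hw h => by
    rcases h with h | h
    exacts [hw.1 h, hw.2 h]) (ee z ν '' closedBall 0 B) ((isCompact_closedBall 0 B).image hc)
  refine Set.Finite.of_finite_image (f := ee z ν) (h1.subset ?_) ?_
  · rintro _ ⟨s, hs, rfl⟩
    exact ⟨hs.2, s, by simpa using hs.1, rfl⟩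
  · intro s hs t ht h
    exact c.inj hs.1 ht.1 h

lemma Ctx.kappa (c : Ctx Φ P V A M δ z ν B C) (j : ℕ) (hj : ‖sj j‖ + 30 ≤ B)
    (h0 : ee z ν (sj j) ∉ P ∧ Φ (ee z ν (sj j)) ≠ a)
    (h1 : ee z ν (sj (j+1)) ∉ P ∧ Φ (ee z ν (sj (j+1))) ≠ a) :
    ∃ κ : ℝ, 3 ≤ κ ∧ κ ≤ 4 ∧ ∀ t : ℝ, 0 ≤ t → t ≤ 1 →
      (ee z ν (sj j + t * (-κ + Real.pi * Complex.I)) ∉ P ∧ Φ (ee z ν (sj j + t * (-κ + Real.pi * Complex.I))) ≠ a) ∧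
      (ee z ν (sj j + (-κ + Real.pi * Complex.I) + t * (κ + Real.pi * Complex.I)) ∉ P ∧
        Φ (ee z ν (sj j + (-κ + Real.pi * Complex.I) + t * (κ + Real.pi * Complex.I))) ≠ a) := by
  have hπ := Real.pi_pos
  set Bad := {s : ℂ | ‖s‖ ≤ B ∧ (ee z ν s ∈ P ∨ Φ (ee z ν s) = a)}
  have hf : Bad.Finite := c.bad_fin a
  obtain ⟨κ, hκ, hn⟩ := (Set.Icc_infinite (show (3:ℝ) < 4 by norm_num)).exists_notMem_finset
    (((hf.image fun s => -Real.pi * (s - sj j).re / (s - sj j).im).union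
      (hf.image fun s => -Real.pi * (s - sj j).re / (2 * Real.pi - (s - sj j).im))).toFinset)
  simp only [Set.Finite.mem_toFinset, Set.mem_union, Set.mem_image, not_or, not_exists, not_and] at hn
  have h4 := Real.pi_lt_four
  have hb : ∀ x y : ℝ, |x| ≤ 4 → |y| ≤ 8 → ‖((x:ℂ) + y * Complex.I)‖ ≤ 12 := fun x y hx hy =>
    (norm_add_le _ _).trans (by
      rw [norm_mul, Complex.norm_I, Complex.norm_real, Complex.norm_real, Real.norm_eq_abs, Real.norm_eq_abs]
      linarith)
  have key : ∀ s : ℂ, ‖s‖ ≤ B → s ∉ Bad → ee z ν s ∉ P ∧ Φ (ee z ν s) ≠ a := by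
    intro s hs h
    by_contra h'
    exact h ⟨hs, by tauto⟩
  refine ⟨κ, hκ.1, hκ.2, fun t t0 t1 => ⟨?_, ?_⟩⟩
  · by_cases ht : t = 0
    · rw [ht]; simpa using h0
    refine key _ ((sj_norm_le j _ ?_).trans (by linarith : ‖sj j‖ + 12 ≤ B)) fun hbad => hn.1 _ hbad ?_
    · convert hb (-(t * κ)) (t * Real.pi) ?_ ?_ using 2
      · push_cast; ring
      · rw [abs_neg, abs_of_nonneg (mul_nonneg t0 (by linarith [hκ.1]))]; nlinarith [hκ.1, hκ.2]
      · rw [abs_of_nonneg (mul_nonneg t0 hπ.le)]; nlinarith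
    · have : sj j + t * (-κ + Real.pi * Complex.I) - sj j = ((-(t * κ) : ℝ) : ℂ) + (t * Real.pi : ℝ) * Complex.I := by
        push_cast; ring
      rw [this]
      simp
      field_simp
  · by_cases ht : t = 1
    · convert h1 using 3
      · rw [ht, sj_succ]; push_cast; ring
      · rw [ht, sj_succ]; congr 1; push_cast; ring
    have e1 : sj j + (-κ + Real.pi * Complex.I) + t * (κ + Real.pi * Complex.I) =
      sj j + (((-((1 - t) * κ) : ℝ) : ℂ) + ((1 + t) * Real.pi : ℝ) * Complex.I) := by
        push_cast; ring
    rw [e1]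
    refine key _ ((sj_norm_le j _ ?_).trans (by linarith : ‖sj j‖ + 12 ≤ B)) fun hbad => hn.2 _ hbad ?_
    · refine hb _ _ ?_ ?_
      · rw [abs_neg, abs_of_nonneg (mul_nonneg (by linarith) (by linarith [hκ.1]))]; nlinarith [hκ.1, hκ.2]
      · rw [abs_of_nonneg (mul_nonneg (by linarith) hπ.le)]; nlinarith
    · have h3 : 1 - t ≠ 0 := fun h => ht (by linarith)
      simp
      rw [show 2 * Real.pi - (1 + t) * Real.pi = (1 - t) * Real.pi by ring]
      field_simp

lemma rho_leg {C : ℝ} (hC : 0 < C) (w d : ℂ) : (rho C w * d).re =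
    ‖rho C w‖ * (Real.cos (w.im / 2) * d.re - Real.sin (w.im / 2) * d.im) := by
  rw [norm_rho hC.le, rho, mul_assoc, Complex.re_ofReal_mul, Complex.mul_re, Complex.exp_re, Complex.exp_im,
    Complex.div_ofNat_re, Complex.div_ofNat_im]
  ring

lemma Ctx.claim3 (c : Ctx Φ P V A M δ z ν B C) (T : TrI Φ P a δ ψ) (T2 : TrI Φ P a δ ψ₂) {j : ℕ} {ζ ζ₂ : ℂ}
    (hj : ‖sj j‖ + 30 ≤ B) (hL : L0 ≤ ζ.re) (ho : On ψ z ν C ((-1) ^ j) (sj j) ζ)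
    (hL2 : L0 ≤ ζ₂.re) (ho2 : On ψ₂ z ν C ((-1) ^ (j + 1)) (sj (j + 1)) ζ₂) : False := by
  have hC := c.Cpos
  have hC1 : 1000 ≤ C := L0_ge'.trans c.hC
  have hρj : ∀ k : ℕ, ‖rho C (sj k)‖ = C := fun k => by
    rw [norm_rho hC.le]; simp [sj]
  obtain ⟨hτ, hτ2⟩ := sgn_cases j
  obtain ⟨p1, p2, p3⟩ := c.uval T hτ hL ho (by rw [hρj]; linarith)
  obtain ⟨q1, q2, q3⟩ := c.uval T2 (sgn_cases (j+1)).1 hL2 ho2 (by rw [hρj]; linarith)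
  obtain ⟨κ, k3, k4, hk⟩ := c.kappa (a := a) j hj ⟨p1, p2⟩ ⟨q1, q2⟩
  have hπ := Real.pi_gt_three
  have hπ4 := Real.pi_lt_d2
  have hd : ∀ x : ℝ, |x| ≤ 4 → ‖((x:ℂ) + Real.pi * Complex.I)‖ ≤ 6 := fun x hx => by
    rw [Complex.norm_add_mul_I, Real.sqrt_le_left (by norm_num)]
    nlinarith [sq_abs x, abs_nonneg x]
  have hd1 : ‖(-κ + Real.pi * Complex.I : ℂ)‖ ≤ 6 := by
    have := hd (-κ) (by rw [abs_neg, abs_of_nonneg] <;> linarith)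
    push_cast at this; exact this
  have hd2 : ‖(κ + Real.pi * Complex.I : ℂ)‖ ≤ 6 := hd κ (by rw [abs_of_nonneg] <;> linarith)
  have htd : ∀ (t : ℝ) (d : ℂ), 0 ≤ t → t ≤ 1 → ‖d‖ ≤ 6 → ‖(t:ℂ) * d‖ ≤ 6 := fun t d t0 t1 h => by
    rw [norm_mul, Complex.norm_real, Real.norm_of_nonneg t0]; nlinarith [norm_nonneg d]
  set τ : ℂ := (-1) ^ j with hτd
  have hτn : ‖τ‖ = 1 := by rcases hτ with h | h <;> rw [h] <;> simp
  have e2 : (1/8:ℝ) ≤ Real.exp (-2) := by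
    have : Real.exp 2 ≤ 8 := by
      rw [show (2:ℝ) = 1 + 1 by norm_num, Real.exp_add]; nlinarith [Real.exp_one_lt_d9, Real.exp_pos 1]
    rw [Real.exp_neg, one_div]
    exact inv_anti₀ (Real.exp_pos _) this
  have hbig : ∀ w : ℂ, -4 ≤ w.re → 100 ≤ ‖rho C (sj j + w)‖ := fun w hw => by
    rw [rho_sj, ← hτd, norm_mul, hτn, one_mul, norm_rho hC.le]
    have : Real.exp (-2) ≤ Real.exp (w.re / 2) := Real.exp_le_exp.2 (by linarith)
    nlinarith
  have hrr : ∀ w d : ℂ, (Real.cos (w.im / 2) * d.re - Real.sin (w.im / 2) * d.im) ≤ -3 →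
      (τ * rho C (sj j + w) * d).re ≤ -3 * ‖rho C (sj j + w)‖ := fun w d h => by
    rw [rho_sj, ← hτd, ← mul_assoc, hτ2, one_mul, rho_leg hC, norm_mul, hτn, one_mul]
    nlinarith [norm_nonneg (rho C w)]
  have trig : ∀ t : ℝ, 0 ≤ t → t ≤ 1 → 0 ≤ Real.cos (t * Real.pi / 2) ∧ 0 ≤ Real.sin (t * Real.pi / 2) ∧
      1 ≤ Real.cos (t * Real.pi / 2) + Real.sin (t * Real.pi / 2) := fun t t0 t1 => by
    have u1 : 0 ≤ t * Real.pi / 2 := by positivity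
    have u2 : t * Real.pi / 2 ≤ Real.pi / 2 := by nlinarith
    have a1 := Real.cos_nonneg_of_mem_Icc (x := t * Real.pi / 2) ⟨by linarith, u2⟩
    have a2 := Real.sin_nonneg_of_mem_Icc (x := t * Real.pi / 2) ⟨u1, by linarith⟩
    refine ⟨a1, a2, ?_⟩
    nlinarith [Real.cos_sq_add_sin_sq (t * Real.pi / 2), mul_nonneg a1 a2]
  have l1 := c.trap (a := a) hτ hd1 (s1 := sj j)
    (fun t t0 t1 => (sj_norm_le j _ (htd t _ t0 t1 hd1)).trans (by linarith)) (fun t t0 t1 => (hk t t0 t1).1)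
    (fun t t0 t1 => hrr _ _ (by
      obtain ⟨a1, a2, a3⟩ := trig t t0 t1
      simp
      nlinarith)) (fun t t0 t1 => hbig _ (by simp; nlinarith)) p3
  have e3 : ∀ t : ℝ, sj j + (-κ + Real.pi * Complex.I) + t * (κ + Real.pi * Complex.I) =
    sj j + (-κ + Real.pi * Complex.I + t * (κ + Real.pi * Complex.I)) := fun t => by ring
  have l2 := c.trap (a := a) hτ hd2 (s1 := sj j + (-κ + Real.pi * Complex.I))
    (fun t t0 t1 => by
      rw [e3]
      exact (sj_norm_le j _ ((norm_add_le _ _).trans (add_le_add hd1 (htd t _ t0 t1 hd2)))).trans (by linarith))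
    (fun t t0 t1 => (hk t t0 t1).2)
    (fun t t0 t1 => by
      rw [e3]
      refine hrr _ _ ?_
      obtain ⟨a1, a2, a3⟩ := trig t t0 t1
      have e4 : (-κ + Real.pi * Complex.I + t * (κ + Real.pi * Complex.I) : ℂ).im / 2 = t * Real.pi / 2 + Real.pi / 2 := by
        simp; ring
      rw [e4, Real.cos_add_pi_div_two, Real.sin_add_pi_div_two]
      simp
      nlinarith) (fun t t0 t1 => by
      rw [e3]; refine hbig _ ?_
      simp; nlinarith) l1
  have e5 : sj j + (-κ + Real.pi * Complex.I) + (κ + Real.pi * Complex.I) = sj (j + 1) := by rw [sj_succ]; ring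
  rw [e5] at l2
  set u := vv (fun x => Φ (ee z ν x)) a (sj (j+1)) / rho C (sj (j+1))
  rw [pow_succ, ← hτd] at q3
  have e6 := norm_sub_le (u + τ / 2) (u + τ * -1 / 2)
  rw [show u + τ / 2 - (u + τ * -1 / 2) = τ by ring, hτn] at e6
  linarith
end
end SW

namespace SW
open Metric

def HasLog (K : Set ℂ) (p : ℂ) : Prop := ∃ g : ℂ → ℂ, ContinuousOn g K ∧ ∀ z ∈ K, Complex.exp (g z) = z - p

lemma HasLog.move {K : Set ℂ} {p q : ℂ} (h : HasLog K p) (hpq : ∀ z ∈ K, (z - q) / (z - p) ∈ Complex.slitPlane) :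
    HasLog K q := by
  obtain ⟨g, hg, he⟩ := h
  have hne : ∀ z ∈ K, z - p ≠ 0 := fun z hz => by rw [← he z hz]; exact Complex.exp_ne_zero _
  refine ⟨fun z => g z + Complex.log ((z - q) / (z - p)), hg.add (ContinuousOn.clog (by fun_prop (disch := assumption)) hpq),
    fun z hz => ?_⟩
  rw [Complex.exp_add, he z hz, Complex.exp_log (Complex.slitPlane_ne_zero (hpq z hz)), mul_div_cancel₀ _ (hne z hz)]

lemma slit_of_lt {x y : ℂ} (h : ‖y - x‖ < ‖x‖) : y / x ∈ Complex.slitPlane := by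
  have hx : x ≠ 0 := norm_pos_iff.1 ((norm_nonneg _).trans_lt h)
  have : y / x = 1 + (y - x) / x := by field_simp; ring
  rw [this]
  exact Complex.mem_slitPlane_of_norm_lt_one (by rwa [norm_div, div_lt_one (norm_pos_iff.2 hx)])

lemma hasLog_of_unbdd {K S : Set ℂ} (hK : IsCompact K) (hS : IsPreconnected S) (hd : Disjoint S K)
    (hu : ∀ R : ℝ, ∃ q ∈ S, R < ‖q‖) {p : ℂ} (hp : p ∈ S) : HasLog K p := by
  obtain ⟨R, hR⟩ := hK.isBounded.exists_norm_le
  obtain ⟨q, hq, hqR⟩ := hu (max R 0)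
  have hR0 := (le_max_right R 0).trans_lt hqR
  have hqL : HasLog K q := by
    have hne : -q ≠ 0 := neg_ne_zero.2 (norm_pos_iff.1 hR0)
    have hs : ∀ z ∈ K, (z - q) / (-q) ∈ Complex.slitPlane := fun z hz => slit_of_lt (by
      rw [norm_neg, show z - q - -q = z by ring]; exact (hR z hz).trans_lt ((le_max_left _ _).trans_lt hqR))
    refine ⟨fun z => Complex.log (-q) + Complex.log ((z - q) / (-q)),
      continuousOn_const.add (ContinuousOn.clog (by fun_prop (disch := assumption)) hs), fun z hz => ?_⟩
    rw [Complex.exp_add, Complex.exp_log hne, Complex.exp_log (Complex.slitPlane_ne_zero (hs z hz)), mul_div_cancel₀ _ hne]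
  refine (hS.induction₂ (fun x y => HasLog K x ↔ HasLog K y) (fun x hx => ?_) (fun x y z _ _ _ => Iff.trans)
    (fun x y _ _ => Iff.symm) hq hp).1 hqL
  obtain ⟨r, hr, hb⟩ := Metric.isOpen_iff.1 hK.isClosed.isOpen_compl x (disjoint_left.1 hd hx)
  refine mem_nhdsWithin_of_mem_nhds ?_
  filter_upwards [ball_mem_nhds x (by linarith : 0 < r / 2)] with y hy
  rw [mem_ball, dist_eq_norm] at hy
  have h1 : ∀ z ∈ K, r ≤ ‖z - x‖ := fun z hz => by
    by_contra h
    exact hb (by rw [mem_ball, dist_eq_norm]; linarith) hz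
  constructor
  · refine fun h => h.move fun z hz => slit_of_lt ?_
    rw [show z - y - (z - x) = -(y - x) by ring, norm_neg]; linarith [h1 z hz]
  · refine fun h => h.move fun z hz => slit_of_lt ?_
    rw [show z - x - (z - y) = y - x by ring]
    have := norm_sub_norm_le (z - x) (y - x)
    rw [show z - x - (y - x) = z - y by ring] at this
    linarith [h1 z hz]

lemma jump {K : Set ℂ} {E : ℂ} {x : ℝ} (hx : 0 < x) (hx1 : x < 1) (hE : E ≠ 0)
    (hpre : IsPreconnected (K \ {E * x})) (hseg : ∀ y : ℝ, x ^ 2 ≤ y → y ≤ 1 → E * y ∈ K → y = x)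
    (h1 : HasLog K E) (h2 : HasLog K (E * x ^ 2)) {θ₀ : ℝ} (hθ₀ : 0 < θ₀)
    (harc : ∀ θ : ℝ, |θ| ≤ θ₀ → E * x * Complex.exp (θ * Complex.I) ∈ K) : False := by
  obtain ⟨g, hg, he⟩ := h1
  obtain ⟨g', hg', he'⟩ := h2
  have hxc : (x:ℂ) ≠ 0 := by exact_mod_cast hx.ne'
  have hne : ∀ z ∈ K, z - E ≠ 0 := fun z hz => by rw [← he z hz]; exact Complex.exp_ne_zero _
  have hne' : ∀ z ∈ K, z - E * x ^ 2 ≠ 0 := fun z hz => by rw [← he' z hz]; exact Complex.exp_ne_zero _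
  set w : ℂ → ℂ := fun z => (z - E) / (z - E * x ^ 2) with hw
  have hwc : ContinuousOn w K := by
    rw [hw]; exact ContinuousOn.div (by fun_prop) (by fun_prop) hne'
  have hslit : ∀ z ∈ K \ {E * x}, w z ∈ Complex.slitPlane := by
    rintro z ⟨hz, hzc⟩
    by_contra hs
    rw [Complex.mem_slitPlane_iff, not_or, not_lt, not_not] at hs
    obtain ⟨r, hr⟩ : ∃ r : ℝ, r = -(w z).re := ⟨_, rfl⟩
    have hr0 : 0 ≤ r := by linarith [hs.1]
    have h3 : w z = -(r:ℂ) := by apply Complex.ext <;> simp [hr, hs.2]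
    have h4 : z - E = -r * (z - E * x ^ 2) := by rw [← h3, hw]; field_simp [hne' z hz]
    have h5 : ((1 + r : ℝ):ℂ) ≠ 0 := by exact_mod_cast (by linarith : (1 + r) ≠ 0)
    have h6 : z = E * ((1 + r * x ^ 2) / (1 + r) : ℝ) := by
      push_cast at h5 ⊢
      field_simp
      linear_combination h4
    have hx2 : x ^ 2 ≤ 1 := by nlinarith
    have h7 := hseg ((1 + r * x ^ 2) / (1 + r)) (by rw [le_div_iff₀ (by linarith)]; nlinarith)
      (by rw [div_le_one (by linarith)]; nlinarith) (h6 ▸ hz)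
    rw [h7] at h6
    exact hzc h6
  set h : ℂ → ℂ := fun z => g z - g' z - Complex.log (w z) with hh
  have hhc : ContinuousOn h (K \ {E * x}) :=
    ((hg.sub hg').mono sdiff_subset).sub ((hwc.mono sdiff_subset).clog hslit)
  have hsub : h '' (K \ {E * x}) ⊆ range (fun n : ℤ => (n:ℂ) * (2 * Real.pi * Complex.I)) := by
    rintro _ ⟨z, hz, rfl⟩
    have : Complex.exp (h z) = 1 := by
      rw [hh]
      simp only
      rw [Complex.exp_sub, Complex.exp_sub, he z hz.1, he' z hz.1, Complex.exp_log (Complex.slitPlane_ne_zero (hslit z hz))]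
      exact div_self (Complex.slitPlane_ne_zero (hslit z hz))
    obtain ⟨n, hn⟩ := Complex.exp_eq_one_iff.1 this
    exact ⟨n, hn.symm⟩
  have hcon := (countable_range _).isTotallyDisconnected _ hsub (hpre.image h hhc)
  set Z : ℝ → ℂ := fun θ => E * x * Complex.exp (θ * Complex.I) with hZ
  have hZc : Continuous Z := by fun_prop
  have hZ0 : Z 0 = E * x := by simp [hZ]
  have hcK : E * x ∈ K := by rw [← hZ0]; exact harc 0 (by simpa using hθ₀.le)
  have hZev : ∀ᶠ θ in 𝓝 (0:ℝ), Z θ ∈ K := by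
    filter_upwards [Metric.ball_mem_nhds 0 hθ₀] with θ hθ
    rw [mem_ball, Real.dist_0_eq_abs] at hθ
    exact harc θ hθ.le
  have hZt : Tendsto Z (𝓝 0) (𝓝[K] (E * x)) := tendsto_nhdsWithin_iff.2 ⟨by rw [← hZ0]; exact hZc.tendsto 0, hZev⟩
  have hG : Tendsto (fun θ => g (Z θ) - g' (Z θ)) (𝓝 0) (𝓝 (g (E * x) - g' (E * x))) :=
    ((hg.sub hg').continuousWithinAt hcK).tendsto.comp hZt
  have hW : Tendsto (fun θ => w (Z θ)) (𝓝 0) (𝓝 (w (E * x))) := (hwc.continuousWithinAt hcK).tendsto.comp hZt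
  have hw0 : w (E * x) = ((-(1 / x) : ℝ) : ℂ) := by
    rw [hw]; push_cast
    have h3 : E * x - E * x ^ 2 ≠ 0 := hne' _ hcK
    rw [div_eq_iff h3]; field_simp; ring
  have hre : (w (E * x)).re < 0 := by rw [hw0, Complex.ofReal_re, neg_lt_zero]; positivity
  have him : (w (E * x)).im = 0 := by rw [hw0, Complex.ofReal_im]
  have himf : ∀ θ : ℝ, Z θ ∈ K → ∃ k : ℝ, 0 < k ∧ (w (Z θ)).im = k * Real.sin θ := fun θ hθ => by
    have h3 := hne' _ hθ
    refine ⟨‖E‖ ^ 2 * x * (1 - x ^ 2) / ‖Z θ - E * x ^ 2‖ ^ 2, ?_, ?_⟩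
    · have : 0 < 1 - x ^ 2 := by nlinarith
      have := norm_pos_iff.2 h3
      have := norm_pos_iff.2 hE
      positivity
    · have e1 : (w (Z θ)).im = ((Z θ - E) * (starRingEnd ℂ) (Z θ - E * x ^ 2)).im / ‖Z θ - E * x ^ 2‖ ^ 2 := by
        rw [hw]; simp only
        rw [Complex.div_im, Complex.normSq_eq_norm_sq, Complex.mul_im, Complex.conj_re, Complex.conj_im]
        ring
      have e2 : ((Z θ - E) * (starRingEnd ℂ) (Z θ - E * x ^ 2)).im = ‖E‖ ^ 2 * x * (1 - x ^ 2) * Real.sin θ := by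
        rw [← Complex.normSq_eq_norm_sq, hZ, Complex.normSq_apply]
        simp [Complex.exp_re, Complex.exp_im, ← Complex.ofReal_pow]
        ring
      rw [e1, e2]; ring
  have hxK : ∀ θ : ℝ, |θ| < Real.pi → θ ≠ 0 → Z θ ∈ K → (Real.sin θ ≠ 0) ∧ Z θ ∈ K \ {E * x} := fun θ h3 h4 h5 => by
    have hs : Real.sin θ ≠ 0 := fun hs => by
      have := (Real.sin_eq_zero_iff_of_lt_of_lt (neg_lt_of_abs_lt h3) (lt_of_abs_lt h3)).1 hs
      exact h4 this
    refine ⟨hs, h5, fun h6 => hs ?_⟩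
    obtain ⟨k, hk, hk'⟩ := himf θ h5
    rw [show Z θ = E * x from h6, him] at hk'
    exact (mul_eq_zero.1 hk'.symm).resolve_left hk.ne'
  set z₁ := Z (min θ₀ 1)
  have hpi := Real.pi_gt_three
  have hz₁ : z₁ ∈ K \ {E * x} := by
    have h3 : 0 < min θ₀ 1 := lt_min hθ₀ one_pos
    refine (hxK _ ?_ h3.ne' (harc _ ?_)).2
    · rw [abs_of_pos h3]; exact (min_le_right _ _).trans_lt (by linarith)
    · rw [abs_of_pos h3]; exact min_le_left _ _
  have hsmall : ∀ᶠ θ in 𝓝 (0:ℝ), |θ| < Real.pi := by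
    filter_upwards [Metric.ball_mem_nhds 0 Real.pi_pos] with θ hθ
    rwa [mem_ball, Real.dist_0_eq_abs] at hθ
  have hh1 : ∀ θ : ℝ, |θ| < Real.pi → θ ≠ 0 → Z θ ∈ K →
      Complex.log (w (Z θ)) = g (Z θ) - g' (Z θ) - h z₁ := fun θ h3 h4 h5 => by
    rw [hcon (mem_image_of_mem h hz₁) (mem_image_of_mem h (hxK θ h3 h4 h5).2), hh]; ring
  have hpos : Tendsto (fun θ => g (Z θ) - g' (Z θ) - h z₁) (𝓝[>] (0:ℝ)) (𝓝 (Real.log ‖w (E * x)‖ + Real.pi * Complex.I)) := by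
    refine ((Complex.tendsto_log_nhdsWithin_im_nonneg_of_re_neg_of_im_zero hre him).comp
      (tendsto_nhdsWithin_iff.2 ⟨hW.mono_left nhdsWithin_le_nhds, ?_⟩)).congr' ?_
    · filter_upwards [self_mem_nhdsWithin, nhdsWithin_le_nhds hZev, nhdsWithin_le_nhds hsmall] with θ h3 h4 h5
      obtain ⟨k, hk, hk'⟩ := himf θ h4
      rw [hk']
      exact mul_nonneg hk.le (Real.sin_nonneg_of_nonneg_of_le_pi (le_of_lt h3) (lt_of_abs_lt h5).le)
    · filter_upwards [self_mem_nhdsWithin, nhdsWithin_le_nhds hZev, nhdsWithin_le_nhds hsmall] with θ h3 h4 h5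
      exact hh1 θ h5 (ne_of_gt h3) h4
  have hneg : Tendsto (fun θ => g (Z θ) - g' (Z θ) - h z₁) (𝓝[<] (0:ℝ)) (𝓝 (Real.log ‖w (E * x)‖ - Real.pi * Complex.I)) := by
    refine ((Complex.tendsto_log_nhdsWithin_im_neg_of_re_neg_of_im_zero hre him).comp
      (tendsto_nhdsWithin_iff.2 ⟨hW.mono_left nhdsWithin_le_nhds, ?_⟩)).congr' ?_
    · filter_upwards [self_mem_nhdsWithin, nhdsWithin_le_nhds hZev, nhdsWithin_le_nhds hsmall] with θ h3 h4 h5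
      obtain ⟨k, hk, hk'⟩ := himf θ h4
      rw [hk']
      exact mul_neg_of_pos_of_neg hk (Real.sin_neg_of_neg_of_neg_pi_lt h3 (neg_lt_of_abs_lt h5))
    · filter_upwards [self_mem_nhdsWithin, nhdsWithin_le_nhds hZev, nhdsWithin_le_nhds hsmall] with θ h3 h4 h5
      exact hh1 θ h5 (ne_of_lt h3) h4
  have hG' := hG.sub_const (h z₁)
  have e1 := tendsto_nhds_unique hpos (hG'.mono_left nhdsWithin_le_nhds)
  have e2 := tendsto_nhds_unique hneg (hG'.mono_left nhdsWithin_le_nhds)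
  rw [← e2] at e1
  have := congrArg Complex.im e1
  simp at this
  linarith
end SW

namespace SW
open Metric

lemma rect_pre {I J : Set ℝ} (hI : I.OrdConnected) (hJ : J.OrdConnected) : IsPreconnected (I ×ℂ J) :=
  ((hI.convex.is_linear_preimage Complex.reLm.isLinear).inter
    (hJ.convex.is_linear_preimage Complex.imLm.isLinear)).isPreconnected

structure Leg (Φ : ℂ → ℂ) (P : Set ℂ) (δ : ℝ) (z : ℂ) (ν C : ℝ) (m : ℕ) (a : ℂ) (ψ : ℂ → ℂ) (ζ : ℂ) : Prop where
  T : TrI Φ P a δ ψ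
  hor : ∀ t : ℝ, 0 ≤ t → t ≤ 10 → ∃ ζ ∈ Hp, ψ ζ = ee z ν (sj m + t)
  deep : 290 * C ≤ ζ.re
  fin : ψ ζ = ee z ν (sj m + 10)

def tail (ψ : ℂ → ℂ) (ζ : ℂ) : Set ℂ := (fun t : ℝ => ψ (ζ + t)) '' Ici 0

lemma sj_re (m : ℕ) : (sj m).re = 0 := by simp [sj]
lemma sj_im (m : ℕ) : (sj m).im = m * (2 * Real.pi) := by simp [sj]

section
variable {Φ : ℂ → ℂ} {P V : Set ℂ} {A : ℂ → ℂ} {M : ℕ} {δ : ℝ} {z : ℂ} {ν B C : ℝ}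
  {a b : ℂ} {ψ ψ₂ : ℂ → ℂ} {ζ : ℂ} {m : ℕ}

lemma TrI.tail_pre (T : TrI Φ P a δ ψ) (h : 0 < ζ.re) : IsPreconnected (tail ψ ζ) := by
  refine isPreconnected_Ici.image _ ?_
  refine T.diff.continuousOn.comp (by fun_prop) fun t ht => ?_
  rw [mem_Hp]; simp only [Complex.add_re, Complex.ofReal_re]
  have : 0 ≤ t := ht
  linarith

lemma TrI.tail_lim (T : TrI Φ P a δ ψ) (ζ : ℂ) : Tendsto (fun t : ℝ => ‖ψ (ζ + t)‖) atTop atTop := by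
  refine T.lim.comp (tendsto_comap_iff.2 ?_)
  have : (Complex.re ∘ fun t : ℝ => ζ + t) = fun t => ζ.re + t := by ext t; simp
  rw [this]
  exact tendsto_atTop_add_const_left _ _ tendsto_id

lemma TrI.tail_unbdd (T : TrI Φ P a δ ψ) (ζ : ℂ) (R : ℝ) : ∃ q ∈ tail ψ ζ, R < ‖q‖ := by
  obtain ⟨t, h1, h2⟩ := (((T.tail_lim ζ).eventually_gt_atTop R).and (eventually_ge_atTop 0)).exists
  exact ⟨_, ⟨t, h2, rfl⟩, h1⟩

lemma Tr.disj (hδ : 0 < δ) (T : Tr Φ P a δ ψ) (T2 : Tr Φ P b δ ψ₂) (h : 2 * δ ≤ ‖b - a‖) {x : ℂ}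
    (h1 : x ∈ ψ '' Hp) (h2 : x ∈ ψ₂ '' Hp) : False := by
  obtain ⟨ζ, hζ, rfl⟩ := h1
  obtain ⟨ζ', hζ', h3⟩ := h2
  have e1 := T.norm hδ hζ
  have e2 := T2.norm hδ hζ'
  rw [h3] at e2
  have e3 : Real.exp (-ζ.re) < 1 := Real.exp_lt_one_iff.2 (by rw [mem_Hp] at hζ; linarith)
  have e4 : Real.exp (-ζ'.re) < 1 := Real.exp_lt_one_iff.2 (by rw [mem_Hp] at hζ'; linarith)
  have e5 := norm_sub_le (Φ (ψ ζ) - a) (Φ (ψ ζ) - b)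
  rw [show Φ (ψ ζ) - a - (Φ (ψ ζ) - b) = b - a by ring] at e5
  nlinarith

lemma Leg.hor' (L : Leg Φ P δ z ν C m a ψ ζ) {s : ℂ} (h0 : 0 ≤ s.re) (h1 : s.re ≤ 10) (him : s.im = (sj m).im) :
    ee z ν s ∈ ψ '' Hp := by
  obtain ⟨ζ, h2, h3⟩ := L.hor s.re h0 h1
  refine ⟨ζ, h2, h3.trans ?_⟩
  congr 1
  apply Complex.ext <;> simp [sj_re, him]

lemma Ctx.deep1 (c : Ctx Φ P V A M δ z ν B C) (T : TrI Φ P a δ ψ) {s ζ : ℂ} (hs : ‖s‖ ≤ B - 13)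
    (h : ψ ζ = ee z ν s) (hd : 290 * C ≤ ζ.re) (hr : s.re ≤ 1) : False := by
  refine c.claim1 T hs h ?_
  have hC := c.Cpos
  rw [norm_rho hC.le]
  have : Real.exp (s.re / 2) ≤ 3 := (Real.exp_le_exp.2 (by linarith : s.re / 2 ≤ 1)).trans
    (by linarith [Real.exp_one_lt_d9])
  have h2 := c.hC
  nlinarith

lemma Ctx.loop (c : Ctx Φ P V A M δ z ν B C) {l i k j : ℕ} {ak al : ℂ} {ψi ψj ψk ψl : ℂ → ℂ} {ζi ζj ζk ζl : ℂ}
    (hli : l < i) (hik : i < k) (hkj : k < j) (hB : ‖sj j‖ + 30 ≤ B)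
    (Li : Leg Φ P δ z ν C i a ψi ζi) (Lj : Leg Φ P δ z ν C j a ψj ζj) (hm : ∃ x, x ∈ ψi '' Hp ∧ x ∈ ψj '' Hp)
    (Lk : Leg Φ P δ z ν C k ak ψk ζk) (Ll : Leg Φ P δ z ν C l al ψl ζl)
    (hak : 2 * δ ≤ ‖ak - a‖) (hal : 2 * δ ≤ ‖al - a‖) : False := by
  have hδ := c.hδ
  have hC := c.Cpos
  have hν := c.νpos
  have hπ := Real.pi_gt_three
  have hgap : ∀ {m n : ℕ}, m < n → (sj m).im + 6 ≤ (sj n).im := fun {m n} h => by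
    rw [sj_im, sj_im]
    have : (m:ℝ) + 1 ≤ n := by exact_mod_cast h
    nlinarith
  have g1 := hgap hli
  have g2 := hgap hik
  have g3 := hgap hkj
  have g0 : 0 ≤ (sj l).im := by rw [sj_im]; positivity
  have hnj : ‖sj j‖ = (sj j).im := by
    rw [Complex.norm_eq_sqrt_sq_add_sq, sj_re]
    rw [zero_pow two_ne_zero, zero_add, Real.sqrt_sq (by linarith)]
  have hN : ∀ s : ℂ, -2 ≤ s.re → s.re ≤ 10 → 0 ≤ s.im → s.im ≤ (sj j).im → ‖s‖ ≤ B - 13 := fun s h1 h2 h3 h4 => by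
    refine (Complex.norm_le_abs_re_add_abs_im s).trans ?_
    rw [abs_of_nonneg h3]
    have : |s.re| ≤ 10 := abs_le.2 ⟨by linarith, h2⟩
    linarith
  have hec : Continuous (ee z ν) := by unfold ee; fun_prop
  obtain ⟨Z, hZd, hZe⟩ : ∃ Z : ℂ, 290 * C ≤ Z.re ∧ ψi Z = ee z ν (sj j + 10) := by
    obtain ⟨x, ⟨u, hu, rfl⟩, v, hv, h⟩ := hm
    obtain ⟨n, -, hn⟩ := Tr.meet hδ c.G.mero Li.T.toTr Lj.T.toTr hu hv h.symm
    have h1 : 290 * C ≤ (ζj - n * (2 * Real.pi * Complex.I)).re := by simpa using Lj.deep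
    refine ⟨ζj - n * (2 * Real.pi * Complex.I), h1, ?_⟩
    rw [hn _ (by rw [mem_Hp]; nlinarith), sub_add_cancel, Lj.fin]
  set yi := (sj i).im
  set yj := (sj j).im
  set yk := (sj k).im
  set yl := (sj l).im
  have hconv : ∀ ζ ∈ segment ℝ ζi Z, 290 * C ≤ ζ.re := fun ζ hζ =>
    (convex_halfSpace_re_ge (290 * C)).segment_subset Li.deep hZd hζ
  set W := ψi '' segment ℝ ζi Z with hW
  have hsH : segment ℝ ζi Z ⊆ Hp := fun ζ hζ => by rw [mem_Hp]; nlinarith [hconv ζ hζ]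
  have hWc : ContinuousOn ψi (segment ℝ ζi Z) := Li.T.diff.continuousOn.mono hsH
  have hWd : ∀ s : ℂ, -2 ≤ s.re → s.re ≤ 1 → 0 ≤ s.im → s.im ≤ yj → ee z ν s ∉ W := by
    rintro s h1 h2 h3 h4 ⟨ζ, hζ, h5⟩
    exact c.deep1 Li.T (hN s h1 (by linarith only [h2]) h3 h4) h5 (hconv ζ hζ) h2
  have hWH : W ⊆ ψi '' Hp := image_mono hsH
  set R : Set ℂ := (Icc (-1) (-1) ×ℂ Icc yi yj) ∪ (Icc (-1) 10 ×ℂ Icc yi yi) ∪ (Icc (-1) 10 ×ℂ Icc yj yj) with hR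
  have hRm : ∀ s ∈ R, -1 ≤ s.re ∧ s.re ≤ 10 ∧ yi ≤ s.im ∧ s.im ≤ yj ∧ (s.re = -1 ∨ s.im = yi ∨ s.im = yj) := by
    rintro s ((⟨⟨h1, h2⟩, h3, h4⟩ | ⟨⟨h1, h2⟩, h3, h4⟩) | ⟨⟨h1, h2⟩, h3, h4⟩)
    · exact ⟨h1, by linarith only [h2], h3, h4, Or.inl (le_antisymm h2 h1)⟩
    · exact ⟨h1, h2, h3, by linarith only [h4, g2, g3], Or.inr (Or.inl (le_antisymm h4 h3))⟩
    · exact ⟨h1, h2, by linarith only [h3, g2, g3], h4, Or.inr (Or.inr (le_antisymm h4 h3))⟩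
  have hRN : ∀ s ∈ R, ‖s‖ ≤ B - 13 := fun s hs => by
    obtain ⟨h1, h2, h3, h4, -⟩ := hRm s hs
    exact hN s (by linarith only [h1]) h2 (by linarith only [h3, g0, g1]) h4
  set K := ee z ν '' R ∪ W with hK
  have hKc : IsCompact K := by
    refine IsCompact.union (IsCompact.image ?_ hec) (IsCompact.image_of_continuousOn ?_ hWc)
    · exact ((isCompact_Icc.reProdIm isCompact_Icc).union (isCompact_Icc.reProdIm isCompact_Icc)).union
        (isCompact_Icc.reProdIm isCompact_Icc)
    · rw [segment_eq_image]; exact isCompact_Icc.image (by fun_prop)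
  have hinj : ∀ s s' : ℂ, ‖s‖ ≤ B - 13 → s' ∈ R → ee z ν s' = ee z ν s → s ∈ R := fun s s' h1 h2 h3 => by
    rwa [c.inj (by linarith only [h1]) (by linarith only [hRN s' h2]) h3.symm]
  -- tails avoid K
  have htail : ∀ {n : ℕ} {b : ℂ} {ψ : ℂ → ℂ} {ζ : ℂ}, Leg Φ P δ z ν C n b ψ ζ → 2 * δ ≤ ‖b - a‖ →
      ∀ x ∈ tail ψ ζ, x ∉ K := by
    rintro n b ψ ζ L hb _ ⟨t, ht, rfl⟩ hx
    have ht0 : (0:ℝ) ≤ t := ht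
    have hdp : 290 * C ≤ (ζ + t).re := by
      rw [Complex.add_re, Complex.ofReal_re]; linarith only [L.deep, ht0]
    have hH : ψ (ζ + t) ∈ ψ '' Hp := ⟨_, by rw [mem_Hp]; nlinarith only [hdp, hC], rfl⟩
    rcases hx with ⟨s, hs, h⟩ | hx
    · obtain ⟨h1, h2, h3, h4, h5⟩ := hRm s hs
      rcases le_or_gt s.re 1 with h6 | h6
      · exact c.deep1 L.T (hRN s hs) h.symm hdp h6
      · have h7 : ee z ν s ∈ ψ '' Hp := by rw [h]; exact hH
        rcases h5 with h5 | h5 | h5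
        · linarith only [h5, h6]
        · exact Tr.disj hδ Li.T.toTr L.T.toTr hb (Li.hor' (by linarith only [h6]) h2 h5) h7
        · exact Tr.disj hδ Lj.T.toTr L.T.toTr hb (Lj.hor' (by linarith only [h6]) h2 h5) h7
    · exact Tr.disj hδ Li.T.toTr L.T.toTr hb (hWH hx) hH
  have htp : ∀ {n : ℕ} {b : ℂ} {ψ : ℂ → ℂ} {ζ : ℂ}, Leg Φ P δ z ν C n b ψ ζ → IsPreconnected (tail ψ ζ) :=
    fun L => L.T.tail_pre (by nlinarith only [L.deep, hC])
  have hmem : ∀ {n : ℕ} {b : ℂ} {ψ : ℂ → ℂ} {ζ : ℂ}, Leg Φ P δ z ν C n b ψ ζ → ee z ν (sj n + 10) ∈ tail ψ ζ :=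
    fun L => ⟨0, by simp, by simp [L.fin]⟩
  have hpre : ∀ I J : Set ℝ, I.OrdConnected → J.OrdConnected → IsPreconnected (ee z ν '' (I ×ℂ J)) := fun I J hI hJ =>
    (rect_pre hI hJ).image _ hec.continuousOn
  -- logs
  have hl1 : HasLog K (ee z ν (sj k)) := by
    refine hasLog_of_unbdd (S := ee z ν '' (Icc 0 10 ×ℂ Icc yk yk) ∪ tail ψk ζk) hKc ?_ ?_ ?_ (Or.inl ?_)
    · refine IsPreconnected.union (ee z ν (sj k + 10)) ⟨_, ?_, rfl⟩ (hmem Lk) (hpre _ _ ordConnected_Icc ordConnected_Icc) (htp Lk)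
      simp [Complex.mem_reProdIm, sj_re, yk]
    · rw [disjoint_left]
      rintro x (⟨s, ⟨⟨h1, h2⟩, h3, h4⟩, rfl⟩ | hx)
      · have him : s.im = yk := le_antisymm h4 h3
        rintro (⟨s', hs', h⟩ | h)
        · obtain ⟨h5, h6, h7, h8, h9⟩ := hRm s (hinj s s' (hN s (by linarith only [h1]) h2 (by linarith only [him, g0, g1, g2]) (by linarith only [him, g3])) hs' h)
          rcases h9 with h9 | h9 | h9
          · linarith only [h9, h1]
          · linarith only [h9, him, g2]
          · linarith only [h9, him, g3]
        · exact Tr.disj hδ Li.T.toTr Lk.T.toTr hak (hWH h) (Lk.hor' h1 h2 him)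
      · exact htail Lk hak x hx
    · intro r
      obtain ⟨q, h1, h2⟩ := Lk.T.tail_unbdd ζk r
      exact ⟨q, Or.inr h1, h2⟩
    · exact ⟨_, by simp [Complex.mem_reProdIm, sj_re, yk], rfl⟩
  have hl2 : HasLog K (ee z ν (sj k + (-2:ℝ))) := by
    refine hasLog_of_unbdd (S := ee z ν '' (Icc (-2) (-2) ×ℂ Icc yl yk) ∪ (ee z ν '' (Icc (-2) 10 ×ℂ Icc yl yl) ∪ tail ψl ζl))
      hKc ?_ ?_ ?_ (Or.inl ?_)
    · refine IsPreconnected.union (ee z ν (sj l + (-2))) ⟨_, ?_, rfl⟩ (Or.inl ⟨_, ?_, rfl⟩) (hpre _ _ ordConnected_Icc ordConnected_Icc)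
        (IsPreconnected.union (ee z ν (sj l + 10)) ⟨_, ?_, rfl⟩ (hmem Ll) (hpre _ _ ordConnected_Icc ordConnected_Icc) (htp Ll))
      · simp [Complex.mem_reProdIm, sj_re]
        exact ⟨le_rfl, by linarith only [g1, g2]⟩
      · simp [Complex.mem_reProdIm, sj_re, yl]; norm_num
      · simp [Complex.mem_reProdIm, sj_re, yl]; norm_num
    · rw [disjoint_left]
      rintro x (⟨s, ⟨⟨h1, h2⟩, h3, h4⟩, rfl⟩ | (⟨s, ⟨⟨h1, h2⟩, h3, h4⟩, rfl⟩ | hx))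
      · rintro (⟨s', hs', h⟩ | h)
        · obtain ⟨h5, -⟩ := hRm s (hinj s s' (hN s h1 (by linarith only [h2]) (by linarith only [h3, g0]) (by linarith only [h4, g3])) hs' h)
          linarith only [h5, h2]
        · exact hWd s h1 (by linarith only [h2]) (by linarith only [h3, g0]) (by linarith only [h4, g3]) h
      · rintro (⟨s', hs', h⟩ | h)
        · obtain ⟨-, -, h7, -⟩ := hRm s (hinj s s' (hN s h1 (by linarith only [h2]) (by linarith only [h3, g0]) (by linarith only [h4, g1, g2, g3])) hs' h)
          linarith only [h7, h4, g1]
        · rcases le_or_gt s.re 1 with h6 | h6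
          · exact hWd s h1 h6 (by linarith only [h3, g0]) (by linarith only [h4, g1, g2, g3]) h
          · exact Tr.disj hδ Li.T.toTr Ll.T.toTr hal (hWH h) (Ll.hor' (by linarith only [h6]) h2 (le_antisymm h4 h3))
      · exact htail Ll hal x hx
    · intro r
      obtain ⟨q, h1, h2⟩ := Ll.T.tail_unbdd ζl r
      exact ⟨q, Or.inr (Or.inr h1), h2⟩
    · exact ⟨_, by simp [Complex.mem_reProdIm, sj_re, yk]; linarith only [g1, g2], rfl⟩
  have hee : ∀ u : ℝ, ee z ν (sj k + u) = ee z ν (sj k) * (Real.exp (u / ν) : ℝ) := fun u => by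
    rw [ee_add]; push_cast; rfl
  have hl2' : HasLog K (ee z ν (sj k) * (Real.exp (-1 / ν) : ℝ) ^ 2) := by
    convert hl2 using 1
    rw [hee, ← Complex.ofReal_pow, ← Real.exp_nat_mul]
    congr 3; push_cast; ring
  have hcR : ∀ u : ℝ, ee z ν (sj k) * (Real.exp (u / ν) : ℝ) ∈ K → -2 ≤ u → u ≤ 0 → u = -1 := fun u h h1 h2 => by
    rw [← hee] at h
    have e1 : (sj k + u).re = u := by simp [sj_re]
    have e2 : (sj k + u).im = yk := by simp [yk]
    rcases h with ⟨s', hs', h⟩ | h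
    · obtain ⟨-, -, -, -, h9⟩ := hRm _ (hinj (sj k + u) s' (hN _ (by rw [e1]; exact h1) (by rw [e1]; linarith only [h2]) (by rw [e2]; linarith only [g0, g1, g2])
        (by rw [e2]; linarith only [g3])) hs' h)
      rw [e1, e2] at h9
      rcases h9 with h9 | h9 | h9
      · exact h9
      · linarith only [h9, g2]
      · linarith only [h9, g3]
    · exact absurd h (hWd _ (by rw [e1]; exact h1) (by rw [e1]; linarith only [h2]) (by rw [e2]; linarith only [g0, g1, g2])
        (by rw [e2]; linarith only [g3]))
  have hcN : ‖sj k + (-1:ℝ)‖ ≤ B - 13 := hN _ (by simp [sj_re]) (by simp [sj_re]; norm_num) (by simp; linarith only [g0, g1, g2])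
    (by simp; linarith only [g3])
  refine jump (K := K) (E := ee z ν (sj k)) (x := Real.exp (-1 / ν)) (Real.exp_pos _) ?_ (c.ee_ne _) ?_ ?_ hl1 hl2'
    (θ₀ := 1 / ν) (by positivity) ?_
  · exact Real.exp_lt_one_iff.2 (by rw [neg_div, neg_lt_zero]; positivity)
  · rw [← hee]
    have : K \ {ee z ν (sj k + (-1:ℝ))} = ((ee z ν '' (Icc (-1) (-1) ×ℂ Ico yi yk) ∪ ee z ν '' (Icc (-1) 10 ×ℂ Icc yi yi)) ∪ W) ∪
        (ee z ν '' (Icc (-1) 10 ×ℂ Icc yj yj) ∪ ee z ν '' (Icc (-1) (-1) ×ℂ Ioc yk yj)) := by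
      have hS : ∀ s ∈ R, ¬ (s.re = -1 ∧ s.im = yk) → ee z ν s ∈ K \ {ee z ν (sj k + (-1:ℝ))} := fun s hs h => by
        refine ⟨Or.inl ⟨s, hs, rfl⟩, fun h' => h ?_⟩
        rw [c.inj (by linarith only [hRN s hs]) (by linarith only [hcN]) h']
        simp [sj_re, yk]
      apply Subset.antisymm
      · rintro x ⟨⟨s, (⟨h1, h2⟩ | hs) | hs, rfl⟩ | hx, hx'⟩
        · rcases lt_trichotomy s.im yk with h3 | h3 | h3
          · exact Or.inl (Or.inl (Or.inl ⟨s, ⟨h1, h2.1, h3⟩, rfl⟩))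
          · exfalso; apply hx'
            rw [mem_singleton_iff]; congr 1
            apply Complex.ext
            · simp [sj_re]; exact le_antisymm h1.2 h1.1
            · simp [h3, yk]
          · exact Or.inr (Or.inr ⟨s, ⟨h1, h3, h2.2⟩, rfl⟩)
        · exact Or.inl (Or.inl (Or.inr ⟨s, hs, rfl⟩))
        · exact Or.inr (Or.inl ⟨s, hs, rfl⟩)
        · exact Or.inl (Or.inr hx)
      · rintro x (((⟨s, ⟨h1, h2, h3⟩, rfl⟩ | ⟨s, ⟨h1, h2, h3⟩, rfl⟩) | hx) | (⟨s, ⟨h1, h2, h3⟩, rfl⟩ | ⟨s, ⟨h1, h2, h3⟩, rfl⟩))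
        · exact hS s (Or.inl (Or.inl ⟨h1, h2, by linarith only [h3, g3]⟩)) fun h => by linarith only [h.2, h3]
        · exact hS s (Or.inl (Or.inr ⟨h1, h2, h3⟩)) fun h => by linarith only [h.2, h3, g2]
        · refine ⟨Or.inr hx, fun h => ?_⟩
          rw [mem_singleton_iff] at h
          rw [h] at hx
          exact hWd _ (by simp [sj_re]) (by simp [sj_re]) (by simp; linarith only [g0, g1, g2]) (by simp; linarith only [g3]) hx
        · exact hS s (Or.inr ⟨h1, h2, h3⟩) fun h => by linarith only [h.2, h2, g3]
        · exact hS s (Or.inl (Or.inl ⟨h1, by linarith only [h2, g2], h3⟩)) fun h => by linarith only [h.2, h2]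
    rw [this]
    have hwp : IsPreconnected W := (convex_segment ζi Z).isPreconnected.image _ hWc
    refine IsPreconnected.union (ee z ν (sj j + 10)) (Or.inr ⟨Z, right_mem_segment _ _ _, hZe⟩) (Or.inl ⟨_, ?_, rfl⟩)
      (IsPreconnected.union (ee z ν (sj i + 10)) (Or.inr ⟨_, ?_, rfl⟩) ⟨ζi, left_mem_segment _ _ _, Li.fin⟩
        (IsPreconnected.union (ee z ν (sj i + (-1))) ⟨_, ?_, rfl⟩ ⟨_, ?_, rfl⟩
          (hpre _ _ ordConnected_Icc ordConnected_Ico) (hpre _ _ ordConnected_Icc ordConnected_Icc)) hwp)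
      (IsPreconnected.union (ee z ν (sj j + (-1))) ⟨_, ?_, rfl⟩ ⟨_, ?_, rfl⟩
          (hpre _ _ ordConnected_Icc ordConnected_Icc) (hpre _ _ ordConnected_Icc ordConnected_Ioc))
    · simp [Complex.mem_reProdIm, sj_re, yj]; norm_num
    · simp [Complex.mem_reProdIm, sj_re, yi]; norm_num
    · simp [Complex.mem_reProdIm, sj_re]; exact ⟨le_rfl, by linarith only [g2]⟩
    · simp [Complex.mem_reProdIm, sj_re, yi]; norm_num
    · simp [Complex.mem_reProdIm, sj_re, yj]; norm_num
    · simp [Complex.mem_reProdIm, sj_re]; exact ⟨by linarith only [g3], le_rfl⟩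
  · intro y h1 h2 h3
    rw [← Real.exp_nat_mul] at h1
    have hy : 0 < y := (Real.exp_pos _).trans_le h1
    have h4 : y = Real.exp (ν * Real.log y / ν) := by rw [mul_div_cancel_left₀ _ hν.ne', Real.exp_log hy]
    rw [h4] at h3 ⊢
    rw [hcR _ h3 ?_ ?_]
    · have := (Real.le_log_iff_exp_le hy).2 h1
      push_cast at this
      have h5 := mul_le_mul_of_nonneg_left this hν.le
      rwa [show ν * (2 * (-1 / ν)) = -2 by field_simp] at h5
    · exact mul_nonpos_of_nonneg_of_nonpos hν.le (Real.log_nonpos hy.le h2)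
  · intro θ hθ
    refine Or.inl ⟨sj k + (-1:ℝ) + (ν * θ : ℝ) * Complex.I, Or.inl (Or.inl ?_), ?_⟩
    · have : |ν * θ| ≤ 1 := by
        rw [abs_mul, abs_of_pos hν]
        calc ν * |θ| ≤ ν * (1 / ν) := by gcongr
          _ = 1 := by field_simp
      obtain ⟨h1, h2⟩ := abs_le.1 this
      refine ⟨by simp [sj_re], ?_⟩
      simp
      exact ⟨by linarith only [h1, g2], by linarith only [h2, g3]⟩
    · rw [ee_add, hee]
      congr 2
      have : (ν:ℂ) ≠ 0 := by exact_mod_cast hν.ne'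
      push_cast
      field_simp
end
end SW

namespace SW
open Metric

lemma sq1_le {x : ℝ} (hx : 0 ≤ x) : Real.sqrt (1 + x ^ 2) ≤ 1 + x :=
  Real.sqrt_le_iff.2 ⟨by linarith, by nlinarith⟩

lemma chordal_inv (b a : ℂ) {δ : ℝ} (hδ : 0 < δ) : ∃ t > 0, ∀ (f : ℂ → ℂ) (P : Set ℂ) (z : ℂ),
    chordal (valueAt f P z) (iv b a) < t → z ∉ Pb f P b ∧ ‖Fb f P b z - a‖ < δ := by
  have hs : ∀ w : ℂ, 0 < Real.sqrt (1 + ‖w‖ ^ 2) := fun w => Real.sqrt_pos.2 (by positivity)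
  by_cases ha : a = 0
  · subst ha
    set r := ‖b‖ + 1 / δ with hr
    have hr0 : 0 ≤ r := by positivity
    refine ⟨1 / (1 + r), by positivity, fun f P z h => ?_⟩
    by_cases hP : z ∈ P
    · exact ⟨fun h' => h'.1 hP, by simpa [Fb, hP] using hδ⟩
    · simp only [valueAt, iv, hP, if_false, if_true, chordal] at h
      have h1 := (one_div_lt_one_div (hs _) (by positivity)).1 h
      have h2 := h1.trans_le (sq1_le (norm_nonneg (f z)))
      have h3 := norm_sub_norm_le (f z) b
      have h4 : 1 / δ < ‖f z - b‖ := by linarith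
      have h5 : 0 < ‖f z - b‖ := lt_trans (by positivity) h4
      refine ⟨fun h' => ?_, ?_⟩
      · rw [h'.2, sub_self, norm_zero] at h5; exact lt_irrefl _ h5
      · simp only [Fb, hP, if_false, sub_zero, norm_inv]
        rw [inv_lt_comm₀ h5 hδ, ← one_div]; exact h4
  · set w0 := b + a⁻¹ with hw0
    have hc : ContinuousAt (fun w : ℂ => (w - b)⁻¹) w0 := ContinuousAt.inv₀ (by fun_prop) (by simp [hw0, ha])
    have hv : (w0 - b)⁻¹ = a := by simp [hw0]
    have hev : ∀ᶠ w in 𝓝 w0, w ≠ b ∧ ‖(w - b)⁻¹ - a‖ < δ := by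
      have h1 := Metric.tendsto_nhds.1 hc.tendsto δ hδ
      rw [hv] at h1
      have h2 : w0 ≠ b := by simp [hw0, ha]
      filter_upwards [h1, eventually_ne_nhds h2] with w h3 h4 using ⟨h4, by rwa [dist_eq_norm] at h3⟩
    obtain ⟨η, hη, hb⟩ := Metric.eventually_nhds_iff_ball.1 hev
    have hn := norm_nonneg w0
    refine ⟨η / ((1 + ‖w0‖ + η) * (1 + ‖w0‖)), by positivity, fun f P z h => ?_⟩
    by_cases hP : z ∈ P
    · exfalso
      simp only [valueAt, iv, hP, ha, if_false, if_true, chordal] at h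
      rw [← hw0] at h
      have h1 : 1 / (1 + ‖w0‖) ≤ 1 / Real.sqrt (1 + ‖w0‖ ^ 2) := one_div_le_one_div_of_le (hs _) (sq1_le hn)
      have h2 : η / ((1 + ‖w0‖ + η) * (1 + ‖w0‖)) ≤ 1 / (1 + ‖w0‖) := by
        rw [div_le_div_iff₀ (by positivity) (by positivity)]; nlinarith
      linarith
    · simp only [valueAt, iv, hP, ha, if_false, chordal] at h
      rw [← hw0] at h
      have hd : ‖f z - w0‖ < η := by
        by_contra hd
        rw [not_lt] at hd
        have h3 : ‖f z‖ ≤ ‖f z - w0‖ + ‖w0‖ := norm_le_norm_sub_add _ _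
        set d := ‖f z - w0‖
        have h1 : Real.sqrt ((1 + ‖f z‖ ^ 2) * (1 + ‖w0‖ ^ 2)) ≤ (1 + ‖w0‖ + d) * (1 + ‖w0‖) := by
          rw [Real.sqrt_mul (by positivity)]
          exact mul_le_mul ((sq1_le (norm_nonneg _)).trans (by linarith)) (sq1_le hn) (hs _).le (by positivity)
        have h2 : d / ((1 + ‖w0‖ + d) * (1 + ‖w0‖)) ≤ d / Real.sqrt ((1 + ‖f z‖ ^ 2) * (1 + ‖w0‖ ^ 2)) :=
          div_le_div_of_nonneg_left (by positivity) (Real.sqrt_pos.2 (by positivity)) h1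
        have h4 : η / ((1 + ‖w0‖ + η) * (1 + ‖w0‖)) ≤ d / ((1 + ‖w0‖ + d) * (1 + ‖w0‖)) := by
          rw [div_le_div_iff₀ (by positivity) (by positivity)]
          nlinarith [mul_nonneg hn hn, mul_nonneg (sub_nonneg.2 hd) (by positivity : 0 ≤ (1 + ‖w0‖) ^ 2)]
        linarith
      obtain ⟨h1, h2⟩ := hb (f z) (by rwa [mem_ball, dist_eq_norm])
      exact ⟨fun h' => h1 h'.2, by simpa [Fb, hP] using h2⟩

def HF (Φ : ℂ → ℂ) (P : Set ℂ) (δ : ℝ) (n : ℕ) : Prop := ∀ (a : ℕ → ℂ) (ψ : ℕ → ℂ → ℂ),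
  (∀ m ≤ n, TrI Φ P (a m) δ (ψ m)) → ∃ i j, i < j ∧ j ≤ n ∧ a i = a j ∧ ∃ x, x ∈ ψ i '' Hp ∧ x ∈ ψ j '' Hp

section
variable {Φ : ℂ → ℂ} {P V : Set ℂ} {A : ℂ → ℂ} {M : ℕ} {δ : ℝ} {a : ℂ} {ψ : ℂ → ℂ}

lemma TrI.stay (G : Good Φ P V A M) (hδ : 0 < δ) (hV : ∀ v ∈ V, v ≠ a → δ ≤ ‖v - a‖)
    (T : TrI Φ P a δ ψ) {S : Set ℂ} (hS : IsPreconnected S)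
    (hSP : ∀ z ∈ S, z ∉ P ∧ ‖Φ z - a‖ < δ) {z0 : ℂ} (h0 : z0 ∈ S) (h0' : z0 ∈ ψ '' Hp) :
    S ⊆ ψ '' Hp := by
  refine hS.subset_of_closure_inter_subset (T.toTr.isOpen hδ G.mero) ⟨z0, h0, h0'⟩ ?_
  rintro z ⟨hcl, hz⟩
  obtain ⟨hzP, hzδ⟩ := hSP z hz
  by_cases hza : Φ z = a
  · exfalso
    have h1 := T.lim.eventually_gt_atTop (‖z‖ + 1)
    obtain ⟨X, hX, hX'⟩ := mem_comap.1 h1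
    obtain ⟨X0, hX0⟩ := mem_atTop_sets.1 hX
    have h2 : ContinuousAt (fun w => ‖Φ w - a‖) z := ((G.mero.2.1 z hzP).continuousAt.sub continuousAt_const).norm
    have h3 : ∀ᶠ w in 𝓝 z, ‖Φ w - a‖ < δ * Real.exp (-X0) :=
      h2.eventually_lt continuousAt_const (by rw [hza]; simp; positivity)
    obtain ⟨_, ⟨h4, h4'⟩, ζ, hζ, rfl⟩ := mem_closure_iff_nhds.1 hcl _ (inter_mem h3 (ball_mem_nhds z one_pos))
    rw [mem_setOf_eq, T.toTr.norm hδ hζ, mul_lt_mul_iff_right₀ hδ, Real.exp_lt_exp] at h4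
    have h5 : ‖z‖ + 1 < ‖ψ ζ‖ := hX' (hX0 ζ.re (by linarith))
    rw [mem_ball, dist_eq_norm] at h4'
    linarith [norm_le_norm_sub_add (ψ ζ) z]
  · exact T.toTr.stay G hδ hV (S := {z}) isPreconnected_singleton (by rintro x rfl; exact ⟨hzP, hza, hzδ⟩) rfl (by
      have hzX : z ∈ XX Φ P := ⟨hzP, fun h => not_lt.2 (hV _ (G.crit z hzP h) hza) hzδ⟩
      obtain ⟨ψ2, T2, ζ, hζ, rfl⟩ := G.tract hδ hV hzX hza hzδ
      obtain ⟨_, ⟨ζ2, h2, rfl⟩, ζ1, h1, h12⟩ := mem_closure_iff.1 hcl _ (T2.isOpen hδ G.mero) ⟨ζ, hζ, rfl⟩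
      obtain ⟨k, -, hk⟩ := T2.meet hδ G.mero T.toTr h2 h1 h12.symm
      refine ⟨ζ + k * (2 * Real.pi * Complex.I), ?_, (hk ζ hζ).symm⟩
      have : (ζ + k * (2 * Real.pi * Complex.I)).re = ζ.re := by simp
      rw [mem_Hp, this]; exact hζ) rfl

lemma Core (G : Good Φ P V A M) (hM : 0 < M) (hδ : 0 < δ) (hV : ∀ a ∈ V, ∀ v ∈ V, v ≠ a → 2 * δ ≤ ‖v - a‖) {n : ℕ}
    (hF : HF Φ P δ n) : ∃ Q0 : ℝ, ∀ z ν B C, Ctx Φ P V A M δ z ν B C → Q0 ≤ C → ‖sj (n + 1)‖ + 30 ≤ B →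
      ∃ m ≤ n + 1, ee z ν (sj m - 1) ∈ P ∨ 2 < ‖Φ (ee z ν (sj m - 1))‖ := by
  obtain ⟨Q0, hQ⟩ := Ctx.start G hM hδ (fun a ha v hv h => by linarith [hV a ha v hv h])
  refine ⟨Q0, fun z ν B C c hC hB => ?_⟩
  by_contra hcon
  push Not at hcon
  have hsjn : ∀ m ≤ n + 1, ‖sj m‖ + 30 ≤ B := fun m hm => by
    have : ‖sj m‖ ≤ ‖sj (n+1)‖ := by
      unfold sj
      simp only [norm_mul, Complex.norm_natCast]
      have : (m:ℝ) ≤ (n+1:ℕ) := by exact_mod_cast hm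
      gcongr
    linarith
  choose! a haV ψ T on hor ζ hd hf using fun m (hm : m ≤ n + 1) =>
    hQ z ν B C c hC m (hsjn m hm) (hcon m hm).1 (hcon m hm).2
  have L : ∀ m ≤ n + 1, Leg Φ P δ z ν C m (a m) (ψ m) (ζ m) := fun m hm => ⟨T m hm, hor m hm, hd m hm, hf m hm⟩
  obtain ⟨i, j, hij, hjn, he, hmeet⟩ := hF (fun m => a (m + 1)) (fun m => ψ (m + 1)) (fun m hm => T _ (by omega))
  have hne : ∀ m, m + 1 ≤ n + 1 → a m ≠ a (m + 1) := fun m hm h => by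
    obtain ⟨ζ, h1, h2⟩ := on m (by omega)
    obtain ⟨ζ', h3, h4⟩ := on (m + 1) hm
    have T1 := T m (by omega)
    rw [h] at T1
    exact c.claim3 T1 (T (m + 1) hm) (hsjn m (by omega)) h1 h2 h3 h4
  have hij' : i + 1 < j := by
    by_contra h
    obtain rfl : j = i + 1 := by omega
    exact hne (i + 1) (by omega) he
  have Lj := L (j + 1) (by omega)
  have he' : a (i + 1) = a (j + 1) := he
  rw [← he'] at Lj
  refine c.loop (l := i) (i := i + 1) (k := i + 2) (j := j + 1) (by omega) (by omega) (by omega) (hsjn _ (by omega))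
    (L (i + 1) (by omega)) Lj hmeet (L (i + 2) (by omega)) (L i (by omega)) ?_ ?_
  · exact hV _ (haV _ (by omega)) _ (haV _ (by omega)) (hne (i + 1) (by omega)).symm
  · exact hV _ (haV _ (by omega)) _ (haV _ (by omega)) (hne i (by omega))

lemma HF_Fb {f : ℂ → ℂ} {Pf : Set ℂ} (hsing : FinitelyManyTranscSing f Pf) : ∃ n, ∀ b V δ,
    Good (Fb f Pf b) (Pb f Pf b) V A M → 0 < δ → (∀ a ∈ V, ∀ v ∈ V, v ≠ a → δ ≤ ‖v - a‖) →
    HF (Fb f Pf b) (Pb f Pf b) δ n := by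
  obtain ⟨n, hn⟩ := hsing
  refine ⟨n, fun b V δ G hδ hV a ψ T => ?_⟩
  by_contra hcon
  push Not at hcon
  have hre : ∀ t : ℝ, 0 ≤ t → (1 + t : ℂ) ∈ Hp := fun t ht => by
    rw [mem_Hp]; simp; linarith
  have hlim : ∀ i ≤ n, Tendsto (fun t : ℝ => Fb f Pf b (ψ i (1 + t))) atTop (𝓝 (a i)) := fun i hi => by
    rw [tendsto_iff_norm_sub_tendsto_zero]
    have h1 : Tendsto (fun t : ℝ => δ * Real.exp (-(1 + t))) atTop (𝓝 (δ * 0)) :=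
      (Real.tendsto_exp_neg_atTop_nhds_zero.comp (tendsto_atTop_add_const_left _ 1 tendsto_id)).const_mul δ
    rw [mul_zero] at h1
    refine h1.congr' ?_
    filter_upwards [eventually_ge_atTop 0] with t ht
    rw [(T i hi).toTr.norm hδ (hre t ht)]; simp
  have hcont : ∀ i ≤ n, ContinuousOn (fun t : ℝ => ψ i (1 + t)) (Ici 0) := fun i hi =>
    (T i hi).diff.continuousOn.comp (by fun_prop) fun t ht => hre t ht
  have hP : ∀ i ≤ n, ∀ t : ℝ, 0 ≤ t → ψ i (1 + t) ∉ Pb f Pf b := fun i hi t ht =>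
    ((T i hi).lift _ (hre t ht)).1.1
  have hpath : ∀ i ≤ n, AsymptoticPath f Pf (iv b (a i)) (fun t : ℝ => ψ i (1 + t)) := fun i hi =>
    Fb_path (hcont i hi) (hP i hi) ((T i hi).tail_lim 1) (hlim i hi)
  have haV : ∀ i ≤ n, a i ∈ V := fun i hi => G.asym _ _ (hcont i hi) (hP i hi) ((T i hi).tail_lim 1) (hlim i hi)
  have := hn (n + 1) (fun i => iv b (a i)) (fun i t => ψ i (1 + t)) (fun i => hpath i (by omega)) ?_
  · omega
  intro i j hij
  by_cases hae : a i = a j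
  swap
  · exact Or.inl fun h => hae (iv_inj b h)
  right
  obtain ⟨t, ht, htt⟩ := chordal_inv b (a i) hδ
  have comp : ∀ k ≤ n, a k = a i → ∃ C, IsComponentOf C {z | chordal (valueAt f Pf z) (iv b (a i)) < t} ∧
      C ⊆ ψ k '' Hp ∧ IsBounded ((fun t : ℝ => ψ k (1 + t)) '' Ici 0 \ C) := fun k hk hki => by
    have h1 := (hpath k hk).2.2.eventually_lt_const ht
    rw [hki] at h1
    obtain ⟨T0, hT0⟩ := eventually_atTop.1 h1
    set T1 := max T0 0
    set S := {z | chordal (valueAt f Pf z) (iv b (a i)) < t}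
    have hin : ψ k (1 + T1) ∈ S := hT0 T1 (le_max_left _ _)
    have hTr := T k hk
    rw [hki] at hTr
    refine ⟨connectedComponentIn S (ψ k (1 + T1)), ⟨_, hin, rfl⟩, ?_, ?_⟩
    · exact hTr.stay G hδ (hV _ (haV i (by omega))) isPreconnected_connectedComponentIn
        (fun z hz => htt f Pf z (show z ∈ S from connectedComponentIn_subset S _ hz)) (mem_connectedComponentIn hin)
        ⟨_, hre T1 (le_max_right _ _), rfl⟩
    · have hsub : (fun t : ℝ => ψ k (1 + t)) '' Ici T1 ⊆ connectedComponentIn S (ψ k (1 + T1)) := by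
        refine IsPreconnected.subset_connectedComponentIn
          (isPreconnected_Ici.image _ ((hcont k hk).mono (Ici_subset_Ici.2 (le_max_right _ _)))) ⟨T1, by simp, rfl⟩ ?_
        rintro _ ⟨u, hu, rfl⟩
        exact hT0 u ((le_max_left _ _).trans hu)
      refine ((isCompact_Icc (a := 0) (b := T1)).image_of_continuousOn ((hcont k hk).mono Icc_subset_Ici_self)).isBounded.subset ?_
      rintro _ ⟨⟨u, hu, rfl⟩, h2⟩
      refine ⟨u, ⟨hu, ?_⟩, rfl⟩
      by_contra h3
      exact h2 (hsub ⟨u, (not_le.1 h3).le, rfl⟩)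
  obtain ⟨C1, c1, c2, c3⟩ := comp i (by omega) rfl
  obtain ⟨C2, d1, d2, d3⟩ := comp j (by omega) hae.symm
  refine ⟨t, ht, C1, C2, c1, ?_, ?_, c3, d3⟩
  · show IsComponentOf C2 {z | chordal (valueAt f Pf z) (iv b (a j)) < t}
    rw [← hae]; exact d1
  · rw [disjoint_left]
    intro x h1 h2
    rcases lt_or_gt_of_ne (fun h => hij (Fin.ext h) : (i:ℕ) ≠ j) with h | h
    · exact hcon i j h (by omega) hae x (c2 h1) (d2 h2)
    · exact hcon j i h (by omega) hae.symm x (d2 h2) (c2 h1)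
end
end SW

namespace SW
open Metric

lemma wvbox {A : ℂ → ℂ} {R : ℝ} (W : WVData A R) {ε : ℝ} (hε : 0 < ε) (B ν0 : ℝ) :
    ∃ z ν q0, ν0 ≤ ν ∧ Box A z ν B ε q0 := by
  have hfr : (atTop ⊓ 𝓟 W.F1 : Filter ℝ).NeBot := by
    rw [← frequently_mem_iff_neBot, frequently_atTop]
    intro c
    obtain ⟨r, h1, h2⟩ := W.F1_unbounded c
    exact ⟨r, h2.le, h1⟩
  have e1 : ∀ᶠ r in atTop ⊓ 𝓟 W.F1, r ∈ W.F1 := mem_inf_of_right (mem_principal_self _)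
  have e2 : ∀ᶠ r in atTop ⊓ 𝓟 W.F1, (0:ℝ) < r := mem_inf_of_left (eventually_gt_atTop 0)
  obtain ⟨r, h1, h2, h3, h4, h5⟩ := (e1.and (e2.and ((W.N_tendsto.eventually_ge_atTop (max 3 ν0)).and
    ((W.phi_over_logN.eventually_ge_atTop |B|).and (W.approx ε hε))))).exists
  set N := W.N r
  set z := W.zr r
  have hN : 3 ≤ N := (le_max_left _ _).trans h3
  have hlog : 1 ≤ Real.log N := by
    rw [Real.le_log_iff_exp_le (by linarith)]
    linarith [Real.exp_one_lt_d9]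
  have hφ : B ≤ W.phi r := by
    rw [le_div_iff₀ (by linarith)] at h4
    nlinarith [abs_nonneg B, le_abs_self B]
  have hz : z ≠ 0 := by
    rw [← norm_pos_iff, W.zr_abs r h1]; exact h2
  have hν : ((N + 2 : ℝ) : ℂ) ≠ 0 := by
    rw [Complex.ofReal_ne_zero]; linarith
  refine ⟨z, N + 2, A z * z ^ 2 / ((N + 2 : ℝ) : ℂ) ^ 2, by linarith [le_max_right 3 ν0], hz, fun s hs => ?_⟩
  set τ : ℂ := s / ((N + 2 : ℝ) : ℂ) with hτ
  have hb : ‖τ‖ ≤ 8 * W.phi r / N := by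
    rw [hτ, norm_div, Complex.norm_real, Real.norm_of_nonneg (by linarith)]
    rw [div_le_div_iff₀ (by linarith) (by linarith)]
    nlinarith [norm_nonneg s, W.phi_ge r h1]
  have h6 := h5 τ ((Complex.abs_re_le_norm _).trans hb) ((Complex.abs_im_le_norm _).trans hb)
  have hs' : s = N * τ + 2 * τ := by
    have : s = ((N + 2 : ℝ) : ℂ) * τ := by rw [hτ]; field_simp
    rw [this]; push_cast; ring
  have he2 : Complex.exp (2 * τ) = Complex.exp τ ^ 2 := by rw [← Complex.exp_nat_mul]; norm_num
  have hes : Complex.exp s = Complex.exp (N * τ) * Complex.exp τ ^ 2 := by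
    rw [← he2, ← Complex.exp_add, ← hs']
  set K : ℂ := (z * Complex.exp τ) ^ 2 / ((N + 2 : ℝ) : ℂ) ^ 2
  have k1 : A (ee z (N + 2) s) * ee z (N + 2) s ^ 2 / ((N + 2 : ℝ) : ℂ) ^ 2 -
      A z * z ^ 2 / ((N + 2 : ℝ) : ℂ) ^ 2 * Complex.exp s =
      (A (z * Complex.exp τ) - Complex.exp (N * τ) * A z) * K := by
    have : ee z (N + 2) s = z * Complex.exp τ := rfl
    rw [this, hes]; ring
  have k2 : A z * z ^ 2 / ((N + 2 : ℝ) : ℂ) ^ 2 * Complex.exp s = Complex.exp (N * τ) * A z * K := by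
    rw [hes]; ring
  rw [k1, k2, norm_mul, norm_mul _ K, ← mul_assoc]
  gcongr

lemma sep {V : Set ℂ} (hV : V.Finite) : ∃ δ : ℝ, 0 < δ ∧ ∀ a ∈ V, ∀ v ∈ V, v ≠ a → 2 * δ ≤ ‖v - a‖ := by
  by_cases hn : V.Nontrivial
  · refine ⟨V.infsep / 2, by linarith [hV.infsep_pos_iff_nontrivial.2 hn], fun a ha v hv h => ?_⟩
    have := infsep_le_dist_of_mem (s := V) hv ha h
    rw [dist_eq_norm] at this
    linarith
  · exact ⟨1, one_pos, fun a ha v hv h => (h (not_nontrivial_iff.1 hn hv ha)).elim⟩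

lemma ubd (u : ℕ → ℝ) (n : ℕ) : ∃ C, ∀ l < n, u l ≤ C :=
  ⟨∑ l ∈ Finset.range n, |u l|, fun l hl => (le_abs_self _).trans
    (Finset.single_le_sum (f := fun l => |u l|) (fun _ _ => abs_nonneg _) (Finset.mem_range.2 hl))⟩

/-- near `b` -/
lemma near_of {f : ℂ → ℂ} {P : Set ℂ} {b p : ℂ} (h : p ∈ Pb f P b ∨ 2 < ‖Fb f P b p‖) : ‖f p - b‖ < 1 / 2 := by
  rcases h with h | h
  · rw [h.2]; simp
  · by_cases hp : p ∈ P
    · simp [Fb, hp] at h; linarith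
    · simp only [Fb, hp, if_false, norm_inv] at h
      by_contra h'
      push Not at h'
      have : ‖f p - b‖⁻¹ ≤ (1 / 2)⁻¹ := inv_anti₀ (by norm_num) h'
      norm_num at this
      linarith

lemma recenter {c C0 : ℝ} (hc : 0 < c) (hC0 : 0 < C0) {q0 : ℂ} (hq : c ≤ ‖q0‖) :
    ∃ s0 : ℂ, ∃ C, C0 ≤ C ∧ ‖s0‖ ≤ |Real.log (C0 ^ 2 / (4 * c))| + 4 ∧
      q0 * Complex.exp s0 = (-(C ^ 2 / 4 : ℝ) : ℂ) := by
  have hq0 : 0 < ‖q0‖ := hc.trans_le hq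
  set D := max (C0 ^ 2) (4 * ‖q0‖)
  have hD : 0 < D := lt_max_of_lt_right (by linarith)
  have hD2 : Real.sqrt D ^ 2 = D := Real.sq_sqrt hD.le
  have hqn : q0 ≠ 0 := norm_pos_iff.1 hq0
  set w : ℂ := -((D / 4 : ℝ) : ℂ) / q0 with hw
  have hwn : ‖w‖ = D / (4 * ‖q0‖) := by
    rw [hw, norm_div, norm_neg, Complex.norm_real, Real.norm_of_nonneg (by linarith)]
    field_simp
  have hw0 : w ≠ 0 := by
    rw [← norm_pos_iff, hwn]; positivity
  refine ⟨Complex.log w, Real.sqrt D, Real.le_sqrt_of_sq_le (le_max_left _ _), ?_, ?_⟩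
  · have h1 := Complex.norm_le_abs_re_add_abs_im (Complex.log w)
    have h2 : |(Complex.log w).im| ≤ 4 := by
      rw [Complex.log_im]; linarith [Complex.abs_arg_le_pi w, Real.pi_lt_four]
    have h3 : |(Complex.log w).re| ≤ |Real.log (C0 ^ 2 / (4 * c))| := by
      rw [Complex.log_re, hwn]
      have h4 : 1 ≤ D / (4 * ‖q0‖) := by
        rw [le_div_iff₀ (by positivity), one_mul]; exact le_max_right _ _
      rw [abs_of_nonneg (Real.log_nonneg h4)]
      rcases le_total (C0 ^ 2) (4 * ‖q0‖) with h | h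
      · rw [show D = 4 * ‖q0‖ from max_eq_right h, div_self (by positivity), Real.log_one]
        positivity
      · rw [show D = C0 ^ 2 from max_eq_left h]
        refine le_trans (Real.log_le_log (by positivity) ?_) (le_abs_self _)
        gcongr
    linarith
  · rw [Complex.exp_log hw0, hD2, hw]
    field_simp

theorem final (M : ℕ) (hM : 0 < M)
    (f A : ℂ → ℂ) (Pf PA : Set ℂ)
    (hf : TranscMeroPlane f Pf)
    (hSf : ∀ z, z ∉ Pf → deriv f z ≠ 0 → schwarzian f z = 2 * A z)
    (hcrit : (CriticalValues f Pf).Finite)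
    (hmult : ∀ z μ, MultiplePointWithMult f z μ → μ ≤ M)
    (hsing : FinitelyManyTranscSing f Pf)
    (hA : TranscMeroPlane A PA) (R : ℝ) (W : WVData A R) : False := by
  set S : Set (Option ℂ) := CriticalValues f Pf ∪ {a | ∃ γ, AsymptoticPath f Pf a γ}
  have hS : S.Finite := hcrit.union (asym_finite hsing)
  have G : ∀ b : ℂ, Good (Fb f Pf b) (Pb f Pf b) {a | iv b a ∈ S} A M := fun b =>
    good_Fb hS hf.1 hf.2 hA.1 hSf hmult subset_union_left (fun a γ h => Or.inr ⟨γ, h⟩) b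
  obtain ⟨n, hn⟩ := HF_Fb (A := A) (M := M) hsing
  choose δ hδ hV using fun b : ℂ => sep (G b).fin
  have hV1 : ∀ b : ℂ, ∀ a ∈ {a | iv b a ∈ S}, ∀ v ∈ {a | iv b a ∈ S}, v ≠ a → δ b ≤ ‖v - a‖ :=
    fun b a ha v hv h => by linarith [hV b a ha v hv h, hδ b]
  choose Q hQ using fun b : ℂ => Core (G b) hM (hδ b) (hV b) (hn b _ (δ b) (G b) (hδ b) (hV1 b))
  choose c B1 ν1 hc ht using fun b : ℂ => (G b).tile1 hM (hδ b) (hV1 b)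
  obtain ⟨Q', hQ'⟩ := ubd (fun l => Q l) (n + 3)
  set c' := min (c 0) (c 1)
  have hc' : 0 < c' := lt_min (hc 0) (hc 1)
  set C0 := max L0 Q'
  have hC0 : 0 < C0 := lt_max_of_lt_left (by linarith [L0_ge'])
  set B' := max 100 (‖sj (n + 1)‖ + 30)
  obtain ⟨z, ν, q0, hν, bx⟩ := wvbox W (ε := th0 / 4) (by linarith [th0_pos])
    (max (max (B1 0) (B1 1)) (B' + (|Real.log (C0 ^ 2 / (4 * c'))| + 4))) (max (max (ν1 0) (ν1 1)) (4 * B'))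
  have hν2 : max (ν1 0) (ν1 1) ≤ ν := (le_max_left _ _).trans hν
  have hq : c' ≤ ‖q0‖ := by
    have hex : (z ∉ Pb f Pf 0 ∧ ‖Fb f Pf 0 z‖ ≤ 2) ∨ (z ∉ Pb f Pf 1 ∧ ‖Fb f Pf 1 z‖ ≤ 2) := by
      by_contra h
      rw [not_or, not_and_or, not_and_or, not_not, not_not, not_le, not_le] at h
      have h1 := near_of h.1
      have h2 := near_of h.2
      have h3 : ‖(1:ℂ)‖ ≤ ‖f z - 0‖ + ‖f z - 1‖ := by
        refine le_trans (le_of_eq ?_) (norm_sub_le _ _)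
        congr 1; ring
      rw [norm_one] at h3
      linarith
    have hth := th0_le
    rcases hex with h | h
    · exact (min_le_left _ _).trans (ht 0 z q0 ν (th0 / 4) (by linarith) ((le_max_left _ _).trans hν2)
        (bx.mono ((le_max_left _ _).trans (le_max_left _ _)) le_rfl) h.1 h.2)
    · exact (min_le_right _ _).trans (ht 1 z q0 ν (th0 / 4) (by linarith) ((le_max_right _ _).trans hν2)
        (bx.mono ((le_max_right _ _).trans (le_max_left _ _)) le_rfl) h.1 h.2)
  obtain ⟨s0, C, hC, hs0, hqe⟩ := recenter hc' hC0 hq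
  have bx' := bx.shift (B' := B') s0 (by
    refine le_trans ?_ (le_max_right _ _)
    linarith only [hs0])
  rw [hqe] at bx'
  have key : ∀ l : Fin (n + 3), ∃ m : Fin (n + 2), ‖f (ee (ee z ν s0) ν (sj m - 1)) - ((l : ℕ) : ℂ)‖ < 1 / 2 := fun l => by
    obtain ⟨m, hm, h⟩ := hQ ((l : ℕ) : ℂ) (ee z ν s0) ν B' C
      ⟨G _, hδ _, by simpa using bx', (le_max_left _ _).trans hC, (le_max_right _ _).trans hν, le_max_left _ _⟩
      ((hQ' l l.2).trans ((le_max_right _ _).trans hC)) (le_max_right _ _)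
    exact ⟨⟨m, by omega⟩, near_of h⟩
  choose m hm using key
  obtain ⟨l, l', hne, he⟩ := Fintype.exists_ne_map_eq_of_card_lt m (by simp)
  have h1 := hm l
  have h2 := hm l'
  rw [← he] at h2
  have h3 : ‖((l' : ℕ) : ℂ) - ((l : ℕ) : ℂ)‖ < 1 := by
    refine lt_of_le_of_lt ?_ (by linarith : ‖f (ee (ee z ν s0) ν (sj (m l) - 1)) - ((l : ℕ) : ℂ)‖ +
      ‖f (ee (ee z ν s0) ν (sj (m l) - 1)) - ((l' : ℕ) : ℂ)‖ < 1)
    refine le_trans (le_of_eq ?_) (norm_sub_le _ _)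
    congr 1; ring
  have h4 : ((l' : ℕ) : ℂ) - ((l : ℕ) : ℂ) = (((l' : ℤ) - (l : ℤ) : ℤ) : ℂ) := by push_cast; ring
  rw [h4, Complex.norm_intCast] at h3
  have h5 : |((l' : ℤ) - (l : ℤ))| < 1 := by exact_mod_cast h3
  rw [Int.abs_lt_one_iff] at h5
  exact hne (Fin.ext (by omega))
end SW

/-- Theorem 2.2: under the hypotheses of Theorem 1.2, if `A = S_f/2` is
transcendental then `A` does not have the Wiman-Valiron property (for any `R ≥ 0`). -/
theorem schwarzian_not_wiman_valiron
    (M : ℕ) (hM : 0 < M)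
    (f A : ℂ → ℂ) (Pf PA : Set ℂ)
    (hf : TranscMeroPlane f Pf)
    (hSf : ∀ z, z ∉ Pf → deriv f z ≠ 0 → schwarzian f z = 2 * A z)
    (hcrit : (CriticalValues f Pf).Finite)
    (hmult : ∀ z μ, MultiplePointWithMult f z μ → μ ≤ M)
    (hsing : FinitelyManyTranscSing f Pf)
    (hA : TranscMeroPlane A PA) :
    ∀ R : ℝ, 0 ≤ R → ¬ HasWVProp A R := by
  rintro R - ⟨W⟩
  exact SW.final M hM f A Pf PA hf hSf hcrit hmult hsing hA R W

end
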